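/- Fix 0 < ε < 1/2, a real number θ with 0 ≤ θ < 1/18, and D > 0. Let P_ε be the set of primes p such that there exist integers a, b with p = a² + b² and |a| ≤ ε√p, and for y ≥ 2, q ≥ 1 and an integer a, let π_ε(y; q, a) = #{p ≤ y : p prime, p ≡ a (mod q), p ∈ P_ε} and π(y) = #{p ≤ y : p prime}. Then there exists a constant c > 0 such that for all x ≥ 2, the sum over odd moduli q ≤ x^θ of max over residues a coprime to q of max over 2 ≤ y ≤ x of |π_ε(y; q, a) − (2/π)·arcsin(ε)·π(y)/φ(q)| is at most c·x/(log x)^D, where φ is Euler's totient function. -/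

import Mathlib

/-- The set of primes `p = a² + b²` with `|a| ≤ ε√p`. -/
def Peps (ε : ℝ) : Set ℕ :=
  {p : ℕ | p.Prime ∧ ∃ a b : ℤ, (p : ℤ) = a ^ 2 + b ^ 2 ∧ |(a : ℝ)| ≤ ε * Real.sqrt p}

/-- `π_ε(y; q, a)`: the number of primes `p ≤ y` with `p ≡ a (mod q)` and `p ∈ P_ε`. -/
noncomputable def piEps (ε : ℝ) (y : ℝ) (q a : ℕ) : ℕ :=
  Nat.card {p : ℕ | (p : ℝ) ≤ y ∧ p ∈ Peps ε ∧ p % q = a % q}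

/-- `π(y)`: the number of primes `p ≤ y`. -/
noncomputable def piCount (y : ℝ) : ℕ := Nat.card {p : ℕ | (p : ℝ) ≤ y ∧ p.Prime}

namespace SectorPrimes

open Finset
open ArithmeticFunction hiding log
open scoped Real ComplexConjugate
open Real (arcsin cos exp exp_nat_mul log log_div log_exp log_le_log log_mul log_natCast_nonneg
  log_nonneg log_pos logb mul_rpow norm_eq_abs norm_of_nonneg one_le_rpow one_le_sqrt pi_ne_zero
  pi_pos rpow_add rpow_def_of_pos rpow_le_one_of_one_le_of_nonpos rpow_le_rpow
  rpow_le_rpow_of_exponent_le rpow_le_rpow_of_nonpos rpow_mul rpow_natCast rpow_neg rpow_neg_one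
  rpow_one sqrt_le_sqrt sqrt_nonneg)
open Complex (I abs_re_le_norm add_im continuous_ofReal cpow_neg mul_im mul_re normSq_eq_norm_sq
  norm_cpow_eq_rpow_re_of_pos norm_natCast norm_real ofReal_mul ofReal_re ofReal_sum)

local notation "𝓐" => ArithmeticFunction ℂ
local notation "𝓧" => DirichletCharacter ℂ

noncomputable section

theorem sum_mul_eq_abel (f : ℕ → ℂ) (w : ℕ → ℝ) (a b : ℕ) (hab : a < b) :
    ∑ n ∈ Ioc a b, (w n : ℂ) * f n = (w b : ℂ) * ∑ n ∈ Ioc a b, f n +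
      ∑ m ∈ Ioo a b, ((w m - w (m + 1) : ℝ) : ℂ) * ∑ n ∈ Ioc a m, f n := by
  induction b, hab using Nat.le_induction with
  | base =>
    have h1 : Ioc a (a + 1) = {a + 1} := by ext; simp
    have h2 : Ioo a (a + 1) = ∅ := by ext; simp
    simp [h1, h2]
  | succ b hb ih =>
    have h2 : Ioo a (b + 1) = insert b (Ioo a b) := by ext; simp; omega
    have hb' : a < b := hb
    rw [sum_Ioc_succ_top (by omega), sum_Ioc_succ_top (by omega), ih, h2, sum_insert (by simp)]
    push_cast
    ring

theorem sum_Ioo_telescope (w : ℕ → ℝ) (a b : ℕ) (hab : a < b) :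
    ∑ m ∈ Ioo a b, (w m - w (m + 1)) = w (a + 1) - w b := by
  induction b, hab using Nat.le_induction with
  | base =>
    have h2 : Ioo a (a + 1) = ∅ := by ext; simp
    simp [h2]
  | succ b hb ih =>
    have h2 : Ioo a (b + 1) = insert b (Ioo a b) := by ext; simp; omega
    rw [h2, sum_insert (by simp), ih]
    ring

/-- Abel summation against nonnegative decreasing weights. -/
theorem norm_sum_antitone_le (f : ℕ → ℂ) (w : ℕ → ℝ) (a b : ℕ) (H : ℝ) (hab : a < b)
    (hw : ∀ m, a < m → m < b → w (m + 1) ≤ w m) (hwb : 0 ≤ w b)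
    (hf : ∀ m, a < m → m ≤ b → ‖∑ n ∈ Ioc a m, f n‖ ≤ H) :
    ‖∑ n ∈ Ioc a b, (w n : ℂ) * f n‖ ≤ H * w (a + 1) := by
  rw [sum_mul_eq_abel f w a b hab]
  have h1 : ‖(w b : ℂ) * ∑ n ∈ Ioc a b, f n‖ ≤ w b * H := by
    rw [norm_mul, norm_real, norm_of_nonneg hwb]
    exact mul_le_mul_of_nonneg_left (hf b hab le_rfl) hwb
  have h2 : ‖∑ m ∈ Ioo a b, ((w m - w (m + 1) : ℝ) : ℂ) * ∑ n ∈ Ioc a m, f n‖ ≤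
      ∑ m ∈ Ioo a b, (w m - w (m + 1)) * H := by
    refine norm_sum_le_of_le _ fun m hm => ?_
    rw [mem_Ioo] at hm
    have := hw m hm.1 hm.2
    rw [norm_mul, norm_real, norm_of_nonneg (by linarith)]
    exact mul_le_mul_of_nonneg_left (hf m hm.1 hm.2.le) (by linarith)
  rw [← sum_mul, sum_Ioo_telescope w a b hab] at h2
  refine (norm_add_le _ _).trans ((add_le_add h1 h2).trans (le_of_eq (by ring)))

/-- Abel summation against nonnegative increasing weights. -/
theorem norm_sum_monotone_le (f : ℕ → ℂ) (w : ℕ → ℝ) (a b : ℕ) (H : ℝ) (hab : a < b)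
    (hw : ∀ m, a < m → m < b → w m ≤ w (m + 1)) (hwa : 0 ≤ w (a + 1)) (hwb : 0 ≤ w b)
    (hf : ∀ m, a < m → m ≤ b → ‖∑ n ∈ Ioc a m, f n‖ ≤ H) :
    ‖∑ n ∈ Ioc a b, (w n : ℂ) * f n‖ ≤ 2 * H * w b := by
  have hH : 0 ≤ H := (norm_nonneg _).trans (hf b hab le_rfl)
  have h1 := norm_sum_antitone_le f (fun n => w b - w n) a b H hab
    (fun m h h' => sub_le_sub_left (hw m h h') _) (sub_self _).ge hf
  have h2 := mul_le_mul_of_nonneg_left (hf b hab le_rfl) hwb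
  have h3 : ∑ n ∈ Ioc a b, (w n : ℂ) * f n =
      w b * ∑ n ∈ Ioc a b, f n - ∑ n ∈ Ioc a b, ((w b - w n : ℝ) : ℂ) * f n := by
    rw [mul_sum, ← sum_sub_distrib]
    exact sum_congr rfl fun n _ => by push_cast; ring
  rw [h3]
  refine (norm_sub_le _ _).trans ?_
  rw [norm_mul, norm_real, norm_of_nonneg hwb]
  nlinarith [mul_nonneg hH hwa]

/-- The number of divisors, as a real number. -/
def dcount (n : ℕ) : ℝ := (n.divisors.card : ℝ)

theorem dcount_nonneg (n : ℕ) : 0 ≤ dcount n := Nat.cast_nonneg _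

theorem one_le_dcount {n : ℕ} (hn : n ≠ 0) : 1 ≤ dcount n := by
  unfold dcount
  exact_mod_cast card_pos.mpr ⟨1, Nat.one_mem_divisors.mpr hn⟩

theorem dcount_mul_le (a b : ℕ) : dcount (a * b) ≤ dcount a * dcount b := by
  unfold dcount
  rcases eq_or_ne (a * b) 0 with h | h
  · rw [h]; simp; positivity
  · rw [Nat.divisors_mul]
    exact_mod_cast card_mul_le

theorem dcount_le_of_dvd {a b : ℕ} (hb : b ≠ 0) (h : a ∣ b) : dcount a ≤ dcount b := by
  unfold dcount
  exact_mod_cast card_le_card (Nat.divisors_subset_of_dvd hb h)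

theorem sum_divisorsAntidiagonal_le (g : ℕ × ℕ → ℝ) (hg : ∀ p, 0 ≤ g p) (X : ℕ) :
    ∑ n ∈ Ioc 0 X, ∑ p ∈ n.divisorsAntidiagonal, g p ≤ ∑ p ∈ Ioc 0 X ×ˢ Ioc 0 X, g p := by
  rw [← sum_biUnion]
  · refine sum_le_sum_of_subset_of_nonneg ?_ fun p _ _ => hg p
    intro p hp
    simp only [mem_biUnion, Nat.mem_divisorsAntidiagonal, mem_Ioc, mem_product] at hp ⊢
    obtain ⟨n, ⟨h1, h2⟩, h3, h4⟩ := hp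
    have hp1 : p.1 ≠ 0 := by rintro h; simp [h] at h3; omega
    have hp2 : p.2 ≠ 0 := by rintro h; simp [h] at h3; omega
    have := Nat.le_mul_of_pos_right p.1 (Nat.pos_of_ne_zero hp2)
    have := Nat.le_mul_of_pos_left p.2 (Nat.pos_of_ne_zero hp1)
    omega
  · intro m _ n _ hmn
    rw [Function.onFun, disjoint_left]
    intro p hp hp'
    rw [Nat.mem_divisorsAntidiagonal] at hp hp'
    exact hmn (hp.1.symm.trans hp'.1)

theorem sum_dcount_mul_le (f : ℕ → ℝ) (hf : ∀ n, 0 ≤ f n)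
    (hm : ∀ a b, f (a * b) ≤ f a * f b) (X : ℕ) :
    ∑ n ∈ Ioc 0 X, dcount n * f n ≤ (∑ n ∈ Ioc 0 X, f n) ^ 2 := by
  have h1 : ∀ n ∈ Ioc 0 X, dcount n * f n ≤ ∑ p ∈ n.divisorsAntidiagonal, f p.1 * f p.2 := by
    intro n _
    have : dcount n * f n = ∑ p ∈ n.divisorsAntidiagonal, f n := by
      rw [sum_const, nsmul_eq_mul, dcount, ← Nat.map_div_right_divisors, card_map]
    rw [this]
    refine sum_le_sum fun p hp => ?_
    rw [Nat.mem_divisorsAntidiagonal] at hp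
    rw [← hp.1]
    exact hm _ _
  refine (sum_le_sum h1).trans ((sum_divisorsAntidiagonal_le _ (fun p => ?_) X).trans ?_)
  · exact mul_nonneg (hf _) (hf _)
  · rw [sq, sum_mul_sum, sum_product]

theorem sum_dcount_pow_mul_le (f : ℕ → ℝ) (hf : ∀ n, 0 ≤ f n)
    (hm : ∀ a b, f (a * b) ≤ f a * f b) (X j : ℕ) :
    ∑ n ∈ Ioc 0 X, dcount n ^ j * f n ≤ (∑ n ∈ Ioc 0 X, f n) ^ (2 ^ j) := by
  induction j with
  | zero => simp
  | succ j ih =>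
    have h := sum_dcount_mul_le (fun n => dcount n ^ j * f n)
      (fun n => mul_nonneg (pow_nonneg (dcount_nonneg n) _) (hf n)) (fun a b => by
        have h1 : dcount (a * b) ^ j ≤ dcount a ^ j * dcount b ^ j := by
          rw [← mul_pow]; exact pow_le_pow_left₀ (dcount_nonneg _) (dcount_mul_le a b) j
        calc dcount (a * b) ^ j * f (a * b) ≤ (dcount a ^ j * dcount b ^ j) * (f a * f b) :=
              mul_le_mul h1 (hm a b) (hf _)
                (mul_nonneg (pow_nonneg (dcount_nonneg _) _) (pow_nonneg (dcount_nonneg _) _))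
          _ = _ := by ring) X
    calc ∑ n ∈ Ioc 0 X, dcount n ^ (j + 1) * f n
        = ∑ n ∈ Ioc 0 X, dcount n * (dcount n ^ j * f n) := by
          refine sum_congr rfl fun n _ => by ring
      _ ≤ _ := h
      _ ≤ ((∑ n ∈ Ioc 0 X, f n) ^ (2 ^ j)) ^ 2 := pow_le_pow_left₀ (sum_nonneg fun n _ =>
            mul_nonneg (pow_nonneg (dcount_nonneg n) _) (hf n)) ih 2
      _ = _ := by rw [← pow_mul, pow_succ]

theorem sum_inv_le_one_add_log (X : ℕ) : ∑ n ∈ Ioc 0 X, (n : ℝ)⁻¹ ≤ 1 + log X := by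
  have h := harmonic_le_one_add_log X
  rw [harmonic_eq_sum_Icc] at h
  have h0 : Ioc 0 X = Icc 1 X := by ext; simp; omega
  rw [h0]
  push_cast at h
  exact h

theorem sum_dcount_pow_div_le (X j : ℕ) :
    ∑ n ∈ Ioc 0 X, dcount n ^ j * (n : ℝ)⁻¹ ≤ (1 + log X) ^ (2 ^ j) := by
  refine (sum_dcount_pow_mul_le (fun n => (n : ℝ)⁻¹) (fun n => by positivity)
    (fun a b => by push_cast; rw [mul_inv]) X j).trans ?_
  exact pow_le_pow_left₀ (sum_nonneg fun n _ => by positivity) (sum_inv_le_one_add_log X) _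

theorem sum_rpow_neg_le {σ : ℝ} (hσ : 1 < σ) (X : ℕ) :
    ∑ n ∈ Ioc 0 X, (n : ℝ) ^ (-σ) ≤ 1 + 1 / (σ - 1) := by
  have hσ' : 0 < σ - 1 := by linarith
  rcases Nat.eq_zero_or_pos X with rfl | hX
  · simp; positivity
  obtain ⟨k, rfl⟩ : ∃ k, X = 1 + k := ⟨X - 1, by omega⟩
  have h0 : Ioc 0 (1 + k) = insert 1 (Ioc 1 (1 + k)) := by
    ext m; simp only [mem_insert, mem_Ioc]; omega
  rw [h0, sum_insert (by simp)]
  have h1 := AntitoneOn.sum_le_integral (f := fun t : ℝ => t ^ (-σ)) (x₀ := 1) (a := k) (by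
    intro x hx y hy hxy
    exact rpow_le_rpow_of_nonpos (by linarith [hx.1]) hxy (by linarith))
  have h2 : ∀ k : ℕ, ∑ n ∈ Ioc 1 (1 + k), (n : ℝ) ^ (-σ) =
      ∑ i ∈ range k, ((1 : ℝ) + ((i + 1 : ℕ) : ℝ)) ^ (-σ) := by
    intro k
    induction k with
    | zero => simp
    | succ k ih =>
      rw [← add_assoc, sum_Ioc_succ_top (by omega), ih, sum_range_succ]
      push_cast
      ring_nf
  rw [h2]
  have h3 : ∫ x in (1 : ℝ)..1 + k, x ^ (-σ) ≤ 1 / (σ - 1) := by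
    rw [integral_rpow (Or.inr ⟨by linarith, by
      rw [Set.uIcc_of_le (by linarith [(Nat.cast_nonneg k : (0 : ℝ) ≤ k)])]
      intro h; linarith [h.1]⟩)]
    have : 0 ≤ ((1 : ℝ) + k) ^ (-σ + 1) := by positivity
    rw [Real.one_rpow, show (-σ + 1) = -(σ - 1) by ring, div_neg, ← neg_div]
    apply div_le_div_of_nonneg_right _ (by linarith)
    rw [show -(σ - 1) = -σ + 1 by ring]
    linarith
  simp only [Nat.cast_one, Real.one_rpow]
  linarith

theorem sum_dcount_pow_rpow_le {σ : ℝ} (hσ : 1 < σ) (X j : ℕ) :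
    ∑ n ∈ Ioc 0 X, dcount n ^ j * (n : ℝ) ^ (-σ) ≤ (1 + 1 / (σ - 1)) ^ (2 ^ j) := by
  refine (sum_dcount_pow_mul_le (fun n => (n : ℝ) ^ (-σ)) (fun n => by positivity)
    (fun a b => by push_cast; rw [mul_rpow (by positivity) (by positivity)]) X j).trans ?_
  exact pow_le_pow_left₀ (sum_nonneg fun n _ => by positivity) (sum_rpow_neg_le hσ X) _

theorem log_le_mul_rpow {n : ℕ} {σ : ℝ} (hσ : 1 < σ) :
    log n ≤ 4 / (σ - 1) * (n : ℝ) ^ ((σ - 1) / 4) := by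
  have h := Real.log_le_rpow_div (x := n) (by positivity) (ε := (σ - 1) / 4) (by linarith)
  refine h.trans (le_of_eq ?_)
  have : σ - 1 ≠ 0 := by linarith
  field_simp

theorem sum_log_sq_rpow_le {σ : ℝ} (hσ : 1 < σ) (X : ℕ) :
    ∑ n ∈ Ioc 0 X, log n ^ 2 * (n : ℝ) ^ (-σ) ≤ 16 / (σ - 1) ^ 2 * (1 + 2 / (σ - 1)) := by
  have h1 : ∀ n ∈ Ioc 0 X, log n ^ 2 * (n : ℝ) ^ (-σ) ≤
      16 / (σ - 1) ^ 2 * (n : ℝ) ^ (-((σ + 1) / 2)) := by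
    intro n hn
    rw [mem_Ioc] at hn
    have hn0 : (0 : ℝ) < n := by exact_mod_cast hn.1
    have h := log_le_mul_rpow (n := n) hσ
    have h0 : 0 ≤ log n := log_natCast_nonneg n
    have h2 := pow_le_pow_left₀ h0 h 2
    calc log n ^ 2 * (n : ℝ) ^ (-σ)
        ≤ (4 / (σ - 1) * (n : ℝ) ^ ((σ - 1) / 4)) ^ 2 * (n : ℝ) ^ (-σ) := by gcongr
      _ = 16 / (σ - 1) ^ 2 * ((n : ℝ) ^ ((σ - 1) / 4) * (n : ℝ) ^ ((σ - 1) / 4) *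
            (n : ℝ) ^ (-σ)) := by rw [mul_pow, div_pow]; ring
      _ = _ := by rw [← rpow_add hn0, ← rpow_add hn0]; ring_nf
  refine (sum_le_sum h1).trans ?_
  rw [← mul_sum]
  have h2 := sum_rpow_neg_le (σ := (σ + 1) / 2) (by linarith) X
  have h3 : 1 / ((σ + 1) / 2 - 1) = 2 / (σ - 1) := by
    rw [show (σ + 1) / 2 - 1 = (σ - 1) / 2 by ring, one_div_div]
  rw [h3] at h2
  exact mul_le_mul_of_nonneg_left h2 (by positivity)

/-- A completely multiplicative function bounded by one. -/
structure IsCM (χ : ℕ → ℂ) : Prop where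
  one : χ 1 = 1
  mul : ∀ m n, χ (m * n) = χ m * χ n
  norm_le : ∀ n, ‖χ n‖ ≤ 1

theorem IsCM.prod {χ ψ : ℕ → ℂ} (h : IsCM χ) (h' : IsCM ψ) : IsCM (fun n => χ n * ψ n) where
  one := by simp [h.one, h'.one]
  mul m n := by rw [h.mul, h'.mul]; ring
  norm_le n := by rw [norm_mul]; exact mul_le_one₀ (h.norm_le n) (norm_nonneg _) (h'.norm_le n)

/-- Pointwise multiplication of an arithmetic function by `χ`. -/
def tw (χ : ℕ → ℂ) (f : 𝓐) : 𝓐 := ⟨fun n => χ n * f n, by simp⟩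

theorem tw_apply (χ : ℕ → ℂ) (f : 𝓐) (n : ℕ) : tw χ f n = χ n * f n := rfl

theorem tw_mul {χ : ℕ → ℂ} (hχ : IsCM χ) (f g : 𝓐) : tw χ (f * g) = tw χ f * tw χ g := by
  ext n
  rw [tw_apply, mul_apply, mul_apply, mul_sum]
  refine sum_congr rfl fun p hp => ?_
  rw [Nat.mem_divisorsAntidiagonal] at hp
  rw [tw_apply, tw_apply, ← hp.1, hχ.mul]
  ring

theorem tw_one {χ : ℕ → ℂ} (hχ : IsCM χ) : tw χ 1 = 1 := by
  ext n
  rw [tw_apply]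
  rcases eq_or_ne n 1 with rfl | h
  · simp [hχ.one]
  · simp [one_apply_ne h]

/-- Multiplication by `log ^ m / m!`. -/
def lg (m : ℕ) (f : 𝓐) : 𝓐 := ⟨fun n => ((log n ^ m / m.factorial : ℝ) : ℂ) * f n, by simp⟩

theorem lg_apply (m : ℕ) (f : 𝓐) (n : ℕ) :
    lg m f n = ((log n ^ m / m.factorial : ℝ) : ℂ) * f n := rfl

theorem lg_tw (m : ℕ) (χ : ℕ → ℂ) (f : 𝓐) : lg m (tw χ f) = tw χ (lg m f) := by
  ext n
  simp only [tw_apply, lg_apply]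
  ring

theorem lg_mul (m : ℕ) (f g : 𝓐) : lg m (f * g) = ∑ p ∈ antidiagonal m, lg p.1 f * lg p.2 g := by
  ext n
  rw [lg_apply, mul_apply, mul_sum]
  have h0 : (∑ p ∈ antidiagonal m, lg p.1 f * lg p.2 g) n =
      ∑ p ∈ antidiagonal m, (lg p.1 f * lg p.2 g) n :=
    map_sum (⟨⟨fun h : 𝓐 => h n, rfl⟩, fun _ _ => rfl⟩ : 𝓐 →+ ℂ) _ _
  rw [h0]
  simp only [mul_apply]
  rw [sum_comm]
  refine sum_congr rfl fun p hp => ?_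
  rw [Nat.mem_divisorsAntidiagonal] at hp
  have hp1 : p.1 ≠ 0 := fun h => hp.2 (by rw [← hp.1, h, zero_mul])
  have hp2 : p.2 ≠ 0 := fun h => hp.2 (by rw [← hp.1, h, mul_zero])
  have hlog : log n = log p.1 + log p.2 := by
    rw [← hp.1, Nat.cast_mul, log_mul (by exact_mod_cast hp1) (by exact_mod_cast hp2)]
  have h1 : log n ^ m / m.factorial = ∑ a ∈ antidiagonal m,
      (log p.1 ^ a.1 / a.1.factorial) * (log p.2 ^ a.2 / a.2.factorial) := by
    rw [hlog, add_pow, Finset.Nat.sum_antidiagonal_eq_sum_range_succ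
      (fun i j => (log p.1 ^ i / i.factorial) * (log p.2 ^ j / j.factorial)), sum_div]
    refine sum_congr rfl fun i hi => ?_
    rw [mem_range] at hi
    rw [Nat.cast_choose ℝ (by omega : i ≤ m)]
    have : (m.factorial : ℝ) ≠ 0 := by positivity
    have : (i.factorial : ℝ) ≠ 0 := by positivity
    have : ((m - i).factorial : ℝ) ≠ 0 := by positivity
    field_simp
  rw [h1, ofReal_sum, sum_mul]
  refine sum_congr rfl fun a _ => ?_
  simp only [lg_apply]
  push_cast
  ring

theorem lg_lg_one (m : ℕ) (f : 𝓐) : lg m (lg 1 f) = ((m + 1 : ℕ) : ℂ) • lg (m + 1) f := by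
  ext n
  change lg m (lg 1 f) n = ((m + 1 : ℕ) : ℂ) * lg (m + 1) f n
  simp only [lg_apply]
  rw [show (m + 1).factorial = (m + 1) * m.factorial from rfl, Nat.factorial_one]
  have h1 : (m.factorial : ℂ) ≠ 0 := by exact_mod_cast m.factorial_ne_zero
  have h2 : ((m : ℂ) + 1) ≠ 0 := by exact_mod_cast m.succ_ne_zero
  push_cast
  field_simp
  ring

/-- Restriction of an arithmetic function to `n ≤ V`. -/
def cut (V : ℕ) (f : 𝓐) : 𝓐 := ⟨fun n => if n ≤ V then f n else 0, by simp⟩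

theorem cut_apply (V : ℕ) (f : 𝓐) (n : ℕ) : cut V f n = if n ≤ V then f n else 0 := rfl

theorem tw_cut (V : ℕ) (χ : ℕ → ℂ) (f : 𝓐) : tw χ (cut V f) = cut V (tw χ f) := by
  ext n
  simp only [tw_apply, cut_apply]
  split_ifs <;> simp

theorem norm_cut_le (V : ℕ) (f : 𝓐) (n : ℕ) : ‖cut V f n‖ ≤ ‖f n‖ := by
  rw [cut_apply]
  split_ifs <;> simp

/-- An invertible arithmetic function together with its inverse and its logarithmic derivative. -/
structure Datum (r μ' Λ' : 𝓐) : Prop where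
  inv : r * μ' = 1
  der : Λ' * r = lg 1 r
  norm_r : ∀ n, ‖r n‖ ≤ dcount n
  norm_inv : ∀ n, ‖μ' n‖ ≤ dcount n
  norm_der : ∀ n, ‖Λ' n‖ ≤ 2 * vonMangoldt n

theorem Datum.twist {r μ' Λ' : 𝓐} (D : Datum r μ' Λ') {χ : ℕ → ℂ}
    (hχ : IsCM χ) : Datum (tw χ r) (tw χ μ') (tw χ Λ') where
  inv := by rw [← tw_mul hχ, D.inv, tw_one hχ]
  der := by rw [← tw_mul hχ, D.der, lg_tw]
  norm_r n := by
    rw [tw_apply, norm_mul]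
    exact (mul_le_of_le_one_left (norm_nonneg _) (hχ.norm_le n)).trans (D.norm_r n)
  norm_inv n := by
    rw [tw_apply, norm_mul]
    exact (mul_le_of_le_one_left (norm_nonneg _) (hχ.norm_le n)).trans (D.norm_inv n)
  norm_der n := by
    rw [tw_apply, norm_mul]
    exact (mul_le_of_le_one_left (norm_nonneg _) (hχ.norm_le n)).trans (D.norm_der n)

/-- The complex valued von Mangoldt function. -/
def mangoldtC : 𝓐 := ⟨fun n => (vonMangoldt n : ℂ), by simp⟩

theorem mangoldtC_apply (n : ℕ) : mangoldtC n = (vonMangoldt n : ℂ) := rfl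

theorem mangoldtC_mul_zeta : mangoldtC * (zeta : 𝓐) = lg 1 (zeta : 𝓐) := by
  ext n
  rw [coe_mul_zeta_apply, lg_apply]
  simp only [mangoldtC_apply]
  rw [← ofReal_sum, vonMangoldt_sum]
  rcases eq_or_ne n 0 with rfl | h
  · simp
  · simp [natCoe_apply, zeta_apply_ne h]

theorem norm_zeta_le (n : ℕ) : ‖(zeta : 𝓐) n‖ ≤ 1 := by
  rw [natCoe_apply, zeta_apply]
  split_ifs <;> simp

theorem norm_zeta_le_dcount (n : ℕ) : ‖(zeta : 𝓐) n‖ ≤ dcount n := by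
  rcases eq_or_ne n 0 with rfl | h
  · simp [dcount_nonneg]
  · exact (norm_zeta_le n).trans (one_le_dcount h)

theorem norm_moebius_le (n : ℕ) : ‖(moebius : 𝓐) n‖ ≤ 1 := by
  rw [intCoe_apply]
  have := abs_moebius_le_one (n := n)
  rw [Complex.norm_intCast]
  exact_mod_cast this

theorem norm_moebius_le_dcount (n : ℕ) : ‖(moebius : 𝓐) n‖ ≤ dcount n := by
  rcases eq_or_ne n 0 with rfl | h
  · simp [dcount_nonneg]
  · exact (norm_moebius_le n).trans (one_le_dcount h)

theorem datum_zeta : Datum (zeta : 𝓐) (moebius : 𝓐) mangoldtC where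
  inv := coe_zeta_mul_coe_moebius
  der := mangoldtC_mul_zeta
  norm_r := norm_zeta_le_dcount
  norm_inv := norm_moebius_le_dcount
  norm_der n := by
    rw [mangoldtC_apply, norm_real, norm_of_nonneg vonMangoldt_nonneg]
    linarith [vonMangoldt_nonneg (n := n)]

theorem norm_mul_le_dcount {f g : 𝓐} (hf : ∀ n, ‖f n‖ ≤ 1)
    (hg : ∀ n, ‖g n‖ ≤ 1) (n : ℕ) : ‖(f * g) n‖ ≤ dcount n := by
  rw [mul_apply]
  refine (norm_sum_le_of_le (f := fun p : ℕ × ℕ => f p.1 * g p.2) _ (n := fun _ => (1 : ℝ))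
    fun p _ => ?_).trans (le_of_eq ?_)
  · rw [norm_mul]
    exact mul_le_one₀ (hf _) (norm_nonneg _) (hg _)
  · rw [sum_const, nsmul_eq_mul, mul_one, dcount, ← Nat.map_div_right_divisors, card_map]

theorem norm_tw_le_one {χ : ℕ → ℂ} (hχ : IsCM χ) {f : 𝓐}
    (hf : ∀ n, ‖f n‖ ≤ 1) (n : ℕ) : ‖tw χ f n‖ ≤ 1 := by
  rw [tw_apply, norm_mul]
  exact mul_le_one₀ (hχ.norm_le n) (norm_nonneg _) (hf n)

theorem lg_one_mul (f g : 𝓐) : lg 1 (f * g) = lg 1 f * g + f * lg 1 g := by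
  have h0 : ∀ f : 𝓐, lg 0 f = f := by intro f; ext n; simp [lg_apply]
  rw [lg_mul, Finset.Nat.antidiagonal_succ]
  simp [h0, add_comm]

theorem datum_prod {A B : ℕ → ℂ} (hA : IsCM A) (hB : IsCM B) :
    Datum (tw A zeta * tw B zeta) (tw A moebius * tw B moebius)
      (tw A mangoldtC + tw B mangoldtC) where
  inv := by rw [mul_mul_mul_comm, (datum_zeta.twist hA).inv, (datum_zeta.twist hB).inv, one_mul]
  der := by
    rw [lg_one_mul, ← (datum_zeta.twist hA).der, ← (datum_zeta.twist hB).der]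
    ring
  norm_r := norm_mul_le_dcount (norm_tw_le_one hA norm_zeta_le) (norm_tw_le_one hB norm_zeta_le)
  norm_inv := norm_mul_le_dcount (norm_tw_le_one hA norm_moebius_le)
    (norm_tw_le_one hB norm_moebius_le)
  norm_der n := by
    have h0 : ‖mangoldtC n‖ = vonMangoldt n := by
      rw [mangoldtC_apply, norm_real, norm_of_nonneg vonMangoldt_nonneg]
    have h1 : ∀ {χ : ℕ → ℂ}, IsCM χ → ‖tw χ mangoldtC n‖ ≤ vonMangoldt n := by
      intro χ hχ
      rw [tw_apply, norm_mul, h0]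
      exact mul_le_of_le_one_left vonMangoldt_nonneg (hχ.norm_le n)
    rw [ArithmeticFunction.add_apply]
    refine (norm_add_le _ _).trans ?_
    linarith [h1 hA, h1 hB]

/-- The logarithmically smoothed summatory function. -/
def smooth (f : 𝓐) (y : ℝ) : ℂ := ∑ n ∈ Ioc 0 ⌊y⌋₊, (log (y / n) : ℂ) * f n

theorem smooth_add (f g : 𝓐) (y : ℝ) : smooth (f + g) y = smooth f y + smooth g y := by
  simp only [smooth, ArithmeticFunction.add_apply, mul_add, sum_add_distrib]

theorem smooth_neg (f : 𝓐) (y : ℝ) : smooth (-f) y = -smooth f y := by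
  simp only [smooth, ArithmeticFunction.neg_apply, mul_neg, sum_neg_distrib]

theorem smooth_sub (f g : 𝓐) (y : ℝ) : smooth (f - g) y = smooth f y - smooth g y := by
  rw [sub_eq_add_neg, smooth_add, smooth_neg, sub_eq_add_neg]

theorem sum_mul_weight (f g : 𝓐) (w : ℕ → ℂ) (N : ℕ) :
    ∑ n ∈ Ioc 0 N, w n * (f * g) n = ∑ a ∈ Ioc 0 N, f a * ∑ b ∈ Ioc 0 (N / a), w (a * b) * g b := by
  have h1 : ∀ n ∈ Ioc 0 N, w n * (f * g) n =
      ∑ p ∈ Ioc 0 N ×ˢ Ioc 0 N with p.1 * p.2 = n, w (p.1 * p.2) * (f p.1 * g p.2) := by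
    intro n hn
    rw [mem_Ioc] at hn
    rw [mul_apply, Nat.divisorsAntidiagonal_eq_prod_filter_of_le hn.1.ne' hn.2, mul_sum]
    refine sum_congr rfl fun p hp => ?_
    rw [mem_filter] at hp
    rw [hp.2]
  have h2 : ∑ n ∈ Ioc 0 N, w n * (f * g) n =
      ∑ p ∈ Ioc 0 N ×ˢ Ioc 0 N with p.1 * p.2 ≤ N, w (p.1 * p.2) * (f p.1 * g p.2) := by
    rw [sum_congr rfl h1]
    simp_rw [sum_filter]
    rw [sum_comm]
    refine sum_congr rfl fun p hp => ?_
    simp only [mem_product, mem_Ioc] at hp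
    have := Nat.mul_pos hp.1.1 hp.2.1
    simp [this]
  rw [h2, sum_filter, sum_product]
  refine sum_congr rfl fun a ha => ?_
  rw [← sum_filter, mul_sum]
  rw [mem_Ioc] at ha
  refine sum_congr ?_ fun b _ => by ring
  ext b
  simp only [mem_filter, mem_Ioc]
  rw [Nat.le_div_iff_mul_le ha.1, mul_comm b a]
  constructor
  · rintro ⟨⟨h1, h2⟩, h3⟩; exact ⟨h1, h3⟩
  · rintro ⟨h1, h3⟩
    exact ⟨⟨h1, (Nat.le_mul_of_pos_left b ha.1).trans h3⟩, h3⟩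

theorem smooth_mul (f g : 𝓐) (y : ℝ) :
    smooth (f * g) y = ∑ a ∈ Ioc 0 ⌊y⌋₊, f a * smooth g (y / a) := by
  rw [smooth, sum_mul_weight f g (fun n => (log (y / n) : ℂ))]
  refine sum_congr rfl fun a _ => ?_
  rw [smooth, Nat.floor_div_natCast]
  congr 1
  refine sum_congr rfl fun b _ => ?_
  push_cast
  rw [div_mul_eq_div_div]

theorem norm_sum_weight_floor_le {f : ℕ → ℂ} {H z : ℝ} (hz : 1 ≤ z) (hH : 0 ≤ H)
    (hf : ∀ N : ℕ, ‖∑ n ∈ Ioc 0 N, f n‖ ≤ H * √N) (w : ℕ → ℝ)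
    (hw : ∀ m n : ℕ, 0 < m → m ≤ n → (n : ℝ) ≤ z → w n ≤ w m)
    (hw0 : ∀ n : ℕ, 0 < n → (n : ℝ) ≤ z → 0 ≤ w n) :
    ‖∑ n ∈ Ioc 0 ⌊z⌋₊, (w n : ℂ) * f n‖ ≤ H * √z * w 1 := by
  have hz' : 0 < ⌊z⌋₊ := Nat.floor_pos.mpr hz
  have hfl : (⌊z⌋₊ : ℝ) ≤ z := Nat.floor_le (by linarith)
  refine norm_sum_antitone_le f w 0 ⌊z⌋₊ (H * √z) hz' (fun m hm1 hm2 => ?_) (hw0 _ hz' hfl)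
    (fun m _ hm => ?_)
  · refine hw _ _ hm1 (Nat.le_succ m) (le_trans ?_ hfl)
    exact_mod_cast hm2
  · refine (hf m).trans (mul_le_mul_of_nonneg_left (sqrt_le_sqrt ?_) hH)
    exact le_trans (by exact_mod_cast hm) hfl

theorem log_div_nonneg {z : ℝ} {n : ℕ} (hn : 0 < n) (hz : (n : ℝ) ≤ z) : 0 ≤ log (z / n) := by
  have : (0 : ℝ) < n := by exact_mod_cast hn
  exact log_nonneg (by rw [le_div_iff₀ this]; linarith)

theorem log_div_anti {z : ℝ} {m n : ℕ} (hm : 0 < m) (hmn : m ≤ n) (hz : (n : ℝ) ≤ z) :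
    log (z / n) ≤ log (z / m) := by
  have h1 : (0 : ℝ) < m := by exact_mod_cast hm
  have h2 : (m : ℝ) ≤ n := by exact_mod_cast hmn
  have h3 : 0 < z := by linarith
  exact log_le_log (div_pos h3 (by linarith)) (by gcongr)

theorem norm_smooth_le {f : 𝓐} {H z : ℝ} (hz : 1 ≤ z) (hH : 0 ≤ H)
    (hf : ∀ N : ℕ, ‖∑ n ∈ Ioc 0 N, f n‖ ≤ H * √N) :
    ‖smooth f z‖ ≤ H * √z * log z := by
  have := norm_sum_weight_floor_le hz hH hf (fun n => log (z / n))
    (fun m n hm hmn hn => log_div_anti hm hmn hn) (fun n hn hz => log_div_nonneg hn hz)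
  simpa [smooth] using this

theorem norm_smooth_lg_le {f : 𝓐} {H z : ℝ} (hz : 1 ≤ z) (hH : 0 ≤ H)
    (hf : ∀ N : ℕ, ‖∑ n ∈ Ioc 0 N, f n‖ ≤ H * √N) :
    ‖smooth (lg 1 f) z‖ ≤ 2 * H * √z * log z ^ 2 := by
  have h1 := norm_smooth_le hz hH hf
  have h2 := norm_sum_weight_floor_le hz hH hf (fun n => log (z / n) ^ 2)
    (fun m n hm hmn hn => pow_le_pow_left₀ (log_div_nonneg (hm.trans_le hmn) hn)
      (log_div_anti hm hmn hn) 2) (fun n _ _ => sq_nonneg _)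
  have h3 : smooth (lg 1 f) z = log z * smooth f z -
      ∑ n ∈ Ioc 0 ⌊z⌋₊, ((log (z / n) ^ 2 : ℝ) : ℂ) * f n := by
    rw [smooth, smooth, mul_sum, ← sum_sub_distrib]
    refine sum_congr rfl fun n hn => ?_
    rw [mem_Ioc] at hn
    have hn0 : (n : ℝ) ≠ 0 := by exact_mod_cast hn.1.ne'
    rw [lg_apply, log_div (by linarith) hn0]
    push_cast
    simp
    ring
  have h4 : 0 ≤ log z := log_nonneg hz
  rw [h3]
  refine (norm_sub_le _ _).trans ?_
  rw [norm_mul, norm_real, norm_of_nonneg h4]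
  simp only [Nat.cast_one, div_one] at h2
  nlinarith [mul_le_mul_of_nonneg_left h1 h4]

theorem sum_dcount_div_sqrt_le (W : ℕ) : ∑ n ∈ Ioc 0 W, dcount n / √n ≤ √W * (1 + log W) ^ 2 := by
  have h := sum_dcount_pow_div_le W 1
  simp only [pow_one] at h
  refine le_trans ?_ (mul_le_mul_of_nonneg_left h (sqrt_nonneg W))
  rw [mul_sum]
  refine sum_le_sum fun n hn => ?_
  rw [mem_Ioc] at hn
  have hn0 : (0 : ℝ) < n := by exact_mod_cast hn.1
  have hs := Real.sqrt_pos.mpr hn0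
  have h1 : √(n : ℝ) ≤ √W := sqrt_le_sqrt (by exact_mod_cast hn.2)
  have h2 : (n : ℝ)⁻¹ = (√n)⁻¹ * (√n)⁻¹ := by rw [← mul_inv, Real.mul_self_sqrt hn0.le]
  rw [h2, div_eq_mul_inv]
  have h3 : √(n : ℝ) * (√n)⁻¹ = 1 := mul_inv_cancel₀ hs.ne'
  calc dcount n * (√n)⁻¹ = √n * (dcount n * ((√n)⁻¹ * (√n)⁻¹)) := by
        linear_combination -(dcount n * (√(n : ℝ))⁻¹) * h3
    _ ≤ _ := by
        refine mul_le_mul_of_nonneg_right h1 ?_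
        exact mul_nonneg (dcount_nonneg n) (by positivity)

theorem norm_smooth_mul_le {K g : 𝓐} {W : ℕ} {B G y : ℝ} (hy : 1 ≤ y) (hB : 0 ≤ B) (hG : 0 ≤ G)
    (hK : ∀ n, W < n → K n = 0) (hK' : ∀ n, 0 < n → ‖K n‖ ≤ B * dcount n)
    (hg : ∀ z, 1 ≤ z → z ≤ y → ‖smooth g z‖ ≤ G * √z) :
    ‖smooth (K * g) y‖ ≤ B * G * √y * (√W * (1 + log W) ^ 2) := by
  rw [smooth_mul]
  have h1 : ∀ a ∈ Ioc 0 ⌊y⌋₊, ‖K a * smooth g (y / a)‖ ≤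
      if a ≤ W then B * G * √y * (dcount a / √a) else 0 := by
    intro a ha
    rw [mem_Ioc] at ha
    split_ifs with h
    · have ha0 : (1 : ℝ) ≤ a := by exact_mod_cast ha.1
      have ha1 : (a : ℝ) ≤ y := (Nat.le_floor_iff (by linarith)).mp ha.2
      have h2 := hg (y / a) (by rw [le_div_iff₀ (by linarith)]; linarith)
        (div_le_self (by linarith) ha0)
      rw [norm_mul]
      refine (mul_le_mul (hK' a ha.1) h2 (norm_nonneg _)
        (mul_nonneg hB (dcount_nonneg a))).trans (le_of_eq ?_)
      rw [Real.sqrt_div (by linarith)]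
      ring
    · rw [hK a (by omega)]; simp
  refine (norm_sum_le_of_le _ h1).trans ?_
  rw [← sum_filter]
  calc ∑ a ∈ Ioc 0 ⌊y⌋₊ with a ≤ W, B * G * √y * (dcount a / √a)
      ≤ ∑ a ∈ Ioc 0 W, B * G * √y * (dcount a / √a) := by
        refine sum_le_sum_of_subset_of_nonneg ?_ fun a _ _ => ?_
        · intro a; simp only [mem_filter, mem_Ioc]; tauto
        · have := dcount_nonneg a; positivity
    _ ≤ _ := by
        rw [← mul_sum]
        exact mul_le_mul_of_nonneg_left (sum_dcount_div_sqrt_le W) (by positivity)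

theorem vaughan_identity {r μ' Λ' : 𝓐} (D : Datum r μ' Λ') (V : ℕ) :
    Λ' = cut V Λ' + cut V μ' * lg 1 r - cut V μ' * cut V Λ' * r +
      (Λ' - cut V Λ') * (1 - cut V μ' * r) := by
  rw [← D.der]
  ring

theorem norm_mul_inv_der_le {r μ' Λ' : 𝓐} (D : Datum r μ' Λ') (V : ℕ) (n : ℕ) :
    ‖(cut V μ' * cut V Λ') n‖ ≤ 2 * log n * dcount n := by
  rcases eq_or_ne n 0 with rfl | hn
  · simp
  rw [mul_apply]
  calc ‖∑ p ∈ n.divisorsAntidiagonal, cut V μ' p.1 * cut V Λ' p.2‖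
      ≤ ∑ p ∈ n.divisorsAntidiagonal, dcount n * (2 * vonMangoldt p.2) := by
        refine norm_sum_le_of_le _ fun p hp => ?_
        rw [Nat.mem_divisorsAntidiagonal] at hp
        rw [norm_mul]
        refine mul_le_mul ?_ ((norm_cut_le _ _ _).trans (D.norm_der _)) (norm_nonneg _)
          (dcount_nonneg n)
        exact ((norm_cut_le _ _ _).trans (D.norm_inv _)).trans
          (dcount_le_of_dvd hn ⟨p.2, hp.1.symm⟩)
    _ = dcount n * (2 * ∑ i ∈ n.divisors, vonMangoldt i) := by
        rw [← mul_sum, ← mul_sum, Nat.sum_divisorsAntidiagonal' (fun _ i => vonMangoldt i)]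
    _ = _ := by rw [vonMangoldt_sum]; ring

theorem norm_smooth_cut_le {Λ' : 𝓐} (hΛ : ∀ n, ‖Λ' n‖ ≤ 2 * vonMangoldt n)
    (V : ℕ) {y : ℝ} (hy : 1 ≤ y) : ‖smooth (cut V Λ') y‖ ≤ V * (2 * log y ^ 2) := by
  have hlog : 0 ≤ log y := log_nonneg hy
  have h1 : ∀ n ∈ Ioc 0 ⌊y⌋₊, ‖(log (y / n) : ℂ) * cut V Λ' n‖ ≤
      if n ≤ V then 2 * log y ^ 2 else 0 := by
    intro n hn
    rw [mem_Ioc] at hn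
    have hn0 : (1 : ℝ) ≤ n := by exact_mod_cast hn.1
    have hn1 : (n : ℝ) ≤ y := (Nat.le_floor_iff (by linarith)).mp hn.2
    rw [cut_apply]
    split_ifs with h
    · rw [norm_mul, norm_real, norm_of_nonneg (log_div_nonneg hn.1 hn1)]
      have h2 : log (y / n) ≤ log y := by
        have := log_div_anti (m := 1) one_pos hn.1 hn1
        simpa using this
      have h3 : ‖Λ' n‖ ≤ 2 * log y := by
        refine (hΛ n).trans (mul_le_mul_of_nonneg_left (vonMangoldt_le_log.trans ?_) (by norm_num))
        exact log_le_log (by linarith) hn1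
      calc _ ≤ log y * (2 * log y) := mul_le_mul h2 h3 (norm_nonneg _) hlog
        _ = _ := by ring
    · simp
  refine (norm_sum_le_of_le _ h1).trans ?_
  rw [← sum_filter]
  calc ∑ n ∈ Ioc 0 ⌊y⌋₊ with n ≤ V, 2 * log y ^ 2
      ≤ ∑ n ∈ Ioc 0 V, 2 * log y ^ 2 := by
        refine sum_le_sum_of_subset_of_nonneg ?_ fun a _ _ => by positivity
        intro a; simp only [mem_filter, mem_Ioc]; tauto
    _ = _ := by rw [sum_const, Nat.card_Ioc, nsmul_eq_mul, Nat.sub_zero]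

theorem mul_cut_eq_zero (f g : 𝓐) (V n : ℕ) (h : V ^ 2 < n) : (cut V f * cut V g) n = 0 := by
  rw [mul_apply]
  refine sum_eq_zero fun p hp => ?_
  rw [Nat.mem_divisorsAntidiagonal] at hp
  simp only [cut_apply]
  by_cases h1 : p.1 ≤ V
  · by_cases h2 : p.2 ≤ V
    · have := Nat.mul_le_mul h1 h2
      rw [hp.1, ← sq] at this
      omega
    · simp [h2]
  · simp [h1]

/-- Vaughan's identity with the first type of sums estimated. -/
theorem vaughan_bound {r μ' Λ' : 𝓐} (D : Datum r μ' Λ') {V : ℕ} (hV : 1 ≤ V)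
    {H x y : ℝ} (hH : 1 ≤ H) (hy : 1 ≤ y) (hyx : y ≤ x) (hVx : (V : ℝ) ^ 2 ≤ x)
    (hr : ∀ N : ℕ, ‖∑ n ∈ Ioc 0 N, r n‖ ≤ H * √N) :
    ‖smooth Λ' y‖ ≤ 6 * H * (1 + log x) ^ 4 * (√x * V) +
      ‖smooth ((Λ' - cut V Λ') * (1 - cut V μ' * r)) y‖ := by
  have hV1 : (1 : ℝ) ≤ V := by exact_mod_cast hV
  have hx : 1 ≤ x := hy.trans hyx
  set ℓ := 1 + log x with hℓ
  have hlx : 0 ≤ log x := log_nonneg hx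
  have hl1 : 1 ≤ ℓ := by linarith
  have hly : ∀ z, 1 ≤ z → z ≤ x → log z ≤ ℓ := fun z hz hzx => by
    have := log_le_log (by linarith) hzx
    linarith
  have hH0 : 0 ≤ H := by linarith
  have hsy : √y ≤ √x := sqrt_le_sqrt hyx
  have hVs : (V : ℝ) ≤ √x := by rw [Real.le_sqrt (by positivity) (by linarith)]; exact hVx
  have hs0 : 0 ≤ √x := sqrt_nonneg x
  have hlog : ∀ z, 1 ≤ z → 0 ≤ log z := fun z hz => log_nonneg hz
  have h1 : ‖smooth (cut V Λ') y‖ ≤ 2 * H * ℓ ^ 4 * (√x * V) := by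
    refine (norm_smooth_cut_le D.norm_der V hy).trans ?_
    have h2 : log y ^ 2 ≤ ℓ ^ 4 :=
      (pow_le_pow_left₀ (hlog y hy) (hly y hy hyx) 2).trans (pow_le_pow_right₀ hl1 (by norm_num))
    have h3 : (1 : ℝ) ≤ √x := hV1.trans hVs
    calc (V : ℝ) * (2 * log y ^ 2) ≤ V * (2 * ℓ ^ 4) := by gcongr
      _ = 2 * 1 * ℓ ^ 4 * (1 * V) := by ring
      _ ≤ _ := by gcongr
  have h2 : ‖smooth (cut V μ' * lg 1 r) y‖ ≤ 2 * H * ℓ ^ 4 * (√x * V) := by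
    refine (norm_smooth_mul_le (W := V) (B := 1) (G := 2 * H * ℓ ^ 2) hy (by norm_num)
      (by positivity) (fun n hn => by rw [cut_apply, if_neg (by omega)])
      (fun n _ => by rw [one_mul]; exact (norm_cut_le _ _ _).trans (D.norm_inv n))
      (fun z hz hzy => ?_)).trans ?_
    · refine (norm_smooth_lg_le hz hH0 hr).trans ?_
      have h2 : log z ^ 2 ≤ ℓ ^ 2 := pow_le_pow_left₀ (hlog z hz) (hly z hz (hzy.trans hyx)) 2
      calc 2 * H * √z * log z ^ 2 ≤ 2 * H * √z * ℓ ^ 2 := by gcongr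
        _ = _ := by ring
    · have h3 : 1 + log V ≤ ℓ := by
        have := log_le_log (by linarith) (show (V : ℝ) ≤ x by nlinarith)
        linarith
      have h4 : √(V : ℝ) ≤ V := by rw [Real.sqrt_le_left (by linarith)]; nlinarith
      have h5 : 0 ≤ log V := hlog _ hV1
      calc 1 * (2 * H * ℓ ^ 2) * √y * (√V * (1 + log V) ^ 2)
          ≤ 1 * (2 * H * ℓ ^ 2) * √x * (V * ℓ ^ 2) := by gcongr
        _ = _ := by ring
  have h3 : ‖smooth (cut V μ' * cut V Λ' * r) y‖ ≤ 2 * H * ℓ ^ 4 * (√x * V) := by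
    refine (norm_smooth_mul_le (W := V ^ 2) (B := 2 * log x) (G := H * ℓ) hy (by positivity)
      (by positivity) (fun n hn => ?_) (fun n hn => ?_)
      (fun z hz hzy => ?_)).trans ?_
    · exact mul_cut_eq_zero _ _ _ _ hn
    · by_cases hnV : V ^ 2 < n
      · rw [mul_cut_eq_zero _ _ _ _ hnV, norm_zero]
        exact mul_nonneg (by positivity) (dcount_nonneg n)
      · refine (norm_mul_inv_der_le D V n).trans ?_
        have hn0 : (0 : ℝ) < n := by exact_mod_cast hn
        have hn1 : (n : ℝ) ≤ x := by
          refine le_trans ?_ hVx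
          exact_mod_cast not_lt.mp hnV
        have := log_le_log hn0 hn1
        have := dcount_nonneg n
        gcongr
    · refine (norm_smooth_le hz hH0 hr).trans ?_
      calc H * √z * log z ≤ H * √z * ℓ := by
            have := hly z hz (hzy.trans hyx)
            gcongr
        _ = _ := by ring
    · have h3 : 1 + log ((V ^ 2 : ℕ) : ℝ) ≤ ℓ := by
        have := log_le_log (by positivity) hVx
        push_cast
        linarith
      have h4 : √((V ^ 2 : ℕ) : ℝ) = V := by
        push_cast
        exact Real.sqrt_sq (by linarith)
      have h5 : 0 ≤ log ((V ^ 2 : ℕ) : ℝ) := hlog _ (by push_cast; nlinarith)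
      rw [h4]
      calc 2 * log x * (H * ℓ) * √y * (V * (1 + log ((V ^ 2 : ℕ) : ℝ)) ^ 2)
          ≤ 2 * ℓ * (H * ℓ) * √x * (V * ℓ ^ 2) := by
            have : log x ≤ ℓ := by linarith
            gcongr
        _ = _ := by ring
  have hid : smooth Λ' y = smooth (cut V Λ') y + smooth (cut V μ' * lg 1 r) y -
      smooth (cut V μ' * cut V Λ' * r) y +
      smooth ((Λ' - cut V Λ') * (1 - cut V μ' * r)) y := by
    conv_lhs => rw [vaughan_identity D V]
    rw [smooth_add, smooth_sub, smooth_add]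
  rw [hid]
  refine (norm_add_le _ _).trans ?_
  refine add_le_add_left
    ((norm_sub_le _ _).trans ((add_le_add_left (norm_add_le _ _) _).trans ?_)) _
  linarith

theorem sub_cut_apply {Λ' : 𝓐} {V n : ℕ} : (Λ' - cut V Λ') n = if n ≤ V then 0 else Λ' n := by
  rw [sub_eq_add_neg, ArithmeticFunction.add_apply, ArithmeticFunction.neg_apply, cut_apply]
  split_ifs <;> simp

theorem one_sub_cut_mul_eq_zero {r μ' Λ' : 𝓐} (D : Datum r μ' Λ') {V n : ℕ}
    (hn : n ≤ V) : (1 - cut V μ' * r) n = 0 := by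
  have h : (cut V μ' * r) n = (μ' * r) n := by
    rw [mul_apply, mul_apply]
    refine sum_congr rfl fun p hp => ?_
    rw [Nat.mem_divisorsAntidiagonal] at hp
    have hp2 : 0 < p.2 := Nat.pos_of_ne_zero (fun h => hp.2 (by rw [← hp.1, h, mul_zero]))
    rw [cut_apply, if_pos ((Nat.le_mul_of_pos_right _ hp2).trans (hp.1.le.trans hn))]
  rw [sub_eq_add_neg, ArithmeticFunction.add_apply, ArithmeticFunction.neg_apply, h,
    mul_comm, D.inv, add_neg_cancel]

theorem norm_one_sub_cut_mul_le {r μ' Λ' : 𝓐} (D : Datum r μ' Λ') (V n : ℕ) :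
    ‖(1 - cut V μ' * r) n‖ ≤ 2 * dcount n ^ 3 := by
  rcases eq_or_ne n 0 with rfl | hn
  · simp only [ArithmeticFunction.map_zero, norm_zero]
    have := dcount_nonneg 0
    positivity
  rw [sub_eq_add_neg, ArithmeticFunction.add_apply, ArithmeticFunction.neg_apply]
  have hd := one_le_dcount hn
  have h1 : ‖(1 : 𝓐) n‖ ≤ 1 := by rw [one_apply]; split_ifs <;> simp
  have h2 : ‖(cut V μ' * r) n‖ ≤ dcount n ^ 3 := by
    rw [mul_apply]
    calc ‖∑ p ∈ n.divisorsAntidiagonal, cut V μ' p.1 * r p.2‖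
        ≤ ∑ p ∈ n.divisorsAntidiagonal, dcount n * dcount n := by
          refine norm_sum_le_of_le _ fun p hp => ?_
          rw [Nat.mem_divisorsAntidiagonal] at hp
          rw [norm_mul]
          exact mul_le_mul (((norm_cut_le _ _ _).trans (D.norm_inv _)).trans
            (dcount_le_of_dvd hn ⟨p.2, hp.1.symm⟩))
            ((D.norm_r _).trans (dcount_le_of_dvd hn ⟨p.1, by rw [mul_comm]; exact hp.1.symm⟩))
            (norm_nonneg _) (dcount_nonneg n)
      _ = _ := by
          rw [sum_const, nsmul_eq_mul, ← Nat.map_div_right_divisors, card_map]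
          change dcount n * _ = _
          ring
  refine (norm_add_le _ _).trans ?_
  rw [norm_neg]
  have : (1 : ℝ) ≤ dcount n ^ 3 := one_le_pow₀ hd
  linarith

/-- Selberg's form of Bessel's inequality, with weights. -/
theorem weighted_bessel {ι : Type*} (X : Finset ι) (N : Finset ℕ) (v : ι → ℕ → ℂ) (w : ℕ → ℝ)
    (hw : ∀ n, 0 ≤ w n) (a : ℕ → ℂ) (Δ : ℝ) (hΔ0 : 0 ≤ Δ)
    (hΔ : ∀ i ∈ X, ∑ j ∈ X, ‖∑ n ∈ N, (w n : ℂ) * (v i n * conj (v j n))‖ ≤ Δ) :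
    ∑ i ∈ X, ‖∑ n ∈ N, (w n : ℂ) * (a n * v i n)‖ ^ 2 ≤ Δ * ∑ n ∈ N, w n * ‖a n‖ ^ 2 := by
  set c : ι → ℂ := fun i => ∑ n ∈ N, (w n : ℂ) * (a n * v i n) with hc
  set T : ℝ := ∑ i ∈ X, ‖c i‖ ^ 2 with hT
  set S : ℝ := ∑ n ∈ N, w n * ‖a n‖ ^ 2 with hS
  set u : ℕ → ℂ := fun n => ∑ i ∈ X, conj (c i) * v i n with hu
  have hS0 : 0 ≤ S := sum_nonneg fun n _ => mul_nonneg (hw n) (sq_nonneg _)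
  have hT0 : 0 ≤ T := sum_nonneg fun n _ => sq_nonneg _
  have h1 : (T : ℂ) = ∑ n ∈ N, (w n : ℂ) * (a n * u n) := by
    have : ∀ i ∈ X, ((‖c i‖ ^ 2 : ℝ) : ℂ) = ∑ n ∈ N, (w n : ℂ) * (a n * (conj (c i) * v i n)) := by
      intro i _
      rw [Complex.ofReal_pow, ← Complex.conj_mul' (c i)]
      conv_lhs => rw [hc]
      rw [mul_sum]
      exact sum_congr rfl fun n _ => by ring
    rw [hT, ofReal_sum, sum_congr rfl this, sum_comm]
    exact sum_congr rfl fun n _ => by rw [hu, mul_sum, mul_sum]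
  have h2 : T ≤ ∑ n ∈ N, w n * (‖a n‖ * ‖u n‖) := by
    have := congrArg norm h1
    rw [norm_real, norm_of_nonneg hT0] at this
    rw [this]
    refine norm_sum_le_of_le _ fun n _ => ?_
    rw [norm_mul, norm_mul, norm_real, norm_of_nonneg (hw n)]
  have h3 : T ^ 2 ≤ S * ∑ n ∈ N, w n * ‖u n‖ ^ 2 := by
    refine (pow_le_pow_left₀ hT0 h2 2).trans ?_
    refine sum_sq_le_sum_mul_sum_of_sq_le_mul _ (fun n _ => mul_nonneg (hw n) (sq_nonneg _))
      (fun n _ => mul_nonneg (hw n) (sq_nonneg _)) (fun n _ => le_of_eq (by ring))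
  have h4 : ((∑ n ∈ N, w n * ‖u n‖ ^ 2 : ℝ) : ℂ) = ∑ i ∈ X, ∑ j ∈ X,
      conj (c i) * c j * ∑ n ∈ N, (w n : ℂ) * (v i n * conj (v j n)) := by
    have : ∀ n ∈ N, ((w n * ‖u n‖ ^ 2 : ℝ) : ℂ) = ∑ i ∈ X, ∑ j ∈ X,
        conj (c i) * c j * ((w n : ℂ) * (v i n * conj (v j n))) := by
      intro n _
      rw [ofReal_mul, Complex.ofReal_pow, ← Complex.mul_conj' (u n)]
      rw [hu]
      simp only [map_sum, map_mul, Complex.conj_conj]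
      rw [sum_mul_sum, mul_sum]
      refine sum_congr rfl fun i _ => ?_
      rw [mul_sum]
      exact sum_congr rfl fun j _ => by ring
    rw [ofReal_sum, sum_congr rfl this, sum_comm]
    refine sum_congr rfl fun i _ => ?_
    rw [sum_comm]
    exact sum_congr rfl fun j _ => (mul_sum _ _ _).symm
  have h5 : ∑ n ∈ N, w n * ‖u n‖ ^ 2 ≤ Δ * T := by
    have h50 : 0 ≤ ∑ n ∈ N, w n * ‖u n‖ ^ 2 := sum_nonneg fun n _ => mul_nonneg (hw n) (sq_nonneg _)
    set g : ι → ι → ℝ := fun i j => ‖∑ n ∈ N, (w n : ℂ) * (v i n * conj (v j n))‖ with hg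
    have hsymm : ∀ i j, g i j = g j i := by
      intro i j
      simp only [hg]
      rw [← Complex.norm_conj]
      congr 1
      rw [map_sum]
      refine sum_congr rfl fun n _ => ?_
      simp only [map_mul, Complex.conj_conj, Complex.conj_ofReal]
      ring
    have := congrArg norm h4
    rw [norm_real, norm_of_nonneg h50] at this
    rw [this]
    calc _ ≤ ∑ i ∈ X, ∑ j ∈ X, (‖c i‖ ^ 2 * g i j + ‖c j‖ ^ 2 * g j i) / 2 := by
          refine norm_sum_le_of_le _ fun i _ => norm_sum_le_of_le _ fun j _ => ?_
          rw [norm_mul, norm_mul, RCLike.norm_conj, ← hsymm i j]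
          change ‖c i‖ * ‖c j‖ * g i j ≤ _
          have : 0 ≤ g i j := norm_nonneg _
          nlinarith [mul_nonneg (sq_nonneg (‖c i‖ - ‖c j‖)) this]
      _ = ∑ i ∈ X, ‖c i‖ ^ 2 * ∑ j ∈ X, g i j := by
          simp only [add_div, sum_add_distrib]
          rw [sum_comm (f := fun i j => ‖c j‖ ^ 2 * g j i / 2)]
          rw [← sum_add_distrib]
          refine sum_congr rfl fun i _ => ?_
          rw [← sum_add_distrib, mul_sum]
          exact sum_congr rfl fun j _ => by ring
      _ ≤ ∑ i ∈ X, ‖c i‖ ^ 2 * Δ :=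
          sum_le_sum fun i hi => mul_le_mul_of_nonneg_left (hΔ i hi) (sq_nonneg _)
      _ = Δ * T := by rw [← sum_mul, mul_comm]
  have h6 : T ^ 2 ≤ S * (Δ * T) := h3.trans (mul_le_mul_of_nonneg_left h5 hS0)
  rcases hT0.eq_or_lt with h | h
  · rw [← h]; exact mul_nonneg hΔ0 hS0
  · nlinarith

/-- Values of a Dirichlet character at natural numbers. -/
def ev {q : ℕ} (χ : 𝓧 q) (n : ℕ) : ℂ := χ (n : ZMod q)

theorem isCM_ev {q : ℕ} (χ : 𝓧 q) : IsCM (ev χ) where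
  one := by simp [ev]
  mul m n := by simp [ev]
  norm_le n := χ.norm_le_one _

theorem sum_Ioc_period {q : ℕ} [NeZero q] (f : ZMod q → ℂ) (a : ℕ) :
    ∑ n ∈ Ioc a (a + q), f (n : ZMod q) = ∑ z, f z := by
  have hinj : Set.InjOn (fun n : ℕ => (n : ZMod q)) (Ioc a (a + q) : Finset ℕ) := by
    intro m hm n hn h
    rw [mem_coe, mem_Ioc] at hm hn
    have h' := (ZMod.natCast_eq_natCast_iff m n q).mp h
    rcases le_total m n with hmn | hmn
    · have := (Nat.modEq_iff_dvd' hmn).mp h'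
      have := Nat.eq_zero_of_dvd_of_lt this (by omega)
      omega
    · have := (Nat.modEq_iff_dvd' hmn).mp h'.symm
      have := Nat.eq_zero_of_dvd_of_lt this (by omega)
      omega
  have himg : (Ioc a (a + q)).image (fun n : ℕ => (n : ZMod q)) = univ := by
    apply eq_univ_of_card
    rw [card_image_of_injOn hinj, Nat.card_Ioc, ZMod.card]
    omega
  rw [← himg, sum_image hinj]

theorem norm_sum_Ioc_le_of_sum_eq_zero {q : ℕ} [NeZero q] (f : ZMod q → ℂ) (hf : ∑ z, f z = 0)
    (hf1 : ∀ z, ‖f z‖ ≤ 1) (k : ℕ) : ∀ a, ‖∑ n ∈ Ioc a (a + k), f (n : ZMod q)‖ ≤ q := by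
  induction k using Nat.strong_induction_on with
  | _ k ih =>
    intro a
    rcases lt_or_ge k q with h | h
    · refine (norm_sum_le_of_le _ (n := fun _ => (1 : ℝ)) fun n _ => hf1 _).trans ?_
      rw [sum_const, Nat.card_Ioc, nsmul_eq_mul, mul_one]
      exact_mod_cast (by omega : a + k - a ≤ q)
    · have h1 : Ioc a (a + k) = Ioc a (a + q) ∪ Ioc (a + q) (a + k) :=
        (Ioc_union_Ioc_eq_Ioc (by omega) (by omega)).symm
      have h2 : Disjoint (Ioc a (a + q)) (Ioc (a + q) (a + k)) := by
        rw [disjoint_left]; intro n; simp only [mem_Ioc]; omega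
      rw [h1, sum_union h2, sum_Ioc_period, hf, zero_add]
      have hq : 0 < q := Nat.pos_of_ne_zero (NeZero.ne q)
      have := ih (k - q) (by omega) (a + q)
      rwa [show a + q + (k - q) = a + k by omega] at this

theorem norm_sum_ev_le {q : ℕ} [NeZero q] {χ : 𝓧 q} (hχ : χ ≠ 1) (a b : ℕ) :
    ‖∑ n ∈ Ioc a b, ev χ n‖ ≤ q := by
  rcases le_total a b with h | h
  · obtain ⟨k, rfl⟩ := Nat.exists_eq_add_of_le h
    exact norm_sum_Ioc_le_of_sum_eq_zero (fun z => χ z) (MulChar.sum_eq_zero_of_ne_one hχ)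
      (fun z => χ.norm_le_one z) k a
  · simp [Ioc_eq_empty_of_le h]

theorem ev_changeLevel {q m : ℕ} (χ : 𝓧 q) (h : q ∣ m) {n : ℕ}
    (hn : n.Coprime m) : ev (DirichletCharacter.changeLevel h χ) n = ev χ n := by
  have hu := ZMod.unitOfCoprime n hn
  have := DirichletCharacter.changeLevel_eq_cast_of_dvd χ h (ZMod.unitOfCoprime n hn)
  rw [ZMod.coe_unitOfCoprime] at this
  rw [ev, ev, this, ZMod.cast_natCast h]

theorem ev_eq_zero {q : ℕ} (χ : 𝓧 q) {n : ℕ} (hn : ¬ n.Coprime q) : ev χ n = 0 :=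
  χ.map_nonunit (fun h => hn ((ZMod.isUnit_iff_coprime n q).mp h))

theorem ev_mul_changeLevel {q q' : ℕ} (χ : 𝓧 q) (χ' : 𝓧 q')
    (n : ℕ) : ev (DirichletCharacter.changeLevel (dvd_mul_right q q') χ *
      DirichletCharacter.changeLevel (dvd_mul_left q' q) χ') n = ev χ n * ev χ' n := by
  by_cases hn : n.Coprime (q * q')
  · rw [← ev_changeLevel χ (dvd_mul_right q q') hn, ← ev_changeLevel χ' (dvd_mul_left q' q) hn]
    simp [ev]
  · rw [ev_eq_zero _ hn]
    rw [Nat.coprime_mul_iff_right, not_and_or] at hn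
    rcases hn with hn | hn
    · rw [ev_eq_zero χ hn, zero_mul]
    · rw [ev_eq_zero χ' hn, mul_zero]

theorem ev_inv {q : ℕ} (χ : 𝓧 q) (n : ℕ) : ev χ⁻¹ n = conj (ev χ n) := by
  rw [ev, ev]
  rcases eq_or_ne q 0 with rfl | h
  · rw [MulChar.inv_apply_eq_inv']
    by_cases hu : IsUnit ((n : ℕ) : ZMod 0)
    · have h1 : ((n : ℕ) : ZMod 0) = 1 := by
        have := (ZMod.isUnit_iff_coprime n 0).mp hu
        rw [Nat.coprime_zero_right] at this
        rw [this]; rfl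
      rw [h1]; simp
    · rw [χ.map_nonunit hu]; simp
  · have := NeZero.mk h
    rw [← MulChar.star_eq_inv, MulChar.star_apply]
    rfl

theorem changeLevel_primitive_ne {q q' : ℕ} [NeZero q] [NeZero q'] {χ : 𝓧 q}
    {χ' : 𝓧 q'} (h : χ.IsPrimitive) (h' : χ'.IsPrimitive)
    (hne : (⟨q, χ⟩ : Σ q, 𝓧 q) ≠ ⟨q', χ'⟩) :
    DirichletCharacter.changeLevel (dvd_mul_right q q') χ ≠
      DirichletCharacter.changeLevel (dvd_mul_left q' q) χ' := by
  intro heq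
  have : NeZero (q * q') := ⟨mul_ne_zero (NeZero.ne q) (NeZero.ne q')⟩
  have h1 := congrArg DirichletCharacter.conductor heq
  rw [DirichletCharacter.conductor_changeLevel, DirichletCharacter.conductor_changeLevel] at h1
  have h2 : q = q' := by rw [← h, ← h', h1]
  subst h2
  exact hne (by rw [DirichletCharacter.changeLevel_injective _ heq])

theorem norm_sum_ev_mul_conj_le {q q' : ℕ} [NeZero q] [NeZero q'] {χ : 𝓧 q}
    {χ' : 𝓧 q'} (h : χ.IsPrimitive) (h' : χ'.IsPrimitive)
    (hne : (⟨q, χ⟩ : Σ q, 𝓧 q) ≠ ⟨q', χ'⟩) (a b : ℕ) :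
    ‖∑ n ∈ Ioc a b, ev χ n * conj (ev χ' n)‖ ≤ q * q' := by
  have : NeZero (q * q') := ⟨mul_ne_zero (NeZero.ne q) (NeZero.ne q')⟩
  have h1 : DirichletCharacter.changeLevel (dvd_mul_right q q') χ *
      DirichletCharacter.changeLevel (dvd_mul_left q' q) χ'⁻¹ ≠ 1 := by
    rw [map_inv, ne_eq, mul_inv_eq_one]
    exact changeLevel_primitive_ne h h' hne
  have h2 := norm_sum_ev_le h1 a b
  simp only [ev_mul_changeLevel, ev_inv] at h2
  exact_mod_cast h2

open Classical in
/-- The primitive characters modulo `q`. -/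
def prims (q : ℕ) : Finset (𝓧 q) := if h : q = 0 then ∅ else
    haveI : NeZero q := ⟨h⟩
    univ.filter fun χ => χ.IsPrimitive

theorem mem_prims {q : ℕ} {χ : 𝓧 q} (hq : q ≠ 0) : χ ∈ prims q ↔ χ.IsPrimitive := by
  simp [prims, hq]

theorem card_prims_le (q : ℕ) : (prims q).card ≤ q := by
  unfold prims
  split_ifs with h
  · simp
  · have : NeZero q := ⟨h⟩
    classical
    refine (card_filter_le _ _).trans ?_
    rw [card_univ, ← Nat.card_eq_fintype_card,
      DirichletCharacter.card_eq_totient_of_hasEnoughRootsOfUnity]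
    exact Nat.totient_le q

theorem hasMellin_neg_log {s : ℂ} (hs : 0 < s.re) :
    HasMellin (fun t : ℝ => Set.indicator (Set.Ioc 0 1) (fun t : ℝ => (-log t : ℂ)) t) s
      (1 / s ^ 2) := by
  have hs0 : s ≠ 0 := by rintro rfl; simp at hs
  have hfc : MeasureTheory.LocallyIntegrableOn
      (Set.indicator (Set.Ioc (0:ℝ) 1) (fun _ => 1 : ℝ → ℂ)) (Set.Ioi 0) := by
    apply MeasureTheory.LocallyIntegrable.locallyIntegrableOn
    apply MeasureTheory.Integrable.locallyIntegrable
    rw [MeasureTheory.integrable_indicator_iff measurableSet_Ioc]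
    simp
  have htop : (Set.indicator (Set.Ioc (0:ℝ) 1) (fun _ => 1 : ℝ → ℂ)) =O[Filter.atTop]
      (fun t : ℝ => t ^ (-(s.re + 1))) := by
    apply Asymptotics.IsBigO.of_bound 0
    filter_upwards [Filter.eventually_gt_atTop (1:ℝ)] with t ht
    rw [Set.indicator_of_notMem (by simp; intro; linarith)]
    simp
  have hbot : (Set.indicator (Set.Ioc (0:ℝ) 1) (fun _ => 1 : ℝ → ℂ)) =O[nhdsWithin 0 (Set.Ioi 0)]
      (fun t : ℝ => t ^ (-(0:ℝ))) := by
    apply Asymptotics.IsBigO.of_bound 1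
    filter_upwards with t
    by_cases ht : t ∈ Set.Ioc (0:ℝ) 1
    · simp [ht]
    · simp [ht]
  have h := mellin_hasDerivAt_of_isBigO_rpow (s := s) (a := s.re + 1) (b := 0) hfc htop
    (by linarith) hbot hs
  have hd : HasDerivAt (mellin (Set.indicator (Set.Ioc (0:ℝ) 1) (fun _ => 1 : ℝ → ℂ)))
      (-(s ^ 2)⁻¹) s := by
    refine (hasDerivAt_inv hs0).congr_of_eventuallyEq ?_
    have : ∀ᶠ z : ℂ in nhds s, 0 < z.re :=
      (isOpen_lt continuous_const Complex.continuous_re).mem_nhds hs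
    filter_upwards [this] with z hz
    rw [(hasMellin_one_Ioc hz).2, one_div]
  have he := h.2.unique hd
  have hfun : (fun t : ℝ => Set.indicator (Set.Ioc 0 1) (fun t : ℝ => (-log t : ℂ)) t) =
      fun t => (-1 : ℂ) • (log t • Set.indicator (Set.Ioc (0:ℝ) 1) (fun _ => 1 : ℝ → ℂ) t) := by
    funext t
    by_cases ht : t ∈ Set.Ioc (0:ℝ) 1
    · simp [ht]
    · simp [ht]
  rw [hfun]
  refine ⟨h.1.const_smul _, ?_⟩
  rw [mellin_const_smul, he]
  simp

theorem norm_line_sq_ge {σ : ℝ} (hσ : 1 ≤ σ) (t : ℝ) :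
    (1 + |t|) ^ 2 / 2 ≤ ‖(σ + t * I : ℂ)‖ ^ 2 := by
  rw [← normSq_eq_norm_sq, Complex.normSq_add_mul_I]
  have : |t| ^ 2 = t ^ 2 := sq_abs t
  nlinarith [sq_nonneg (1 - |t|)]

theorem line_ne_zero {σ : ℝ} (hσ : 1 ≤ σ) (t : ℝ) : (σ + t * I : ℂ) ≠ 0 := by
  intro h
  have := congrArg Complex.re h
  simp at this
  linarith

theorem continuous_line_inv_sq {σ : ℝ} (hσ : 1 ≤ σ) :
    Continuous (fun t : ℝ => 1 / (σ + t * I : ℂ) ^ 2) := by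
  apply Continuous.div continuous_const (by fun_prop)
  intro t
  exact pow_ne_zero _ (line_ne_zero hσ t)

theorem norm_line_inv_sq_le {σ : ℝ} (hσ : 1 ≤ σ) (t : ℝ) :
    ‖1 / (σ + t * I : ℂ) ^ 2‖ ≤ 2 * (1 + |t|) ^ (-2 : ℝ) := by
  have h1 : 0 < 1 + |t| := by positivity
  rw [norm_div, norm_one, norm_pow, rpow_neg h1.le, one_div]
  have := norm_line_sq_ge hσ t
  rw [show (2:ℝ) * ((1 + |t|) ^ (2:ℝ))⁻¹ = ((1 + |t|) ^ 2 / 2)⁻¹ by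
    rw [inv_div, Real.rpow_two]; rfl]
  exact inv_anti₀ (by positivity) this

theorem integrable_line {σ : ℝ} (hσ : 1 ≤ σ) :
    MeasureTheory.Integrable (fun t : ℝ => 1 / (σ + t * I : ℂ) ^ 2) := by
  have h := (integrable_one_add_norm (E := ℝ) (μ := MeasureTheory.volume) (r := 2)
    (by simp)).const_mul 2
  refine h.mono' (continuous_line_inv_sq hσ).aestronglyMeasurable ?_
  filter_upwards with t
  simpa using norm_line_inv_sq_le hσ t

theorem log_weight_eq_integral {σ : ℝ} (hσ : 1 ≤ σ) {x : ℝ} (hx : 0 < x) :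
    ((max (log x) 0 : ℝ) : ℂ) = (1 / (2 * π) : ℝ) •
      ∫ t : ℝ, (x : ℂ) ^ (σ + t * I : ℂ) * (1 / (σ + t * I : ℂ) ^ 2) := by
  have hM : ∀ s : ℂ, 0 < s.re → _ := fun s hs => hasMellin_neg_log hs
  set f : ℝ → ℂ := fun t : ℝ => Set.indicator (Set.Ioc 0 1) (fun t : ℝ => (-log t : ℂ)) t
  have hline : ∀ t : ℝ, mellin f (σ + t * I) = 1 / (σ + t * I : ℂ) ^ 2 := fun t =>
    (hM _ (by simp; linarith)).2
  have hf : ∀ z : ℝ, 0 < z → f z = ((max (-log z) 0 : ℝ) : ℂ) := by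
    intro z hz
    rcases le_or_gt z 1 with h | h
    · simp only [f]
      rw [Set.indicator_of_mem (show z ∈ Set.Ioc (0:ℝ) 1 from ⟨hz, h⟩),
        max_eq_left (by linarith [Real.log_nonpos hz.le h])]
      push_cast; rfl
    · simp only [f]
      rw [Set.indicator_of_notMem (by simp [h]), max_eq_right (by linarith [log_pos h])]
      simp
  have hc : ContinuousAt f x⁻¹ := by
    have h2 : ContinuousAt (fun z : ℝ => ((max (-log z) 0 : ℝ) : ℂ)) x⁻¹ := by
      apply continuous_ofReal.continuousAt.comp
      exact (Real.continuousAt_log (by positivity)).neg.max continuousAt_const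
    refine h2.congr ?_
    filter_upwards [lt_mem_nhds (show 0 < x⁻¹ by positivity)] with z hz
    exact (hf z hz).symm
  have := mellinInv_mellin_eq σ f (x := x⁻¹) (by positivity) (hM σ (by simp; linarith)).1 (by
      unfold Complex.VerticalIntegrable
      simp_rw [hline]
      exact integrable_line hσ) hc
  rw [hf _ (by positivity), Real.log_inv, neg_neg, mellinInv] at this
  rw [← this]
  simp_rw [hline, smul_eq_mul]
  congr 2
  funext t
  congr 1
  push_cast
  rw [Complex.inv_cpow _ _ (by rw [Complex.arg_ofReal_of_nonneg hx.le]; exact pi_pos.ne),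
    cpow_neg, inv_inv]

/-- The constant of the smoothing kernel. -/
def kernelConst : ℝ := ∫ t : ℝ, 2 * (1 + ‖t‖) ^ (-(3 / 2) : ℝ)

theorem integrable_kernel :
    MeasureTheory.Integrable (fun t : ℝ => 2 * (1 + ‖t‖) ^ (-(3 / 2) : ℝ)) :=
  (integrable_one_add_norm (E := ℝ) (μ := MeasureTheory.volume) (r := 3 / 2)
    (by simp; norm_num)).const_mul 2

theorem kernelConst_nonneg : 0 ≤ kernelConst := MeasureTheory.integral_nonneg fun t => by positivity

theorem norm_smooth_le_of_LSeries {F : 𝓐} {σ B y : ℝ} (hσ : 1 ≤ σ)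
    (hy : 0 < y) (hF : LSeriesSummable (F ·) σ)
    (hB : ∀ t : ℝ, ‖LSeries (F ·) (σ + t * I)‖ ≤ B * (1 + |t|) ^ (1 / 2 : ℝ)) :
    ‖smooth F y‖ ≤ kernelConst * B * y ^ σ := by
  have hB0 : 0 ≤ B := by simpa using (norm_nonneg _).trans (hB 0)
  set G : ℕ → ℝ → ℂ := fun n t => LSeries.term (F ·) (σ + t * I) n *
    (y : ℂ) ^ (σ + t * I : ℂ) * (1 / (σ + t * I : ℂ) ^ 2) with hG
  have hyn : ∀ t : ℝ, ‖(y : ℂ) ^ (σ + t * I : ℂ)‖ = y ^ σ := by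
    intro t
    rw [norm_cpow_eq_rpow_re_of_pos hy]; simp
  have hterm : ∀ n (t : ℝ), ‖LSeries.term (F ·) (σ + t * I) n‖ = ‖LSeries.term (F ·) σ n‖ := by
    intro n t
    rw [LSeries.norm_term_eq, LSeries.norm_term_eq]; simp
  have hGn : ∀ n t, ‖G n t‖ = ‖LSeries.term (F ·) σ n‖ * y ^ σ * ‖1 / (σ + t * I : ℂ) ^ 2‖ := by
    intro n t
    rw [hG]; simp only [norm_mul, hyn, hterm]
  have hcont : ∀ n, Continuous (G n) := by
    intro n
    refine (Continuous.mul ?_ ?_).mul (continuous_line_inv_sq hσ)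
    · rcases eq_or_ne n 0 with rfl | hn
      · simp only [LSeries.term_zero]; exact continuous_const
      · simp only [LSeries.term_of_ne_zero hn]
        have hn' : (n : ℂ) ≠ 0 := by exact_mod_cast hn
        refine continuous_const.div (Continuous.const_cpow (by fun_prop) (Or.inl hn')) ?_
        intro t
        rw [Complex.cpow_def_of_ne_zero hn']
        exact Complex.exp_ne_zero _
    · exact Continuous.const_cpow (by fun_prop) (Or.inl (by exact_mod_cast hy.ne'))
  have hint : ∀ n, MeasureTheory.Integrable (G n) := by
    intro n
    refine MeasureTheory.Integrable.mono'
      ((integrable_line hσ).norm.const_mul (‖LSeries.term (F ·) σ n‖ * y ^ σ))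
      (hcont n).aestronglyMeasurable ?_
    filter_upwards with t
    rw [hGn]
  have hsum : Summable fun n => ∫ t, ‖G n t‖ := by
    simp_rw [hGn, MeasureTheory.integral_const_mul]
    exact (hF.norm.mul_right _).mul_right _
  have hS := MeasureTheory.hasSum_integral_of_summable_integral_norm hint hsum
  have htsum : ∀ t, ∑' n, G n t = LSeries (F ·) (σ + t * I) *
      (y : ℂ) ^ (σ + t * I : ℂ) * (1 / (σ + t * I : ℂ) ^ 2) := by
    intro t
    simp only [hG]
    rw [tsum_mul_right, tsum_mul_right]; rfl
  have hval : ∀ n, (1 / (2 * π) : ℝ) • ∫ t, G n t =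
      if 0 < n ∧ (n : ℝ) ≤ y then ((log (y / n) : ℝ) : ℂ) * F n else 0 := by
    intro n
    rcases Nat.eq_zero_or_pos n with rfl | hn
    · simp [hG, LSeries.term_zero]
    have hn' : (0 : ℝ) < n := by exact_mod_cast hn
    have h1 := log_weight_eq_integral hσ (x := y / n) (by positivity)
    have h2 : ∀ t, G n t = F n * (((y / n : ℝ) : ℂ) ^ (σ + t * I : ℂ) *
        (1 / (σ + t * I : ℂ) ^ 2)) := by
      intro t
      simp only [hG]
      rw [LSeries.term_of_ne_zero hn.ne', div_eq_mul_inv y, ofReal_mul,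
        Complex.mul_cpow_ofReal_nonneg hy.le (by positivity), Complex.ofReal_inv,
        Complex.inv_cpow _ _ (by rw [Complex.arg_ofReal_of_nonneg hn'.le]; exact pi_pos.ne)]
      push_cast
      ring
    simp_rw [h2]
    rw [MeasureTheory.integral_const_mul, ← mul_smul_comm, ← h1, mul_comm]
    by_cases hny : (n : ℝ) ≤ y
    · rw [if_pos ⟨hn, hny⟩, max_eq_left]
      exact log_nonneg (by rw [le_div_iff₀ hn']; linarith)
    · rw [if_neg (by tauto), max_eq_right]
      · simp
      · exact Real.log_nonpos (by positivity) (by rw [div_le_iff₀ hn']; linarith)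
  have hS2 := hS.const_smul (1 / (2 * π) : ℝ)
  simp_rw [hval] at hS2
  have hsm : smooth F y = ∑' n : ℕ, if 0 < n ∧ (n : ℝ) ≤ y then
      ((log (y / n) : ℝ) : ℂ) * F n else 0 := by
    rw [tsum_eq_sum (s := Ioc 0 ⌊y⌋₊)]
    · unfold smooth
      refine sum_congr rfl fun n hn => ?_
      rw [mem_Ioc, Nat.le_floor_iff hy.le] at hn
      rw [if_pos hn]
    · intro n hn
      rw [mem_Ioc, Nat.le_floor_iff hy.le] at hn
      rw [if_neg hn]
  rw [hsm, hS2.tsum_eq, norm_smul]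
  have hbd : ‖∫ t, ∑' n, G n t‖ ≤ ∫ t : ℝ, B * y ^ σ * (2 * (1 + ‖t‖) ^ (-(3 / 2) : ℝ)) := by
    refine MeasureTheory.norm_integral_le_of_norm_le (integrable_kernel.const_mul _) ?_
    filter_upwards with t
    have h1 : 0 < 1 + |t| := by positivity
    rw [htsum, norm_mul, norm_mul, hyn]
    calc _ ≤ B * (1 + |t|) ^ (1 / 2 : ℝ) * y ^ σ * (2 * (1 + |t|) ^ (-2 : ℝ)) := by
          gcongr
          · exact hB t
          · exact norm_line_inv_sq_le hσ t
      _ = _ := by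
          rw [show (-(3 / 2) : ℝ) = 1 / 2 + (-2) by norm_num, rpow_add (by positivity), norm_eq_abs]
          ring
  rw [MeasureTheory.integral_const_mul] at hbd
  have hpi : ‖(1 / (2 * π) : ℝ)‖ ≤ 1 := by
    rw [norm_of_nonneg (by positivity), div_le_one (by positivity)]
    linarith [Real.pi_gt_three]
  calc _ ≤ 1 * (B * y ^ σ * kernelConst) := by
        gcongr
        exact hbd
    _ = _ := by ring

theorem LSeriesSummable_of_support {f : ℕ → ℂ} {N : ℕ} (hf : ∀ n, N < n → f n = 0) (s : ℂ) :
    LSeriesSummable f s := by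
  apply summable_of_ne_finset_zero (s := range (N + 1))
  intro n hn
  rw [mem_range, not_lt] at hn
  rw [LSeries.term_of_ne_zero (by omega), hf n (by omega), zero_div]

theorem LSeries_eq_sum_Ioc {f : ℕ → ℂ} {V N : ℕ} (hf : ∀ n, n ∉ Ioc V N → f n = 0) (s : ℂ) :
    LSeries f s = ∑ n ∈ Ioc V N, f n / (n : ℂ) ^ s := by
  unfold LSeries
  rw [tsum_eq_sum (s := Ioc V N)]
  · refine sum_congr rfl fun n hn => ?_
    rw [mem_Ioc] at hn
    rw [LSeries.term_of_ne_zero (by omega)]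
  · intro n hn
    rcases eq_or_ne n 0 with rfl | h0
    · simp
    · rw [LSeries.term_of_ne_zero h0, hf n hn, zero_div]

theorem natCast_line_split {n : ℕ} (hn : n ≠ 0) (σ t : ℝ) (z : ℂ) : z / (n : ℂ) ^ (σ + t * I : ℂ) =
      (((n : ℝ) ^ (-σ) : ℝ) : ℂ) * (z * (n : ℂ) ^ (-(t * I) : ℂ)) := by
  have hn' : (n : ℂ) ≠ 0 := by exact_mod_cast hn
  rw [Complex.ofReal_cpow (by positivity), div_eq_mul_inv, ← cpow_neg, neg_add,
    Complex.cpow_add _ _ hn']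
  push_cast
  ring

theorem norm_natCast_cpow_mul_I {n : ℕ} (hn : n ≠ 0) (t : ℝ) : ‖(n : ℂ) ^ (-(t * I) : ℂ)‖ = 1 := by
  rw [Complex.norm_natCast_cpow_of_pos (Nat.pos_of_ne_zero hn)]
  simp

theorem sum_norm_LSeries_tw_sq_le (X : Finset (Σ q, 𝓧 q)) {Q V N : ℕ}
    (hX : ∀ i ∈ X, i.1 ≠ 0 ∧ i.1 ≤ Q ∧ i.2.IsPrimitive) (hV : 1 ≤ V) (hc : X.card * Q ^ 2 ≤ V)
    (b : 𝓐) (hb : ∀ n, n ∉ Ioc V N → b n = 0) {σ : ℝ} (hσ : 1 < σ) (t : ℝ) :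
    ∑ i ∈ X, ‖LSeries (tw (ev i.2) b ·) (σ + t * I)‖ ^ 2 ≤
      (2 + 1 / (σ - 1)) * ∑ n ∈ Ioc V N, (n : ℝ) ^ (-σ) * ‖b n‖ ^ 2 := by
  have hσ' : 0 < σ - 1 := by linarith
  have h := weighted_bessel X (Ioc V N) (fun i n => ev i.2 n) (fun n => (n : ℝ) ^ (-σ))
    (fun n => by positivity) (fun n => b n * (n : ℂ) ^ (-(t * I) : ℂ))
    (2 + 1 / (σ - 1)) (by positivity) ?_
  · refine le_trans (le_of_eq ?_) (h.trans (le_of_eq ?_))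
    · refine sum_congr rfl fun i _ => ?_
      rw [LSeries_eq_sum_Ioc (V := V) (N := N) (fun n hn => by rw [tw_apply, hb n hn, mul_zero])]
      congr 2
      refine sum_congr rfl fun n hn => ?_
      rw [mem_Ioc] at hn
      rw [natCast_line_split (by omega), tw_apply]
      ring
    · congr 1
      refine sum_congr rfl fun n hn => ?_
      rw [mem_Ioc] at hn
      rw [norm_mul, norm_natCast_cpow_mul_I (by omega), mul_one]
  · intro i hi
    rcases le_or_gt N V with hNV | hNV
    · rw [Ioc_eq_empty (by omega)]
      simp only [sum_empty, norm_zero, sum_const_zero]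
      positivity
    classical
    rw [← add_sum_erase _ _ hi]
    have hdiag : ‖∑ n ∈ Ioc V N, (((n : ℝ) ^ (-σ) : ℝ) : ℂ) *
        (ev i.2 n * conj (ev i.2 n))‖ ≤ 1 + 1 / (σ - 1) := by
      refine (norm_sum_le _ _).trans (le_trans ?_ (sum_rpow_neg_le hσ N))
      refine (sum_le_sum fun n _ => ?_).trans (sum_le_sum_of_subset_of_nonneg
        (Ioc_subset_Ioc_left (Nat.zero_le V)) fun n _ _ => by positivity)
      have h1 := (isCM_ev i.2).norm_le n
      rw [norm_mul, norm_mul, RCLike.norm_conj, norm_real, norm_of_nonneg (by positivity)]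
      refine mul_le_of_le_one_right (by positivity) ?_
      exact mul_le_one₀ h1 (norm_nonneg _) h1
    have hoff : ∀ j ∈ X.erase i, ‖∑ n ∈ Ioc V N, (((n : ℝ) ^ (-σ) : ℝ) : ℂ) *
        (ev i.2 n * conj (ev j.2 n))‖ ≤ (Q : ℝ) ^ 2 / V := by
      intro j hj
      rw [mem_erase] at hj
      obtain ⟨hi0, hiQ, hip⟩ := hX i hi
      obtain ⟨hj0, hjQ, hjp⟩ := hX j hj.2
      have : NeZero i.1 := ⟨hi0⟩
      have : NeZero j.1 := ⟨hj0⟩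
      have hV0 : (0 : ℝ) < V := by exact_mod_cast hV
      have h1 := norm_sum_antitone_le (fun n => ev i.2 n * conj (ev j.2 n))
        (fun n => (n : ℝ) ^ (-σ)) V N ((Q : ℝ) ^ 2) hNV
        (fun m hm _ => rpow_le_rpow_of_nonpos (by exact_mod_cast (by omega : 0 < m))
          (by push_cast; linarith) (by linarith)) (by positivity)
        (fun m _ _ => (norm_sum_ev_mul_conj_le hip hjp (fun h => hj.1 h.symm) V m).trans (by
          rw [sq]; gcongr))
      refine h1.trans ?_
      rw [div_eq_mul_inv, ← rpow_neg_one]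
      gcongr
      calc ((V + 1 : ℕ) : ℝ) ^ (-σ) ≤ ((V + 1 : ℕ) : ℝ) ^ (-1 : ℝ) :=
            rpow_le_rpow_of_exponent_le (by push_cast; linarith) (by linarith)
        _ ≤ (V : ℝ) ^ (-1 : ℝ) := rpow_le_rpow_of_nonpos hV0 (by push_cast; linarith) (by norm_num)
    have hoffs : ∑ j ∈ X.erase i, ‖∑ n ∈ Ioc V N, (((n : ℝ) ^ (-σ) : ℝ) : ℂ) *
        (ev i.2 n * conj (ev j.2 n))‖ ≤ 1 := by
      refine (sum_le_sum hoff).trans ?_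
      rw [sum_const, nsmul_eq_mul, ← mul_div_assoc, div_le_one (by exact_mod_cast hV)]
      exact_mod_cast (Nat.mul_le_mul_right (Q ^ 2) (card_le_card (erase_subset i X))).trans hc
    calc _ ≤ (1 + 1 / (σ - 1)) + 1 := add_le_add hdiag hoffs
      _ = _ := by ring

theorem exists_norm_eq_mul (z : ℂ) : ∃ c : ℂ, ‖c‖ = 1 ∧ c * z = ‖z‖ := by
  rcases eq_or_ne z 0 with rfl | hz
  · exact ⟨1, by simp, by simp⟩
  · have hz' : (‖z‖ : ℂ) ≠ 0 := by exact_mod_cast norm_ne_zero_iff.2 hz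
    refine ⟨conj z / ‖z‖, by simp [hz], ?_⟩
    rw [div_mul_eq_mul_div, mul_comm, Complex.mul_conj, normSq_eq_norm_sq]
    push_cast
    field_simp

theorem mul_eq_zero_of_support {a g : 𝓐} {N : ℕ} (ha : ∀ n, N < n → a n = 0)
    (hg : ∀ n, N < n → g n = 0) (n : ℕ) (hn : N * N < n) : (a * g) n = 0 := by
  rw [mul_apply]
  refine sum_eq_zero fun p hp => ?_
  rw [Nat.mem_divisorsAntidiagonal] at hp
  rcases lt_or_ge N p.1 with h | h
  · rw [ha _ h, zero_mul]
  · rcases lt_or_ge N p.2 with h' | h'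
    · rw [hg _ h', mul_zero]
    · exact absurd (Nat.mul_le_mul h h') (by omega)

theorem sum_norm_smooth_tw_mul_le (X : Finset (Σ q, 𝓧 q)) {Q V N : ℕ}
    (hX : ∀ i ∈ X, i.1 ≠ 0 ∧ i.1 ≤ Q ∧ i.2.IsPrimitive) (hV : 1 ≤ V) (hc : X.card * Q ^ 2 ≤ V)
    {a g : 𝓐} (ha : ∀ n, n ∉ Ioc V N → a n = 0)
    (hg : ∀ n, n ∉ Ioc V N → g n = 0) {σ : ℝ} (hσ : 1 < σ) {S : ℝ} (hS : 0 ≤ S)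
    (haS : ∑ n ∈ Ioc V N, (n : ℝ) ^ (-σ) * ‖a n‖ ^ 2 ≤ S)
    (hgS : ∑ n ∈ Ioc V N, (n : ℝ) ^ (-σ) * ‖g n‖ ^ 2 ≤ S) {y : ℝ} (hy : 0 < y) :
    ∑ i ∈ X, ‖smooth (tw (ev i.2) (a * g)) y‖ ≤ kernelConst * ((2 + 1 / (σ - 1)) * S) * y ^ σ := by
  have hσ' : 0 < σ - 1 := by linarith
  choose c hc1 hc2 using fun i : (Σ q, 𝓧 q) => exists_norm_eq_mul (smooth (tw (ev i.2) (a * g)) y)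
  set F : 𝓐 := ⟨fun n => ∑ i ∈ X, c i * tw (ev i.2) (a * g) n, by simp⟩ with hF
  have hFa : ∀ n, F n = ∑ i ∈ X, c i * tw (ev i.2) (a * g) n := fun n => rfl
  have ha' : ∀ n, N < n → a n = 0 := fun n hn => ha n (by rw [mem_Ioc]; omega)
  have hg' : ∀ n, N < n → g n = 0 := fun n hn => hg n (by rw [mem_Ioc]; omega)
  have hag : ∀ (i : Σ q, 𝓧 q) n, N * N < n → tw (ev i.2) (a * g) n = 0 :=
    fun i n hn => by rw [tw_apply, mul_eq_zero_of_support ha' hg' n hn, mul_zero]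
  have hsm : ((∑ i ∈ X, ‖smooth (tw (ev i.2) (a * g)) y‖ : ℝ) : ℂ) = smooth F y := by
    rw [ofReal_sum]
    simp_rw [← hc2]
    unfold smooth
    simp_rw [hFa, mul_sum]
    rw [sum_comm]
    refine sum_congr rfl fun n _ => sum_congr rfl fun i _ => ?_
    ring
  have hFs : LSeriesSummable (F ·) σ := LSeriesSummable_of_support (N := N * N) (fun n hn => by
    rw [hFa]; exact sum_eq_zero fun i _ => by rw [hag i n hn, mul_zero]) _
  have hB : ∀ t : ℝ, ‖LSeries (F ·) (σ + t * I)‖ ≤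
      ((2 + 1 / (σ - 1)) * S) * (1 + |t|) ^ (1 / 2 : ℝ) := by
    intro t
    set s : ℂ := σ + t * I
    have h1 : LSeries (F ·) s = ∑ i ∈ X, c i * (LSeries (tw (ev i.2) a ·) s *
        LSeries (tw (ev i.2) g ·) s) := by
      have : (F · : ℕ → ℂ) = ∑ i ∈ X, c i • fun n => tw (ev i.2) (a * g) n := by
        funext n
        rw [hFa]; simp
      rw [this, LSeries_sum]
      · refine sum_congr rfl fun i _ => ?_
        rw [LSeries_smul, tw_mul (isCM_ev i.2), ArithmeticFunction.LSeries_mul']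
        · exact LSeriesSummable_of_support (N := N)
            (fun n hn => by rw [tw_apply, ha' n hn, mul_zero]) _
        · exact LSeriesSummable_of_support (N := N)
            (fun n hn => by rw [tw_apply, hg' n hn, mul_zero]) _
      · intro i _
        exact (LSeriesSummable_of_support (N := N * N) (hag i) _).smul _
    have hA := sum_norm_LSeries_tw_sq_le X hX hV hc a ha hσ t
    have hG := sum_norm_LSeries_tw_sq_le X hX hV hc g hg hσ t
    have h2 : ‖LSeries (F ·) s‖ ≤ (2 + 1 / (σ - 1)) * S := by
      rw [h1]
      refine (norm_sum_le _ _).trans ?_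
      have h3 : ∀ i ∈ X, ‖c i * (LSeries (tw (ev i.2) a ·) s * LSeries (tw (ev i.2) g ·) s)‖ ≤
          1 / 2 * (‖LSeries (tw (ev i.2) a ·) s‖ ^ 2 + ‖LSeries (tw (ev i.2) g ·) s‖ ^ 2) := by
        intro i _
        rw [norm_mul, hc1, norm_mul, one_mul]
        linarith [two_mul_le_add_sq ‖LSeries (tw (ev i.2) a ·) s‖ ‖LSeries (tw (ev i.2) g ·) s‖]
      refine (sum_le_sum h3).trans ?_
      rw [← mul_sum, sum_add_distrib]
      have h4 := mul_le_mul_of_nonneg_left haS (show 0 ≤ 2 + 1 / (σ - 1) by positivity)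
      have h5 := mul_le_mul_of_nonneg_left hgS (show 0 ≤ 2 + 1 / (σ - 1) by positivity)
      linarith
    refine h2.trans (le_mul_of_one_le_right (by positivity) ?_)
    exact one_le_rpow (by linarith [abs_nonneg t]) (by norm_num)
  have h := norm_smooth_le_of_LSeries hσ.le hy hFs hB
  rw [← hsm, norm_real] at h
  exact (le_abs_self _).trans h

theorem tw_sub (χ : ℕ → ℂ) (f g : 𝓐) : tw χ (f - g) = tw χ f - tw χ g := by
  ext n
  simp only [sub_eq_add_neg, tw_apply, ArithmeticFunction.add_apply, ArithmeticFunction.neg_apply]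
  ring

theorem cut_mul_cut_apply {a g : 𝓐} {N n : ℕ} (hn : n ≤ N) : (cut N a * cut N g) n = (a * g) n := by
  rw [mul_apply, mul_apply]
  refine sum_congr rfl fun p hp => ?_
  rw [Nat.mem_divisorsAntidiagonal] at hp
  have h1 : 0 < p.1 := Nat.pos_of_ne_zero (fun h => hp.2 (by rw [← hp.1, h, zero_mul]))
  have h2 : 0 < p.2 := Nat.pos_of_ne_zero (fun h => hp.2 (by rw [← hp.1, h, mul_zero]))
  rw [cut_apply, cut_apply, if_pos ((Nat.le_mul_of_pos_right _ h2).trans (hp.1.le.trans hn)),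
    if_pos ((Nat.le_mul_of_pos_left _ h1).trans (hp.1.le.trans hn))]

theorem sum_norm_smooth_tw_der_le {r μ' Λ' : 𝓐} (D : Datum r μ' Λ')
    (X : Finset (Σ q, 𝓧 q)) {Q V : ℕ}
    (hX : ∀ i ∈ X, i.1 ≠ 0 ∧ i.1 ≤ Q ∧ i.2.IsPrimitive) (hV : 1 ≤ V) (hc : X.card * Q ^ 2 ≤ V)
    {H x y : ℝ} (hH : 1 ≤ H) (hx : 1 < x) (hy : 1 ≤ y) (hyx : y ≤ x) (hVx : (V : ℝ) ^ 2 ≤ x)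
    (hr : ∀ i ∈ X, ∀ N : ℕ, ‖∑ n ∈ Ioc 0 N, tw (ev i.2) r n‖ ≤ H * √N) :
    ∑ i ∈ X, ‖smooth (tw (ev i.2) Λ') y‖ ≤ X.card * (6 * H * (1 + log x) ^ 4 * (√x * V)) +
        1152 * kernelConst * (1 + log x) ^ 65 * x := by
  have hlx : 0 < log x := log_pos hx
  set ℓ := 1 + log x with hℓ
  have hl1 : 1 ≤ ℓ := by linarith
  set N := ⌊x⌋₊
  set a := cut N (Λ' - cut V Λ') with ha
  set g := cut N (1 - cut V μ' * r) with hg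
  set σ := 1 + 1 / log x with hσ
  have hσ1 : 1 < σ := by rw [hσ]; linarith [one_div_pos.2 hlx]
  have hσl : 1 / (σ - 1) = ℓ - 1 := by rw [hσ, hℓ]; field_simp; ring
  have hsup : ∀ f : 𝓐, (∀ n ≤ V, f n = 0) → ∀ n, n ∉ Ioc V N → cut N f n = 0 := by
    intro f hf n hn
    rw [mem_Ioc] at hn
    rw [cut_apply]
    split_ifs with h
    · exact hf n (by omega)
    · rfl
  have ha0 : ∀ n, n ∉ Ioc V N → a n = 0 := hsup _ fun n hn => by rw [sub_cut_apply, if_pos hn]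
  have hg0 : ∀ n, n ∉ Ioc V N → g n = 0 := hsup _ fun n hn => one_sub_cut_mul_eq_zero D hn
  have hpow : ∀ k, k ≤ 64 → ℓ ^ k ≤ ℓ ^ 64 := fun k hk => pow_le_pow_right₀ hl1 hk
  have haS : ∑ n ∈ Ioc V N, (n : ℝ) ^ (-σ) * ‖a n‖ ^ 2 ≤ 192 * ℓ ^ 64 := by
    have h1 : ∀ n ∈ Ioc V N, (n : ℝ) ^ (-σ) * ‖a n‖ ^ 2 ≤ 4 * (log n ^ 2 * (n : ℝ) ^ (-σ)) := by
      intro n _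
      have h2 : ‖a n‖ ≤ 2 * log n := by
        refine (norm_cut_le _ _ _).trans ?_
        rw [sub_cut_apply]
        split_ifs
        · have := log_natCast_nonneg n
          simp; linarith
        · exact (D.norm_der n).trans (by linarith [vonMangoldt_le_log (n := n)])
      calc (n : ℝ) ^ (-σ) * ‖a n‖ ^ 2 ≤ (n : ℝ) ^ (-σ) * (2 * log n) ^ 2 := by gcongr
        _ = _ := by ring
    refine (sum_le_sum h1).trans ?_
    rw [← mul_sum]
    have h3 := (sum_le_sum_of_subset_of_nonneg
      (Ioc_subset_Ioc_left (Nat.zero_le V)) fun n _ _ => by positivity).trans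
      (sum_log_sq_rpow_le hσ1 N)
    have h4 : 16 / (σ - 1) ^ 2 * (1 + 2 / (σ - 1)) = 16 * (ℓ - 1) ^ 2 * (1 + 2 * (ℓ - 1)) := by
      rw [← hσl]; field_simp
    rw [h4] at h3
    have h5 := hpow 3 (by norm_num)
    have h6 : (ℓ - 1) ^ 2 * (1 + 2 * (ℓ - 1)) ≤ ℓ ^ 2 * (3 * ℓ) := by gcongr <;> linarith
    linarith
  have hgS : ∑ n ∈ Ioc V N, (n : ℝ) ^ (-σ) * ‖g n‖ ^ 2 ≤ 192 * ℓ ^ 64 := by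
    have h1 : ∀ n ∈ Ioc V N, (n : ℝ) ^ (-σ) * ‖g n‖ ^ 2 ≤ 4 * (dcount n ^ 6 * (n : ℝ) ^ (-σ)) := by
      intro n _
      have h2 : ‖g n‖ ≤ 2 * dcount n ^ 3 :=
        (norm_cut_le _ _ _).trans (norm_one_sub_cut_mul_le D V n)
      calc (n : ℝ) ^ (-σ) * ‖g n‖ ^ 2 ≤ (n : ℝ) ^ (-σ) * (2 * dcount n ^ 3) ^ 2 := by gcongr
        _ = _ := by ring
    refine (sum_le_sum h1).trans ?_
    rw [← mul_sum]
    have h3 := (sum_le_sum_of_subset_of_nonneg (Ioc_subset_Ioc_left (Nat.zero_le V)) fun n _ _ => by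
        have := dcount_nonneg n
        positivity).trans
      (sum_dcount_pow_rpow_le hσ1 N 6)
    rw [hσl] at h3
    norm_num at h3
    have : 0 ≤ ℓ ^ 64 := by positivity
    linarith
  have hII := sum_norm_smooth_tw_mul_le X hX hV hc ha0 hg0 hσ1 (by positivity) haS hgS
    (show 0 < y by linarith)
  have hone : ∀ i ∈ X, ‖smooth (tw (ev i.2) Λ') y‖ ≤ 6 * H * ℓ ^ 4 * (√x * V) +
      ‖smooth (tw (ev i.2) (a * g)) y‖ := by
    intro i hi
    have hcm := isCM_ev i.2
    have h := vaughan_bound (D.twist hcm) hV hH hy hyx hVx (hr i hi)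
    have he : smooth (tw (ev i.2) (a * g)) y = smooth ((tw (ev i.2) Λ' - cut V (tw (ev i.2) Λ')) *
        (1 - cut V (tw (ev i.2) μ') * tw (ev i.2) r)) y := by
      rw [← tw_cut, ← tw_cut, ← tw_mul hcm, ← tw_sub, ← tw_one hcm, ← tw_sub, ← tw_mul hcm]
      unfold smooth
      refine sum_congr rfl fun n hn => ?_
      rw [mem_Ioc] at hn
      rw [tw_apply, tw_apply, ha, hg, cut_mul_cut_apply (hn.2.trans (Nat.floor_le_floor hyx))]
    rw [he]
    exact h
  refine (sum_le_sum hone).trans ?_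
  rw [sum_add_distrib, sum_const, nsmul_eq_mul]
  gcongr
  refine hII.trans ?_
  have hyσ : y ^ σ ≤ 3 * x := by
    calc y ^ σ ≤ x ^ σ := rpow_le_rpow (by linarith) hyx (by linarith)
      _ = x * exp 1 := by
        rw [hσ, rpow_add (by linarith), rpow_one, rpow_def_of_pos (by linarith),
          mul_one_div_cancel hlx.ne']
      _ ≤ x * 3 := by
        gcongr
        linarith [Real.exp_one_lt_d9]
      _ = 3 * x := mul_comm _ _
  have hk := kernelConst_nonneg
  have hd : 2 + 1 / (σ - 1) ≤ 2 * ℓ := by rw [hσl]; linarith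
  calc _ ≤ kernelConst * ((2 * ℓ) * (192 * ℓ ^ 64)) * (3 * x) := by gcongr
    _ = _ := by ring

theorem sum_Icc_one_eq (f : ℕ → ℂ) (n : ℕ) : ∑ k ∈ Icc 1 n, f k = ∑ k ∈ Ioc 0 n, f k := rfl

/-- Truncation bound for a Dirichlet series whose coefficients have small partial sums. -/
theorem norm_LSeries_le_of_partial_sums {f : ℕ → ℂ} (hf0 : f 0 = 0) {K : ℝ} (hK : 0 ≤ K)
    (hf : ∀ n : ℕ, ‖∑ k ∈ Ioc 0 n, f k‖ ≤ K * (n : ℝ) ^ (3 / 4 : ℝ)) {s : ℂ} (hs : 1 < s.re)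
    (hsum : LSeriesSummable f s) {N : ℕ} (hN : 1 ≤ N) :
    ‖LSeries f s‖ ≤ ∑ n ∈ Ioc 0 N, ‖f n‖ * (n : ℝ) ^ (-s.re) +
      8 * (‖s‖ * K * (N : ℝ) ^ (-(1 / 4) : ℝ)) := by
  set g : ℕ → ℂ := fun n => if n ≤ N then f n else 0 with hg
  set h : ℕ → ℂ := fun n => if n ≤ N then 0 else f n with hh
  have hgs : LSeriesSummable g s :=
    LSeriesSummable_of_support (N := N) (fun n hn => by simp [hg, hn]) s
  have hfgh : f = g + h := by
    funext n
    simp only [hg, hh, Pi.add_apply]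
    split_ifs <;> simp
  have hhs : LSeriesSummable h s := by
    have : h = f - g := by rw [hfgh]; simp
    rw [this]
    exact hsum.sub hgs
  have hN0 : (1 : ℝ) ≤ N := by exact_mod_cast hN
  have hzero : ∀ n ≤ N, ∑ k ∈ Ioc 0 n, h k = 0 := by
    intro n hn
    refine sum_eq_zero fun k hk => ?_
    rw [mem_Ioc] at hk
    simp only [hh, if_pos (hk.2.trans hn)]
  have hpart : ∀ n, N ≤ n → ‖∑ k ∈ Ioc 0 n, h k‖ ≤ 2 * K * (n : ℝ) ^ (3 / 4 : ℝ) := by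
    intro n hn
    have h1 : ∑ k ∈ Ioc 0 n, h k = ∑ k ∈ Ioc 0 n, f k - ∑ k ∈ Ioc 0 N, f k := by
      rw [← sum_Ioc_consecutive h (Nat.zero_le N) hn, hzero N le_rfl, zero_add,
        ← sum_Ioc_consecutive f (Nat.zero_le N) hn, add_sub_cancel_left]
      refine sum_congr rfl fun k hk => ?_
      rw [mem_Ioc] at hk
      simp only [hh, if_neg (not_le.2 hk.1)]
    rw [h1]
    have h2 : (N : ℝ) ^ (3 / 4 : ℝ) ≤ (n : ℝ) ^ (3 / 4 : ℝ) :=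
      rpow_le_rpow (by positivity) (by exact_mod_cast hn) (by norm_num)
    have := norm_sub_le (∑ k ∈ Ioc 0 n, f k) (∑ k ∈ Ioc 0 N, f k)
    nlinarith [hf n, hf N]
  have hO : (fun n => ∑ k ∈ Icc 1 n, h k) =O[Filter.atTop] fun n : ℕ => (n : ℝ) ^ (3 / 4 : ℝ) := by
    apply Asymptotics.IsBigO.of_bound (2 * K)
    filter_upwards [Filter.eventually_ge_atTop N] with n hn
    rw [sum_Icc_one_eq, norm_of_nonneg (by positivity)]
    exact hpart n hn
  have htail : ‖LSeries h s‖ ≤ 8 * (‖s‖ * K * (N : ℝ) ^ (-(1 / 4) : ℝ)) := by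
    rw [LSeries_eq_mul_integral h (by norm_num) (show (3 / 4 : ℝ) < s.re by linarith) hhs hO,
      norm_mul]
    have hint : MeasureTheory.IntegrableOn (fun t : ℝ => 2 * K * t ^ (-(5 / 4) : ℝ))
        (Set.Ioi (N : ℝ)) :=
      (integrableOn_Ioi_rpow_of_lt (by norm_num) (by linarith)).const_mul _
    have hb : ‖∫ t in Set.Ioi (1 : ℝ), (∑ k ∈ Icc 1 ⌊t⌋₊, h k) * (t : ℂ) ^ (-(s + 1))‖ ≤
        ∫ t in Set.Ioi (1 : ℝ), (Set.Ioi (N : ℝ)).indicator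
          (fun t : ℝ => 2 * K * t ^ (-(5 / 4) : ℝ)) t := by
      refine MeasureTheory.norm_integral_le_of_norm_le ?_ ?_
      · exact ((MeasureTheory.integrable_indicator_iff measurableSet_Ioi).2 hint).integrableOn
      · filter_upwards [MeasureTheory.ae_restrict_mem measurableSet_Ioi] with t ht
        have ht1 : 1 < t := ht
        by_cases htN : t ∈ Set.Ioi (N : ℝ)
        · rw [Set.indicator_of_mem htN, norm_mul, norm_cpow_eq_rpow_re_of_pos (by linarith)]
          have h1 : N ≤ ⌊t⌋₊ := Nat.le_floor (le_of_lt htN)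
          have h2 : ((⌊t⌋₊ : ℕ) : ℝ) ^ (3 / 4 : ℝ) ≤ t ^ (3 / 4 : ℝ) :=
            rpow_le_rpow (by positivity) (Nat.floor_le (by linarith)) (by norm_num)
          have h3 : t ^ (-(s + 1)).re ≤ t ^ (-2 : ℝ) :=
            rpow_le_rpow_of_exponent_le ht1.le (by simp; linarith)
          calc _ ≤ (2 * K * t ^ (3 / 4 : ℝ)) * t ^ (-2 : ℝ) := by
                gcongr
                exact (hpart _ h1).trans (by gcongr)
            _ = _ := by
                rw [mul_assoc, ← rpow_add (by linarith)]
                norm_num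
        · rw [Set.indicator_of_notMem htN, sum_Icc_one_eq, hzero _ (Nat.floor_le_of_le
            (by simpa using htN)), zero_mul, norm_zero]
    rw [MeasureTheory.setIntegral_indicator measurableSet_Ioi,
      Set.inter_eq_self_of_subset_right (Set.Ioi_subset_Ioi hN0),
      MeasureTheory.integral_const_mul, integral_Ioi_rpow_of_lt (by norm_num) (by linarith)] at hb
    calc _ ≤ ‖s‖ * (2 * K * (-(N : ℝ) ^ (-(5 / 4) + 1 : ℝ) / (-(5 / 4) + 1))) := by gcongr
      _ = _ := by
        rw [show (-(5 / 4) + 1 : ℝ) = -(1 / 4) by norm_num]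
        ring
  have hhead : ‖LSeries g s‖ ≤ ∑ n ∈ Ioc 0 N, ‖f n‖ * (n : ℝ) ^ (-s.re) := by
    rw [LSeries_eq_sum_Ioc (V := 0) (N := N) (fun n hn => ?_) s]
    · refine (norm_sum_le _ _).trans (sum_le_sum fun n hn => ?_)
      rw [mem_Ioc] at hn
      simp only [hg, if_pos hn.2]
      rw [norm_div, Complex.norm_natCast_cpow_of_pos hn.1, rpow_neg (by positivity)]
      rfl
    · rw [mem_Ioc] at hn
      simp only [hg]
      rcases Nat.eq_zero_or_pos n with rfl | h0
      · simp [hf0]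
      · rw [if_neg (by omega)]
  rw [hfgh, LSeries_add hgs hhs]
  rw [← hfgh]
  exact (norm_add_le _ _).trans (add_le_add hhead htail)

theorem abscissa_le_one_of_norm_le_dcount {r : 𝓐} (hr : ∀ n, ‖r n‖ ≤ dcount n) :
    LSeries.abscissaOfAbsConv (r ·) ≤ 1 := by
  apply LSeries.abscissaOfAbsConv_le_of_forall_lt_LSeriesSummable'
  intro σ hσ
  have hσ1 : 1 < σ := by exact_mod_cast hσ
  have : Summable fun n => ‖LSeries.term (r ·) σ n‖ := by
    refine summable_of_sum_range_le (c := (1 + 1 / (σ - 1)) ^ 2)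
      (fun n => norm_nonneg _) fun n => ?_
    refine le_trans ?_ (sum_dcount_pow_rpow_le hσ1 n 1)
    have hsub : (range n).erase 0 ⊆ Ioc 0 n := by
      intro m hm
      rw [mem_erase, mem_range] at hm
      rw [mem_Ioc]; omega
    rw [← sum_erase (a := 0) (range n) (by simp)]
    refine le_trans (sum_le_sum fun m hm => ?_) (sum_le_sum_of_subset_of_nonneg hsub fun m _ _ => by
        have := dcount_nonneg m
        positivity)
    rw [mem_erase] at hm
    rw [LSeries.norm_term_eq, if_neg hm.1, rpow_neg (by positivity), pow_one, div_eq_mul_inv]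
    simp only [ofReal_re]
    gcongr
    exact hr m
  exact this.of_norm

theorem lg_one_eq_logMul (f : 𝓐) : (lg 1 f · : ℕ → ℂ) = LSeries.logMul (f ·) := by
  funext n
  rw [lg_apply, LSeries.logMul, ← Complex.natCast_log]
  simp

theorem abscissa_lg_le_one {f : 𝓐} (hf : LSeries.abscissaOfAbsConv (f ·) ≤ 1) (m : ℕ) :
    LSeries.abscissaOfAbsConv (lg m f ·) ≤ 1 := by
  induction m generalizing f with
  | zero =>
    have : lg 0 f = f := by ext n; simp [lg_apply]
    rwa [this]
  | succ m ih =>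
    have h1 : LSeries.abscissaOfAbsConv (lg 1 f ·) ≤ 1 := by
      rw [lg_one_eq_logMul, LSeries.abscissaOfAbsConv_logMul]; exact hf
    have h2 := ih h1
    rw [lg_lg_one] at h2
    have hm : ((m + 1 : ℕ) : ℂ) ≠ 0 := by exact_mod_cast Nat.succ_ne_zero m
    apply LSeries.abscissaOfAbsConv_le_of_forall_lt_LSeriesSummable'
    intro σ hσ
    have h3 : LSeriesSummable ((((m + 1 : ℕ) : ℂ) • lg (m + 1) f) ·) σ :=
      LSeriesSummable_of_abscissaOfAbsConv_lt_re (lt_of_le_of_lt h2 (by exact_mod_cast hσ))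
    have h4 := h3.smul ((m + 1 : ℕ) : ℂ)⁻¹
    refine (LSeriesSummable_congr _ fun {n} _ => ?_).1 h4
    change ((m + 1 : ℕ) : ℂ)⁻¹ * (((m + 1 : ℕ) : ℂ) * lg (m + 1) f n) = lg (m + 1) f n
    rw [inv_mul_cancel_left₀ hm]

theorem summable_of_abscissa {f : ℕ → ℂ} (hf : LSeries.abscissaOfAbsConv f ≤ 1) {s : ℂ}
    (hs : 1 < s.re) : LSeriesSummable f s :=
  LSeriesSummable_of_abscissaOfAbsConv_lt_re (lt_of_le_of_lt hf (by exact_mod_cast hs))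

theorem log_pow_div_factorial_le {N : ℕ} (hN : 1 ≤ N) (j : ℕ) {ε : ℝ} (hε : 0 < ε) :
    log N ^ j / (j.factorial : ℝ) ≤ (ε ^ j)⁻¹ * (N : ℝ) ^ ε := by
  have hN' : (1 : ℝ) ≤ N := by exact_mod_cast hN
  have h := Real.pow_div_factorial_le_exp (ε * log N) (mul_nonneg hε.le (log_nonneg hN')) j
  rw [mul_comm ε (log N), ← rpow_def_of_pos (by linarith), mul_pow] at h
  rw [← div_eq_inv_mul, le_div_iff₀ (by positivity)]
  calc _ = log N ^ j * ε ^ j / (j.factorial : ℝ) := by ring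
    _ ≤ _ := h

theorem norm_sum_lg_le {r : 𝓐} {H : ℝ} (hH : 0 ≤ H)
    (hr : ∀ N : ℕ, ‖∑ n ∈ Ioc 0 N, r n‖ ≤ H * √N) (j N : ℕ) :
    ‖∑ n ∈ Ioc 0 N, lg j r n‖ ≤ 2 * 4 ^ j * H * (N : ℝ) ^ (3 / 4 : ℝ) := by
  rcases Nat.eq_zero_or_pos N with rfl | hN
  · simp
  have hN' : (1 : ℝ) ≤ N := by exact_mod_cast hN
  have h := norm_sum_monotone_le (fun n => r n)
    (fun n => log n ^ j / (j.factorial : ℝ)) 0 N (H * √N) hN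
    (fun m hm _ => by
      have hm' : (1 : ℝ) ≤ m := by exact_mod_cast hm
      have := log_nonneg hm'
      push_cast
      gcongr
      linarith) (by simp only [zero_add, Nat.cast_one, Real.log_one]; positivity) (by
      have := log_natCast_nonneg N
      positivity)
    (fun m _ hm => (hr m).trans (by gcongr))
  have he : ∑ n ∈ Ioc 0 N, lg j r n = ∑ n ∈ Ioc 0 N,
      ((log n ^ j / (j.factorial : ℝ) : ℝ) : ℂ) * r n := by
    refine sum_congr rfl fun n _ => ?_
    rw [lg_apply]
  rw [he]
  refine h.trans ?_
  have h2 := log_pow_div_factorial_le hN j (show (0 : ℝ) < 1 / 4 by norm_num)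
  calc 2 * (H * √N) * (log N ^ j / (j.factorial : ℝ)) ≤
      2 * (H * √N) * (((1 / 4 : ℝ) ^ j)⁻¹ * (N : ℝ) ^ (1 / 4 : ℝ)) := by gcongr
    _ = 2 * 4 ^ j * H * ((N : ℝ) ^ (1 / 2 : ℝ) * (N : ℝ) ^ (1 / 4 : ℝ)) := by
      rw [Real.sqrt_eq_rpow]
      simp only [one_div, inv_pow, inv_inv]
      ring_nf
    _ = _ := by
      rw [← rpow_add (by linarith)]
      norm_num

/-- Upper bounds for the derivatives of a Dirichlet series close to the line `Re s = 1`. -/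
theorem exists_norm_LSeries_lg_le (j : ℕ) {δ : ℝ} (hδ : 0 < δ) :
    ∃ C : ℝ, 0 < C ∧ ∀ (r : 𝓐) (H : ℝ), (∀ n, ‖r n‖ ≤ dcount n) → 1 ≤ H →
      (∀ N : ℕ, ‖∑ n ∈ Ioc 0 N, r n‖ ≤ H * √N) → ∀ σ t : ℝ, 1 < σ → σ ≤ 2 →
        ‖LSeries (lg j r ·) (σ + t * I)‖ ≤ C * (H * (2 + |t|)) ^ δ := by
  set ε := δ / 8 with hε
  have hε0 : 0 < ε := by positivity
  set K : ℝ := (ε ^ j)⁻¹ * (2 + 4 * (ε ^ 2)⁻¹) with hK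
  refine ⟨K * 2 ^ (2 * ε) + 16 * 4 ^ j, by positivity, ?_⟩
  intro r H hd hH hr σ t hσ hσ2
  set X := H * (2 + |t|) with hX
  have hX2 : 2 ≤ X := by
    have := abs_nonneg t
    nlinarith
  set N := ⌈X ^ 4⌉₊ with hN
  have hX4 : (16 : ℝ) ≤ X ^ 4 := by
    calc (16 : ℝ) = 2 ^ 4 := by norm_num
      _ ≤ X ^ 4 := by gcongr
  have hNge : X ^ 4 ≤ N := Nat.le_ceil _
  have hNle : (N : ℝ) ≤ 2 * X ^ 4 := by
    have := Nat.ceil_lt_add_one (show 0 ≤ X ^ 4 by positivity)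
    linarith
  have hN1 : (1 : ℝ) ≤ N := by linarith
  have hN1' : 1 ≤ N := by exact_mod_cast hN1
  have hL0 := log_nonneg hN1
  have hre : (σ + t * I : ℂ).re = σ := by simp
  have h := norm_LSeries_le_of_partial_sums (f := (lg j r ·)) (by simp) (by positivity)
    (norm_sum_lg_le (by linarith) hr j) (s := σ + t * I) (by rw [hre]; exact hσ)
    (summable_of_abscissa (abscissa_lg_le_one (abscissa_le_one_of_norm_le_dcount hd) j)
      (by rw [hre]; exact hσ)) hN1'
  have hs : ‖(σ + t * I : ℂ)‖ ≤ 2 + |t| := by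
    refine (norm_add_le _ _).trans ?_
    rw [norm_mul, Complex.norm_I, mul_one, norm_real, norm_real,
      norm_of_nonneg (by linarith), norm_eq_abs]
    linarith
  have htail : 8 * (‖(σ + t * I : ℂ)‖ * (2 * 4 ^ j * H) * (N : ℝ) ^ (-(1 / 4) : ℝ)) ≤
      16 * 4 ^ j := by
    have h1 : (N : ℝ) ^ (-(1 / 4) : ℝ) ≤ X⁻¹ := by
      calc (N : ℝ) ^ (-(1 / 4) : ℝ) ≤ (X ^ 4) ^ (-(1 / 4) : ℝ) :=
            rpow_le_rpow_of_nonpos (by positivity) hNge (by norm_num)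
        _ = X⁻¹ := by
            rw [← rpow_natCast, ← rpow_mul (by positivity), ← rpow_neg_one]
            norm_num
    calc _ ≤ 8 * ((2 + |t|) * (2 * 4 ^ j * H) * X⁻¹) := by gcongr
      _ = 16 * 4 ^ j * (X * X⁻¹) := by rw [hX]; ring
      _ = _ := by rw [mul_inv_cancel₀ (by positivity), mul_one]
  have hhead : ∑ n ∈ Ioc 0 N, ‖lg j r n‖ * (n : ℝ) ^ (-(σ + t * I : ℂ).re) ≤
      K * 2 ^ (2 * ε) * X ^ δ := by
    rw [hre]
    have h1 : ∀ n ∈ Ioc 0 N, ‖lg j r n‖ * (n : ℝ) ^ (-σ) ≤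
        (log N ^ j / (j.factorial : ℝ)) * (dcount n ^ 1 / n) := by
      intro n hn
      rw [mem_Ioc] at hn
      have hn1 : (1 : ℝ) ≤ n := by exact_mod_cast hn.1
      have hln := log_nonneg hn1
      rw [lg_apply, norm_mul, norm_real, norm_of_nonneg (by positivity), mul_assoc,
        pow_one, div_eq_mul_inv (dcount n), ← rpow_neg_one]
      have hdn := dcount_nonneg n
      have hln2 : log n ≤ log N := log_le_log (by linarith) (by exact_mod_cast hn.2)
      gcongr
      · exact hd n
    refine (sum_le_sum h1).trans ?_
    rw [← mul_sum]
    have h2 := sum_dcount_pow_div_le N 1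
    have h3 := log_pow_div_factorial_le hN1' j hε0
    have h4 := log_pow_div_factorial_le hN1' 2 hε0
    have h5 : 1 ≤ (N : ℝ) ^ ε := one_le_rpow hN1 hε0.le
    have h6 : (1 + log N) ^ 2 ≤ (2 + 4 * (ε ^ 2)⁻¹) * (N : ℝ) ^ ε := by
      norm_num [Nat.factorial] at h4
      nlinarith [sq_nonneg (1 - log N)]
    calc _ ≤ ((ε ^ j)⁻¹ * (N : ℝ) ^ ε) * ((2 + 4 * (ε ^ 2)⁻¹) * (N : ℝ) ^ ε) := by
          refine mul_le_mul h3 ?_ (sum_nonneg fun n _ => ?_) (by positivity)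
          · simpa [div_eq_mul_inv] using h2.trans (by simpa using h6)
          · have := dcount_nonneg n
            positivity
      _ = K * ((N : ℝ) ^ (2 * ε)) := by
          rw [two_mul ε, rpow_add (by linarith), hK]
          ring
      _ ≤ K * ((2 * X ^ 4) ^ (2 * ε)) := by gcongr
      _ = _ := by
          rw [mul_rpow (by norm_num) (by positivity), ← rpow_natCast X,
            ← rpow_mul (by positivity), mul_assoc]
          rw [show ((4 : ℕ) : ℝ) * (2 * ε) = δ by rw [hε]; push_cast; ring]
          ring
  have hX1 : 1 ≤ X ^ δ := one_le_rpow (by linarith) hδ.le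
  refine h.trans ((add_le_add hhead htail).trans ?_)
  rw [add_mul]
  exact add_le_add_right (le_mul_of_one_le_right (by positivity) hX1) _

theorem LSeries_finset_sum {ι : Type*} (S : Finset ι) (F : ι → 𝓐) {s : ℂ}
    (hF : ∀ i ∈ S, LSeriesSummable (F i ·) s) :
    LSeries ((∑ i ∈ S, F i) ·) s = ∑ i ∈ S, LSeries (F i ·) s := by
  rw [← LSeries_sum hF]
  congr 1
  funext n
  rw [Finset.sum_apply]
  exact map_sum (⟨⟨fun h : 𝓐 => h n, rfl⟩, fun _ _ => rfl⟩ : 𝓐 →+ ℂ) F S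

theorem Datum.abscissa_der {r μ' Λ' : 𝓐} (D : Datum r μ' Λ') :
    LSeries.abscissaOfAbsConv (Λ' ·) ≤ 1 := by
  apply LSeries.abscissaOfAbsConv_le_of_forall_lt_LSeriesSummable'
  intro σ hσ
  have hσ1 : 1 < (σ : ℂ).re := by exact_mod_cast hσ
  have h := (LSeriesSummable_vonMangoldt hσ1).smul (2 : ℂ)
  rw [LSeriesSummable, ← summable_norm_iff] at h ⊢
  refine h.of_nonneg_of_le (fun _ => norm_nonneg _) fun n => LSeries.norm_term_le _ ?_
  refine (D.norm_der n).trans (le_of_eq ?_)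
  simp [abs_of_nonneg vonMangoldt_nonneg]

theorem Datum.abscissa_r {r μ' Λ' : 𝓐} (D : Datum r μ' Λ') : LSeries.abscissaOfAbsConv (r ·) ≤ 1 :=
  abscissa_le_one_of_norm_le_dcount D.norm_r

theorem LSeries_smul_arith (c : ℂ) (f : 𝓐) (s : ℂ) : LSeries ((c • f) ·) s = c * LSeries (f ·) s :=
  LSeries_smul (f ·) c s

theorem LSeries_sum_mul {S : Finset (ℕ × ℕ)} {F G : ℕ → 𝓐} {s : ℂ}
    (hF : ∀ i, LSeriesSummable (F i ·) s) (hG : ∀ i, LSeriesSummable (G i ·) s) :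
    LSeries ((∑ p ∈ S, F p.1 * G p.2) ·) s =
      ∑ p ∈ S, LSeries (F p.1 ·) s * LSeries (G p.2 ·) s := by
  rw [LSeries_finset_sum S (fun p => F p.1 * G p.2)
    fun p _ => ArithmeticFunction.LSeriesSummable_mul (hF p.1) (hG p.2)]
  exact sum_congr rfl fun p _ => ArithmeticFunction.LSeries_mul' (hF p.1) (hG p.2)

theorem Datum.sum_LSeries_lg {r μ' Λ' : 𝓐} (D : Datum r μ' Λ') (M : ℕ) {s : ℂ}
    (hs : 1 < s.re) : ∑ p ∈ antidiagonal M, LSeries (lg p.1 Λ' ·) s * LSeries (lg p.2 r ·) s =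
      ((M + 1 : ℕ) : ℂ) * LSeries (lg (M + 1) r ·) s := by
  rw [← LSeries_smul_arith, ← lg_lg_one, ← D.der, lg_mul]
  exact (LSeries_sum_mul (F := fun i => lg i Λ') (G := fun i => lg i r)
    (fun i => summable_of_abscissa (abscissa_lg_le_one D.abscissa_der i) hs)
    (fun i => summable_of_abscissa (abscissa_lg_le_one D.abscissa_r i) hs)).symm

theorem lg_zero (f : 𝓐) : lg 0 f = f := by ext n; simp [lg_apply]

/-- A lower bound of the shape `(H (2 + |t|)) ^ (-δ)` for a Dirichlet series right of `Re s = 1`. -/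
def LowerBound (c : ℝ → ℝ) (r : 𝓐) (H : ℝ) : Prop := ∀ δ : ℝ, 0 < δ → ∀ σ t : ℝ, 1 < σ → σ ≤ 2 →
    c δ * (H * (2 + |t|)) ^ (-δ) ≤ ‖LSeries (r ·) (σ + t * I)‖

theorem one_le_conductor_mul {H : ℝ} (hH : 1 ≤ H) (t : ℝ) : 1 ≤ H * (2 + |t|) := by
  have := abs_nonneg t
  nlinarith

theorem exists_norm_LSeries_lg_der_le {c : ℝ → ℝ} (hc : ∀ δ, 0 < δ → 0 < c δ) (M : ℕ) :
    ∀ δ : ℝ, 0 < δ → ∃ C : ℝ, 0 < C ∧ ∀ (r μ' Λ' : 𝓐) (H : ℝ),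
      Datum r μ' Λ' → 1 ≤ H → (∀ N : ℕ, ‖∑ n ∈ Ioc 0 N, r n‖ ≤ H * √N) → LowerBound c r H →
      ∀ σ t : ℝ, 1 < σ → σ ≤ 2 → ‖LSeries (lg M Λ' ·) (σ + t * I)‖ ≤ C * (H * (2 + |t|)) ^ δ := by
  induction M using Nat.strong_induction_on with
  | _ M ih =>
  intro δ hδ
  have hδ3 : 0 < δ / 3 := by positivity
  choose! C hC0 hC using fun i (hi : i < M) => ih i hi (δ / 3) hδ3
  choose E hE0 hE using fun j => exists_norm_LSeries_lg_le j hδ3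
  refine ⟨((M + 1 : ℕ) * E (M + 1) + ∑ i ∈ range M, C i * E (M - i)) / c (δ / 3), ?_, ?_⟩
  · have := hc _ hδ3
    have h1 := hE0 (M + 1)
    have h2 : 0 ≤ ∑ i ∈ range M, C i * E (M - i) := sum_nonneg fun i hi =>
      mul_nonneg (hC0 i (mem_range.1 hi)).le (hE0 _).le
    positivity
  intro r μ' Λ' H D hH hr hlow σ t hσ hσ2
  set s : ℂ := σ + t * I with hs
  have hsre : 1 < s.re := by simpa [hs] using hσ
  set X := H * (2 + |t|) with hX
  have hX1 : 1 ≤ X := one_le_conductor_mul hH t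
  have hX0 : 0 < X := by linarith
  have hP : 1 ≤ X ^ (δ / 3) := one_le_rpow hX1 hδ3.le
  set P := X ^ (δ / 3) with hPdef
  have hsum := D.sum_LSeries_lg M hsre
  rw [Finset.Nat.sum_antidiagonal_eq_sum_range_succ_mk, sum_range_succ] at hsum
  simp only [Nat.sub_self, lg_zero] at hsum
  have h1 : LSeries (lg M Λ' ·) s * LSeries (r ·) s = ((M + 1 : ℕ) : ℂ) * LSeries (lg (M + 1) r ·) s
      - ∑ i ∈ range M, LSeries (lg i Λ' ·) s * LSeries (lg (M - i) r ·) s := by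
    rw [← hsum]; ring
  have h2 : ‖LSeries (lg M Λ' ·) s‖ * ‖LSeries (r ·) s‖ ≤
      ((M + 1 : ℕ) * E (M + 1) + ∑ i ∈ range M, C i * E (M - i)) * P ^ 2 := by
    rw [← norm_mul, h1]
    refine (norm_sub_le _ _).trans ?_
    rw [add_mul, sum_mul]
    refine add_le_add ?_ ((norm_sum_le _ _).trans (sum_le_sum fun i hi => ?_))
    · rw [norm_mul, norm_natCast, mul_assoc]
      refine mul_le_mul_of_nonneg_left ((hE (M + 1) r H D.norm_r hH hr σ t hσ hσ2).trans ?_)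
        (by positivity)
      refine mul_le_mul_of_nonneg_left ?_ (hE0 _).le
      exact le_self_pow₀ hP two_ne_zero
    · rw [norm_mul]
      rw [mem_range] at hi
      calc _ ≤ (C i * P) * (E (M - i) * P) :=
            mul_le_mul (hC i hi r μ' Λ' H D hH hr hlow σ t hσ hσ2)
              (hE (M - i) r H D.norm_r hH hr σ t hσ hσ2) (norm_nonneg _)
              (mul_nonneg (hC0 i hi).le (by positivity))
        _ = _ := by ring
  have h3 := hlow (δ / 3) hδ3 σ t hσ hσ2
  rw [← hX, rpow_neg hX0.le, ← hPdef] at h3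
  have hcp := hc _ hδ3
  have h4 : ‖LSeries (lg M Λ' ·) s‖ * (c (δ / 3) * P⁻¹) ≤
      ((M + 1 : ℕ) * E (M + 1) + ∑ i ∈ range M, C i * E (M - i)) * P ^ 2 :=
    (mul_le_mul_of_nonneg_left h3 (norm_nonneg _)).trans h2
  have hP3 : P ^ 3 = X ^ δ := by
    rw [hPdef, ← rpow_natCast, ← rpow_mul hX0.le]
    norm_num
  rw [← hP3, div_mul_eq_mul_div, le_div_iff₀ hcp]
  calc _ = ‖LSeries (lg M Λ' ·) s‖ * (c (δ / 3) * P⁻¹) * P := by field_simp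
    _ ≤ _ := mul_le_mul_of_nonneg_right h4 (by positivity)
    _ = _ := by ring

theorem smooth_sub_smooth (f : 𝓐) {y z : ℝ} (hy : 0 < y) (hyz : y ≤ z) :
    smooth f z - smooth f y = (log (z / y) : ℂ) * ∑ n ∈ Ioc 0 ⌊y⌋₊, f n +
      ∑ n ∈ Ioc ⌊y⌋₊ ⌊z⌋₊, (log (z / n) : ℂ) * f n := by
  have hz : 0 < z := hy.trans_le hyz
  have h1 : smooth f z = ∑ n ∈ Ioc 0 ⌊y⌋₊, (log (z / n) : ℂ) * f n +
      ∑ n ∈ Ioc ⌊y⌋₊ ⌊z⌋₊, (log (z / n) : ℂ) * f n :=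
    (sum_Ioc_consecutive _ (Nat.zero_le _) (Nat.floor_le_floor hyz)).symm
  rw [h1, smooth, add_sub_right_comm, ← sum_sub_distrib, mul_sum]
  congr 1
  refine sum_congr rfl fun n hn => ?_
  rw [mem_Ioc] at hn
  have hn0 : (0 : ℝ) < n := by exact_mod_cast hn.1
  rw [← sub_mul, ← Complex.ofReal_sub, log_div hz.ne' hn0.ne', log_div hy.ne' hn0.ne',
    log_div hz.ne' hy.ne']
  congr 2
  ring

/-- Removing a logarithmic smoothing. -/
theorem norm_sum_le_of_smooth (f : 𝓐) {y z : ℝ} (hy : 0 < y) (hyz : y < z) :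
    log (z / y) * ‖∑ n ∈ Ioc 0 ⌊y⌋₊, f n‖ ≤ ‖smooth f z‖ + ‖smooth f y‖ +
      log (z / y) * ∑ n ∈ Ioc ⌊y⌋₊ ⌊z⌋₊, ‖f n‖ := by
  have h := smooth_sub_smooth f hy hyz.le
  have hz : 0 < z := hy.trans hyz
  have h0 : 0 ≤ log (z / y) := log_nonneg (by rw [le_div_iff₀ hy]; linarith)
  have h1 : ‖∑ n ∈ Ioc ⌊y⌋₊ ⌊z⌋₊, (log (z / n) : ℂ) * f n‖ ≤
      log (z / y) * ∑ n ∈ Ioc ⌊y⌋₊ ⌊z⌋₊, ‖f n‖ := by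
    rw [mul_sum]
    refine (norm_sum_le _ _).trans (sum_le_sum fun n hn => ?_)
    rw [mem_Ioc] at hn
    have hyn : y < n := Nat.lt_of_floor_lt hn.1
    have hnz : (n : ℝ) ≤ z := (Nat.le_floor_iff hz.le).1 hn.2
    rw [norm_mul, norm_real, norm_of_nonneg (log_div_nonneg (by omega) hnz)]
    have : 0 < z / n := div_pos hz (hy.trans hyn)
    gcongr
  rw [← norm_of_nonneg h0, ← norm_real, ← norm_mul, norm_real, norm_of_nonneg h0]
  calc _ = ‖smooth f z - smooth f y - ∑ n ∈ Ioc ⌊y⌋₊ ⌊z⌋₊, (log (z / n) : ℂ) * f n‖ := by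
        rw [h]; congr 1; ring
    _ ≤ _ := (norm_sub_le _ _).trans (add_le_add (norm_sub_le _ _) h1)

theorem card_Ioc_floor_le {y z : ℝ} (hy : 0 ≤ y) (hyz : y ≤ z) :
    ((Ioc ⌊y⌋₊ ⌊z⌋₊).card : ℝ) ≤ z - y + 1 := by
  rw [Nat.card_Ioc, Nat.cast_sub (Nat.floor_le_floor hyz)]
  have h1 := Nat.floor_le (hy.trans hyz)
  have h2 := Nat.lt_floor_add_one y
  linarith

theorem log_pow_le_factorial_mul {x : ℝ} (hx : 1 ≤ x) (n : ℕ) : log x ^ n ≤ n.factorial * x := by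
  have h := Real.pow_div_factorial_le_exp (log x) (log_nonneg hx) n
  rwa [Real.exp_log (by linarith), div_le_iff₀ (by positivity), mul_comm] at h

theorem Datum.norm_lg_der_le {r μ' Λ' : 𝓐} (D : Datum r μ' Λ') (M : ℕ) {n : ℕ}
    {L : ℝ} (hL : log n ≤ L) : ‖lg M Λ' n‖ ≤ 2 * L ^ (M + 1) := by
  have h0 := log_natCast_nonneg n
  rw [lg_apply, norm_mul, norm_real, norm_of_nonneg (by positivity)]
  have h1 : ‖Λ' n‖ ≤ 2 * L := (D.norm_der n).trans (by
    have := vonMangoldt_le_log (n := n)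
    linarith)
  have h2 : log n ^ M / (M.factorial : ℝ) ≤ L ^ M := by
    have hf : (1 : ℝ) ≤ M.factorial := by exact_mod_cast M.factorial_pos
    calc _ ≤ log n ^ M / 1 := by gcongr
      _ ≤ _ := by rw [div_one]; gcongr
  calc _ ≤ L ^ M * (2 * L) := mul_le_mul h2 h1 (norm_nonneg _) (pow_nonneg (h0.trans hL) _)
    _ = _ := by ring

/-- Bounds for the partial sums of `Λ' (log n) ^ M`, weak in `M`. -/
theorem exists_norm_sum_lg_der_le {c : ℝ → ℝ} (hc : ∀ δ, 0 < δ → 0 < c δ) (m B : ℕ) :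
    ∃ C : ℝ, 0 < C ∧ ∀ (r μ' Λ' : 𝓐) (H x : ℝ), 1 ≤ log x →
      1 ≤ x → Datum r μ' Λ' → 1 ≤ H → H ≤ log x ^ B →
      (∀ N : ℕ, ‖∑ n ∈ Ioc 0 N, r n‖ ≤ H * √N) → LowerBound c r H →
      ∀ y : ℝ, 0 < y → y ≤ x → ‖∑ n ∈ Ioc 0 ⌊y⌋₊, lg (2 * m) Λ' n‖ ≤ C * x * log x ^ (m + 1) := by
  have hδ : 0 < (1 / (B + 2) : ℝ) := by positivity
  obtain ⟨E, hE0, hE⟩ := exists_norm_LSeries_lg_der_le hc (2 * m) _ hδ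
  have hk := kernelConst_nonneg
  refine ⟨8 * (kernelConst * (2 * E) * exp 2) + 2 ^ (2 * m + 4) * (1 + m.factorial), ?_, ?_⟩
  · positivity
  intro r μ' Λ' H x hL hx D hH hHB hr hlow y hy hyx
  set L := log x with hLdef
  have hL0 : 0 < L := by linarith
  have hx0 : 0 < x := by linarith
  set δ : ℝ := 1 / (B + 2) with hδdef
  have hδ2 : δ ≤ 1 / 2 := by
    rw [hδdef]
    gcongr
    have : (0 : ℝ) ≤ B := by positivity
    linarith
  have hBδ : H ^ δ ≤ L := by
    calc H ^ δ ≤ (L ^ B) ^ δ := by gcongr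
      _ = L ^ (B * δ : ℝ) := by rw [← rpow_natCast, ← rpow_mul hL0.le]
      _ ≤ L ^ (1 : ℝ) := rpow_le_rpow_of_exponent_le hL (by
          rw [hδdef, mul_one_div, div_le_one (by positivity)]; linarith)
      _ = L := rpow_one L
  set σ : ℝ := 1 + 1 / L with hσ
  have hσ1 : 1 < σ := by rw [hσ]; have : 0 < 1 / L := by positivity
                         linarith
  have hσ2 : σ ≤ 2 := by rw [hσ]; have : 1 / L ≤ 1 := by rw [div_le_one hL0]; exact hL
                         linarith
  have hsm : ∀ z : ℝ, 0 < z → z ≤ exp 1 * x →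
      ‖smooth (lg (2 * m) Λ') z‖ ≤ kernelConst * (2 * E) * exp 2 * (L * z) := by
    intro z hz hzx
    have hB : ∀ t : ℝ, ‖LSeries (lg (2 * m) Λ' ·) (σ + t * I)‖ ≤
        (2 * E * L) * (1 + |t|) ^ (1 / 2 : ℝ) := by
      intro t
      have ht := abs_nonneg t
      refine (hE r μ' Λ' H D hH hr hlow σ t hσ1 hσ2).trans ?_
      rw [mul_rpow (by linarith) (by linarith)]
      calc E * (H ^ δ * (2 + |t|) ^ δ) ≤ E * (L * (2 * (1 + |t|)) ^ (1 / 2 : ℝ)) := by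
            gcongr
            calc (2 + |t|) ^ δ ≤ (2 + |t|) ^ (1 / 2 : ℝ) :=
                  rpow_le_rpow_of_exponent_le (by linarith) hδ2
              _ ≤ _ := by gcongr; linarith
        _ ≤ E * (L * (2 * (1 + |t|) ^ (1 / 2 : ℝ))) := by
            rw [mul_rpow (by norm_num) (by linarith)]
            gcongr
            calc (2 : ℝ) ^ (1 / 2 : ℝ) ≤ 2 ^ (1 : ℝ) :=
                  rpow_le_rpow_of_exponent_le (by norm_num) (by norm_num)
              _ = 2 := rpow_one 2
        _ = _ := by ring
    have h := norm_smooth_le_of_LSeries hσ1.le hz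
      (summable_of_abscissa (abscissa_lg_le_one D.abscissa_der (2 * m)) (by simpa using hσ1)) hB
    refine h.trans ?_
    have hzσ : z ^ σ ≤ z * exp 2 := by
      rw [hσ, rpow_add hz, rpow_one]
      gcongr
      rw [rpow_def_of_pos hz, Real.exp_le_exp, mul_one_div, div_le_iff₀ hL0]
      have := log_le_log hz hzx
      rw [log_mul (Real.exp_pos 1).ne' hx0.ne', log_exp] at this
      linarith
    calc _ ≤ kernelConst * (2 * E * L) * (z * exp 2) := by gcongr
      _ = _ := by ring
  set η : ℝ := (L ^ m)⁻¹ with hη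
  have hLm : 1 ≤ L ^ m := one_le_pow₀ hL
  have hη0 : 0 < η := by positivity
  have hη1 : η ≤ 1 := inv_le_one_of_one_le₀ hLm
  have he3 : exp 1 ≤ 3 := Real.exp_one_lt_three.le
  have hez : exp η * y ≤ exp 1 * x := by gcongr
  have hyz : y < exp η * y := by
    have := Real.add_one_lt_exp hη0.ne'
    nlinarith
  have hexp : exp η ≤ 1 + 2 * η := by
    have := Real.abs_exp_sub_one_sub_id_le (x := η) (by rwa [abs_of_pos hη0])
    have := (abs_le.1 this).2
    nlinarith
  have hun := norm_sum_le_of_smooth (lg (2 * m) Λ') hy hyz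
  rw [mul_div_assoc, div_self hy.ne', mul_one, log_exp] at hun
  have hshort : ∑ n ∈ Ioc ⌊y⌋₊ ⌊exp η * y⌋₊, ‖lg (2 * m) Λ' n‖ ≤
      (2 * η * x + 1) * (2 * (2 * L) ^ (2 * m + 1)) := by
    calc _ ≤ ∑ n ∈ Ioc ⌊y⌋₊ ⌊exp η * y⌋₊, 2 * (2 * L) ^ (2 * m + 1) := by
          refine sum_le_sum fun n hn => ?_
          rw [mem_Ioc] at hn
          have hn0 : 0 < n := by omega
          refine D.norm_lg_der_le (2 * m) ?_
          have h1 : (n : ℝ) ≤ exp 1 * x := ((Nat.le_floor_iff (by positivity)).1 hn.2).trans hez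
          have := log_le_log (by exact_mod_cast hn0) h1
          rw [log_mul (Real.exp_pos 1).ne' hx0.ne', log_exp] at this
          linarith
      _ ≤ _ := by
          rw [sum_const, nsmul_eq_mul]
          gcongr
          refine (card_Ioc_floor_le hy.le hyz.le).trans ?_
          have : exp η * y ≤ (1 + 2 * η) * y := by gcongr
          have : η * y ≤ η * x := by gcongr
          linarith
  have h1 := hsm y hy (by nlinarith [Real.add_one_le_exp (1 : ℝ)])
  have h2 := hsm (exp η * y) (by positivity) hez
  have hA : ‖∑ n ∈ Ioc 0 ⌊y⌋₊, lg (2 * m) Λ' n‖ ≤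
      L ^ m * (kernelConst * (2 * E) * exp 2 * (L * (3 * x)) +
        kernelConst * (2 * E) * exp 2 * (L * x)) +
      (2 * η * x + 1) * (2 * (2 * L) ^ (2 * m + 1)) := by
    have h3 : η * ‖∑ n ∈ Ioc 0 ⌊y⌋₊, lg (2 * m) Λ' n‖ ≤
        η * (L ^ m * (kernelConst * (2 * E) * exp 2 * (L * (3 * x)) +
        kernelConst * (2 * E) * exp 2 * (L * x)) +
      (2 * η * x + 1) * (2 * (2 * L) ^ (2 * m + 1))) := by
      rw [mul_add, ← mul_assoc, hη, inv_mul_cancel₀ (by positivity), one_mul, ← hη]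
      refine hun.trans (add_le_add (add_le_add (h2.trans ?_) (h1.trans ?_)) ?_)
      · gcongr
        exact (Real.exp_le_exp.2 hη1).trans he3
      · gcongr
      · gcongr
    exact le_of_mul_le_mul_left h3 hη0
  refine hA.trans ?_
  have h4 : (2 * η * x + 1) * (2 * (2 * L) ^ (2 * m + 1)) ≤
      2 ^ (2 * m + 4) * (1 + m.factorial) * x * L ^ (m + 1) := by
    have h5 := log_pow_le_factorial_mul hx m
    have e1 : (2 * L) ^ (2 * m + 1) = 2 ^ (2 * m + 1) * (L ^ m * L ^ (m + 1)) := by ring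
    rw [e1]
    have e2 : η * L ^ m = 1 := inv_mul_cancel₀ (by positivity)
    calc _ = 2 ^ (2 * m + 3) * L ^ (m + 1) * x * (η * L ^ m) +
          2 ^ (2 * m + 2) * L ^ (m + 1) * L ^ m := by ring
      _ ≤ 2 ^ (2 * m + 4) * L ^ (m + 1) * x * 1 +
          2 ^ (2 * m + 4) * L ^ (m + 1) * (m.factorial * x) := by
          rw [e2]
          gcongr <;> norm_num
      _ = _ := by ring
  have h6 : L ^ m * (kernelConst * (2 * E) * exp 2 * (L * (3 * x)) +
        kernelConst * (2 * E) * exp 2 * (L * x)) ≤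
      8 * (kernelConst * (2 * E) * exp 2) * x * L ^ (m + 1) := by
    have : 0 ≤ kernelConst * (2 * E) * exp 2 * x * L ^ (m + 1) := by positivity
    calc _ = 4 * (kernelConst * (2 * E) * exp 2 * x * L ^ (m + 1)) := by ring
      _ ≤ 8 * (kernelConst * (2 * E) * exp 2 * x * L ^ (m + 1)) := by linarith
      _ = _ := by ring
  refine (add_le_add h6 h4).trans (le_of_eq ?_)
  ring

/-- A Siegel-Walfisz bound for the coefficients of a logarithmic derivative. -/
theorem siegelWalfisz {c : ℝ → ℝ} (hc : ∀ δ, 0 < δ → 0 < c δ) (A B : ℕ) :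
    ∃ C : ℝ, 0 < C ∧ ∀ (r μ' Λ' : 𝓐) (H x : ℝ), 1 ≤ log x →
      1 ≤ x → Datum r μ' Λ' → 1 ≤ H → H ≤ log x ^ B →
      (∀ N : ℕ, ‖∑ n ∈ Ioc 0 N, r n‖ ≤ H * √N) → LowerBound c r H →
      ∀ y : ℝ, 1 ≤ y → y ≤ x → ‖smooth Λ' y‖ * log x ^ A ≤ C * x := by
  set m := A + 2 with hm
  obtain ⟨C, hC0, hC⟩ := exists_norm_sum_lg_der_le hc m B
  refine ⟨2 ^ (A + 3) * (A + 2).factorial + 2 * C * ((2 * m).factorial * 2 ^ (2 * m)),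
    by positivity, ?_⟩
  intro r μ' Λ' H x hL hx D hH hHB hr hlow y hy hyx
  set L := log x with hLdef
  have hL0 : 0 < L := by linarith
  have hx0 : 0 < x := by linarith
  have hy0 : 0 < y := by linarith
  have hsx1 : 1 ≤ √x := one_le_sqrt.2 hx
  have hlsx : log √x = L / 2 := Real.log_sqrt hx0.le
  have hlogy : log y ≤ L := log_le_log hy0 hyx
  set N := ⌊√x⌋₊ with hN
  have hN1 : 1 ≤ N := Nat.le_floor (by simpa using hsx1)
  have htriv : ∀ K : ℕ, K ≤ N → K ≤ ⌊y⌋₊ →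
      ‖∑ n ∈ Ioc 0 K, (log (y / n) : ℂ) * Λ' n‖ ≤ 2 * L ^ 2 * √x := by
    intro K hK hKy
    calc _ ≤ ∑ n ∈ Ioc 0 K, 2 * L ^ 2 := by
          refine (norm_sum_le _ _).trans (sum_le_sum fun n hn => ?_)
          rw [mem_Ioc] at hn
          have hn0 : (1 : ℝ) ≤ n := by exact_mod_cast hn.1
          have hny : (n : ℝ) ≤ y := (Nat.le_floor_iff hy0.le).1 (hn.2.trans hKy)
          have h1 := log_div_nonneg hn.1 hny
          have h2 : log (y / n) ≤ L := by
            rw [log_div hy0.ne' (by linarith)]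
            have := log_nonneg hn0
            linarith
          have h3 : ‖Λ' n‖ ≤ 2 * L := (D.norm_der n).trans (by
            have := vonMangoldt_le_log (n := n)
            have := log_le_log (by linarith) (hny.trans hyx)
            linarith)
          rw [norm_mul, norm_real, norm_of_nonneg h1]
          calc _ ≤ L * (2 * L) := by gcongr
            _ = _ := by ring
      _ = 2 * L ^ 2 * K := by rw [sum_const, Nat.card_Ioc, nsmul_eq_mul, Nat.sub_zero]; ring
      _ ≤ _ := by
          gcongr
          exact (Nat.cast_le.2 hK).trans (Nat.floor_le (sqrt_nonneg x))
  have hsqrt : 2 * L ^ 2 * √x * L ^ A ≤ 2 ^ (A + 3) * (A + 2).factorial * x := by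
    have h1 := log_pow_le_factorial_mul hsx1 (A + 2)
    rw [hlsx, div_pow, div_le_iff₀ (by positivity)] at h1
    calc _ = 2 * √x * L ^ (A + 2) := by ring
      _ ≤ 2 * √x * ((A + 2).factorial * √x * 2 ^ (A + 2)) := by gcongr
      _ = 2 ^ (A + 3) * (A + 2).factorial * (√x * √x) := by ring
      _ = _ := by rw [Real.mul_self_sqrt hx0.le]
  rcases le_or_gt ⌊y⌋₊ N with hyN | hyN
  · calc _ ≤ 2 * L ^ 2 * √x * L ^ A := by gcongr; exact htriv _ hyN le_rfl
      _ ≤ _ := hsqrt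
      _ ≤ _ := by
        gcongr
        linarith [show 0 ≤ 2 * C * ((2 * m).factorial * 2 ^ (2 * m)) by positivity]
  set w : ℕ → ℝ := fun n => log (y / n) * ((2 * m).factorial / log n ^ (2 * m)) with hw
  have hlogn : ∀ n : ℕ, N < n → L / 2 ≤ log n := by
    intro n hn
    rw [← hlsx]
    exact log_le_log (by linarith) (Nat.lt_of_floor_lt hn).le
  have hpart : ∀ k, N < k → k ≤ ⌊y⌋₊ → ‖∑ n ∈ Ioc N k, lg (2 * m) Λ' n‖ ≤
      2 * (C * x * L ^ (m + 1)) := by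
    intro k hNk hky
    have e : ∑ n ∈ Ioc N k, lg (2 * m) Λ' n =
        ∑ n ∈ Ioc 0 k, lg (2 * m) Λ' n - ∑ n ∈ Ioc 0 N, lg (2 * m) Λ' n :=
      eq_sub_of_add_eq' (sum_Ioc_consecutive _ (Nat.zero_le _) hNk.le)
    have hky' : (k : ℝ) ≤ x := ((Nat.le_floor_iff hy0.le).1 hky).trans hyx
    have h1 := hC r μ' Λ' H x hL hx D hH hHB hr hlow k (by exact_mod_cast (by omega : 0 < k)) hky'
    have h2 := hC r μ' Λ' H x hL hx D hH hHB hr hlow N (by exact_mod_cast hN1)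
      ((Nat.cast_le.2 hNk.le).trans hky')
    rw [Nat.floor_natCast] at h1 h2
    rw [e]
    refine (norm_sub_le _ _).trans ?_
    linarith
  have hpos : ∀ n, N < n → 0 < log n := fun n hn => by linarith [hlogn n hn]
  have htail := norm_sum_antitone_le (fun n => lg (2 * m) Λ' n) w N ⌊y⌋₊ _ hyN (fun k hk hky => by
      have h1 := hpos k hk
      have h2 : log k ≤ log (k + 1 : ℕ) :=
        log_le_log (by exact_mod_cast (by omega : 0 < k)) (by push_cast; linarith)
      have hk1 : ((k + 1 : ℕ) : ℝ) ≤ y := (Nat.le_floor_iff hy0.le).1 hky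
      have h3 := log_div_anti (m := k) (n := k + 1) (by omega) (by omega) hk1
      have h4 := log_div_nonneg (n := k + 1) (by omega) hk1
      simp only [hw]
      have h5 : 0 < log (k + 1 : ℕ) := by linarith
      gcongr
      exact h4.trans h3)
    (by
      have h1 := log_div_nonneg (n := ⌊y⌋₊) (by omega) (Nat.floor_le hy0.le)
      have h2 := hpos _ hyN
      positivity) hpart
  have hw1 : w (N + 1) ≤ L * ((2 * m).factorial * 2 ^ (2 * m) / L ^ (2 * m)) := by
    have h1 := hlogn (N + 1) (by omega)
    have hk1 : ((N + 1 : ℕ) : ℝ) ≤ y := (Nat.le_floor_iff hy0.le).1 hyN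
    have h4 := log_div_nonneg (n := N + 1) (by omega) hk1
    have h2 : log (y / (N + 1 : ℕ)) ≤ L := by
      rw [log_div hy0.ne' (by positivity)]
      have := log_natCast_nonneg (N + 1)
      linarith
    calc w (N + 1) ≤ L * ((2 * m).factorial / (L / 2) ^ (2 * m)) := by
          simp only [hw]
          gcongr
      _ = _ := by rw [div_pow, div_div_eq_mul_div]
  have hsplit : smooth Λ' y = ∑ n ∈ Ioc 0 N, (log (y / n) : ℂ) * Λ' n +
      ∑ n ∈ Ioc N ⌊y⌋₊, (w n : ℂ) * lg (2 * m) Λ' n := by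
    rw [smooth, ← sum_Ioc_consecutive _ (Nat.zero_le _) hyN.le]
    congr 1
    refine sum_congr rfl fun n hn => ?_
    rw [mem_Ioc] at hn
    have h1 := (hpos n hn.1).ne'
    have h2 : ((2 * m).factorial : ℝ) ≠ 0 := by positivity
    rw [lg_apply, ← mul_assoc, ← ofReal_mul]
    congr 2
    simp only [hw]
    field_simp
  have hfin : ‖smooth Λ' y‖ ≤ 2 * L ^ 2 * √x + 2 * (C * x * L ^ (m + 1)) *
      (L * ((2 * m).factorial * 2 ^ (2 * m) / L ^ (2 * m))) := by
    rw [hsplit]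
    refine (norm_add_le _ _).trans (add_le_add (htriv N le_rfl hyN.le) (htail.trans ?_))
    gcongr
  calc _ ≤ (2 * L ^ 2 * √x + 2 * (C * x * L ^ (m + 1)) *
      (L * ((2 * m).factorial * 2 ^ (2 * m) / L ^ (2 * m)))) * L ^ A := by gcongr
    _ = 2 * L ^ 2 * √x * L ^ A + 2 * C * ((2 * m).factorial * 2 ^ (2 * m)) * x *
        (L ^ (m + 2 + A) / L ^ (2 * m)) := by ring
    _ = 2 * L ^ 2 * √x * L ^ A + 2 * C * ((2 * m).factorial * 2 ^ (2 * m)) * x := by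
        rw [show m + 2 + A = 2 * m by omega, div_self (by positivity), mul_one]
    _ ≤ _ := by rw [add_mul]; gcongr

theorem norm_LSeries_sub_le {f : 𝓐} (hf : LSeries.abscissaOfAbsConv (f ·) ≤ 1) {K T : ℝ}
    (hK : ∀ σ t : ℝ, 1 < σ → σ ≤ 2 → |t| ≤ T → ‖LSeries (lg 1 f ·) (σ + t * I)‖ ≤ K)
    {s w : ℂ} (hs1 : 1 < s.re) (hs2 : s.re ≤ 2) (hs3 : |s.im| ≤ T) (hw1 : 1 < w.re)
    (hw2 : w.re ≤ 2) (hw3 : |w.im| ≤ T) :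
    ‖LSeries (f ·) w - LSeries (f ·) s‖ ≤ K * ‖w - s‖ := by
  have hconv : Convex ℝ (Set.Ioc (1 : ℝ) 2 ×ℂ Set.Icc (-T) T) :=
    ((convex_Ioc 1 2).linear_preimage Complex.reLm).inter
      ((convex_Icc (-T) T).linear_preimage Complex.imLm)
  refine hconv.norm_image_sub_le_of_norm_hasDerivWithin_le (f' := fun z => -LSeries (lg 1 f ·) z)
    (fun z hz => ?_) (fun z hz => ?_) ⟨⟨hs1, hs2⟩, abs_le.1 hs3⟩ ⟨⟨hw1, hw2⟩, abs_le.1 hw3⟩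
  · rw [lg_one_eq_logMul]
    exact (LSeries_hasDerivAt (lt_of_le_of_lt hf (by exact_mod_cast hz.1.1))).hasDerivWithinAt
  · rw [norm_neg]
    have h := hK z.re z.im hz.1.1 hz.1.2 (abs_le.2 hz.2)
    rwa [Complex.re_add_im] at h

/-- A lower bound that degenerates at the line `Re s = 1` extends to it when the derivative is
bounded. -/
theorem le_norm_LSeries_of_pow_four {f : 𝓐}
    (hf : LSeries.abscissaOfAbsConv (f ·) ≤ 1) {c C P t : ℝ} (hc : 0 < c) (hC : 0 < C)
    (hP0 : 0 < P) (hP1 : P ≤ 1)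
    (hK : ∀ σ : ℝ, 1 < σ → σ ≤ 2 → ‖LSeries (lg 1 f ·) (σ + t * I)‖ ≤ C * P⁻¹)
    (hlow : ∀ σ : ℝ, 1 < σ → σ ≤ 2 →
      c ^ 4 * (σ - 1) ^ 3 * P ^ 4 ≤ ‖LSeries (f ·) (σ + t * I)‖ ^ 4) {σ : ℝ} (hσ : 1 < σ)
    (hσ2 : σ ≤ 2) :
    c / 2 * min 1 (c / (2 * C)) ^ 3 * P ^ 7 ≤ ‖LSeries (f ·) (σ + t * I)‖ := by
  set b := min 1 (c / (2 * C)) with hb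
  have hb0 : 0 < b := lt_min one_pos (by positivity)
  have hb1 : b ≤ 1 := min_le_left _ _
  have hbC : C * b ≤ c / 2 := by
    have := min_le_right 1 (c / (2 * C))
    rw [← hb, le_div_iff₀ (by positivity)] at this
    linarith
  have key : ∀ ρ : ℝ, 1 + b ^ 4 * P ^ 8 ≤ ρ → ρ ≤ 2 →
      c * b ^ 3 * P ^ 7 ≤ ‖LSeries (f ·) (ρ + t * I)‖ := by
    intro ρ hρ hρ2
    have h0 : 0 < b ^ 4 * P ^ 8 := by positivity
    refine le_of_pow_le_pow_left₀ four_ne_zero (norm_nonneg _) ?_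
    refine le_trans ?_ (hlow ρ (by linarith) hρ2)
    calc (c * b ^ 3 * P ^ 7) ^ 4 = c ^ 4 * (b ^ 4 * P ^ 8) ^ 3 * P ^ 4 := by ring
      _ ≤ _ := by gcongr; linarith
  rcases le_or_gt (1 + b ^ 4 * P ^ 8) σ with h | h
  · refine le_trans ?_ (key σ h hσ2)
    have : 0 ≤ c * b ^ 3 * P ^ 7 := by positivity
    linarith
  · have h2 : 1 + b ^ 4 * P ^ 8 ≤ 2 := by
      have : b ^ 4 * P ^ 8 ≤ 1 := mul_le_one₀ (pow_le_one₀ hb0.le hb1) (by positivity)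
        (pow_le_one₀ hP0.le hP1)
      linarith
    have h1 : 1 < 1 + b ^ 4 * P ^ 8 := by linarith
    have h3 := key _ le_rfl h2
    set ρ : ℝ := 1 + b ^ 4 * P ^ 8 with hρ
    have hconv : Convex ℝ (Set.Ioc (1 : ℝ) 2) := convex_Ioc 1 2
    have h4 := hconv.norm_image_sub_le_of_norm_hasDerivWithin_le
      (f := fun x : ℝ => LSeries (f ·) (x + t * I))
      (f' := fun x : ℝ => -LSeries (lg 1 f ·) (x + t * I)) (C := C * P⁻¹)
      (fun x hx => by
        rw [lg_one_eq_logMul]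
        have h5 : HasDerivAt (fun x : ℝ => (x : ℂ) + t * I) 1 x :=
          (Complex.ofRealCLM.hasDerivAt (x := x)).add_const _
        have h6 := LSeries_hasDerivAt (f := (f ·)) (s := (x : ℂ) + t * I)
          (lt_of_le_of_lt hf (by simpa using (by exact_mod_cast hx.1 : (1 : EReal) < (x : ℝ))))
        have h7 := (h6.comp x h5).hasDerivWithinAt (s := Set.Ioc (1 : ℝ) 2)
        rw [mul_one] at h7
        exact h7)
      (fun x hx => by rw [norm_neg]; exact hK x hx.1 hx.2) ⟨h1, h2⟩ ⟨hσ, hσ2⟩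
    have h5 : ‖σ - ρ‖ ≤ b ^ 4 * P ^ 8 := by
      rw [norm_eq_abs, abs_sub_comm, abs_of_pos (by linarith)]
      linarith
    have h6 : C * P⁻¹ * ‖σ - ρ‖ ≤ c / 2 * b ^ 3 * P ^ 7 := by
      calc _ ≤ C * P⁻¹ * (b ^ 4 * P ^ 8) := by gcongr
        _ = (C * b) * b ^ 3 * P ^ 7 * (P⁻¹ * P) := by ring
        _ = (C * b) * b ^ 3 * P ^ 7 := by rw [inv_mul_cancel₀ hP0.ne', mul_one]
        _ ≤ _ := by gcongr
    have h7 := norm_sub_norm_le (LSeries (f ·) (ρ + t * I)) (LSeries (f ·) (σ + t * I))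
    rw [norm_sub_rev] at h7
    have h8 := h4.trans h6
    linarith

theorem norm_cpow_sub_le {n : ℝ} (hn : 1 ≤ n) {s : ℂ} (hs : 1 < s.re) {x : ℝ}
    (hx : x ∈ Set.Icc n (n + 1)) : ‖(x : ℂ) ^ (-s) - (n : ℂ) ^ (-s)‖ ≤ ‖s‖ * (n ^ 2)⁻¹ := by
  have h := (convex_Icc n (n + 1)).norm_image_sub_le_of_norm_hasDerivWithin_le
    (f := fun y : ℝ => (y : ℂ) ^ (-s)) (f' := fun y : ℝ => -s * (y : ℂ) ^ (-s - 1))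
    (C := ‖s‖ * (n ^ 2)⁻¹) (fun y hy => ?_) (fun y hy => ?_) (Set.left_mem_Icc.2 (by linarith)) hx
  · refine h.trans (mul_le_of_le_one_right (by positivity) ?_)
    rw [norm_eq_abs, abs_of_nonneg (by linarith [hx.1])]
    linarith [hx.2]
  · have hy0 : (y : ℝ) ≠ 0 := by linarith [hy.1]
    have hs0 : -s ≠ 0 := by
      intro h0
      have : s.re = 0 := by rw [neg_eq_zero.1 h0]; rfl
      linarith
    exact (hasDerivAt_ofReal_cpow_const hy0 hs0).hasDerivWithinAt
  · have hy0 : 0 < y := by linarith [hy.1]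
    rw [norm_mul, norm_neg, norm_cpow_eq_rpow_re_of_pos hy0]
    gcongr
    rw [← rpow_natCast, ← rpow_neg (by linarith)]
    calc y ^ (-s - 1).re ≤ n ^ (-s - 1).re :=
          rpow_le_rpow_of_nonpos (by linarith) hy.1 (by simp; linarith)
      _ ≤ _ := rpow_le_rpow_of_exponent_le hn (by simp; linarith)

theorem norm_zeta_term_le {n : ℝ} (hn : 1 ≤ n) {s : ℂ} (hs : 1 < s.re) :
    ‖(n : ℂ) ^ (-s) - (((n + 1 : ℝ) : ℂ) ^ (-s + 1) / (-s + 1) -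
      (n : ℂ) ^ (-s + 1) / (-s + 1))‖ ≤ ‖s‖ * (n ^ 2)⁻¹ := by
  have h := (convex_Icc n (n + 1)).norm_image_sub_le_of_norm_hasDerivWithin_le
    (f := fun y : ℝ => (y : ℂ) ^ (-s + 1) / (-s + 1) - y * (n : ℂ) ^ (-s))
    (f' := fun y : ℝ => (y : ℂ) ^ (-s) - (n : ℂ) ^ (-s))
    (C := ‖s‖ * (n ^ 2)⁻¹) (fun y hy => ?_) (fun y hy => norm_cpow_sub_le hn hs hy)
    (Set.left_mem_Icc.2 (by linarith)) (Set.right_mem_Icc.2 (by linarith))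
  · have e : n + 1 - n = 1 := by ring
    rw [e, norm_one, mul_one] at h
    rw [← norm_neg]
    refine le_trans (le_of_eq ?_) h
    congr 1
    push_cast
    ring
  · have hy0 : (y : ℝ) ≠ 0 := by linarith [hy.1]
    have hs1 : -s ≠ -1 := by
      intro h0
      have : s.re = 1 := by rw [neg_inj.1 h0]; rfl
      linarith
    have h1 := hasDerivAt_ofReal_cpow_const' hy0 hs1
    have h2 : HasDerivAt (fun y : ℝ => (y : ℂ) * (n : ℂ) ^ (-s)) ((n : ℂ) ^ (-s)) y := by
      simpa using (Complex.ofRealCLM.hasDerivAt (x := y)).mul_const ((n : ℂ) ^ (-s))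
    exact (h1.sub h2).hasDerivWithinAt

theorem sum_inv_sq_le {N : ℕ} (hN : 1 ≤ N) (k : ℕ) :
    ∑ i ∈ range k, (((N + i : ℕ) : ℝ) ^ 2)⁻¹ ≤ 2 / N - 2 / (N + k : ℕ) := by
  induction k with
  | zero => simp
  | succ k ih =>
    rw [sum_range_succ]
    have h0 : (1 : ℝ) ≤ (N + k : ℕ) := by exact_mod_cast (by omega : 1 ≤ N + k)
    have e : ((N + (k + 1) : ℕ) : ℝ) = (N + k : ℕ) + 1 := by push_cast; ring
    rw [e]
    set m : ℝ := ((N + k : ℕ) : ℝ)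
    have h1 : (m ^ 2)⁻¹ ≤ 2 / m - 2 / (m + 1) := by
      rw [div_sub_div _ _ (by positivity) (by positivity), ← one_div,
        div_le_div_iff₀ (by positivity) (by positivity)]
      nlinarith
    linarith

theorem erase_range_subset (N : ℕ) : (range N).erase 0 ⊆ Ioc 0 N := fun m hm => by
  rw [mem_erase, mem_range] at hm
  rw [mem_Ioc]; omega

theorem norm_LSeries_zeta_le {s : ℂ} (hs : 1 < s.re) {N : ℕ} (hN : 1 ≤ N) :
    ‖LSeries ((zeta : 𝓐) ·) s‖ ≤ 1 + log N + (2 / ‖s - 1‖ + 2 * ‖s‖ / N) := by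
  have hsum : LSeriesSummable ((zeta : 𝓐) ·) s := summable_of_abscissa datum_zeta.abscissa_r hs
  have hlim := (hsum.hasSum.tendsto_sum_nat.comp (Filter.tendsto_add_atTop_nat N)).norm
  refine le_of_tendsto hlim (Filter.Eventually.of_forall fun k => ?_)
  have hN0 : (1 : ℝ) ≤ N := by exact_mod_cast hN
  have hterm : ∀ n : ℕ, 1 ≤ n → LSeries.term ((zeta : 𝓐) ·) s n = ((n : ℝ) : ℂ) ^ (-s) := by
    intro n hn
    rw [LSeries.term_of_ne_zero (by omega), cpow_neg]
    simp [natCoe_apply, zeta_apply_ne (by omega : n ≠ 0), div_eq_mul_inv]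
  rw [Function.comp_apply, add_comm k N, sum_range_add]
  refine (norm_add_le _ _).trans (add_le_add ?_ ?_)
  · refine le_trans ?_ (sum_inv_le_one_add_log N)
    refine (norm_sum_le _ _).trans ?_
    rw [← sum_erase (a := 0) (range N) (by simp)]
    refine le_trans (sum_le_sum fun m hm => ?_) (sum_le_sum_of_subset_of_nonneg
      (erase_range_subset N) fun m _ _ => by positivity)
    rw [mem_erase] at hm
    have hm1 : (1 : ℝ) ≤ m := by exact_mod_cast Nat.one_le_iff_ne_zero.2 hm.1
    rw [hterm m (Nat.one_le_iff_ne_zero.2 hm.1), norm_cpow_eq_rpow_re_of_pos (by linarith),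
      ← rpow_neg_one]
    exact rpow_le_rpow_of_exponent_le hm1 (by simp; linarith)
  · set φ : ℕ → ℂ := fun i => (((N + i : ℕ) : ℝ) : ℂ) ^ (-s + 1) / (-s + 1) with hφ
    have hφn : ∀ i, ‖φ i‖ ≤ 1 / ‖s - 1‖ := by
      intro i
      have h1 : (1 : ℝ) ≤ (N + i : ℕ) := by exact_mod_cast (by omega : 1 ≤ N + i)
      rw [hφ, norm_div, norm_cpow_eq_rpow_re_of_pos (by linarith),
        show (-s + 1 : ℂ) = -(s - 1) by ring, norm_neg]
      gcongr
      exact rpow_le_one_of_one_le_of_nonpos h1 (by simp; linarith)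
    have hsplit : ∑ i ∈ range k, LSeries.term ((zeta : 𝓐) ·) s (N + i) =
        (φ k - φ 0) + ∑ i ∈ range k, ((((N + i : ℕ) : ℝ) : ℂ) ^ (-s) - (φ (i + 1) - φ i)) := by
      rw [sum_sub_distrib, sum_range_sub, add_sub_cancel]
      exact sum_congr rfl fun i _ => hterm _ (by omega)
    rw [hsplit]
    refine (norm_add_le _ _).trans (add_le_add ?_ ?_)
    · refine (norm_sub_le _ _).trans ((add_le_add (hφn k) (hφn 0)).trans (le_of_eq ?_))
      ring
    · refine (norm_sum_le _ _).trans ?_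
      calc _ ≤ ∑ i ∈ range k, ‖s‖ * (((N + i : ℕ) : ℝ) ^ 2)⁻¹ := by
            refine sum_le_sum fun i _ => ?_
            have h1 : (1 : ℝ) ≤ (N + i : ℕ) := by exact_mod_cast (by omega : 1 ≤ N + i)
            have h2 := norm_zeta_term_le h1 hs
            have e : ((N + (i + 1) : ℕ) : ℝ) = (N + i : ℕ) + 1 := by push_cast; ring
            simp only [hφ, e]
            exact h2
        _ ≤ ‖s‖ * (2 / N) := by
            rw [← mul_sum]
            gcongr
            refine (sum_inv_sq_le hN k).trans ?_
            have : (0 : ℝ) ≤ 2 / (N + k : ℕ) := by positivity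
            linarith
        _ = _ := by ring

theorem norm_line_le {σ t : ℝ} (hσ : 1 < σ) (hσ2 : σ ≤ 2) : ‖(σ + t * I : ℂ)‖ ≤ 2 + |t| := by
  refine (norm_add_le _ _).trans ?_
  rw [norm_mul, Complex.norm_I, mul_one, norm_real, norm_real,
    norm_of_nonneg (by linarith), norm_eq_abs]
  linarith

theorem exists_norm_LSeries_zeta_le {δ : ℝ} (hδ : 0 < δ) :
    ∃ C : ℝ, 0 < C ∧ ∀ σ t : ℝ, 1 < σ → σ ≤ 2 → t ≠ 0 → ‖LSeries ((zeta : 𝓐) ·) (σ + t * I)‖ ≤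
        C * (2 + |t|) ^ δ * (1 + 1 / |t|) := by
  refine ⟨5 + 2 ^ δ / δ, by positivity, fun σ t hσ hσ2 ht => ?_⟩
  have ht0 := abs_nonneg t
  set s : ℂ := σ + t * I with hs
  have hsre : s.re = σ := by simp [hs]
  have hsim : s.im = t := by simp [hs]
  set N := ⌈2 + |t|⌉₊ with hN
  have hN1 : 2 + |t| ≤ N := Nat.le_ceil _
  have hN2 : (N : ℝ) ≤ 2 * (2 + |t|) := by
    have := Nat.ceil_lt_add_one (show 0 ≤ 2 + |t| by positivity)
    linarith
  have hN3 : 1 ≤ N := by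
    have : (1 : ℝ) ≤ N := by linarith
    exact_mod_cast this
  refine (norm_LSeries_zeta_le (by rw [hsre]; exact hσ) hN3).trans ?_
  have h1 : log N ≤ 2 ^ δ / δ * (2 + |t|) ^ δ := by
    calc log N ≤ (N : ℝ) ^ δ / δ := Real.log_le_rpow_div (by positivity) hδ
      _ ≤ (2 * (2 + |t|)) ^ δ / δ := by gcongr
      _ = _ := by rw [mul_rpow (by norm_num) (by positivity)]; ring
  have h2 : 2 / ‖s - 1‖ ≤ 2 * (1 / |t|) := by
    rw [mul_one_div]
    gcongr
    have := Complex.abs_im_le_norm (s - 1)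
    rwa [Complex.sub_im, hsim, Complex.one_im, sub_zero] at this
  have h3 : 2 * ‖s‖ / N ≤ 2 := by
    rw [div_le_iff₀ (by linarith)]
    have := norm_line_le (t := t) hσ hσ2
    linarith
  have h4 : 1 ≤ (2 + |t|) ^ δ := one_le_rpow (by linarith) hδ.le
  have h5 : 0 ≤ 1 / |t| := by positivity
  have h6 : 0 ≤ 2 ^ δ / δ := by positivity
  calc _ ≤ 1 + 2 ^ δ / δ * (2 + |t|) ^ δ + (2 * (1 / |t|) + 2) := by linarith
    _ ≤ (3 + 2 ^ δ / δ) * (2 + |t|) ^ δ + 2 * (2 + |t|) ^ δ * (1 / |t|) := by nlinarith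
    _ ≤ (5 + 2 ^ δ / δ) * (2 + |t|) ^ δ + (5 + 2 ^ δ / δ) * (2 + |t|) ^ δ * (1 / |t|) := by
        gcongr <;> linarith
    _ = _ := by ring

/-- The arithmetic function of a Dirichlet character. -/
def dchar {q : ℕ} (ψ : 𝓧 q) : 𝓐 := tw (ev ψ) zeta

theorem dchar_apply {q : ℕ} (ψ : 𝓧 q) {n : ℕ} (hn : n ≠ 0) : dchar ψ n = ψ n := by
  rw [dchar, tw_apply, natCoe_apply, zeta_apply_ne hn, Nat.cast_one, mul_one, ev]

theorem dchar_norm_le {q : ℕ} (ψ : 𝓧 q) (n : ℕ) : ‖dchar ψ n‖ ≤ dcount n :=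
  (datum_zeta.twist (isCM_ev ψ)).norm_r n

theorem LSeries_dchar {q : ℕ} (ψ : 𝓧 q) (s : ℂ) :
    LSeries (dchar ψ ·) s = LSeries (fun n => ψ n) s :=
  LSeries_congr (fun {_} hn => dchar_apply ψ hn) s

theorem norm_sum_dchar_le {q : ℕ} [NeZero q] {ψ : 𝓧 q} (hψ : ψ ≠ 1) (N : ℕ) :
    ‖∑ n ∈ Ioc 0 N, dchar ψ n‖ ≤ q * √N := by
  rcases Nat.eq_zero_or_pos N with rfl | hN
  · simp
  have e : ∑ n ∈ Ioc 0 N, dchar ψ n = ∑ n ∈ Ioc 0 N, ev ψ n :=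
    sum_congr rfl fun n hn => dchar_apply ψ (by rw [mem_Ioc] at hn; omega)
  rw [e]
  refine (norm_sum_ev_le hψ 0 N).trans (le_mul_of_one_le_right (by positivity) ?_)
  rw [one_le_sqrt]
  exact_mod_cast hN

theorem one_le_cast {q : ℕ} [NeZero q] : (1 : ℝ) ≤ q := by
  exact_mod_cast Nat.one_le_iff_ne_zero.2 (NeZero.ne q)

theorem exists_norm_LSeries_dchar_le {δ : ℝ} (hδ : 0 < δ) :
    ∃ C : ℝ, 0 < C ∧ ∀ (q : ℕ) [NeZero q] (ψ : 𝓧 q) (σ t : ℝ), 1 < σ → σ ≤ 2 →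
      t ≠ 0 → ‖LSeries (dchar ψ ·) (σ + t * I)‖ ≤ C * (q * (2 + |t|)) ^ δ * (1 + 1 / |t|) := by
  obtain ⟨C, hC0, hC⟩ := exists_norm_LSeries_lg_le 0 hδ
  obtain ⟨E, hE0, hE⟩ := exists_norm_LSeries_zeta_le hδ
  refine ⟨2 * C + E, by positivity, ?_⟩
  intro q _ ψ σ t hσ hσ2 ht
  have hq : (1 : ℝ) ≤ q := one_le_cast
  have hq0 : (q : ℂ) ≠ 0 := by exact_mod_cast NeZero.ne q
  set s : ℂ := σ + t * I with hs
  have hsre : 1 < s.re := by simpa [hs] using hσ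
  set μ : ℂ := (∑ z, ψ z) / q with hμ
  have hμ1 : ‖μ‖ ≤ 1 := by
    rw [hμ, norm_div, norm_natCast, div_le_one (by linarith)]
    refine (norm_sum_le _ _).trans ((sum_le_sum fun z _ => ψ.norm_le_one z).trans (le_of_eq ?_))
    simp [ZMod.card]
  set g : 𝓐 := (1 / 2 : ℂ) • (dchar ψ + (-μ) • (zeta : 𝓐)) with hg
  have hgn : ∀ n : ℕ, n ≠ 0 → g n = (ψ n - μ) / 2 := by
    intro n hn
    change (1 / 2 : ℂ) * (dchar ψ n + (-μ) * (zeta : 𝓐) n) = _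
    rw [dchar_apply ψ hn, natCoe_apply, zeta_apply_ne hn]
    push_cast
    ring
  have hb : ∀ z : ZMod q, ‖(ψ z - μ) / 2‖ ≤ 1 := by
    intro z
    rw [norm_div, Complex.norm_ofNat]
    have := (norm_sub_le (ψ z) μ).trans (add_le_add (ψ.norm_le_one z) hμ1)
    linarith
  have hg1 : ∀ n, ‖g n‖ ≤ dcount n := by
    intro n
    rcases eq_or_ne n 0 with rfl | hn
    · simpa using dcount_nonneg 0
    · rw [hgn n hn]
      exact (hb n).trans (one_le_dcount hn)
  have hgs : ∀ N : ℕ, ‖∑ n ∈ Ioc 0 N, g n‖ ≤ q * √N := by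
    intro N
    rcases Nat.eq_zero_or_pos N with rfl | hN
    · simp
    have e : ∑ n ∈ Ioc 0 N, g n = ∑ n ∈ Ioc 0 (0 + N), (fun z : ZMod q => (ψ z - μ) / 2) n := by
      rw [zero_add]
      exact sum_congr rfl fun n hn => hgn n (by rw [mem_Ioc] at hn; omega)
    rw [e]
    refine (norm_sum_Ioc_le_of_sum_eq_zero _ ?_ hb N 0).trans
      (le_mul_of_one_le_right (by positivity) ?_)
    · rw [← sum_div, sum_sub_distrib, sum_const, card_univ, ZMod.card, nsmul_eq_mul, hμ,
        mul_div_cancel₀ _ hq0, sub_self, zero_div]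
    · rw [one_le_sqrt]
      exact_mod_cast hN
  have h1 := hC g q hg1 hq hgs σ t hσ hσ2
  rw [lg_zero] at h1
  have h2 := hE σ t hσ hσ2 ht
  have hsz : LSeriesSummable ((zeta : 𝓐) ·) s := summable_of_abscissa datum_zeta.abscissa_r hsre
  have hsg : LSeriesSummable (g ·) s :=
    summable_of_abscissa (abscissa_le_one_of_norm_le_dcount hg1) hsre
  have h3 : LSeries (dchar ψ ·) s = 2 * LSeries (g ·) s + μ * LSeries ((zeta : 𝓐) ·) s := by
    rw [← LSeries_smul (g ·) 2 s, ← LSeries_smul ((zeta : 𝓐) ·) μ s,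
      ← LSeries_add (hsg.smul 2) (hsz.smul μ)]
    refine LSeries_congr (fun {n} hn => ?_) s
    change _ = 2 * g n + μ * (zeta : 𝓐) n
    rw [dchar_apply ψ hn, hgn n hn, natCoe_apply, zeta_apply_ne hn]
    push_cast
    ring
  have ht0 : 0 < |t| := abs_pos.2 ht
  have hX : (2 + |t|) ^ δ ≤ (q * (2 + |t|)) ^ δ := by
    gcongr
    exact le_mul_of_one_le_left (by positivity) hq
  rw [h3]
  calc _ ≤ 2 * (C * (q * (2 + |t|)) ^ δ) + 1 * (E * (2 + |t|) ^ δ * (1 + 1 / |t|)) := by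
        refine (norm_add_le _ _).trans (add_le_add ?_ ?_)
        · rw [norm_mul, Complex.norm_ofNat]
          gcongr
        · rw [norm_mul]
          gcongr
    _ ≤ 2 * (C * (q * (2 + |t|)) ^ δ * (1 + 1 / |t|)) +
        1 * (E * (q * (2 + |t|)) ^ δ * (1 + 1 / |t|)) := by
        have h4 : 0 ≤ 1 / |t| := by positivity
        have h5 : 0 ≤ C * (q * (2 + |t|)) ^ δ := by positivity
        have h6 : C * (q * (2 + |t|)) ^ δ ≤ C * (q * (2 + |t|)) ^ δ * (1 + 1 / |t|) :=
          le_mul_of_one_le_right h5 (by linarith)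
        have h7 : E * (2 + |t|) ^ δ * (1 + 1 / |t|) ≤ E * (q * (2 + |t|)) ^ δ * (1 + 1 / |t|) := by
          gcongr
        linarith
    _ = _ := by ring

theorem norm_LSeries_le_two_div {f : 𝓐} (hf : ∀ n, n ≠ 0 → ‖f n‖ ≤ 1) {s : ℂ}
    {σ : ℝ} (hs : s.re = σ) (hσ : 1 < σ) (hσ2 : σ ≤ 2) : ‖LSeries (f ·) s‖ ≤ 2 / (σ - 1) := by
  have hf1 : ∀ n, ‖f n‖ ≤ dcount n := by
    intro n
    rcases eq_or_ne n 0 with rfl | hn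
    · simpa using dcount_nonneg 0
    · exact (hf n hn).trans (one_le_dcount hn)
  have hsum : LSeriesSummable (f ·) s :=
    summable_of_abscissa (abscissa_le_one_of_norm_le_dcount hf1) (by rw [hs]; exact hσ)
  refine le_of_tendsto hsum.hasSum.tendsto_sum_nat.norm (Filter.Eventually.of_forall fun N => ?_)
  have h1 : 1 + 1 / (σ - 1) ≤ 2 / (σ - 1) := by
    rw [← sub_nonneg]
    have e : 2 / (σ - 1) - (1 + 1 / (σ - 1)) = (2 - σ) / (σ - 1) := by
      have : σ - 1 ≠ 0 := by linarith
      field_simp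
      ring
    rw [e]
    exact div_nonneg (by linarith) (by linarith)
  refine ((norm_sum_le _ _).trans ?_).trans ((sum_rpow_neg_le hσ N).trans h1)
  rw [← sum_erase (a := 0) (range N) (by simp)]
  refine le_trans (sum_le_sum fun m hm => ?_) (sum_le_sum_of_subset_of_nonneg (erase_range_subset N)
    fun m _ _ => by positivity)
  rw [mem_erase] at hm
  rw [LSeries.norm_term_eq, if_neg hm.1, hs, rpow_neg (by positivity), ← one_div]
  gcongr
  exact hf m hm.1

theorem norm_LSeries_dchar_le_two_div {q : ℕ} (ψ : 𝓧 q) {s : ℂ} {σ : ℝ}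
    (hs : s.re = σ) (hσ : 1 < σ) (hσ2 : σ ≤ 2) : ‖LSeries (dchar ψ ·) s‖ ≤ 2 / (σ - 1) := by
  refine norm_LSeries_le_two_div (fun n hn => ?_) hs hσ hσ2
  rw [dchar_apply ψ hn]
  exact ψ.norm_le_one _

theorem one_le_norm_LSeries_mul {q : ℕ} (ψ : 𝓧 q) {s : ℂ} {σ : ℝ}
    (hs : s.re = σ) (hσ : 1 < σ) (hσ2 : σ ≤ 2) : 1 ≤ ‖LSeries (dchar ψ ·) s‖ * (2 / (σ - 1)) := by
  have hD := datum_zeta.twist (isCM_ev ψ)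
  have hsre : 1 < s.re := by rw [hs]; exact hσ
  have h1 : LSeriesSummable (tw (ev ψ) moebius ·) s :=
    summable_of_abscissa (abscissa_le_one_of_norm_le_dcount hD.norm_inv) hsre
  have h2 := ArithmeticFunction.LSeries_mul' (summable_of_abscissa hD.abscissa_r hsre) h1
  rw [hD.inv, ArithmeticFunction.one_eq_delta, LSeries_delta] at h2
  have h3 : ‖LSeries (tw (ev ψ) moebius ·) s‖ ≤ 2 / (σ - 1) := by
    refine norm_LSeries_le_two_div (fun n hn => ?_) hs hσ hσ2
    rw [tw_apply, norm_mul]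
    refine mul_le_one₀ ((isCM_ev ψ).norm_le n) (norm_nonneg _) ?_
    rw [intCoe_apply, Complex.norm_intCast]
    exact_mod_cast abs_moebius_le_one
  calc (1 : ℝ) = ‖LSeries (dchar ψ ·) s‖ * ‖LSeries (tw (ev ψ) moebius ·) s‖ := by
        rw [← norm_mul, dchar, ← h2, Pi.one_apply, norm_one]
    _ ≤ _ := by gcongr

theorem abs_sum_antidiagonal_le {c d : ℕ → ℝ} {A B : ℝ} (hA : 0 ≤ A) (hB : 0 ≤ B)
    (hc : ∀ m, |c m| ≤ A * (4 / 7) ^ m) (hd : ∀ m, |d m| ≤ B * (3 / 5) ^ m) (m : ℕ) :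
    |∑ p ∈ antidiagonal m, c p.1 * d p.2| ≤ 21 * (A * B) * (3 / 5) ^ m := by
  have h1 : ∀ p ∈ antidiagonal m, |c p.1 * d p.2| ≤ A * B * (3 / 5) ^ m * (20 / 21) ^ p.1 := by
    intro p hp
    rw [HasAntidiagonal.mem_antidiagonal] at hp
    rw [abs_mul]
    calc |c p.1| * |d p.2| ≤ (A * (4 / 7) ^ p.1) * (B * (3 / 5) ^ p.2) :=
          mul_le_mul (hc _) (hd _) (abs_nonneg _) (by positivity)
      _ = _ := by
          rw [← hp, pow_add, show (4 / 7 : ℝ) = 3 / 5 * (20 / 21) by norm_num, mul_pow]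
          ring
  refine (abs_sum_le_sum_abs _ _).trans ((sum_le_sum h1).trans ?_)
  rw [← mul_sum, Nat.sum_antidiagonal_eq_sum_range_succ (fun i _ => (20 / 21 : ℝ) ^ i)]
  have h2 : ∑ i ∈ range m.succ, (20 / 21 : ℝ) ^ i ≤ 21 := by
    refine (Summable.sum_le_tsum _ (fun i _ => by positivity)
      (summable_geometric_of_lt_one (by norm_num) (by norm_num))).trans ?_
    rw [tsum_geometric_of_lt_one (by norm_num) (by norm_num)]
    norm_num
  calc _ ≤ A * B * (3 / 5) ^ m * 21 := by gcongr
    _ = _ := by ring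

theorem summable_mul_pow {c : ℕ → ℝ} {A a u : ℝ} (ha : 0 ≤ a) (hu : 0 ≤ u) (hau : a * u < 1)
    (hc : ∀ m, |c m| ≤ A * a ^ m) : Summable fun m => ‖c m * u ^ m‖ := by
  refine Summable.of_nonneg_of_le (fun m => norm_nonneg _) (fun m => ?_)
    ((summable_geometric_of_lt_one (mul_nonneg ha hu) hau).mul_left A)
  rw [norm_mul, norm_pow, norm_eq_abs, norm_of_nonneg hu, mul_pow, ← mul_assoc]
  gcongr
  exact hc m

/-- Estermann's argument: a lower bound for the value at `1` of a power series `G`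
such that `G / (1 - u)`, up to an analytic error, has nonnegative coefficients. -/
theorem le_tsum_of_convolution_nonneg {g z : ℕ → ℝ} {R Z h : ℝ} (hR : 1 ≤ R) (hZ : 1 ≤ Z)
    (hh : 0 < h) (hhZ : h ≤ 1 / (8 * Z)) (hg : ∀ m, |g m| ≤ R * (3 / 5) ^ m)
    (hz : ∀ m, |z m| ≤ Z * (4 / 7) ^ m)
    (hb : ∀ m, 0 ≤ ∑ p ∈ antidiagonal m, (1 + z p.1) * g p.2)
    (hb0 : 1 ≤ (1 + z 0) * g 0) (hG : 0 ≤ ∑' m, g m * (1 + h) ^ m) :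
    h / 4 * (142 * (R * Z)) ^ (-(3 * h)) ≤ ∑' m, g m := by
  have hh8 : h ≤ 1 / 8 := hhZ.trans (one_div_le_one_div_of_le (by norm_num) (by linarith))
  set u : ℝ := 1 + h with hu
  have hu0 : 0 ≤ u := by positivity
  have hu8 : u ≤ 9 / 8 := by rw [hu]; linarith
  have hau : 3 / 5 * u < 1 := by linarith
  have hau' : 4 / 7 * u < 1 := by linarith
  have sg := summable_mul_pow (by norm_num) hu0 hau hg
  have sz := summable_mul_pow (by norm_num) hu0 hau' hz
  have sg1 : Summable g := by
    have := (summable_mul_pow (u := 1) (by norm_num) (by norm_num) (by norm_num) hg).of_norm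
    simpa using this
  set l : ℝ := ∑' m, g m with hl
  set G : ℝ := ∑' m, g m * u ^ m with hGdef
  set W : ℝ := ∑' m, z m * u ^ m with hWdef
  set T : ℕ → ℝ := fun m => ∑ i ∈ range (m + 1), g i - l with hT
  set b : ℕ → ℝ := fun m => ∑ p ∈ antidiagonal m, (1 + z p.1) * g p.2 with hbdef
  set w : ℕ → ℝ := fun m => ∑ p ∈ antidiagonal m, z p.1 * g p.2 with hw
  have hbw : ∀ m, b m - l = T m + w m := by
    intro m
    simp only [hbdef, hT, hw]
    rw [← Nat.sum_antidiagonal_eq_sum_range_succ (fun i _ => g i) m,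
      ← Nat.sum_antidiagonal_swap (f := fun p : ℕ × ℕ => g p.1), add_comm, ← add_sub_assoc,
      ← sum_add_distrib]
    congr 1
    exact sum_congr rfl fun p _ => by simp only [Prod.fst_swap]; ring
  have hTb : ∀ m, |T m| ≤ 3 / 2 * R * (3 / 5) ^ m := by
    intro m
    have h1 : T m = -∑' i, g (i + (m + 1)) := by
      simp only [hT]
      rw [hl, ← sg1.sum_add_tsum_nat_add (m + 1)]
      ring
    have h2 : HasSum (fun i => R * (3 / 5) ^ (m + 1) * (3 / 5 : ℝ) ^ i)
        (R * (3 / 5) ^ (m + 1) * (1 - 3 / 5)⁻¹) :=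
      (hasSum_geometric_of_lt_one (by norm_num) (by norm_num)).mul_left _
    rw [h1, abs_neg, ← norm_eq_abs]
    refine (tsum_of_norm_bounded h2 fun i => ?_).trans (le_of_eq ?_)
    · rw [norm_eq_abs]
      refine (hg _).trans (le_of_eq ?_)
      rw [pow_add]
      ring
    · rw [pow_succ]
      norm_num
      ring
  have hwb : ∀ m, |w m| ≤ 21 * (Z * R) * (3 / 5) ^ m :=
    abs_sum_antidiagonal_le (by linarith) (by linarith) hz hg
  have hbl : ∀ m, |b m - l| ≤ 23 * (R * Z) * (3 / 5) ^ m := by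
    intro m
    rw [hbw]
    have h1 : 3 / 2 * R ≤ 2 * (R * Z) := by nlinarith
    calc |T m + w m| ≤ 3 / 2 * R * (3 / 5) ^ m + 21 * (Z * R) * (3 / 5) ^ m :=
          (abs_add_le _ _).trans (add_le_add (hTb m) (hwb m))
      _ ≤ 2 * (R * Z) * (3 / 5) ^ m + 21 * (Z * R) * (3 / 5) ^ m := by gcongr
      _ = _ := by ring
  have sT := (summable_mul_pow (by norm_num) hu0 hau hTb).of_norm
  have sb := (summable_mul_pow (by norm_num) hu0 hau hbl).of_norm
  have hTsum : h * ∑' m, T m * u ^ m = l - G := by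
    have e0 := sT.tsum_eq_zero_add
    have eg := sg.of_norm.tsum_eq_zero_add
    have e1 : ∑' m, T (m + 1) * u ^ (m + 1) =
        u * ∑' m, T m * u ^ m + ∑' m, g (m + 1) * u ^ (m + 1) := by
      rw [← tsum_mul_left, ← (sT.mul_left u).tsum_add ((summable_nat_add_iff 1).2 sg.of_norm)]
      refine tsum_congr fun m => ?_
      simp only [hT]
      rw [sum_range_succ _ (m + 1), pow_succ]
      ring
    have e2 : T 0 = g 0 - l := by simp [hT]
    rw [e1, e2] at e0
    simp only [pow_zero, mul_one] at e0 eg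
    rw [← hGdef] at eg
    have : u * ∑' m, T m * u ^ m = ∑' m, T m * u ^ m + h * ∑' m, T m * u ^ m := by rw [hu]; ring
    linarith
  have hwsum : ∑' m, w m * u ^ m = W * G := by
    rw [hWdef, hGdef, tsum_mul_tsum_eq_tsum_sum_antidiagonal_of_summable_norm sz sg]
    refine tsum_congr fun m => ?_
    simp only [hw]
    rw [sum_mul]
    refine sum_congr rfl fun p hp => ?_
    rw [HasAntidiagonal.mem_antidiagonal] at hp
    rw [← hp, pow_add]
    ring
  have sw := (summable_mul_pow (by norm_num) hu0 hau hwb).of_norm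
  have hsum : ∑' m, (b m - l) * u ^ m = (l - G) / h + W * G := by
    rw [← hwsum, ← hTsum, mul_div_cancel_left₀ _ hh.ne', ← sT.tsum_add sw]
    exact tsum_congr fun m => by rw [hbw]; ring
  have hW : W ≤ 1 / h := by
    have h2 : HasSum (fun m => Z * (9 / 14 : ℝ) ^ m) (Z * (1 - 9 / 14)⁻¹) :=
      (hasSum_geometric_of_lt_one (by norm_num) (by norm_num)).mul_left _
    have h3 : ‖W‖ ≤ Z * (1 - 9 / 14)⁻¹ := by
      refine tsum_of_norm_bounded h2 fun m => ?_
      rw [norm_mul, norm_pow, norm_eq_abs, norm_of_nonneg hu0]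
      calc |z m| * u ^ m ≤ Z * (4 / 7) ^ m * (9 / 8) ^ m := by gcongr; exact hz m
        _ = _ := by rw [mul_assoc, ← mul_pow]; norm_num
    have h4 : 8 * Z ≤ 1 / h := by
      rw [le_div_iff₀ hh]
      rw [le_div_iff₀ (by linarith)] at hhZ
      linarith
    have h5 : Z * (1 - 9 / 14)⁻¹ ≤ 8 * Z := by
      norm_num
      linarith
    exact (Real.le_norm_self W).trans (h3.trans (h5.trans h4))
  have hup : ∑' m, (b m - l) * u ^ m ≤ l / h := by
    rw [hsum, sub_div]
    have : W * G ≤ 1 / h * G := by gcongr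
    have e : G / h = 1 / h * G := by ring
    linarith
  have hK : 1 ≤ 142 * (R * Z) := by nlinarith
  obtain ⟨m₀, hm₀, hm₀'⟩ : ∃ m₀ : ℕ, 142 * (R * Z) ≤ (40 / 27) ^ m₀ ∧
      u ^ m₀ ≤ 2 * (142 * (R * Z)) ^ (3 * h) := by
    have hlogK : 0 ≤ log (142 * (R * Z)) := log_nonneg hK
    refine ⟨⌈3 * log (142 * (R * Z))⌉₊, ?_, ?_⟩
    · have h1 : exp (1 / 3) ≤ 40 / 27 := by
        have h2 : exp (1 / 3) ^ 3 ≤ (40 / 27 : ℝ) ^ 3 := by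
          rw [← exp_nat_mul]
          norm_num
          exact (Real.exp_one_lt_d9.le).trans (by norm_num)
        exact le_of_pow_le_pow_left₀ (by norm_num) (by norm_num) h2
      calc 142 * (R * Z) = exp (1 / 3 * (3 * log (142 * (R * Z)))) := by
            rw [show ∀ v : ℝ, 1 / 3 * (3 * v) = v by intro v; ring, Real.exp_log (by linarith)]
        _ ≤ exp (1 / 3 * (⌈3 * log (142 * (R * Z))⌉₊ : ℝ)) := by
            gcongr
            exact Nat.le_ceil _
        _ = exp (1 / 3) ^ ⌈3 * log (142 * (R * Z))⌉₊ := by rw [← exp_nat_mul, mul_comm]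
        _ ≤ _ := by gcongr
    · calc u ^ ⌈3 * log (142 * (R * Z))⌉₊
          ≤ exp h ^ ⌈3 * log (142 * (R * Z))⌉₊ := by
            gcongr
            rw [hu, add_comm]
            exact Real.add_one_le_exp h
        _ = exp (⌈3 * log (142 * (R * Z))⌉₊ * h) := by rw [exp_nat_mul]
        _ ≤ exp ((3 * log (142 * (R * Z)) + 1) * h) := by
            gcongr
            exact (Nat.ceil_lt_add_one (by positivity)).le
        _ = exp h * (142 * (R * Z)) ^ (3 * h) := by
            rw [rpow_def_of_pos (by linarith), ← Real.exp_add]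
            congr 1
            ring
        _ ≤ _ := by
            gcongr
            have h1 : exp h ^ 2 ≤ (2 : ℝ) ^ 2 := by
              rw [← exp_nat_mul]
              refine (Real.exp_monotone (b := 1) ?_).trans
                ((Real.exp_one_lt_d9.le).trans (by norm_num))
              push_cast
              linarith
            exact le_of_pow_le_pow_left₀ (by norm_num) (by norm_num) h1
  have hm1 : 1 ≤ m₀ := by
    rcases Nat.eq_zero_or_pos m₀ with h0 | h0
    · rw [h0, pow_zero] at hm₀
      nlinarith
    · exact h0
  have hlow : 1 / 2 - l * ((u ^ m₀ - 1) / h) ≤ ∑' m, (b m - l) * u ^ m := by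
    rw [← sb.sum_add_tsum_nat_add m₀]
    have h1 : 1 - l * ((u ^ m₀ - 1) / h) ≤ ∑ m ∈ range m₀, (b m - l) * u ^ m := by
      have e : (u ^ m₀ - 1) / h = ∑ m ∈ range m₀, u ^ m := by
        rw [geom_sum_eq (by rw [hu]; linarith), hu]
        congr 1
        ring
      rw [e]
      simp only [sub_mul]
      rw [sum_sub_distrib, ← mul_sum]
      have : 1 ≤ ∑ m ∈ range m₀, b m * u ^ m := by
        have h3 : b 0 * u ^ 0 ≤ ∑ m ∈ range m₀, b m * u ^ m :=
          single_le_sum (f := fun m => b m * u ^ m)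
            (fun m _ => mul_nonneg (hb m) (by positivity)) (mem_range.2 hm1)
        have h4 : b 0 = (1 + z 0) * g 0 := by simp [hbdef]
        rw [h4, pow_zero, mul_one] at h3
        linarith
      linarith
    have h2 : -(1 / 2) ≤ ∑' m, (b (m + m₀) - l) * u ^ (m + m₀) := by
      have h3 : HasSum (fun i => 23 * (R * Z) * (27 / 40) ^ m₀ * (27 / 40 : ℝ) ^ i)
          (23 * (R * Z) * (27 / 40) ^ m₀ * (1 - 27 / 40)⁻¹) :=
        (hasSum_geometric_of_lt_one (by norm_num) (by norm_num)).mul_left _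
      have h4 : ‖∑' m, (b (m + m₀) - l) * u ^ (m + m₀)‖ ≤
          23 * (R * Z) * (27 / 40) ^ m₀ * (1 - 27 / 40)⁻¹ := by
        refine tsum_of_norm_bounded h3 fun m => ?_
        rw [norm_mul, norm_pow, norm_eq_abs, norm_of_nonneg hu0]
        calc |b (m + m₀) - l| * u ^ (m + m₀)
            ≤ 23 * (R * Z) * (3 / 5) ^ (m + m₀) * (9 / 8) ^ (m + m₀) := by
              gcongr
              exact hbl _
          _ = _ := by
              rw [mul_assoc, ← mul_pow, pow_add]
              norm_num
              ring
      have h5 : 23 * (R * Z) * (27 / 40) ^ m₀ * (1 - 27 / 40)⁻¹ ≤ 1 / 2 := by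
        have h6 : 142 * (R * Z) * (27 / 40) ^ m₀ ≤ 1 := by
          calc 142 * (R * Z) * (27 / 40) ^ m₀ ≤ (40 / 27) ^ m₀ * (27 / 40) ^ m₀ := by gcongr
            _ = 1 := by rw [← mul_pow]; norm_num
        have h7 : 0 ≤ R * Z * (27 / 40) ^ m₀ := by positivity
        norm_num
        linarith
      have := (abs_le.1 (h4.trans h5)).1
      exact this
    linarith
  have hfin : h / 2 ≤ l * u ^ m₀ := by
    have h1 := hlow.trans hup
    have h2 : 1 / 2 ≤ l * u ^ m₀ / h := by
      have e : l * u ^ m₀ / h = l / h + l * ((u ^ m₀ - 1) / h) := by ring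
      linarith
    rw [le_div_iff₀ hh] at h2
    linarith
  have hP : 0 < (142 * (R * Z)) ^ (3 * h) := Real.rpow_pos_of_pos (by linarith) _
  have hl0 : 0 ≤ l := by
    by_contra hneg
    rw [not_le] at hneg
    have : l * u ^ m₀ ≤ 0 := mul_nonpos_of_nonpos_of_nonneg hneg.le (by positivity)
    linarith
  rw [rpow_neg (by linarith), ← div_eq_mul_inv, div_le_iff₀ hP]
  have h9 : l * u ^ m₀ ≤ l * (2 * (142 * (R * Z)) ^ (3 * h)) := by gcongr
  linarith

theorem norm_LSeries_lg_two_le {f : 𝓐} (hfa : LSeries.abscissaOfAbsConv (f ·) ≤ 1) {K : ℝ}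
    (hf : ∀ N : ℕ, ‖∑ n ∈ Ioc 0 N, f n‖ ≤ K) (m : ℕ) :
    ‖LSeries (lg m f ·) 2‖ ≤ 22 * K * (4 / 7) ^ m := by
  have hK : 0 ≤ K := (norm_nonneg _).trans (hf 0)
  have hF : ∀ N : ℕ, 1 ≤ N →
      ‖∑ n ∈ Ioc 0 N, lg m f n‖ ≤ 2 * K * (4 / 7) ^ m * (N : ℝ) ^ (7 / 4 : ℝ) := by
    intro N hN
    have h1 : ‖∑ n ∈ Ioc 0 N, ((log n ^ m / m.factorial : ℝ) : ℂ) * f n‖ ≤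
        2 * K * (log N ^ m / m.factorial) :=
      norm_sum_monotone_le f (fun n : ℕ => log n ^ m / m.factorial) 0 N K hN (fun n hn _ => by
          have : (1 : ℝ) ≤ n := by exact_mod_cast hn
          have : 0 ≤ log n := log_nonneg this
          push_cast
          gcongr
          linarith)
        (div_nonneg (pow_nonneg (log_natCast_nonneg _) _) (by positivity))
        (div_nonneg (pow_nonneg (log_natCast_nonneg _) _) (by positivity))
        (fun n _ _ => hf n)
    refine h1.trans ?_
    rw [mul_assoc (2 * K)]
    gcongr
    refine (log_pow_div_factorial_le hN m (ε := 7 / 4) (by norm_num)).trans (le_of_eq ?_)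
    rw [← inv_pow]
    norm_num
  have hs := summable_of_abscissa (s := 2) (abscissa_lg_le_one hfa m) (by simp)
  refine le_of_tendsto (hs.hasSum.tendsto_sum_nat.comp (Filter.tendsto_add_atTop_nat 1)).norm
    ((Filter.eventually_ge_atTop 1).mono fun N hN => ?_)
  have hN0 : (0 : ℝ) < N := by exact_mod_cast hN
  have e1 : ∑ n ∈ range (N + 1), LSeries.term (lg m f ·) 2 n =
      ∑ n ∈ Ioc 0 N, (((n : ℝ) ^ (-2 : ℝ) : ℝ) : ℂ) * lg m f n := by
    rw [← sum_erase (a := 0) (range (N + 1)) (by simp)]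
    have : (range (N + 1)).erase 0 = Ioc 0 N := by ext n; rw [mem_erase, mem_range, mem_Ioc]; omega
    rw [this]
    refine sum_congr rfl fun n hn => ?_
    rw [mem_Ioc] at hn
    rw [LSeries.term_of_ne_zero (by omega), Complex.ofReal_cpow (by positivity)]
    push_cast
    rw [cpow_neg]
    ring
  simp only [Function.comp]
  rw [e1, sum_mul_eq_abel _ (fun n : ℕ => (n : ℝ) ^ (-2 : ℝ)) 0 N hN]
  have h2 : ‖(((N : ℝ) ^ (-2 : ℝ) : ℝ) : ℂ) * ∑ n ∈ Ioc 0 N, lg m f n‖ ≤ 2 * K * (4 / 7) ^ m := by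
    rw [norm_mul, norm_real, norm_of_nonneg (by positivity)]
    calc (N : ℝ) ^ (-2 : ℝ) * ‖∑ n ∈ Ioc 0 N, lg m f n‖
        ≤ (N : ℝ) ^ (-2 : ℝ) * (2 * K * (4 / 7) ^ m * (N : ℝ) ^ (7 / 4 : ℝ)) := by
          gcongr; exact hF N hN
      _ = 2 * K * (4 / 7) ^ m * (N : ℝ) ^ (-(1 / 4) : ℝ) := by
          rw [show (-(1 / 4) : ℝ) = -2 + 7 / 4 by norm_num, rpow_add hN0]; ring
      _ ≤ 2 * K * (4 / 7) ^ m * 1 := by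
          gcongr
          exact rpow_le_one_of_one_le_of_nonpos (by exact_mod_cast hN) (by norm_num)
      _ = _ := mul_one _
  have h3 : ∀ n ∈ Ioo 0 N, ‖(((n : ℝ) ^ (-2 : ℝ) - ((n + 1 : ℕ) : ℝ) ^ (-2 : ℝ) : ℝ) : ℂ) *
      ∑ i ∈ Ioc 0 n, lg m f i‖ ≤ 4 * K * (4 / 7) ^ m * (n : ℝ) ^ (-(5 / 4) : ℝ) := by
    intro n hn
    rw [mem_Ioo] at hn
    have hn0 : (0 : ℝ) < n := by exact_mod_cast hn.1
    have h4 : (n : ℝ) ^ (-2 : ℝ) - ((n + 1 : ℕ) : ℝ) ^ (-2 : ℝ) ≤ 2 * (n : ℝ) ^ (-3 : ℝ) := by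
      push_cast
      rw [rpow_neg hn0.le, rpow_neg (by positivity), rpow_neg hn0.le]
      rw [show (2 : ℝ) = (2 : ℕ) by norm_num, show (3 : ℝ) = (3 : ℕ) by norm_num]
      simp only [rpow_natCast]
      have e : 2 * ((n : ℝ) ^ 3)⁻¹ - (((n : ℝ) ^ 2)⁻¹ - (((n : ℝ) + 1) ^ 2)⁻¹) =
          (3 * n + 2) / (n ^ 3 * (n + 1) ^ 2) := by field_simp; ring
      have : (0 : ℝ) ≤ (3 * n + 2) / (n ^ 3 * (n + 1) ^ 2) := by positivity
      push_cast
      linarith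
    have h5 : 0 ≤ (n : ℝ) ^ (-2 : ℝ) - ((n + 1 : ℕ) : ℝ) ^ (-2 : ℝ) := by
      rw [sub_nonneg]
      exact rpow_le_rpow_of_nonpos hn0 (by push_cast; linarith) (by norm_num)
    rw [norm_mul, norm_real, norm_of_nonneg h5]
    calc _ ≤ 2 * (n : ℝ) ^ (-3 : ℝ) * (2 * K * (4 / 7) ^ m * (n : ℝ) ^ (7 / 4 : ℝ)) :=
          mul_le_mul h4 (hF n hn.1) (norm_nonneg _) (by positivity)
      _ = _ := by rw [show (-(5 / 4) : ℝ) = -3 + 7 / 4 by norm_num, rpow_add hn0]; ring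
  have h6 : ∑ n ∈ Ioo 0 N, (n : ℝ) ^ (-(5 / 4) : ℝ) ≤ 5 := by
    refine (sum_le_sum_of_subset_of_nonneg Ioo_subset_Ioc_self fun _ _ _ => by positivity).trans ?_
    refine (sum_rpow_neg_le (by norm_num : (1 : ℝ) < 5 / 4) N).trans ?_
    norm_num
  refine (norm_add_le _ _).trans ?_
  have h7 := (norm_sum_le (Ioo 0 N) fun n =>
    (((n : ℝ) ^ (-2 : ℝ) - ((n + 1 : ℕ) : ℝ) ^ (-2 : ℝ) : ℝ) : ℂ) *
      ∑ i ∈ Ioc 0 n, lg m f i).trans (sum_le_sum h3)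
  rw [← mul_sum] at h7
  have h8 : 4 * K * (4 / 7) ^ m * ∑ n ∈ Ioo 0 N, (n : ℝ) ^ (-(5 / 4) : ℝ) ≤
      4 * K * (4 / 7) ^ m * 5 := by gcongr
  have h9 : 0 ≤ K * (4 / 7 : ℝ) ^ m := by positivity
  linarith

theorem iterate_logMul (f : 𝓐) (m n : ℕ) :
    (LSeries.logMul^[m] (f ·)) n = (m.factorial : ℂ) * lg m f n := by
  have h : (LSeries.logMul^[m] (f ·)) n = (log n : ℂ) ^ m * f n := by
    induction m with
    | zero => simp
    | succ k ih =>
      rw [Function.iterate_succ_apply', LSeries.logMul, ih, pow_succ, Complex.natCast_log]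
      ring
  rw [h, lg_apply]
  have : (m.factorial : ℂ) ≠ 0 := by exact_mod_cast m.factorial_ne_zero
  push_cast
  field_simp

theorem iteratedDeriv_LSeries_two {f : 𝓐} (hfa : LSeries.abscissaOfAbsConv (f ·) ≤ 1) (m : ℕ) :
    iteratedDeriv m (LSeries (f ·)) 2 = (-1) ^ m * (m.factorial * LSeries (lg m f ·) 2) := by
  have h2 : LSeries.abscissaOfAbsConv (f ·) < ((2 : ℂ).re : EReal) := by
    refine lt_of_le_of_lt hfa ?_
    rw [Complex.re_ofNat]
    norm_cast
  rw [LSeries_iteratedDeriv m h2, ← LSeries_smul_arith]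
  congr 1
  refine LSeries_congr (fun {n} _ => ?_) 2
  rw [iterate_logMul]
  rfl

theorem eventually_one_lt_re : ∀ᶠ s : ℂ in nhds 2, 1 < s.re :=
  (isOpen_lt continuous_const Complex.continuous_re).mem_nhds (by simp)

theorem hasSum_LSeries_lg {f : 𝓐}
    (hfa : LSeries.abscissaOfAbsConv (f ·) ≤ 1) {F : ℂ → ℂ} (hF : Differentiable ℂ F)
    (hFf : ∀ s : ℂ, 1 < s.re → F s = LSeries (f ·) s) (u : ℂ) :
    HasSum (fun m => LSeries (lg m f ·) 2 * u ^ m) (F (2 - u)) := by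
  have h1 := Complex.hasSum_taylorSeries_of_entire hF 2 (2 - u)
  have h2 : ∀ m, iteratedDeriv m F 2 = (-1) ^ m * (m.factorial * LSeries (lg m f ·) 2) := by
    intro m
    rw [← iteratedDeriv_LSeries_two hfa]
    exact Filter.EventuallyEq.iteratedDeriv_eq m (eventually_one_lt_re.mono fun s hs => hFf s hs)
  refine (congrArg (HasSum · (F (2 - u))) (funext fun m => ?_)).mpr h1
  rw [h2, smul_eq_mul, smul_eq_mul, show (2 - u - 2 : ℂ) = -1 * u by ring, mul_pow]
  have h3 : (m.factorial : ℂ) ≠ 0 := by exact_mod_cast m.factorial_ne_zero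
  have h4 : ((-1 : ℂ) ^ m) * (-1) ^ m = 1 := by rw [← mul_pow]; norm_num
  field_simp
  linear_combination (-(LSeries (lg m f ·) 2 * u ^ m)) * h4

theorem exists_norm_LSeries_lg_zeta_sub_one_le : ∃ Z : ℝ, 1 ≤ Z ∧
    ∀ m, ‖LSeries (lg m (zeta : 𝓐) ·) 2 - 1‖ ≤ Z * (4 / 7) ^ m := by
  set g : ℂ → ℂ := DirichletCharacter.LFunctionTrivChar₁ 1 with hg
  have hgd : Differentiable ℂ g := DirichletCharacter.differentiable_LFunctionTrivChar₁ 1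
  have hfd : Differentiable ℂ (dslope g 1) := by
    rw [← differentiableOn_univ, Complex.differentiableOn_dslope Filter.univ_mem]
    exact hgd.differentiableOn
  have hg1 : g 1 = 1 := by simp [hg]
  have hfe : ∀ᶠ s : ℂ in nhds 2, dslope g 1 s = LSeries ((zeta : 𝓐) ·) s - (s - 1)⁻¹ := by
    refine eventually_one_lt_re.mono fun s hs => ?_
    have hs1 : s ≠ 1 := by rintro rfl; simp at hs
    have hs2 : s - 1 ≠ 0 := sub_ne_zero.2 hs1
    have hgs : g s = (s - 1) * LSeries ((zeta : 𝓐) ·) s := by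
      have hz : LSeries ((zeta : 𝓐) ·) s = riemannZeta s := by
        rw [← ArithmeticFunction.LSeries_zeta_eq_riemannZeta hs]
        rfl
      rw [hz, hg, DirichletCharacter.LFunctionTrivChar₁, Function.update_of_ne hs1,
        DirichletCharacter.LFunctionTrivChar, DirichletCharacter.LFunction_modOne_eq]
    rw [dslope_of_ne _ hs1, slope_def_field, hg1, hgs]
    field_simp
  obtain ⟨C, hC⟩ := (isCompact_sphere (2 : ℂ) (7 / 4)).exists_bound_of_continuousOn
    hfd.continuous.continuousOn
  refine ⟨max 1 C, le_max_left _ _, fun m => ?_⟩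
  have h1 := Complex.norm_iteratedDeriv_le_of_forall_mem_sphere_norm_le m
    (by norm_num : (0 : ℝ) < 7 / 4) hfd.diffContOnCl hC
  have hm : (0 : ℝ) < m.factorial := by positivity
  have hinv : ContDiffAt ℂ m (fun s : ℂ => (s - 1)⁻¹) 2 :=
    (contDiffAt_id.sub contDiffAt_const).inv (by norm_num)
  have hanz : ContDiffAt ℂ m (LSeries ((zeta : 𝓐) ·)) 2 := by
    refine ContDiffAt.congr_of_eventuallyEq (f := fun s => dslope g 1 s + (s - 1)⁻¹) ?_
      (hfe.mono fun s hs => by simp only [hs]; ring)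
    exact hfd.contDiff.contDiffAt.add hinv
  have h2 : iteratedDeriv m (dslope g 1) 2 = (-1) ^ m * m.factorial *
      (LSeries (lg m (zeta : 𝓐) ·) 2 - 1) := by
    rw [Filter.EventuallyEq.iteratedDeriv_eq m hfe, iteratedDeriv_fun_sub hanz hinv,
      iteratedDeriv_LSeries_two datum_zeta.abscissa_r]
    have h3 : iteratedDeriv m (fun s : ℂ => (s - 1)⁻¹) 2 = (-1) ^ m * m.factorial := by
      have := congrFun (iteratedDeriv_comp_sub_const m (Inv.inv : ℂ → ℂ) 1) 2
      rw [this, iteratedDeriv_eq_iterate, iter_deriv_inv]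
      norm_num
    rw [h3]
    ring
  rw [h2, norm_mul, norm_mul, norm_pow, norm_neg, norm_one, one_pow, one_mul,
    norm_natCast, mul_div_assoc, mul_le_mul_iff_right₀ hm] at h1
  refine h1.trans ?_
  rw [div_eq_mul_inv, ← inv_pow, show ((7 / 4 : ℝ))⁻¹ = 4 / 7 by norm_num]
  gcongr
  exact le_max_right _ _

/-- The coefficients of the Taylor expansion at `2` of the L-series of `f`, in the
variable `2 - s`. -/
def cf (m : ℕ) (f : 𝓐) : ℝ := (LSeries (lg m f ·) 2).re

theorem LSeries_lg_two_eq_tsum {f : 𝓐} (hf : ∀ n, (f n).im = 0) (m : ℕ) :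
    LSeries (lg m f ·) 2 = ((∑' n : ℕ, (f n).re * (log n ^ m / m.factorial) / n ^ 2 : ℝ) : ℂ) := by
  rw [LSeries, Complex.ofReal_tsum]
  refine tsum_congr fun n => ?_
  rcases eq_or_ne n 0 with rfl | hn
  · simp
  have h1 : f n = ((f n).re : ℂ) := Complex.ext rfl (by simp [hf])
  rw [LSeries.term_of_ne_zero hn, lg_apply, h1]
  norm_cast
  rw [mul_comm (f n).re]

theorem LSeries_lg_two {f : 𝓐} (hf : ∀ n, (f n).im = 0) (m : ℕ) :
    LSeries (lg m f ·) 2 = (cf m f : ℂ) := by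
  rw [cf, LSeries_lg_two_eq_tsum hf, ofReal_re]

theorem cf_nonneg {f : 𝓐} (hf : ∀ n, (f n).im = 0) (hf0 : ∀ n, 0 ≤ (f n).re)
    (m : ℕ) : 0 ≤ cf m f := by
  rw [cf, LSeries_lg_two_eq_tsum hf, ofReal_re]
  refine tsum_nonneg fun n => ?_
  have := hf0 n
  have := log_natCast_nonneg n
  positivity

theorem one_le_cf_zero {f : 𝓐} (hfa : LSeries.abscissaOfAbsConv (f ·) ≤ 1)
    (hf : ∀ n, (f n).im = 0) (hf0 : ∀ n, 0 ≤ (f n).re) (hf1 : f 1 = 1) : 1 ≤ cf 0 f := by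
  rw [cf, LSeries_lg_two_eq_tsum hf, ofReal_re]
  have hs : Summable fun n : ℕ => (f n).re * (log n ^ 0 / (0 : ℕ).factorial) / (n : ℝ) ^ 2 := by
    have h1 : LSeriesSummable (f ·) 2 := summable_of_abscissa hfa (by simp)
    refine (Complex.reCLM.summable h1).congr fun n => ?_
    rcases eq_or_ne n 0 with rfl | hn
    · simp
    have h2 : f n = ((f n).re : ℂ) := Complex.ext rfl (by simp [hf])
    change (LSeries.term (f ·) 2 n).re = _
    rw [LSeries.term_of_ne_zero hn, h2]
    norm_cast
    simp
  have h := hs.le_tsum 1 fun n _ => by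
    have := hf0 n
    positivity
  simpa [hf1] using h

/-- Bounds and power series for the Taylor coefficients of an L-series with real coefficients. -/
structure Coef (f : 𝓐) (ρ A : ℝ) (V : ℝ → ℝ) : Prop where
  abscissa : LSeries.abscissaOfAbsConv (f ·) ≤ 1
  real : ∀ n, (f n).im = 0
  bound : ∀ m, |cf m f| ≤ A * ρ ^ m
  sum : ∀ u, 0 ≤ u → u ≤ 9 / 8 → HasSum (fun m => cf m f * u ^ m) (V u)

theorem mul_im_eq_zero {f g : 𝓐} (hf : ∀ n, (f n).im = 0)
    (hg : ∀ n, (g n).im = 0) (n : ℕ) : ((f * g) n).im = 0 := by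
  rw [mul_apply, Complex.im_sum]
  exact sum_eq_zero fun p _ => by rw [mul_im, hf, hg]; ring

theorem abscissa_mul_le_one {f g : 𝓐}
    (hf : LSeries.abscissaOfAbsConv (f ·) ≤ 1) (hg : LSeries.abscissaOfAbsConv (g ·) ≤ 1) :
    LSeries.abscissaOfAbsConv ((f * g) ·) ≤ 1 := by
  refine LSeries.abscissaOfAbsConv_le_of_forall_lt_LSeriesSummable (x := 1) fun y hy => ?_
  exact LSeriesSummable_mul (summable_of_abscissa hf (by simpa using hy))
    (summable_of_abscissa hg (by simpa using hy))

theorem cf_mul {f g : 𝓐} (hfa : LSeries.abscissaOfAbsConv (f ·) ≤ 1)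
    (hga : LSeries.abscissaOfAbsConv (g ·) ≤ 1) (hf : ∀ n, (f n).im = 0) (hg : ∀ n, (g n).im = 0)
    (m : ℕ) : cf m (f * g) = ∑ p ∈ antidiagonal m, cf p.1 f * cf p.2 g := by
  rw [cf, lg_mul, LSeries_sum_mul (F := fun i => lg i f) (G := fun i => lg i g)
    (fun p => summable_of_abscissa (abscissa_lg_le_one hfa _) (by simp))
    (fun p => summable_of_abscissa (abscissa_lg_le_one hga _) (by simp)), Complex.re_sum]
  refine sum_congr rfl fun p _ => ?_
  rw [LSeries_lg_two hf, LSeries_lg_two hg, ← ofReal_mul, ofReal_re]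

theorem Coef.mul {f g : 𝓐} {A B : ℝ} {V W : ℝ → ℝ} (hf : Coef f (4 / 7) A V)
    (hg : Coef g (3 / 5) B W) : Coef (f * g) (3 / 5) (21 * (A * B)) (fun u => V u * W u) where
  abscissa := abscissa_mul_le_one hf.abscissa hg.abscissa
  real := mul_im_eq_zero hf.real hg.real
  bound m := by
    have hA : 0 ≤ A := by simpa using (abs_nonneg _).trans (hf.bound 0)
    have hB : 0 ≤ B := by simpa using (abs_nonneg _).trans (hg.bound 0)
    rw [cf_mul hf.abscissa hg.abscissa hf.real hg.real]
    exact abs_sum_antidiagonal_le hA hB hf.bound hg.bound m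
  sum u hu hu' := by
    have h1 := summable_mul_pow (by norm_num) hu (by linarith) hf.bound
    have h2 := summable_mul_pow (by norm_num) hu (by linarith) hg.bound
    have h3 := tsum_mul_tsum_eq_tsum_sum_antidiagonal_of_summable_norm h1 h2
    have h4 := summable_sum_mul_antidiagonal_of_summable_norm' h1 h1.of_norm h2 h2.of_norm
    rw [(hf.sum u hu hu').tsum_eq, (hg.sum u hu hu').tsum_eq] at h3
    rw [h3]
    refine (congrArg (HasSum · _) (funext fun m => ?_)).mpr h4.hasSum
    rw [cf_mul hf.abscissa hg.abscissa hf.real hg.real, sum_mul]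
    refine sum_congr rfl fun p hp => ?_
    rw [← HasAntidiagonal.mem_antidiagonal.1 hp, pow_add]
    ring

theorem nonneg_of_mul_eq_lg {f Λ' : 𝓐} (h1 : f 1 = 1)
    (hd : Λ' * f = lg 1 f) (hΛ1 : Λ' 1 = 0) (hΛi : ∀ n, (Λ' n).im = 0) (hΛ : ∀ n, 0 ≤ (Λ' n).re)
    (n : ℕ) : (f n).im = 0 ∧ 0 ≤ (f n).re := by
  induction n using Nat.strong_induction_on with
  | _ n ih =>
    rcases Nat.lt_or_ge 1 n with hn | hn
    · have hl : 0 < log n := log_pos (by exact_mod_cast hn)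
      have h2 : (log n : ℂ) * f n = ∑ p ∈ n.divisorsAntidiagonal, Λ' p.1 * f p.2 := by
        rw [← mul_apply, hd, lg_apply]
        simp
      have h3 : ∀ p ∈ n.divisorsAntidiagonal, (Λ' p.1 * f p.2).im = 0 ∧
          0 ≤ (Λ' p.1 * f p.2).re := by
        intro p hp
        rw [Nat.mem_divisorsAntidiagonal] at hp
        rcases eq_or_ne p.1 1 with hp1 | hp1
        · rw [hp1, hΛ1]; simp
        have hp2 : p.2 < n := by
          have h0 : p.1 ≠ 0 := by rintro h; rw [h, zero_mul] at hp; exact hp.2 hp.1.symm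
          have h02 : p.2 ≠ 0 := by rintro h; rw [h, mul_zero] at hp; exact hp.2 hp.1.symm
          rw [← hp.1]
          exact lt_mul_of_one_lt_left (Nat.pos_of_ne_zero h02) (by omega)
        obtain ⟨hi, hr⟩ := ih p.2 hp2
        rw [mul_im, mul_re, hΛi, hi]
        refine ⟨by ring, ?_⟩
        have := mul_nonneg (hΛ p.1) hr
        linarith
      have h4 : log n * (f n).im = 0 := by
        rw [← Complex.im_ofReal_mul, h2, Complex.im_sum]
        exact sum_eq_zero fun p hp => (h3 p hp).1
      have h5 : 0 ≤ log n * (f n).re := by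
        rw [← Complex.re_ofReal_mul, h2, Complex.re_sum]
        exact sum_nonneg fun p hp => (h3 p hp).2
      exact ⟨(mul_eq_zero.1 h4).resolve_left hl.ne', nonneg_of_mul_nonneg_right h5 hl⟩
    · interval_cases n
      · simp
      · rw [h1]; simp

theorem Coef.weaken {f : 𝓐} {A : ℝ} {V : ℝ → ℝ} (hf : Coef f (4 / 7) A V) : Coef f (3 / 5) A V where
  abscissa := hf.abscissa
  real := hf.real
  bound m := by
    have hA : 0 ≤ A := by simpa using (abs_nonneg _).trans (hf.bound 0)
    exact (hf.bound m).trans (mul_le_mul_of_nonneg_left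
      (pow_le_pow_left₀ (by norm_num) (by norm_num) m) hA)
  sum := hf.sum

theorem ev_real {q : ℕ} {ψ : 𝓧 q} (h2 : ψ ^ 2 = 1) (n : ℕ) :
    (ev ψ n).im = 0 ∧ -1 ≤ (ev ψ n).re := by
  have h : (ψ (n : ZMod q)) ^ 2 = (1 : 𝓧 q) (n : ZMod q) := by
    rw [← h2, MulChar.pow_apply' ψ two_ne_zero]
  have h3 : ev ψ n = 0 ∨ ev ψ n = 1 ∨ ev ψ n = -1 := by
    by_cases hu : IsUnit (n : ZMod q)
    · rw [MulChar.one_apply hu, sq, mul_self_eq_one_iff] at h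
      right
      exact h
    · left
      exact MulChar.map_nonunit ψ hu
  rcases h3 with h | h | h <;> rw [h] <;> simp

theorem dchar_im {q : ℕ} {ψ : 𝓧 q} (h2 : ψ ^ 2 = 1) (n : ℕ) : (dchar ψ n).im = 0 := by
  rcases eq_or_ne n 0 with rfl | hn
  · simp
  · rw [dchar_apply ψ hn]
    exact (ev_real h2 n).1

theorem hasSum_cf_dchar {q : ℕ} [NeZero q] {ψ : 𝓧 q} (hψ : ψ ≠ 1) (h2 : ψ ^ 2 = 1) (u : ℝ) :
    HasSum (fun m => ((cf m (dchar ψ) * u ^ m : ℝ) : ℂ))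
      (DirichletCharacter.LFunction ψ (2 - u)) := by
  have h := hasSum_LSeries_lg (f := dchar ψ) (abscissa_le_one_of_norm_le_dcount (dchar_norm_le ψ))
    (DirichletCharacter.differentiable_LFunction hψ) (fun s hs => by
      rw [DirichletCharacter.LFunction_eq_LSeries ψ hs, LSeries_dchar]) u
  refine (congrArg (HasSum · _) (funext fun m => ?_)).mpr h
  rw [LSeries_lg_two (dchar_im h2)]
  push_cast
  rfl

theorem coef_dchar {q : ℕ} [NeZero q] {ψ : 𝓧 q} (hψ : ψ ≠ 1) (h2 : ψ ^ 2 = 1) :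
    Coef (dchar ψ) (4 / 7) (22 * q) (fun u => (DirichletCharacter.LFunction ψ (2 - u)).re) where
  abscissa := abscissa_le_one_of_norm_le_dcount (dchar_norm_le ψ)
  real := dchar_im h2
  bound m := (abs_re_le_norm _).trans (norm_LSeries_lg_two_le
    (abscissa_le_one_of_norm_le_dcount (dchar_norm_le ψ)) (fun N => by
      have e : ∑ n ∈ Ioc 0 N, dchar ψ n = ∑ n ∈ Ioc 0 N, ev ψ n :=
        sum_congr rfl fun n hn => dchar_apply ψ (by rw [mem_Ioc] at hn; omega)
      rw [e]
      exact norm_sum_ev_le hψ 0 N) m)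
  sum u _ _ := by
    have h := Complex.reCLM.hasSum (hasSum_cf_dchar hψ h2 u)
    exact h

theorem LFunction_im {q : ℕ} [NeZero q] {ψ : 𝓧 q} (hψ : ψ ≠ 1)
    (h2 : ψ ^ 2 = 1) (u : ℝ) : (DirichletCharacter.LFunction ψ (2 - u)).im = 0 := by
  have h := Complex.imCLM.hasSum (hasSum_cf_dchar hψ h2 u)
  refine h.unique ?_
  refine (congrArg (HasSum · 0) (funext fun m => ?_)).mpr (hasSum_zero (α := ℝ) (β := ℕ))
  exact Complex.ofReal_im (cf m (dchar ψ) * u ^ m)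

theorem der_mul {f g Λ₁ Λ₂ : 𝓐} (hf : Λ₁ * f = lg 1 f) (hg : Λ₂ * g = lg 1 g) :
    (Λ₁ + Λ₂) * (f * g) = lg 1 (f * g) := by
  rw [lg_one_mul, ← hf, ← hg]
  ring

theorem dchar_der {q : ℕ} (ψ : 𝓧 q) : tw (ev ψ) mangoldtC * dchar ψ = lg 1 (dchar ψ) :=
  (datum_zeta.twist (isCM_ev ψ)).der

theorem dchar_one {q : ℕ} (ψ : 𝓧 q) : dchar ψ 1 = 1 := by rw [dchar_apply ψ one_ne_zero]; simp

theorem mul_apply_one' {f g : 𝓐} (hf : f 1 = 1) (hg : g 1 = 1) : (f * g) 1 = 1 := by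
  rw [mul_apply_one, hf, hg, one_mul]

theorem zeta_one : (zeta : 𝓐) 1 = 1 := by simp

theorem zeta_mul_dchar_nonneg {q : ℕ} {ψ : 𝓧 q} (h2 : ψ ^ 2 = 1) (n : ℕ) :
    (((zeta : 𝓐) * dchar ψ) n).im = 0 ∧ 0 ≤ (((zeta : 𝓐) * dchar ψ) n).re := by
  have hv : ∀ n, (mangoldtC + tw (ev ψ) mangoldtC) n = (1 + ev ψ n) * (vonMangoldt n : ℂ) := by
    intro n
    rw [ArithmeticFunction.add_apply, tw_apply, mangoldtC_apply]
    ring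
  refine nonneg_of_mul_eq_lg (mul_apply_one' zeta_one (dchar_one ψ))
    (der_mul mangoldtC_mul_zeta (dchar_der ψ)) (by rw [hv]; simp) (fun n => ?_) (fun n => ?_) n
  · rw [hv, Complex.im_mul_ofReal, add_im, (ev_real h2 n).1]
    simp
  · rw [hv, Complex.re_mul_ofReal, Complex.add_re, Complex.one_re]
    exact mul_nonneg (by linarith [(ev_real h2 n).2]) vonMangoldt_nonneg

theorem zeta_mul_dchar_mul_nonneg {q₁ q₂ q₃ : ℕ} {ψ₁ : 𝓧 q₁}
    {ψ₂ : 𝓧 q₂} {ψ₃ : 𝓧 q₃} (h1 : ψ₁ ^ 2 = 1)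
    (h2 : ψ₂ ^ 2 = 1) (h3 : ∀ n, ev ψ₃ n = ev ψ₁ n * ev ψ₂ n) (n : ℕ) :
    (((zeta : 𝓐) * (dchar ψ₁ * (dchar ψ₂ * dchar ψ₃))) n).im = 0 ∧
      0 ≤ (((zeta : 𝓐) * (dchar ψ₁ * (dchar ψ₂ * dchar ψ₃))) n).re := by
  have hv : ∀ n, (mangoldtC + (tw (ev ψ₁) mangoldtC + (tw (ev ψ₂) mangoldtC +
      tw (ev ψ₃) mangoldtC))) n = ((1 + ev ψ₁ n) * (1 + ev ψ₂ n)) * (vonMangoldt n : ℂ) := by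
    intro n
    simp only [ArithmeticFunction.add_apply, tw_apply, mangoldtC_apply, h3]
    ring
  refine nonneg_of_mul_eq_lg (mul_apply_one' zeta_one (mul_apply_one' (dchar_one ψ₁)
    (mul_apply_one' (dchar_one ψ₂) (dchar_one ψ₃))))
    (der_mul mangoldtC_mul_zeta (der_mul (dchar_der ψ₁) (der_mul (dchar_der ψ₂) (dchar_der ψ₃))))
    (by rw [hv]; simp) (fun n => ?_) (fun n => ?_) n
  · rw [hv, Complex.im_mul_ofReal, mul_im, add_im, add_im, (ev_real h1 n).1, (ev_real h2 n).1]
    simp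
  · rw [hv, Complex.re_mul_ofReal, mul_re, add_im, add_im,
      (ev_real h1 n).1, (ev_real h2 n).1, Complex.add_re, Complex.add_re, Complex.one_re,
      Complex.one_im, add_zero, zero_mul, sub_zero]
    exact mul_nonneg (mul_nonneg (by linarith [(ev_real h1 n).2])
      (by linarith [(ev_real h2 n).2])) vonMangoldt_nonneg

theorem exists_le_of_zeta_mul_nonneg : ∃ Z : ℝ, 1 ≤ Z ∧ ∀ (f : 𝓐) (R : ℝ)
    (V : ℝ → ℝ) (h : ℝ), 1 ≤ R → Coef f (3 / 5) R V → f 1 = 1 →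
      (∀ n, 0 ≤ (((zeta : 𝓐) * f) n).re) → 0 < h → h ≤ 1 / (8 * Z) →
      0 ≤ V (1 + h) → h / 4 * (142 * (R * Z)) ^ (-(3 * h)) ≤ V 1 := by
  obtain ⟨Z, hZ1, hZ⟩ := exists_norm_LSeries_lg_zeta_sub_one_le
  refine ⟨Z, hZ1, fun f R V h hR hf hf1 hn hh hhZ hV => ?_⟩
  have hza := datum_zeta.abscissa_r
  have hzr : ∀ n, ((zeta : 𝓐) n).im = 0 := by intro n; rw [natCoe_apply, Complex.natCast_im]
  have hz1 : ∀ m, 1 + (cf m (zeta : 𝓐) - 1) = cf m (zeta : 𝓐) := fun m => by ring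
  have hh8 : h ≤ 1 / 8 := hhZ.trans (one_div_le_one_div_of_le (by norm_num) (by linarith))
  have s1 := hf.sum 1 zero_le_one (by norm_num)
  have s2 := hf.sum (1 + h) (by positivity) (by linarith)
  have hm := mul_im_eq_zero hzr hf.real
  have key := le_tsum_of_convolution_nonneg (g := fun m => cf m f)
    (z := fun m => cf m (zeta : 𝓐) - 1) hR hZ1 hh hhZ hf.bound
    (fun m => by
      refine le_trans ?_ (hZ m)
      rw [LSeries_lg_two hzr, ← Complex.ofReal_one, ← Complex.ofReal_sub, norm_real, norm_eq_abs])
    (fun m => by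
      simp only [hz1]
      rw [← cf_mul hza hf.abscissa hzr hf.real]
      exact cf_nonneg hm hn m)
    (by
      have := one_le_cf_zero (abscissa_mul_le_one hza hf.abscissa) hm hn
        (mul_apply_one' zeta_one hf1)
      rw [cf_mul hza hf.abscissa hzr hf.real] at this
      simpa using this)
    (by rw [s2.tsum_eq]; exact hV)
  simp only [one_pow, mul_one] at s1
  rwa [s1.tsum_eq] at key

theorem exists_norm_LFunction_one_le {δ : ℝ} (hδ : 0 < δ) : ∃ C : ℝ, 0 < C ∧
    ∀ (q : ℕ) [NeZero q] (ψ : 𝓧 q), ψ ≠ 1 →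
      ‖DirichletCharacter.LFunction ψ 1‖ ≤ C * (q : ℝ) ^ δ := by
  obtain ⟨C, hC0, hC⟩ := exists_norm_LSeries_lg_le 0 hδ
  refine ⟨C * 2 ^ δ, by positivity, fun q _ ψ hψ => ?_⟩
  have h1 : Filter.Tendsto (fun σ : ℝ => ‖DirichletCharacter.LFunction ψ σ‖)
      (nhdsWithin 1 (Set.Ioi 1)) (nhds ‖DirichletCharacter.LFunction ψ 1‖) := by
    have h2 : Continuous fun σ : ℝ => ‖DirichletCharacter.LFunction ψ σ‖ :=
      ((DirichletCharacter.differentiable_LFunction hψ).continuous.comp continuous_ofReal).norm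
    simpa using (h2.tendsto 1).mono_left nhdsWithin_le_nhds
  refine le_of_tendsto h1 ?_
  filter_upwards [Ioc_mem_nhdsGT (one_lt_two : (1 : ℝ) < 2)] with σ hσ
  have h3 := hC (dchar ψ) q (dchar_norm_le ψ) one_le_cast (norm_sum_dchar_le hψ) σ 0 hσ.1 hσ.2
  rw [lg_zero, LSeries_dchar] at h3
  simp only [Complex.ofReal_zero, zero_mul, add_zero, abs_zero] at h3
  rw [DirichletCharacter.LFunction_eq_LSeries ψ (by simpa using hσ.1)]
  rwa [mul_rpow (Nat.cast_nonneg _) zero_le_two, mul_comm ((q : ℝ) ^ δ), ← mul_assoc] at h3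

section
open DirichletCharacter

theorem exists_pos_root_of_neg {q : ℕ} [NeZero q] {ψ : 𝓧 q} (hψ : ψ ≠ 1)
    (h2 : ψ ^ 2 = 1) {h₀ : ℝ} (h0 : 0 < h₀)
    (hneg : (LFunction ψ (2 - (1 + h₀ : ℝ))).re < 0) :
    ∃ h, 0 < h ∧ h ≤ h₀ ∧ (LFunction ψ (2 - (1 + h : ℝ))).re = 0 := by
  set V : ℝ → ℝ := fun u => (LFunction ψ (2 - u)).re with hV
  have hc : Continuous V := Complex.continuous_re.comp
    ((differentiable_LFunction hψ).continuous.comp (continuous_const.sub continuous_ofReal))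
  have hV0 : 0 ≤ V 0 := by
    have h1 := (coef_dchar hψ h2).sum 0 le_rfl (by norm_num)
    have h3 : HasSum (fun m => cf m (dchar ψ) * (0 : ℝ) ^ m) (cf 0 (dchar ψ)) := by
      have := hasSum_single (f := fun m => cf m (dchar ψ) * (0 : ℝ) ^ m) 0 (fun m hm => by
        rw [zero_pow hm, mul_zero])
      simpa using this
    have h4 : V 0 = cf 0 (dchar ψ) := h1.unique h3
    have hza := datum_zeta.abscissa_r
    have hzr : ∀ n, ((zeta : 𝓐) n).im = 0 := by intro n; rw [natCoe_apply, Complex.natCast_im]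
    have hfa := (coef_dchar hψ h2).abscissa
    have h5 := one_le_cf_zero (abscissa_mul_le_one hza hfa) (mul_im_eq_zero hzr (dchar_im h2))
      (fun n => (zeta_mul_dchar_nonneg h2 n).2) (mul_apply_one' zeta_one (dchar_one ψ))
    rw [cf_mul hza hfa hzr (dchar_im h2)] at h5
    simp only [Finset.Nat.antidiagonal_zero, sum_singleton] at h5
    have h6 : 0 ≤ cf 0 (zeta : 𝓐) := cf_nonneg hzr (fun n => by
      rw [natCoe_apply, Complex.natCast_re]; positivity) 0
    rw [h4]
    exact (pos_of_mul_pos_right (by linarith) h6).le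
  obtain ⟨u, hu, hu0⟩ := intermediate_value_Icc' (by positivity : (0 : ℝ) ≤ 1 + h₀)
    hc.continuousOn ⟨hneg.le, hV0⟩
  refine ⟨u - 1, ?_, by linarith [hu.2], by rw [add_sub_cancel]; exact hu0⟩
  by_contra hu1
  refine LFunction_ne_zero_of_one_le_re ψ (s := 2 - u) (Or.inl hψ) ?_ (Complex.ext hu0 ?_)
  · simp only [Complex.sub_re, Complex.re_ofNat, ofReal_re]
    linarith
  · exact LFunction_im hψ h2 u

theorem siegel (𝒞 : ∀ q : ℕ, Set (𝓧 q)) (h0 : ∀ q, ∀ ψ ∈ 𝒞 q, ψ ≠ 1 ∧ ψ ^ 2 = 1)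
    (hd : ∀ q q', ∀ ψ ∈ 𝒞 q, ∀ ψ' ∈ 𝒞 q', (⟨q, ψ⟩ : Σ q, 𝓧 q) ≠ ⟨q', ψ'⟩ →
      changeLevel (dvd_mul_right q q') ψ * changeLevel (dvd_mul_left q' q) ψ' ≠ 1)
    {δ : ℝ} (hδ : 0 < δ) : ∃ c : ℝ, 0 < c ∧ ∀ (q : ℕ) [NeZero q], ∀ ψ ∈ 𝒞 q,
      c * (q : ℝ) ^ (-δ) ≤ ‖LFunction ψ 1‖ := by
  obtain ⟨Z, hZ1, hZ⟩ := exists_le_of_zeta_mul_nonneg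
  obtain ⟨C, hC0, hC⟩ := exists_norm_LFunction_one_le (half_pos hδ)
  set h₀ : ℝ := min (1 / (8 * Z)) (δ / 12) with hh₀
  have hh0 : 0 < h₀ := by positivity
  have hhZ : h₀ ≤ 1 / (8 * Z) := min_le_left _ _
  have hhδ : h₀ ≤ δ / 12 := min_le_right _ _
  have h21 : (2 : ℂ) - ((1 : ℝ) : ℂ) = 1 := by norm_num
  by_cases hcase : ∀ (q : ℕ) [NeZero q], ∀ ψ ∈ 𝒞 q, 0 ≤ (LFunction ψ (2 - (1 + h₀ : ℝ))).re
  · refine ⟨h₀ / 4 * (142 * (22 * Z)) ^ (-(3 * h₀)), by positivity, fun q _ ψ hψ => ?_⟩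
    obtain ⟨hψ1, hψ2⟩ := h0 q ψ hψ
    have hq : (1 : ℝ) ≤ q := one_le_cast
    have h1 := hZ (dchar ψ) (22 * q) _ h₀ (by linarith) (coef_dchar hψ1 hψ2).weaken (dchar_one ψ)
      (fun n => (zeta_mul_dchar_nonneg hψ2 n).2) hh0 hhZ (hcase q ψ hψ)
    rw [h21] at h1
    refine le_trans ?_ (h1.trans ((le_abs_self _).trans (abs_re_le_norm _)))
    rw [show (142 : ℝ) * (22 * q * Z) = 142 * (22 * Z) * q by ring,
      mul_rpow (x := 142 * (22 * Z)) (y := q) (by positivity) (by positivity),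
      ← mul_assoc (h₀ / 4)]
    gcongr
    linarith
  · push Not at hcase
    obtain ⟨q₁, hq₁, ψ₁, hψ₁, hneg⟩ := hcase
    obtain ⟨hψ₁1, hψ₁2⟩ := h0 q₁ ψ₁ hψ₁
    obtain ⟨h, hh, hhle, hz⟩ := exists_pos_root_of_neg hψ₁1 hψ₁2 hh0 hneg
    have hq₁1 : (1 : ℝ) ≤ q₁ := one_le_cast
    have hL1 : 0 < ‖LFunction ψ₁ 1‖ := norm_pos_iff.2 (LFunction_apply_one_ne_zero hψ₁1)
    set K : ℝ := 142 * (21 * (22 * q₁ * (21 * (22 * (22 * q₁)))) * Z) with hK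
    have hK0 : 0 < K := by positivity
    set M : ℝ := ‖LFunction ψ₁ 1‖ * (C * (q₁ : ℝ) ^ (δ / 2)) with hM
    have hM0 : 0 < M := by positivity
    refine ⟨min ‖LFunction ψ₁ 1‖ (h / 4 * K ^ (-(3 * h)) / M), by positivity, fun q _ ψ hψ => ?_⟩
    obtain ⟨hψ1, hψ2⟩ := h0 q ψ hψ
    have hq : (1 : ℝ) ≤ q := one_le_cast
    by_cases he : (⟨q₁, ψ₁⟩ : Σ q, 𝓧 q) = ⟨q, ψ⟩
    · cases he
      calc _ ≤ ‖LFunction ψ₁ 1‖ * 1 := by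
            gcongr
            · exact min_le_left _ _
            · exact rpow_le_one_of_one_le_of_nonpos hq (by linarith)
        _ = _ := mul_one _
    · set ψ₃ := changeLevel (dvd_mul_right q₁ q) ψ₁ * changeLevel (dvd_mul_left q q₁) ψ with hψ₃
      have hψ₃1 : ψ₃ ≠ 1 := hd q₁ q ψ₁ hψ₁ ψ hψ he
      have hev : ∀ n, ev ψ₃ n = ev ψ₁ n * ev ψ n := ev_mul_changeLevel ψ₁ ψ
      have hψ₃2 : ψ₃ ^ 2 = 1 := by
        rw [hψ₃, mul_pow, ← map_pow, ← map_pow, hψ₁2, hψ2, map_one, map_one, one_mul]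
      have h1 := hZ (dchar ψ₁ * (dchar ψ * dchar ψ₃)) _ _ h (by
          push_cast
          have : (1 : ℝ) ≤ q₁ * q := one_le_mul_of_one_le_of_one_le hq₁1 hq
          have h5 : (1 : ℝ) ≤ 22 * q₁ := by linarith
          have h6 : (1 : ℝ) ≤ 22 * q * (22 * (q₁ * q)) :=
            one_le_mul_of_one_le_of_one_le (by linarith) (by linarith)
          have h7 : (1 : ℝ) ≤ (22 * q₁) * (21 * (22 * q * (22 * (q₁ * q)))) :=
            one_le_mul_of_one_le_of_one_le h5 (by linarith)
          linarith)
        ((coef_dchar hψ₁1 hψ₁2).mul ((coef_dchar hψ1 hψ2).mul (coef_dchar hψ₃1 hψ₃2).weaken))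
        (mul_apply_one' (dchar_one ψ₁) (mul_apply_one' (dchar_one ψ) (dchar_one ψ₃)))
        (fun n => (zeta_mul_dchar_mul_nonneg hψ₁2 hψ2 hev n).2) hh (hhle.trans hhZ)
        (by rw [hz, zero_mul])
      rw [h21] at h1
      have h2 : ‖LFunction ψ₃ 1‖ ≤ C * (q₁ : ℝ) ^ (δ / 2) * (q : ℝ) ^ (δ / 2) := by
        have := hC (q₁ * q) ψ₃ hψ₃1
        rwa [Nat.cast_mul, mul_rpow (by positivity) (by positivity), ← mul_assoc] at this
      have h3 : (LFunction ψ₁ 1).re * ((LFunction ψ 1).re * (LFunction ψ₃ 1).re) ≤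
          M * (q : ℝ) ^ (δ / 2) * ‖LFunction ψ 1‖ := by
        refine (le_abs_self _).trans ?_
        rw [abs_mul, abs_mul]
        calc _ ≤ ‖LFunction ψ₁ 1‖ * (‖LFunction ψ 1‖ *
              (C * (q₁ : ℝ) ^ (δ / 2) * (q : ℝ) ^ (δ / 2))) := by
              gcongr
              · exact abs_re_le_norm _
              · exact abs_re_le_norm _
              · exact (abs_re_le_norm _).trans h2
          _ = _ := by rw [hM]; ring
      have h4 : K ^ (-(3 * h)) * (q : ℝ) ^ (-(δ / 2)) ≤
          (142 * (21 * (22 * q₁ * (21 * (22 * q * (22 * ((q₁ * q : ℕ) : ℝ))))) * Z)) ^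
            (-(3 * h)) := by
        rw [show 142 * (21 * (22 * (q₁ : ℝ) * (21 * (22 * q * (22 * ((q₁ * q : ℕ) : ℝ))))) * Z) =
          K * (q : ℝ) ^ (2 : ℝ) by rw [hK, Real.rpow_two]; push_cast; ring,
          mul_rpow hK0.le (by positivity), ← rpow_mul (by positivity)]
        refine mul_le_mul_of_nonneg_left ?_ (by positivity)
        exact rpow_le_rpow_of_exponent_le hq (by linarith)
      have h5 : h / 4 * (K ^ (-(3 * h)) * (q : ℝ) ^ (-(δ / 2))) ≤
          M * (q : ℝ) ^ (δ / 2) * ‖LFunction ψ 1‖ :=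
        (mul_le_mul_of_nonneg_left h4 (by positivity)).trans (h1.trans h3)
      have h6 : (0 : ℝ) < (q : ℝ) ^ (δ / 2) := by positivity
      calc _ ≤ h / 4 * K ^ (-(3 * h)) / M * (q : ℝ) ^ (-δ) := by
            gcongr
            exact min_le_right _ _
        _ = h / 4 * (K ^ (-(3 * h)) * (q : ℝ) ^ (-(δ / 2))) / (M * (q : ℝ) ^ (δ / 2)) := by
            rw [show -δ = -(δ / 2) - δ / 2 by ring, Real.rpow_sub (by positivity)]
            field_simp
        _ ≤ _ := by
            rw [div_le_iff₀ (by positivity), mul_comm ‖LFunction ψ 1‖]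
            exact h5

end

section
open DirichletCharacter

theorem le_norm_LSeries_dchar_pow_four {q : ℕ} [NeZero q] (ψ : 𝓧 q)
    {σ t B : ℝ} (hσ : 1 < σ) (hσ2 : σ ≤ 2) (hB : 0 < B)
    (h2 : ‖LSeries (dchar (ψ ^ 2) ·) (σ + (2 * t : ℝ) * I)‖ ≤ B) :
    (8 * B)⁻¹ * (σ - 1) ^ 3 ≤ ‖LSeries (dchar ψ ·) (σ + t * I)‖ ^ 4 := by
  have h := norm_LSeries_product_ge_one ψ (sub_pos.2 hσ) t
  have e1 : (1 : ℂ) + ((σ - 1 : ℝ) : ℂ) = σ := by push_cast; ring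
  rw [e1, show (σ : ℂ) + 2 * I * t = σ + (2 * t : ℝ) * I by push_cast; ring,
    mul_comm I, norm_mul, norm_mul, norm_pow, norm_pow, ← LSeries_dchar, ← LSeries_dchar,
    ← LSeries_dchar] at h
  have h1 := norm_LSeries_dchar_le_two_div (1 : 𝓧 q) (s := σ) (ofReal_re σ) hσ hσ2
  have h3 : 1 ≤ (2 / (σ - 1)) ^ 3 * ‖LSeries (dchar ψ ·) (σ + t * I)‖ ^ 4 * B := by
    refine le_trans h ?_
    gcongr
  have h4 : 0 < σ - 1 := sub_pos.2 hσ
  have e2 : (2 / (σ - 1)) ^ 3 * ‖LSeries (dchar ψ ·) (σ + t * I)‖ ^ 4 * B =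
      ‖LSeries (dchar ψ ·) (σ + t * I)‖ ^ 4 / ((8 * B)⁻¹ * (σ - 1) ^ 3) := by
    field_simp
    ring
  rw [e2, one_le_div (by positivity)] at h3
  exact h3

theorem norm_LFunction_one_sub_le {q : ℕ} [NeZero q] {ψ : 𝓧 q} (hψ : ψ ≠ 1)
    {K : ℝ} (hK : ∀ σ t : ℝ, 1 < σ → σ ≤ 2 → |t| ≤ 1 →
      ‖LSeries (lg 1 (dchar ψ) ·) (σ + t * I)‖ ≤ K) {σ t : ℝ} (hσ : 1 < σ) (hσ2 : σ ≤ 2)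
    (ht : |t| ≤ 1) :
    ‖LFunction ψ 1 - LSeries (dchar ψ ·) (σ + t * I)‖ ≤ K * ((σ - 1) + |t|) := by
  have hK0 : 0 ≤ K := (norm_nonneg _).trans (hK σ t hσ hσ2 ht)
  set s : ℂ := σ + t * I with hs
  have h1 : Filter.Tendsto (fun η : ℝ => ‖LFunction ψ η - LSeries (dchar ψ ·) s‖)
      (nhdsWithin 1 (Set.Ioi 1)) (nhds ‖LFunction ψ 1 - LSeries (dchar ψ ·) s‖) := by
    have h2 : Continuous fun η : ℝ => ‖LFunction ψ η - LSeries (dchar ψ ·) s‖ :=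
      (((differentiable_LFunction hψ).continuous.comp continuous_ofReal).sub continuous_const).norm
    simpa using (h2.tendsto 1).mono_left nhdsWithin_le_nhds
  refine le_of_tendsto h1 ?_
  filter_upwards [Ioc_mem_nhdsGT hσ] with η hη
  have hη1 : 1 < η := hη.1
  have h3 := norm_LSeries_sub_le (abscissa_le_one_of_norm_le_dcount (dchar_norm_le ψ)) hK
    (s := s) (w := (η : ℂ)) (by simpa [hs] using hσ) (by simpa [hs] using hσ2)
    (by simpa [hs] using ht) (by simpa using hη1) (by simpa using hη.2.trans hσ2) (by simp)
  rw [LSeries_dchar ψ (η : ℂ), ← LFunction_eq_LSeries ψ (s := (η : ℂ)) (by simpa using hη1)] at h3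
  refine h3.trans (mul_le_mul_of_nonneg_left ?_ hK0)
  have e : (η : ℂ) - s = ((η - σ : ℝ) : ℂ) + ((-t : ℝ) : ℂ) * I := by rw [hs]; push_cast; ring
  rw [e]
  refine (norm_add_le _ _).trans ?_
  rw [norm_mul, Complex.norm_I, mul_one, norm_real, norm_real, norm_neg,
    norm_eq_abs, norm_eq_abs, abs_sub_comm, abs_of_nonneg (by linarith [hη.2])]
  linarith

theorem exists_lowerBound_dchar (𝒟 : ∀ q : ℕ, Set (𝓧 q)) (h1 : ∀ q, ∀ ψ ∈ 𝒟 q, ψ ≠ 1)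
    (hd : ∀ q q', ∀ ψ ∈ 𝒟 q, ∀ ψ' ∈ 𝒟 q', ψ ^ 2 = 1 → ψ' ^ 2 = 1 → (⟨q, ψ⟩ : Σ q, 𝓧 q) ≠ ⟨q', ψ'⟩ →
      changeLevel (dvd_mul_right q q') ψ * changeLevel (dvd_mul_left q' q) ψ' ≠ 1) :
    ∃ c : ℝ → ℝ, (∀ δ, 0 < δ → 0 < c δ) ∧ ∀ (q : ℕ) [NeZero q], ∀ ψ ∈ 𝒟 q,
      LowerBound c (dchar ψ) q := by
  have main : ∀ δ : ℝ, 0 < δ → ∃ c : ℝ, 0 < c ∧ ∀ (q : ℕ) [NeZero q], ∀ ψ ∈ 𝒟 q,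
      ∀ σ t : ℝ, 1 < σ → σ ≤ 2 → c * (q * (2 + |t|)) ^ (-δ) ≤
        ‖LSeries (dchar ψ ·) (σ + t * I)‖ := by
    intro δ' hδ'
    set δ := min (δ' / 7) 1 with hδdef
    have hδ : 0 < δ := by positivity
    have hδ1 : δ ≤ 1 := min_le_right _ _
    have hδ7 : 7 * δ ≤ δ' := by linarith [min_le_left (δ' / 7) 1]
    obtain ⟨b₀, hb₀, hS⟩ := siegel (fun q => {ψ | ψ ∈ 𝒟 q ∧ ψ ^ 2 = 1})
      (fun q ψ hψ => ⟨h1 q ψ hψ.1, hψ.2⟩)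
      (fun q q' ψ hψ ψ' hψ' => hd q q' ψ hψ.1 ψ' hψ'.1 hψ.2 hψ'.2) hδ
    obtain ⟨C₀, hC₀, hL0⟩ := exists_norm_LSeries_lg_le 0 hδ
    obtain ⟨C₁, hC₁, hL1⟩ := exists_norm_LSeries_lg_le 1 hδ
    obtain ⟨C₂, hC₂, hL2⟩ := exists_norm_LSeries_dchar_le hδ
    set b := min (1 / 2) (b₀ / (8 * C₁)) with hb
    have hb0 : 0 < b := by positivity
    set E := 2 * C₀ + 2 * C₂ * (1 + 1 / b) with hE
    have hE0 : 0 < E := by positivity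
    set c := ((8 * E)⁻¹) ^ (1 / 4 : ℝ) with hc
    have hc0 : 0 < c := by positivity
    have hc4 : c ^ 4 = (8 * E)⁻¹ := by
      rw [hc, ← rpow_natCast, ← rpow_mul (by positivity)]
      norm_num
    refine ⟨min (c / 2 * min 1 (c / (2 * C₁)) ^ 3) (min (b₀ / 2) (b / 2)), by positivity, ?_⟩
    intro q _ ψ hψ σ t hσ hσ2
    have hq : (1 : ℝ) ≤ q := one_le_cast
    have ht0 := abs_nonneg t
    set X : ℝ := q * (2 + |t|) with hX
    have hX1 : 1 ≤ X := one_le_conductor_mul hq t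
    have hqX : (q : ℝ) ≤ X := by rw [hX]; nlinarith
    have hX0 : 0 < X := by linarith
    set P : ℝ := X ^ (-δ) with hP
    have hP0 : 0 < P := by positivity
    have hP1 : P ≤ 1 := rpow_le_one_of_one_le_of_nonpos hX1 (by linarith)
    have hPinv : P⁻¹ = X ^ δ := by rw [hP, rpow_neg hX0.le, inv_inv]
    have hPpow : ∀ k : ℕ, P ^ k ≤ 1 := fun k => pow_le_one₀ hP0.le hP1
    have hX2 : (2 * X) ^ δ ≤ 2 * P⁻¹ := by
      rw [mul_rpow zero_le_two hX0.le, hPinv]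
      gcongr
      calc (2 : ℝ) ^ δ ≤ 2 ^ (1 : ℝ) := rpow_le_rpow_of_exponent_le (by norm_num) hδ1
        _ = 2 := rpow_one 2
    have hfin : X ^ (-δ') ≤ P ^ 7 := by
      rw [hP, ← rpow_natCast, ← rpow_mul hX0.le]
      exact rpow_le_rpow_of_exponent_le hX1 (by push_cast; linarith)
    have hψ1 := h1 q ψ hψ
    refine (mul_le_mul_of_nonneg_left hfin (by positivity)).trans ?_
    have huse : ∀ a k, (0 : ℝ) ≤ a → k ≤ 7 →
        min (c / 2 * min 1 (c / (2 * C₁)) ^ 3) (min (b₀ / 2) (b / 2)) ≤ a →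
        min (c / 2 * min 1 (c / (2 * C₁)) ^ 3) (min (b₀ / 2) (b / 2)) * P ^ 7 ≤ a * P ^ k :=
      fun a k ha hk h => mul_le_mul h (pow_le_pow_of_le_one hP0.le hP1 hk) (by positivity) ha
    by_cases hcase : ψ ^ 2 ≠ 1 ∨ b * P ^ 2 < |t|
    · have hup : ∀ σ : ℝ, 1 < σ → σ ≤ 2 →
          ‖LSeries (dchar (ψ ^ 2) ·) (σ + (2 * t : ℝ) * I)‖ ≤ E * P⁻¹ ^ 4 := by
        intro σ hσ hσ2
        have hle : (q * (2 + |2 * t|)) ^ δ ≤ 2 * P⁻¹ := by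
          refine le_trans (rpow_le_rpow (by positivity) ?_ hδ.le) hX2
          rw [abs_mul, abs_two, hX]
          nlinarith
        have hPi : 1 ≤ P⁻¹ := (one_le_inv₀ hP0).2 hP1
        by_cases hψ2 : ψ ^ 2 = 1
        · have ht : b * P ^ 2 < |t| := hcase.resolve_left (not_not.2 hψ2)
          have htpos : 0 < |t| := lt_trans (by positivity) ht
          have h3 := hL2 q (ψ ^ 2) σ (2 * t) hσ hσ2 (mul_ne_zero two_ne_zero (abs_pos.1 htpos))
          have h4 : 1 / |2 * t| ≤ 1 / b * P⁻¹ ^ 2 := by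
            rw [abs_mul, abs_two, inv_pow, ← one_div (P ^ 2), div_mul_div_comm, one_mul]
            exact one_div_le_one_div_of_le (by positivity) (by linarith)
          calc _ ≤ C₂ * (2 * P⁻¹) * (P⁻¹ ^ 2 + 1 / b * P⁻¹ ^ 2) := by
                refine h3.trans ?_
                gcongr
                exact one_le_pow₀ hPi
            _ = 2 * C₂ * (1 + 1 / b) * P⁻¹ ^ 3 := by ring
            _ ≤ E * P⁻¹ ^ 4 := by
                gcongr
                · rw [hE]; linarith
                · norm_num
        · have h3 := hL0 (dchar (ψ ^ 2)) q (dchar_norm_le _) hq (norm_sum_dchar_le hψ2) σ (2 * t)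
            hσ hσ2
          rw [lg_zero] at h3
          calc _ ≤ C₀ * (2 * P⁻¹) := by
                refine h3.trans ?_
                gcongr
            _ = 2 * C₀ * P⁻¹ ^ 1 := by ring
            _ ≤ E * P⁻¹ ^ 4 := by
                gcongr
                · rw [hE]
                  have : 0 ≤ 2 * C₂ * (1 + 1 / b) := by positivity
                  linarith
                · norm_num
      refine (huse _ 7 (by positivity) le_rfl (min_le_left _ _)).trans ?_
      refine le_norm_LSeries_of_pow_four (abscissa_le_one_of_norm_le_dcount (dchar_norm_le ψ))
        hc0 hC₁ hP0 hP1 (fun σ hσ hσ2 => ?_) (fun σ hσ hσ2 => ?_) hσ hσ2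
      · rw [hPinv]
        exact hL1 (dchar ψ) q (dchar_norm_le _) hq (norm_sum_dchar_le hψ1) σ t hσ hσ2
      · have := le_norm_LSeries_dchar_pow_four ψ hσ hσ2 (by positivity) (hup σ hσ hσ2)
        refine le_trans (le_of_eq ?_) this
        rw [hc4, inv_pow]
        field_simp
    · push Not at hcase
      obtain ⟨hψ2, ht⟩ := hcase
      by_cases hσb : σ - 1 ≤ b * P ^ 2
      · have hP2 := hPpow 2
        have hb2 : b ≤ 1 / 2 := min_le_left _ _
        have hb3 : b * (8 * C₁) ≤ b₀ := by
          rw [← le_div_iff₀ (by positivity)]; exact min_le_right _ _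
        have hbP : b * P ^ 2 ≤ 1 / 2 :=
          (mul_le_mul hb2 hP2 (by positivity) (by norm_num)).trans (by norm_num)
        have h3 := norm_LFunction_one_sub_le hψ1 (K := C₁ * (2 * P⁻¹)) (fun σ t hσ hσ2 ht' => by
          refine (hL1 (dchar ψ) q (dchar_norm_le _) hq (norm_sum_dchar_le hψ1) σ t hσ hσ2).trans ?_
          have : ((q : ℝ) * (2 + |t|)) ^ δ ≤ (2 * X) ^ δ := by
            refine rpow_le_rpow (by positivity) ?_ hδ.le
            rw [hX]
            nlinarith
          gcongr
          exact this.trans hX2) hσ hσ2 (ht.trans (by linarith))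
        have h4 : b₀ * P ≤ ‖LFunction ψ 1‖ := by
          refine le_trans ?_ (hS q ψ ⟨hψ, hψ2⟩)
          gcongr
          exact rpow_le_rpow_of_nonpos (by linarith) hqX (by linarith)
        have h5 : C₁ * (2 * P⁻¹) * ((σ - 1) + |t|) ≤ b₀ / 2 * P := by
          calc _ ≤ C₁ * (2 * P⁻¹) * (b * P ^ 2 + b * P ^ 2) := by gcongr
            _ = b * (8 * C₁) / 2 * P := by field_simp; ring
            _ ≤ _ := by gcongr
        have h6 := norm_sub_norm_le (LFunction ψ 1) (LSeries (dchar ψ ·) (σ + t * I))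
        refine (huse (b₀ / 2) 1 (by positivity) (by norm_num)
          ((min_le_right _ _).trans (min_le_left _ _))).trans ?_
        rw [pow_one]
        linarith
      · push Not at hσb
        have h3 := one_le_norm_LSeries_mul ψ (s := σ + t * I) (σ := σ) (by simp) hσ hσ2
        refine (huse (b / 2) 2 (by positivity) (by norm_num)
          ((min_le_right _ _).trans (min_le_right _ _))).trans ?_
        have h4 : 0 < σ - 1 := by linarith
        rw [mul_div_assoc', le_div_iff₀ h4] at h3
        linarith
  refine ⟨fun δ => if h : 0 < δ then (main δ h).choose else 1, fun δ hδ => ?_, ?_⟩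
  · simp only [hδ, dif_pos]
    exact (main δ hδ).choose_spec.1
  · intro q _ ψ hψ δ hδ
    simp only [hδ, dif_pos]
    exact (main δ hδ).choose_spec.2 q ψ hψ

end

section
open DirichletCharacter

/-- A datum all of whose twists by primitive characters of odd conductor (by nonprincipal ones, if
`e` holds) have small partial sums and L-series bounded from below. -/
structure Admissible (e : Prop) (c : ℝ → ℝ) (H : ℝ) (r μ' Λ' : 𝓐) : Prop where
  datum : Datum r μ' Λ'
  one_le : 1 ≤ H
  bound : ∀ (q : ℕ) [NeZero q] (χ : 𝓧 q), Odd q → χ.IsPrimitive →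
    (e → q ≠ 1) → ∀ N : ℕ, ‖∑ n ∈ Ioc 0 N, tw (ev χ) r n‖ ≤ H * q ^ 2 * √N
  lower : ∀ (q : ℕ) [NeZero q] (χ : 𝓧 q), Odd q → χ.IsPrimitive →
    (e → q ≠ 1) → LowerBound c (tw (ev χ) r) (H * q ^ 2)

theorem LowerBound.mono {c : ℝ → ℝ} (hc : ∀ δ, 0 < δ → 0 < c δ) {r : 𝓐}
    {H H' : ℝ} (hH : 1 ≤ H) (hHH : H ≤ H') (h : LowerBound c r H) : LowerBound c r H' := by
  intro δ hδ σ t hσ hσ2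
  refine le_trans ?_ (h δ hδ σ t hσ hσ2)
  have := abs_nonneg t
  refine mul_le_mul_of_nonneg_left ?_ (hc δ hδ).le
  refine rpow_le_rpow_of_nonpos (by positivity) ?_ (by linarith)
  gcongr

theorem eq_of_mul_eq_one_of_sq_eq_one {G : Type*} [CommGroup G] {a b : G} (h : a * b = 1)
    (hb : b ^ 2 = 1) : a = b := by
  have h1 : a * b = b * b := by rw [h, ← sq, hb]
  exact mul_right_cancel h1

theorem exists_admissible_zeta : ∃ c : ℝ → ℝ, (∀ δ, 0 < δ → 0 < c δ) ∧
    Admissible True c 1 zeta moebius mangoldtC := by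
  obtain ⟨c, hc, h⟩ := exists_lowerBound_dchar
    (fun q => {ψ | q ≠ 0 ∧ q ≠ 1 ∧ ψ.IsPrimitive}) (fun q ψ hψ => by
      rintro rfl
      obtain ⟨h0, h1, h2⟩ := hψ
      have : NeZero q := ⟨h0⟩
      rw [IsPrimitive, conductor_one] at h2
      exact h1 h2.symm) (fun q q' ψ hψ ψ' hψ' _ h2 hne h => by
      have : NeZero q := ⟨hψ.1⟩
      have : NeZero q' := ⟨hψ'.1⟩
      exact changeLevel_primitive_ne hψ.2.2 hψ'.2.2 hne
        (eq_of_mul_eq_one_of_sq_eq_one h (by rw [← map_pow, h2, map_one])))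
  refine ⟨c, hc, datum_zeta, le_rfl, fun q _ χ _ hχ hq N => ?_, fun q _ χ _ hχ hq => ?_⟩
  · have hχ1 : χ ≠ 1 := by
      rintro rfl
      rw [IsPrimitive, conductor_one] at hχ
      exact hq trivial hχ.symm
    refine (norm_sum_dchar_le hχ1 N).trans ?_
    have : (1 : ℝ) ≤ q := one_le_cast
    gcongr
    nlinarith
  · refine (h q χ ⟨NeZero.ne q, hq trivial, hχ⟩).mono hc one_le_cast ?_
    have : (1 : ℝ) ≤ q := one_le_cast
    nlinarith

/-- The nonprincipal character modulo `4`. -/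
def chi4 : 𝓧 4 := ZMod.χ₄.ringHomComp (Int.castRingHom ℂ)

theorem ev_chi4 (n : ℕ) : ev chi4 n = (ZMod.χ₄ n : ℤ) := rfl

/-- The character `χ χ₄`. -/
def mulChi4 {q : ℕ} (χ : 𝓧 q) : 𝓧 (q * 4) :=
  changeLevel (dvd_mul_right q 4) χ * changeLevel (dvd_mul_left 4 q) chi4

theorem tw_dchar_chi4 {q : ℕ} (χ : 𝓧 q) : tw (ev χ) (dchar chi4) = dchar (mulChi4 χ) := by
  ext n
  rw [dchar, dchar, tw_apply, tw_apply, tw_apply, mulChi4, ev_mul_changeLevel]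
  ring

theorem mulChi4_ne_one {q : ℕ} (hq : Odd q) (χ : 𝓧 q) : mulChi4 χ ≠ 1 := by
  intro h
  have h1 : ev (mulChi4 χ) (2 * q + 1) = -1 := by
    rw [mulChi4, ev_mul_changeLevel, ev_chi4, ZMod.χ₄_nat_three_mod_four, ev]
    · simp
    · obtain ⟨k, rfl⟩ := hq
      omega
  rw [h, ev] at h1
  by_cases hu : IsUnit ((2 * q + 1 : ℕ) : ZMod (q * 4))
  · rw [MulChar.one_apply hu] at h1
    norm_num at h1
  · rw [MulChar.map_nonunit _ hu] at h1
    norm_num at h1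

theorem exists_admissible_chi4 : ∃ c : ℝ → ℝ, (∀ δ, 0 < δ → 0 < c δ) ∧
    Admissible False c 4 (dchar chi4) (tw (ev chi4) moebius) (tw (ev chi4) mangoldtC) := by
  obtain ⟨c, hc, h⟩ := exists_lowerBound_dchar
    (fun m => {ψ | ∃ (q : ℕ) (χ : 𝓧 q), Odd q ∧ χ.IsPrimitive ∧
      (⟨m, ψ⟩ : Σ q, 𝓧 q) = ⟨q * 4, mulChi4 χ⟩}) (by
      rintro m ψ ⟨q, χ, hq, hχ, he⟩
      cases he
      exact mulChi4_ne_one hq χ) (by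
      rintro m m' ψ ⟨q, χ, hq, hχ, he⟩ ψ' ⟨q', χ', hq', hχ', he'⟩ h2 h2' hne h
      cases he
      cases he'
      have : NeZero q := ⟨hq.pos.ne'⟩
      have : NeZero q' := ⟨hq'.pos.ne'⟩
      have : NeZero (q * 4 * (q' * 4)) := ⟨mul_ne_zero (mul_ne_zero (NeZero.ne q) (by norm_num))
        (mul_ne_zero (NeZero.ne q') (by norm_num))⟩
      refine changeLevel_primitive_ne hχ hχ' (fun he => hne (by cases he; rfl)) ?_
      have h3 := eq_of_mul_eq_one_of_sq_eq_one h (by rw [← map_pow, h2', map_one])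
      have hd : q * q' ∣ q * 4 * (q' * 4) := ⟨16, by ring⟩
      refine changeLevel_injective hd ?_
      rw [mulChi4, mulChi4, map_mul, map_mul, ← changeLevel_trans, ← changeLevel_trans,
        ← changeLevel_trans, ← changeLevel_trans] at h3
      rw [← changeLevel_trans, ← changeLevel_trans]
      exact mul_right_cancel h3)
  have key : ∀ (q : ℕ) [NeZero q] (N : ℕ), ((q * 4 : ℕ) : ℝ) ≤ 4 * q ^ 2 := by
    intro q _ N
    have : (1 : ℝ) ≤ q := one_le_cast
    push_cast
    nlinarith
  refine ⟨c, hc, datum_zeta.twist (isCM_ev chi4), by norm_num, fun q _ χ hq hχ _ N => ?_,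
    fun q _ χ hq hχ _ => ?_⟩
  · have : NeZero (q * 4) := ⟨mul_ne_zero (NeZero.ne q) (by norm_num)⟩
    rw [tw_dchar_chi4]
    refine (norm_sum_dchar_le (mulChi4_ne_one hq χ) N).trans ?_
    exact mul_le_mul_of_nonneg_right (key q N) (sqrt_nonneg _)
  · have : NeZero (q * 4) := ⟨mul_ne_zero (NeZero.ne q) (by norm_num)⟩
    rw [tw_dchar_chi4]
    exact (h (q * 4) (mulChi4 χ) ⟨q, χ, hq, hχ, rfl⟩).mono hc one_le_cast (key q 0)

end

/-- The completely multiplicative function with given values at primes. -/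
def cmExt (h : ℕ → ℂ) (n : ℕ) : ℂ := if n = 0 then 0 else (n.primeFactorsList.map h).prod

theorem cmExt_prime (h : ℕ → ℂ) {p : ℕ} (hp : p.Prime) : cmExt h p = h p := by
  simp [cmExt, hp.ne_zero, Nat.primeFactorsList_prime hp]

theorem isCM_cmExt {h : ℕ → ℂ} (hh : ∀ p, p.Prime → ‖h p‖ ≤ 1) : IsCM (cmExt h) where
  one := by simp [cmExt]
  mul m n := by
    rcases eq_or_ne m 0 with rfl | hm
    · simp [cmExt]
    rcases eq_or_ne n 0 with rfl | hn
    · simp [cmExt]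
    rw [cmExt, cmExt, cmExt, if_neg hm, if_neg hn, if_neg (mul_ne_zero hm hn),
      ((Nat.perm_primeFactorsList_mul hm hn).map h).prod_eq, List.map_append, List.prod_append]
  norm_le n := by
    rw [cmExt]
    split_ifs with h0
    · simp
    · have : ∀ l : List ℕ, (∀ p ∈ l, p.Prime) → ‖(l.map h).prod‖ ≤ 1 := by
        intro l
        induction l with
        | nil => simp
        | cons p l ih =>
          intro hl
          rw [List.map_cons, List.prod_cons, norm_mul]
          exact mul_le_one₀ (hh p (hl p (by simp))) (norm_nonneg _)
            (ih fun a ha => hl a (List.mem_cons_of_mem _ ha))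
      exact this _ fun p hp => Nat.prime_of_mem_primeFactorsList hp

/-- The `4k`-th power of the direction of a complex number. -/
def ang (k : ℕ) (z : ℂ) : ℂ := (z / (‖z‖ : ℂ)) ^ (4 * k)

theorem ang_mul (k : ℕ) (z w : ℂ) : ang k (z * w) = ang k z * ang k w := by
  rw [ang, ang, ang, norm_mul, ← mul_pow, ofReal_mul, mul_div_mul_comm]

theorem norm_ang_le (k : ℕ) (z : ℂ) : ‖ang k z‖ ≤ 1 := by
  rw [ang, norm_pow, norm_div, norm_real, norm_norm]
  exact pow_le_one₀ (by positivity) (div_self_le_one _)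

theorem ang_natCast (k : ℕ) {n : ℕ} (hn : n ≠ 0) : ang k n = 1 := by
  rw [ang, norm_natCast, Complex.ofReal_natCast, div_self (by exact_mod_cast hn), one_pow]

theorem ang_conj (k : ℕ) (z : ℂ) : ang k (conj z) = conj (ang k z) := by simp [ang]

theorem ang_mul_conj (k : ℕ) {z : ℂ} (hz : z ≠ 0) : ang k z * conj (ang k z) = 1 := by
  have : (‖ang k z‖ : ℂ) = 1 := by
    rw [ang, norm_pow, norm_div, norm_real, norm_norm, div_self (norm_ne_zero_iff.2 hz)]
    simp
  rw [Complex.mul_conj', this, one_pow]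

theorem exists_norm_eq {p : ℕ} (hp : p.Prime) (h : p % 4 ≠ 3) : ∃ w : GaussianInt, w.norm = p := by
  have := Fact.mk hp
  obtain ⟨a, b, hab⟩ := Nat.Prime.sq_add_sq h
  refine ⟨⟨a, b⟩, ?_⟩
  rw [Zsqrtd.norm_def, ← hab]
  push_cast
  ring

open Classical in
/-- A Gaussian integer of norm `p`, if there is one. -/
def gp (p : ℕ) : GaussianInt := if h : ∃ w : GaussianInt, w.norm = p then h.choose else 0

theorem norm_gp {p : ℕ} (hp : p.Prime) (h : p % 4 ≠ 3) : (gp p).norm = p := by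
  rw [gp, dif_pos (exists_norm_eq hp h)]
  exact (exists_norm_eq hp h).choose_spec

/-- The two completely multiplicative functions whose Dirichlet convolution is the coefficient
function of the Hecke `L`-function with angular character of frequency `4k`. -/
def gA (k : ℕ) : ℕ → ℂ := cmExt fun p => if p % 4 = 3 then 1 else ang k (gp p)

def gB (k : ℕ) : ℕ → ℂ :=
  cmExt fun p => if p % 4 = 3 then -1 else if p = 2 then 0 else conj (ang k (gp p))

theorem isCM_gA (k : ℕ) : IsCM (gA k) := isCM_cmExt fun p _ => by
  split_ifs
  · simp
  · exact norm_ang_le _ _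

theorem isCM_gB (k : ℕ) : IsCM (gB k) := isCM_cmExt fun p _ => by
  split_ifs
  · simp
  · simp
  · rw [RCLike.norm_conj]
    exact norm_ang_le _ _

/-- Coefficients of the angular Hecke `L`-function. -/
def rG (k : ℕ) : 𝓐 := tw (gA k) zeta * tw (gB k) zeta

theorem conv_recursion {A B : ℕ → ℂ} (hA : IsCM A) (hB : IsCM B) {p : ℕ} (hp : p.Prime) {n : ℕ}
    (hn : n ≠ 0) : ((tw A zeta * tw B zeta : 𝓐)) (p * n) =
      (A p + B p) * (tw A zeta * tw B zeta : 𝓐) n -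
        if p ∣ n then A p * B p * (tw A zeta * tw B zeta : 𝓐) (n / p) else 0 := by
  have hp0 := hp.ne_zero
  have hz : ∀ m : ℕ, m ≠ 0 → ∀ F : ℕ → ℂ, tw F zeta m = F m := by
    intro m hm F
    simp [tw_apply, natCoe_apply, zeta_apply, hm]
  have key : ∀ m : ℕ, m ≠ 0 → (tw A zeta * tw B zeta : 𝓐) m =
      ∑ x ∈ m.divisorsAntidiagonal, A x.1 * B x.2 := by
    intro m hm
    rw [ArithmeticFunction.mul_apply]
    refine sum_congr rfl fun x hx => ?_
    obtain ⟨hx1, hx2⟩ := Nat.mem_divisorsAntidiagonal.1 hx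
    rw [hz _ (by rintro h; simp [h] at hx1; omega), hz _ (by rintro h; simp [h] at hx1; omega)]
  rw [key _ (mul_ne_zero hp0 hn), key _ hn]
  set T := (p * n).divisorsAntidiagonal with hT
  have hmem : ∀ x : ℕ × ℕ, x ∈ T ↔ x.1 * x.2 = p * n := by
    intro x
    rw [hT, Nat.mem_divisorsAntidiagonal]
    simp [hp0, hn]
  have h1 : ∑ x ∈ T with p ∣ x.1, A x.1 * B x.2 =
      A p * ∑ x ∈ n.divisorsAntidiagonal, A x.1 * B x.2 := by
    rw [mul_sum]
    refine sum_bij' (fun x _ => (x.1 / p, x.2)) (fun x _ => (p * x.1, x.2)) ?_ ?_ ?_ ?_ ?_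
    · intro x hx
      obtain ⟨hx1, hx2⟩ := mem_filter.1 hx
      obtain ⟨d, hd⟩ := hx2
      have := (hmem x).1 hx1
      rw [Nat.mem_divisorsAntidiagonal]
      refine ⟨?_, hn⟩
      rw [hd, mul_assoc] at this
      simpa [hd, hp.pos] using Nat.eq_of_mul_eq_mul_left hp.pos this
    · intro x hx
      obtain ⟨hx1, hx2⟩ := Nat.mem_divisorsAntidiagonal.1 hx
      simp only [mem_filter, hmem, dvd_mul_right, and_true, mul_assoc, hx1]
    · intro x hx
      obtain ⟨hx1, hx2⟩ := mem_filter.1 hx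
      simp [Nat.mul_div_cancel' hx2]
    · intro x hx
      simp [hp.pos]
    · intro x hx
      obtain ⟨hx1, hx2⟩ := mem_filter.1 hx
      obtain ⟨d, hd⟩ := hx2
      simp only [hd, Nat.mul_div_cancel_left _ hp.pos, hA.mul]
      ring
  have h2 : ∑ x ∈ T with p ∣ x.2, A x.1 * B x.2 =
      B p * ∑ x ∈ n.divisorsAntidiagonal, A x.1 * B x.2 := by
    rw [mul_sum]
    refine sum_bij' (fun x _ => (x.1, x.2 / p)) (fun x _ => (x.1, p * x.2)) ?_ ?_ ?_ ?_ ?_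
    · intro x hx
      obtain ⟨hx1, hx2⟩ := mem_filter.1 hx
      obtain ⟨d, hd⟩ := hx2
      have := (hmem x).1 hx1
      rw [Nat.mem_divisorsAntidiagonal]
      refine ⟨?_, hn⟩
      rw [hd, mul_left_comm] at this
      simpa [hd, hp.pos] using Nat.eq_of_mul_eq_mul_left hp.pos this
    · intro x hx
      obtain ⟨hx1, hx2⟩ := Nat.mem_divisorsAntidiagonal.1 hx
      simp only [mem_filter, hmem, dvd_mul_right, and_true, mul_left_comm, hx1]
    · intro x hx
      obtain ⟨hx1, hx2⟩ := mem_filter.1 hx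
      simp [Nat.mul_div_cancel' hx2]
    · intro x hx
      simp [hp.pos]
    · intro x hx
      obtain ⟨hx1, hx2⟩ := mem_filter.1 hx
      obtain ⟨d, hd⟩ := hx2
      simp only [hd, Nat.mul_div_cancel_left _ hp.pos, hB.mul]
      ring
  have h3 : ∑ x ∈ T with (p ∣ x.1 ∧ p ∣ x.2), A x.1 * B x.2 =
      if p ∣ n then A p * B p * (tw A zeta * tw B zeta : 𝓐) (n / p) else 0 := by
    split_ifs with hpn
    · obtain ⟨m, rfl⟩ := hpn
      have hm : m ≠ 0 := right_ne_zero_of_mul hn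
      rw [Nat.mul_div_cancel_left _ hp.pos, key m hm, mul_sum]
      refine sum_bij' (fun x _ => (x.1 / p, x.2 / p)) (fun x _ => (p * x.1, p * x.2)) ?_ ?_ ?_ ?_ ?_
      · intro x hx
        obtain ⟨hx1, ⟨d, hd⟩, ⟨e, he⟩⟩ := mem_filter.1 hx
        have := (hmem x).1 hx1
        rw [Nat.mem_divisorsAntidiagonal]
        refine ⟨?_, hm⟩
        have h5 : p * (p * (d * e)) = p * (p * m) := by rw [← this, hd, he]; ring
        simpa [hd, he, hp.pos] using Nat.eq_of_mul_eq_mul_left hp.pos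
          (Nat.eq_of_mul_eq_mul_left hp.pos h5)
      · intro x hx
        obtain ⟨hx1, hx2⟩ := Nat.mem_divisorsAntidiagonal.1 hx
        simp only [mem_filter, hmem, dvd_mul_right, and_true, ← hx1]
        ring
      · intro x hx
        obtain ⟨hx1, hx2, hx3⟩ := mem_filter.1 hx
        simp [Nat.mul_div_cancel' hx2, Nat.mul_div_cancel' hx3]
      · intro x hx
        simp [hp.pos]
      · intro x hx
        obtain ⟨hx1, ⟨d, hd⟩, ⟨e, he⟩⟩ := mem_filter.1 hx
        simp only [hd, he, Nat.mul_div_cancel_left _ hp.pos, hA.mul, hB.mul]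
        ring
    · refine sum_eq_zero fun x hx => ?_
      obtain ⟨hx1, ⟨d, hd⟩, ⟨e, he⟩⟩ := mem_filter.1 hx
      have := (hmem x).1 hx1
      rw [hd, he, mul_assoc] at this
      exact absurd ⟨d * e, by rw [← Nat.eq_of_mul_eq_mul_left hp.pos this]; ring⟩ hpn
  have h4 : ∀ x ∈ T, A x.1 * B x.2 = (if p ∣ x.1 then A x.1 * B x.2 else 0) +
      (if p ∣ x.2 then A x.1 * B x.2 else 0) -
      (if p ∣ x.1 ∧ p ∣ x.2 then A x.1 * B x.2 else 0) := by
    intro x hx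
    have h5 : p ∣ x.1 ∨ p ∣ x.2 := hp.dvd_mul.1 ((hmem x).1 hx ▸ dvd_mul_right p n)
    by_cases ha : p ∣ x.1 <;> by_cases hb : p ∣ x.2 <;> simp_all
  rw [sum_congr rfl h4, sum_sub_distrib, sum_add_distrib, ← sum_filter, ← sum_filter,
    ← sum_filter, h1, h2, h3]
  ring

/-- The Gaussian integers of norm `n`. -/
def circ (n : ℕ) : Finset GaussianInt :=
  ((Icc (-(n : ℤ)) n ×ˢ Icc (-(n : ℤ)) n).image fun x => (⟨x.1, x.2⟩ : GaussianInt)).filter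
    fun w => w.norm = n

theorem sq_add_sq_eq_norm (w : GaussianInt) : w.re ^ 2 + w.im ^ 2 = w.norm := by
  rw [Zsqrtd.norm_def]; ring

theorem mem_circ {n : ℕ} {w : GaussianInt} : w ∈ circ n ↔ w.norm = n := by
  simp only [circ, mem_filter, mem_image, mem_product, mem_Icc, and_iff_right_iff_imp]
  intro h
  have h1 := sq_add_sq_eq_norm w
  rw [h] at h1
  have key : ∀ a b : ℤ, a ^ 2 + b ^ 2 = n → -(n : ℤ) ≤ a ∧ a ≤ n := by
    intro a b hab
    rw [← abs_le]
    have h2 : |a| ≤ |a| ^ 2 := by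
      rcases eq_or_ne a 0 with rfl | ha
      · simp
      · have : 1 ≤ |a| := Int.one_le_abs ha
        nlinarith
    rw [sq_abs] at h2
    nlinarith [sq_nonneg b]
  exact ⟨(w.re, w.im), ⟨key _ _ h1, key _ _ ((add_comm _ _).trans h1)⟩, rfl⟩

/-- The sum of the angular character over the Gaussian integers of norm `n`. -/
def circSum (k n : ℕ) : ℂ := ∑ w ∈ circ n, ang k w

open Classical in
theorem sum_circ_dvd {k n P : ℕ} (hP : P ≠ 0) {z : GaussianInt} (hz : z.norm = P) :
    ∑ w ∈ circ (P * n) with z ∣ w, ang k w = ang k z * circSum k n := by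
  have hz0 : z ≠ 0 := by
    rintro rfl
    simp at hz
    omega
  have : (circ (P * n)).filter (z ∣ ·) = (circ n).image (z * ·) := by
    ext w
    simp only [mem_filter, mem_circ, mem_image]
    constructor
    · rintro ⟨h1, v, rfl⟩
      refine ⟨v, ?_, rfl⟩
      rw [Zsqrtd.norm_mul, hz, Nat.cast_mul] at h1
      exact mul_left_cancel₀ (by exact_mod_cast hP) h1
    · rintro ⟨v, hv, rfl⟩
      exact ⟨by rw [Zsqrtd.norm_mul, hz, hv, Nat.cast_mul], dvd_mul_right _ _⟩
  rw [this, sum_image fun a _ b _ h => mul_left_cancel₀ hz0 h, circSum, mul_sum]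
  refine sum_congr rfl fun w _ => ?_
  rw [GaussianInt.toComplex_mul, ang_mul]

open Classical in
theorem sum_circ_natCast_dvd {k n p : ℕ} (hp : p.Prime) :
    ∑ w ∈ circ (p * n) with (p : GaussianInt) ∣ w, ang k w =
      if p ∣ n then circSum k (n / p) else 0 := by
  split_ifs with h
  · obtain ⟨m, rfl⟩ := h
    rw [Nat.mul_div_cancel_left _ hp.pos, ← mul_assoc,
      sum_circ_dvd (mul_ne_zero hp.ne_zero hp.ne_zero) (by simp [Zsqrtd.norm_natCast])]
    simp [ang_natCast k hp.ne_zero]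
  · refine sum_eq_zero fun w hw => absurd ?_ h
    obtain ⟨h1, v, rfl⟩ := mem_filter.1 hw
    rw [mem_circ, Zsqrtd.norm_mul, Zsqrtd.norm_natCast, Nat.cast_mul, mul_assoc] at h1
    have h2 := mul_left_cancel₀ (by exact_mod_cast hp.ne_zero) h1
    exact Int.natCast_dvd_natCast.1 ⟨_, h2.symm⟩

theorem prime_of_norm_prime {z : GaussianInt} {p : ℕ} (hp : p.Prime) (hz : z.norm = p) :
    Prime z := by
  refine Irreducible.prime ⟨fun h => ?_, fun a b hab => ?_⟩
  · rw [← Zsqrtd.norm_eq_one_iff, hz] at h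
    exact hp.ne_one (by simpa using h)
  · rw [hab, Zsqrtd.norm_mul] at hz
    rw [← Zsqrtd.norm_eq_one_iff, ← Zsqrtd.norm_eq_one_iff]
    have h1 : a.norm.natAbs * b.norm.natAbs = p := by rw [← Int.natAbs_mul, hz, Int.natAbs_natCast]
    rcases hp.eq_one_or_self_of_dvd _ ⟨_, h1.symm⟩ with h | h
    · exact Or.inl h
    · right
      rw [h] at h1
      exact Nat.eq_of_mul_eq_mul_left hp.pos (h1.trans (mul_one p).symm)

theorem star_dvd_star {a b : GaussianInt} (h : a ∣ b) : star a ∣ star b := by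
  obtain ⟨c, rfl⟩ := h
  exact ⟨star c, by rw [star_mul, mul_comm]⟩

open Classical in
theorem circSum_recursion_aux {k n p : ℕ} (hp : p.Prime) (h3 : p % 4 ≠ 3) (h2 : p ≠ 2) :
    circSum k (p * n) = (ang k (gp p) + conj (ang k (gp p))) * circSum k n -
      if p ∣ n then circSum k (n / p) else 0 := by
  have hz := norm_gp hp h3
  set z := gp p
  have hz' : (star z).norm = p := by rw [Zsqrtd.norm_conj, hz]
  have hzz : (p : GaussianInt) = z * star z := by
    have := Zsqrtd.norm_eq_mul_conj z
    rw [hz] at this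
    exact_mod_cast this
  have hpr := prime_of_norm_prime hp hz
  have hpr' := prime_of_norm_prime hp hz'
  have hnd : ¬ star z ∣ z := by
    intro h
    have h4 : star z ∣ ((2 * z.re : ℤ) : GaussianInt) := by
      have : ((2 * z.re : ℤ) : GaussianInt) = z + star z := by ext <;> simp; ring
      rw [this]
      exact dvd_add h dvd_rfl
    obtain ⟨v, hv⟩ := h4
    have h5 := congrArg Zsqrtd.norm hv
    rw [Zsqrtd.norm_mul, hz', Zsqrtd.norm_intCast] at h5
    have h6 : (p : ℤ) ∣ (2 * z.re) * (2 * z.re) := ⟨_, h5⟩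
    have hpp : Prime (p : ℤ) := Nat.prime_iff_prime_int.1 hp
    have h7 : (p : ℤ) ∣ z.re := by
      have h8 : (p : ℤ) ∣ 2 * z.re := (hpp.dvd_or_dvd h6).elim id id
      refine (hpp.dvd_or_dvd h8).resolve_left fun h9 => h2 ?_
      exact (Nat.prime_dvd_prime_iff_eq hp Nat.prime_two).1 (by exact_mod_cast h9)
    have h8 := sq_add_sq_eq_norm z
    rw [hz] at h8
    have h9 : (p : ℤ) ∣ z.im := by
      refine hpp.dvd_of_dvd_pow (n := 2) ?_
      rw [eq_sub_of_add_eq' h8]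
      exact dvd_sub dvd_rfl (h7.trans (dvd_pow_self _ two_ne_zero))
    obtain ⟨a, ha⟩ := h7
    obtain ⟨b, hb⟩ := h9
    rw [ha, hb] at h8
    have h10 : (p : ℤ) * (p * (a ^ 2 + b ^ 2)) = p * 1 := by linarith
    have h11 := mul_left_cancel₀ hpp.ne_zero h10
    exact hpp.not_isUnit (isUnit_of_dvd_one ⟨_, h11.symm⟩)
  have hor : ∀ w ∈ circ (p * n), z ∣ w ∨ star z ∣ w := by
    intro w hw
    rw [mem_circ] at hw
    have : z ∣ w * star w := by
      rw [← Zsqrtd.norm_eq_mul_conj w, hw]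
      push_cast
      rw [hzz, mul_assoc]
      exact dvd_mul_right _ _
    rcases hpr.dvd_or_dvd this with h | h
    · exact Or.inl h
    · right
      simpa using star_dvd_star h
  have hand : ∀ w, (z ∣ w ∧ star z ∣ w) ↔ (p : GaussianInt) ∣ w := by
    intro w
    rw [hzz]
    constructor
    · rintro ⟨⟨v, rfl⟩, h⟩
      exact mul_dvd_mul_left z ((hpr'.dvd_or_dvd h).resolve_left hnd)
    · intro h
      exact ⟨(dvd_mul_right _ _).trans h, (dvd_mul_left _ _).trans h⟩
  have h4 : ∀ w ∈ circ (p * n), ang k w = (if z ∣ w then ang k w else 0) +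
      (if star z ∣ w then ang k w else 0) -
      (if (p : GaussianInt) ∣ w then ang k w else 0) := by
    intro w hw
    have h5 := hor w hw
    rw [← hand]
    by_cases ha : z ∣ w <;> by_cases hb : star z ∣ w <;> simp_all
  have e1 := sum_circ_dvd (k := k) (n := n) hp.ne_zero hz
  have e2 := sum_circ_dvd (k := k) (n := n) hp.ne_zero hz'
  have e3 := sum_circ_natCast_dvd (k := k) (n := n) hp
  rw [GaussianInt.toComplex_star, ang_conj] at e2
  rw [circSum, sum_congr rfl h4, sum_sub_distrib, sum_add_distrib, ← sum_filter, ← sum_filter,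
    ← sum_filter]
  rw [add_mul, ← e1, ← e2, ← e3]

open Classical in
theorem circSum_recursion {k n p : ℕ} (hp : p.Prime) :
    circSum k (p * n) = (gA k p + gB k p) * circSum k n -
      if p ∣ n then gA k p * gB k p * circSum k (n / p) else 0 := by
  rw [gA, gB, cmExt_prime _ hp, cmExt_prime _ hp]
  by_cases h3 : p % 4 = 3
  · rw [if_pos h3, if_pos h3]
    have := Fact.mk hp
    have hpr := GaussianInt.prime_of_nat_prime_of_mod_four_eq_three p h3
    have hf : (circ (p * n)).filter ((p : GaussianInt) ∣ ·) = circ (p * n) := by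
      refine filter_true_of_mem fun w hw => ?_
      rw [mem_circ] at hw
      have : (p : GaussianInt) ∣ w * star w := by
        rw [← Zsqrtd.norm_eq_mul_conj w, hw]
        push_cast
        exact dvd_mul_right _ _
      rcases hpr.dvd_or_dvd this with h | h
      · exact h
      · simpa using star_dvd_star h
    have := sum_circ_natCast_dvd (k := k) (n := n) hp
    rw [hf] at this
    rw [circSum, this]
    split_ifs <;> simp
  · rw [if_neg h3, if_neg h3]
    by_cases h2 : p = 2
    · subst h2
      rw [if_pos rfl]
      have hz := norm_gp Nat.prime_two (by norm_num)
      set z := gp 2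
      have hpr := prime_of_norm_prime Nat.prime_two hz
      have hf : (circ (2 * n)).filter (z ∣ ·) = circ (2 * n) := by
        refine filter_true_of_mem fun w hw => ?_
        rw [mem_circ] at hw
        have hzz : (2 : GaussianInt) = z * star z := by
          have := Zsqrtd.norm_eq_mul_conj z
          rw [hz] at this
          exact_mod_cast this
        have : z ∣ w * star w := by
          rw [← Zsqrtd.norm_eq_mul_conj w, hw]
          push_cast
          rw [hzz, mul_assoc]
          exact dvd_mul_right _ _
        rcases hpr.dvd_or_dvd this with h | h
        · exact h
        · have h5 : star z ∣ w := by simpa using star_dvd_star h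
          refine dvd_trans ?_ h5
          have h6 : z ∣ z + star z := by
            have h8 : z + star z = 2 * (z.re : GaussianInt) := by ext <;> simp; ring
            rw [h8, hzz, mul_assoc]
            exact dvd_mul_right _ _
          exact (dvd_add_right dvd_rfl).1 h6
      have := sum_circ_dvd (k := k) (n := n) two_ne_zero hz
      rw [hf] at this
      rw [circSum, this]
      simp
    · rw [if_neg h2, circSum_recursion_aux hp h3 h2]
      have hne : ((gp p : GaussianInt) : ℂ) ≠ 0 := by
        rw [Ne, GaussianInt.toComplex_eq_zero]
        intro h
        have := norm_gp hp h3
        rw [h] at this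
        simp at this
        exact hp.ne_zero (by exact_mod_cast this.symm)
      rw [ang_mul_conj k hne, one_mul]

theorem circSum_one (k : ℕ) : circSum k 1 = 4 := by
  have : circ 1 = {(⟨1, 0⟩ : GaussianInt), ⟨-1, 0⟩, ⟨0, 1⟩, ⟨0, -1⟩} := by decide +kernel
  rw [circSum, this, sum_insert (by decide), sum_insert (by decide), sum_insert (by decide),
    sum_singleton]
  simp only [ang, GaussianInt.toComplex_def', pow_mul]
  norm_num [Complex.I_pow_four]

theorem circSum_eq (k : ℕ) : ∀ n : ℕ, n ≠ 0 → circSum k n = 4 * rG k n := by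
  intro n
  induction n using Nat.strong_induction_on with
  | _ n ih =>
    intro hn
    rcases eq_or_ne n 1 with rfl | h1
    · simp [circSum_one, rG, tw_apply, (isCM_gA k).one, (isCM_gB k).one]
    · obtain ⟨m, hm⟩ := n.minFac_dvd
      have hp := Nat.minFac_prime h1
      set p := n.minFac
      have hm0 : m ≠ 0 := by rintro rfl; simp at hm; exact hn hm
      have hmn : m < n := by
        rw [hm]
        nlinarith [hp.two_le, Nat.pos_of_ne_zero hm0]
      rw [hm, circSum_recursion hp, rG, conv_recursion (isCM_gA k) (isCM_gB k) hp hm0, ← rG,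
        ih m hmn hm0]
      split_ifs with hd
      · rw [ih (m / p) ((Nat.div_le_self _ _).trans_lt hmn)
          (Nat.div_pos (Nat.le_of_dvd (Nat.pos_of_ne_zero hm0) hd) hp.pos).ne']
        ring
      · ring

section
open MeasureTheory

theorem norm_pow_sub_pow_le {a b : ℂ} (ha : ‖a‖ ≤ 1) (hb : ‖b‖ ≤ 1) (n : ℕ) :
    ‖a ^ n - b ^ n‖ ≤ n * ‖a - b‖ := by
  induction n with
  | zero => simp
  | succ n ih =>
    have h : a ^ (n + 1) - b ^ (n + 1) = a * (a ^ n - b ^ n) + (a - b) * b ^ n := by ring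
    have h1 : ‖a * (a ^ n - b ^ n)‖ ≤ 1 * (n * ‖a - b‖) := by rw [norm_mul]; gcongr
    have h2 : ‖(a - b) * b ^ n‖ ≤ ‖a - b‖ * 1 := by
      rw [norm_mul, norm_pow]
      gcongr
      exact pow_le_one₀ (norm_nonneg _) hb
    rw [h]
    push_cast
    linarith [norm_add_le (a * (a ^ n - b ^ n)) ((a - b) * b ^ n)]

theorem norm_div_norm_le (z : ℂ) : ‖z / (‖z‖ : ℂ)‖ ≤ 1 := by
  rw [norm_div, norm_real, norm_norm]
  exact div_self_le_one _

theorem norm_dir_sub_dir_mul_le (z w : ℂ) :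
    ‖z / (‖z‖ : ℂ) - w / (‖w‖ : ℂ)‖ * ‖z‖ ≤ 2 * ‖z - w‖ := by
  rcases eq_or_ne z 0 with rfl | hz
  · simp
  have hz' : (‖z‖ : ℂ) ≠ 0 := by simpa using hz
  have hn : ‖z / (‖z‖ : ℂ) - w / (‖w‖ : ℂ)‖ * ‖z‖ = ‖z - w / (‖w‖ : ℂ) * ‖z‖‖ := by
    calc _ = ‖(z / (‖z‖ : ℂ) - w / (‖w‖ : ℂ)) * (‖z‖ : ℂ)‖ := by rw [norm_mul, norm_real, norm_norm]
      _ = _ := by rw [sub_mul, div_mul_cancel₀ _ hz']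
  rw [hn]
  rcases eq_or_ne w 0 with rfl | hw
  · simp only [zero_div, zero_mul, sub_zero]
    linarith [norm_nonneg z]
  have hw' : (‖w‖ : ℂ) ≠ 0 := by simpa using hw
  have h1 : z - w / (‖w‖ : ℂ) * ‖z‖ = (z - w) + w / (‖w‖ : ℂ) * ((‖w‖ - ‖z‖ : ℝ) : ℂ) := by
    push_cast
    field_simp
    ring
  rw [h1]
  have h2 : ‖w / (‖w‖ : ℂ) * ((‖w‖ - ‖z‖ : ℝ) : ℂ)‖ ≤ 1 * ‖z - w‖ := by
    rw [norm_mul, norm_real, norm_eq_abs]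
    gcongr
    · exact norm_div_norm_le w
    · rw [norm_sub_rev]
      exact abs_norm_sub_norm_le w z
  linarith [norm_add_le (z - w) (w / (‖w‖ : ℂ) * ((‖w‖ - ‖z‖ : ℝ) : ℂ))]

theorem norm_ang_sub_mul_le (k : ℕ) (z w : ℂ) : ‖ang k z - ang k w‖ * ‖z‖ ≤ 8 * k * ‖z - w‖ := by
  have h := norm_pow_sub_pow_le (norm_div_norm_le z) (norm_div_norm_le w) (4 * k)
  have h1 := norm_dir_sub_dir_mul_le z w
  calc ‖ang k z - ang k w‖ * ‖z‖
      ≤ ((4 * k : ℕ) * ‖z / (‖z‖ : ℂ) - w / (‖w‖ : ℂ)‖) * ‖z‖ := by rw [ang, ang]; gcongr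
    _ = (4 * k : ℕ) * (‖z / (‖z‖ : ℂ) - w / (‖w‖ : ℂ)‖ * ‖z‖) := by ring
    _ ≤ (4 * k : ℕ) * (2 * ‖z - w‖) := by gcongr
    _ = _ := by push_cast; ring

open Classical in
/-- The angular character cut off to the closed disc of radius `R`. -/
def discAng (k : ℕ) (R : ℝ) (z : ℂ) : ℂ := if ‖z‖ ≤ R then ang k z else 0

theorem measurable_discAng (k : ℕ) (R : ℝ) : Measurable (discAng k R) := by
  unfold discAng ang
  refine Measurable.ite (measurableSet_le measurable_norm measurable_const) ?_ measurable_const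
  fun_prop

theorem norm_discAng_le (k : ℕ) (R : ℝ) (z : ℂ) : ‖discAng k R z‖ ≤ 1 := by
  rw [discAng]
  split_ifs
  · exact norm_ang_le k z
  · simp

theorem integrable_discAng (k : ℕ) (R : ℝ) : Integrable (discAng k R) := by
  have h : IntegrableOn (discAng k R) (Metric.closedBall 0 R) :=
    Measure.integrableOn_of_bounded (M := 1) measure_closedBall_lt_top.ne
      (measurable_discAng k R).aestronglyMeasurable
      (Filter.Eventually.of_forall fun z => norm_discAng_le k R z)
  refine (integrableOn_iff_integrable_of_support_subset ?_).1 h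
  intro z hz
  rw [mem_closedBall_zero_iff]
  by_contra h
  exact hz (if_neg h)

theorem integral_discAng {k : ℕ} (hk : 1 ≤ k) (R : ℝ) : ∫ z, discAng k R z = 0 := by
  set c : Circle := Circle.exp (π / (4 * k)) with hc
  have hcn : (c : ℂ) ^ (4 * k) = -1 := by
    rw [hc, Circle.coe_exp, ← Complex.exp_nat_mul, ← Complex.exp_pi_mul_I]
    congr 1
    push_cast
    have : (k : ℂ) ≠ 0 := by exact_mod_cast (by omega : k ≠ 0)
    field_simp
  have h1 : ∀ z, discAng k R (rotation c z) = -discAng k R z := by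
    intro z
    rw [rotation_apply, discAng, discAng, norm_mul, Circle.norm_coe, one_mul, ang_mul]
    have : ang k c = -1 := by rw [ang, Circle.norm_coe]; simp [hcn]
    rw [this]
    split_ifs <;> simp
  have h2 := (rotation c).measurePreserving.integral_comp
    (rotation c).toHomeomorph.measurableEmbedding (discAng k R)
  simp only [h1, integral_neg] at h2
  linear_combination (-1 / 2 : ℂ) * h2

theorem integral_indicator_square (a b : ℤ) (c : ℂ) :
    Integrable ({z : ℂ | ⌊z.re⌋ = a ∧ ⌊z.im⌋ = b}.indicator fun _ => c) ∧
    ∫ z, ({z : ℂ | ⌊z.re⌋ = a ∧ ⌊z.im⌋ = b}.indicator fun _ => c) z = c := by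
  have hS : {z : ℂ | ⌊z.re⌋ = a ∧ ⌊z.im⌋ = b} = Complex.measurableEquivRealProd ⁻¹'
      (Set.Ico (a : ℝ) (a + 1) ×ˢ Set.Ico (b : ℝ) (b + 1)) := by
    ext z
    simp [Int.floor_eq_iff]
  have hm : MeasurableSet {z : ℂ | ⌊z.re⌋ = a ∧ ⌊z.im⌋ = b} := by
    rw [hS]
    exact Complex.measurableEquivRealProd.measurable (measurableSet_Ico.prod measurableSet_Ico)
  have hv : volume {z : ℂ | ⌊z.re⌋ = a ∧ ⌊z.im⌋ = b} = 1 := by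
    rw [hS, Complex.volume_preserving_equiv_real_prod.measure_preimage_equiv,
      Measure.volume_eq_prod, Measure.prod_prod]
    simp
  refine ⟨(integrable_indicator_iff hm).2 (integrableOn_const (by simp [hv])), ?_⟩
  rw [integral_indicator_const _ hm, measureReal_def, hv]
  simp

/-- The bound for the variation of the cut-off angular character over a square at a given
distance from the origin. -/
def varBound (k : ℕ) (R r : ℝ) : ℝ := ((Set.Icc (R - 2) (R + 2)).indicator (fun _ => R + 2) r +
    (Set.Ioc 0 R).indicator (fun _ => 16 * (k : ℝ)) r) / r

theorem norm_discAng_sub_le {k : ℕ} {R : ℝ} {z w : ℂ} (hz : z ≠ 0) (hzw : ‖z - w‖ ≤ 2) :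
    ‖discAng k R w - discAng k R z‖ ≤ varBound k R ‖z‖ := by
  have hz0 : 0 < ‖z‖ := norm_pos_iff.2 hz
  have hab := abs_le.1 ((abs_norm_sub_norm_le z w).trans hzw)
  rw [varBound, le_div_iff₀ hz0]
  have hI1 : 0 ≤ (Set.Ioc 0 R).indicator (fun _ => 16 * (k : ℝ)) ‖z‖ :=
    Set.indicator_nonneg (fun _ _ => by positivity) _
  by_cases h1 : ‖z‖ ≤ R
  · by_cases h2 : ‖w‖ ≤ R
    · rw [discAng, discAng, if_pos h1, if_pos h2, Set.indicator_of_mem (s := Set.Ioc 0 R) ⟨hz0, h1⟩,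
        norm_sub_rev]
      have hI2 : 0 ≤ (Set.Icc (R - 2) (R + 2)).indicator (fun _ => R + 2) ‖z‖ :=
        Set.indicator_nonneg (fun _ _ => by linarith) _
      have := norm_ang_sub_mul_le k z w
      have : 8 * (k : ℝ) * ‖z - w‖ ≤ 8 * k * 2 := by gcongr
      linarith
    · rw [Set.indicator_of_mem (s := Set.Icc (R - 2) (R + 2)) ⟨by linarith, by linarith⟩]
      have : ‖discAng k R w - discAng k R z‖ ≤ 1 := by
        rw [discAng, if_neg h2, zero_sub, norm_neg]
        exact norm_discAng_le k R z
      nlinarith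
  · by_cases h2 : ‖w‖ ≤ R
    · rw [Set.indicator_of_mem (s := Set.Icc (R - 2) (R + 2)) ⟨by linarith, by linarith⟩]
      have : ‖discAng k R w - discAng k R z‖ ≤ 1 := by
        rw [discAng, discAng, if_neg h1, sub_zero, ← discAng]
        exact norm_discAng_le k R w
      nlinarith
    · rw [discAng, discAng, if_neg h1, if_neg h2, sub_zero, norm_zero, zero_mul]
      refine add_nonneg (Set.indicator_apply_nonneg fun h => ?_) hI1
      linarith [h.2]

theorem integrable_varBound (k : ℕ) {R : ℝ} (hR : 0 ≤ R) :
    Integrable (fun z : ℂ => varBound k R ‖z‖) ∧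
    ∫ z : ℂ, varBound k R ‖z‖ ≤
      2 * (volume : Measure ℂ).real (Metric.ball 0 1) * (4 * (R + 2) + 16 * k * R) := by
  have hf : Set.EqOn (fun y : ℝ => y ^ (Module.finrank ℝ ℂ - 1) • varBound k R y)
      (fun y => (Set.Icc (R - 2) (R + 2)).indicator (fun _ => R + 2) y +
        (Set.Ioc 0 R).indicator (fun _ => 16 * (k : ℝ)) y) (Set.Ioi 0) := by
    intro y hy
    have hy' : y ≠ 0 := (Set.mem_Ioi.1 hy).ne'
    simp only [Complex.finrank_real_complex, varBound, smul_eq_mul]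
    norm_num
    field_simp
  have hi1 : Integrable ((Set.Icc (R - 2) (R + 2)).indicator (fun _ => R + 2)) :=
    (integrable_indicator_iff measurableSet_Icc).2 (integrableOn_const (by simp))
  have hi2 : Integrable ((Set.Ioc 0 R).indicator (fun _ => 16 * (k : ℝ))) :=
    (integrable_indicator_iff measurableSet_Ioc).2 (integrableOn_const (by simp))
  constructor
  · rw [integrable_fun_norm_addHaar, integrableOn_congr_fun hf measurableSet_Ioi]
    exact (hi1.add hi2).integrableOn
  · rw [integral_fun_norm_addHaar, setIntegral_congr_fun measurableSet_Ioi hf, nsmul_eq_mul,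
      smul_eq_mul, Complex.finrank_real_complex, ← mul_assoc]
    refine mul_le_mul_of_nonneg_left ?_ (by positivity)
    calc _ ≤ ∫ y : ℝ, ((Set.Icc (R - 2) (R + 2)).indicator (fun _ => R + 2) y +
        (Set.Ioc 0 R).indicator (fun _ => 16 * (k : ℝ)) y) := by
          refine setIntegral_le_integral (hi1.add hi2) (Filter.Eventually.of_forall fun y => ?_)
          refine add_nonneg (Set.indicator_nonneg (fun _ _ => by linarith) _)
            (Set.indicator_nonneg (fun _ _ => by positivity) _)
      _ = (4 * (R + 2) + 16 * k * R) := by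
          rw [integral_add hi1 hi2, integral_indicator_const _ measurableSet_Icc,
            integral_indicator_const _ measurableSet_Ioc]
          simp [Real.volume_real_Icc, Real.volume_real_Ioc, hR]
          ring

/-- The point of a translate of the square lattice with given coordinates. -/
def lpt (τ : ℂ) (u : ℤ × ℤ) : ℂ := u.1 + u.2 * I + τ

theorem norm_sum_lattice_le {k : ℕ} (hk : 1 ≤ k) {R : ℝ} (hR : 0 ≤ R) {τ : ℂ} (h0 : 0 ≤ τ.re)
    (h1 : τ.re < 1) (h2 : 0 ≤ τ.im) (h3 : τ.im < 1) {U : Finset (ℤ × ℤ)}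
    (hU : ∀ u, u ∈ U ↔ ‖lpt τ u‖ ≤ R) :
    ‖∑ u ∈ U, ang k (lpt τ u)‖ ≤
      2 * (volume : Measure ℂ).real (Metric.ball 0 1) * (4 * (R + 2) + 16 * k * R) := by
  set P : ℂ → ℂ := fun z => lpt τ (⌊z.re⌋, ⌊z.im⌋) with hP
  have hdec : ∀ z, discAng k R (P z) = ∑ u ∈ U,
      ({z : ℂ | ⌊z.re⌋ = u.1 ∧ ⌊z.im⌋ = u.2}.indicator fun _ => ang k (lpt τ u)) z := by
    intro z
    simp only [Set.indicator_apply, Set.mem_ofPred_eq]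
    rw [← sum_filter]
    by_cases h : (⌊z.re⌋, ⌊z.im⌋) ∈ U
    · have : U.filter (fun u => ⌊z.re⌋ = u.1 ∧ ⌊z.im⌋ = u.2) = {(⌊z.re⌋, ⌊z.im⌋)} := by
        ext u
        simp only [mem_filter, mem_singleton]
        constructor
        · rintro ⟨_, h5, h6⟩
          exact Prod.ext h5.symm h6.symm
        · rintro rfl
          exact ⟨h, rfl, rfl⟩
      rw [this, sum_singleton, discAng, if_pos ((hU _).1 h)]
    · have : U.filter (fun u => ⌊z.re⌋ = u.1 ∧ ⌊z.im⌋ = u.2) = ∅ := by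
        refine filter_eq_empty_iff.2 fun u hu h5 => h ?_
        rwa [h5.1, h5.2]
      rw [this, sum_empty, discAng, if_neg (fun h6 => h ((hU _).2 h6))]
  have hint : Integrable (fun z => discAng k R (P z)) := by
    simp only [hdec]
    exact integrable_finsetSum _ fun u _ => (integral_indicator_square _ _ _).1
  have hval : ∫ z, discAng k R (P z) = ∑ u ∈ U, ang k (lpt τ u) := by
    simp only [hdec]
    rw [integral_finsetSum _ fun u _ => (integral_indicator_square _ _ _).1]
    exact sum_congr rfl fun u _ => (integral_indicator_square _ _ _).2
  have hsub := integral_sub hint (integrable_discAng k R)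
  rw [integral_discAng hk R, sub_zero, hval] at hsub
  rw [← hsub]
  refine le_trans (norm_integral_le_of_norm_le (integrable_varBound k hR).1 ?_)
    (integrable_varBound k hR).2
  have hae : ∀ᵐ z : ℂ, z ≠ 0 := by simp [ae_iff]
  filter_upwards [hae] with z hz
  refine norm_discAng_sub_le hz ((Complex.norm_le_abs_re_add_abs_im _).trans ?_)
  have e1 : (z - P z).re = Int.fract z.re - τ.re := by simp [hP, lpt, ← Int.self_sub_floor]; ring
  have e2 : (z - P z).im = Int.fract z.im - τ.im := by simp [hP, lpt, ← Int.self_sub_floor]; ring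
  rw [e1, e2]
  have a1 : |Int.fract z.re - τ.re| ≤ 1 := abs_le.2 ⟨by linarith [Int.fract_nonneg z.re],
    by linarith [Int.fract_lt_one z.re]⟩
  have a2 : |Int.fract z.im - τ.im| ≤ 1 := abs_le.2 ⟨by linarith [Int.fract_nonneg z.im],
    by linarith [Int.fract_lt_one z.im]⟩
  linarith

end

section
open MeasureTheory

theorem volume_real_ball_le : (volume : Measure ℂ).real (Metric.ball 0 1) ≤ 4 := by
  rw [measureReal_def, Complex.volume_ball]
  simpa using Real.pi_le_four

theorem circSum_eq' {k : ℕ} (hk : 1 ≤ k) (n : ℕ) : circSum k n = 4 * rG k n := by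
  rcases eq_or_ne n 0 with rfl | hn
  · rw [ArithmeticFunction.map_zero, mul_zero, circSum]
    refine sum_eq_zero fun w hw => ?_
    rw [mem_circ, Nat.cast_zero, GaussianInt.norm_eq_zero] at hw
    subst hw
    simp [ang]
    omega
  · exact circSum_eq k n hn

theorem norm_toComplex_le_iff {w : GaussianInt} {N : ℕ} : ‖(w : ℂ)‖ ≤ √N ↔ w.norm ≤ N := by
  rw [Real.le_sqrt (norm_nonneg _) (by positivity), ← normSq_eq_norm_sq,
    ← GaussianInt.intCast_real_norm]
  exact_mod_cast Iff.rfl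

theorem norm_sum_class_le {k : ℕ} (hk : 1 ≤ k) (q : ℕ) [NeZero q] (j : ZMod q × ZMod q) {N : ℕ}
    (hN : 1 ≤ N) {W : Finset GaussianInt}
    (hW : ∀ w, w ∈ W ↔ w.norm ≤ N ∧ ((w.re : ZMod q), (w.im : ZMod q)) = j) :
    ‖∑ w ∈ W, ang k w‖ ≤ 224 * k * √N := by
  have hq : (0 : ℝ) < q := by exact_mod_cast Nat.pos_of_ne_zero (NeZero.ne q)
  have hq1 : (1 : ℝ) ≤ q := one_le_cast
  have hqz : (q : ℤ) ≠ 0 := by exact_mod_cast NeZero.ne q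
  have hqc : (q : ℂ) ≠ 0 := by exact_mod_cast NeZero.ne q
  set τ : ℂ := ⟨j.1.val / q, j.2.val / q⟩ with hτ
  have hval : ∀ a : ZMod q, (0 : ℝ) ≤ a.val / q ∧ (a.val : ℝ) / q < 1 := fun a =>
    ⟨by positivity, (div_lt_one hq).2 (by exact_mod_cast a.val_lt)⟩
  have hmod : ∀ (a : ℤ) (b : ZMod q), (a : ZMod q) = b → a = q * (a / q) + b.val := by
    intro a b hab
    rw [← hab, ZMod.val_intCast, Int.mul_ediv_add_emod]
  set mk : ℤ × ℤ → GaussianInt := fun u => ⟨q * u.1 + j.1.val, q * u.2 + j.2.val⟩ with hmk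
  have hmk' : ∀ u, ((mk u : GaussianInt) : ℂ) = q * lpt τ u := by
    intro u
    apply Complex.ext <;>
      simp [hmk, lpt, hτ, GaussianInt.toComplex_def, -ZMod.natCast_val] <;> field_simp
  have hinj : ∀ u v, mk u = mk v → u = v := by
    intro u v h
    simp only [hmk, Zsqrtd.mk.injEq, add_left_inj] at h
    exact Prod.ext (mul_left_cancel₀ hqz h.1) (mul_left_cancel₀ hqz h.2)
  have hsurj : ∀ w ∈ W, mk (w.re / q, w.im / q) = w := by
    intro w hw
    have h := ((hW w).1 hw).2
    ext
    · exact (hmod _ _ (congrArg Prod.fst h)).symm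
    · exact (hmod _ _ (congrArg Prod.snd h)).symm
  have hmem : ∀ u, mk u ∈ W ↔ ‖lpt τ u‖ ≤ √N / q := by
    intro u
    rw [hW, ← norm_toComplex_le_iff, hmk', norm_mul, norm_natCast, le_div_iff₀' hq]
    simp [hmk]
  classical
  set U := W.image (fun w => (w.re / (q : ℤ), w.im / (q : ℤ))) with hU
  have hUm : ∀ u, u ∈ U ↔ ‖lpt τ u‖ ≤ √N / q := by
    intro u
    rw [← hmem, hU, mem_image]
    constructor
    · rintro ⟨w, hw, rfl⟩
      rwa [hsurj w hw]
    · intro h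
      exact ⟨mk u, h, hinj _ _ (hsurj _ h)⟩
  have hsum : ∑ w ∈ W, ang k w = ∑ u ∈ U, ang k (lpt τ u) := by
    symm
    refine sum_bij' (fun u _ => mk u) (fun w _ => (w.re / (q : ℤ), w.im / (q : ℤ)))
      (fun u hu => (hmem u).2 ((hUm u).1 hu)) (fun w hw => mem_image_of_mem _ hw)
      (fun u hu => hinj _ _ (hsurj _ ((hmem u).2 ((hUm u).1 hu)))) (fun w hw => hsurj w hw) ?_
    intro u _
    rw [hmk', ang_mul, ang_natCast k (NeZero.ne q), one_mul]
  have hb := norm_sum_lattice_le hk (R := √N / q) (by positivity) (τ := τ) (hval j.1).1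
    (hval j.1).2 (hval j.2).1 (hval j.2).2 hUm
  rw [hsum]
  refine hb.trans ?_
  have hs1 : 1 ≤ √(N : ℝ) := one_le_sqrt.2 (by exact_mod_cast hN)
  have hs2 : √(N : ℝ) / q ≤ √N := div_le_self (sqrt_nonneg _) hq1
  have hk1 : (1 : ℝ) ≤ k := by exact_mod_cast hk
  calc _ ≤ 2 * 4 * (4 * (√(N : ℝ) + 2 * √N) + 16 * k * √N) := by
        gcongr
        · exact volume_real_ball_le
        · linarith
    _ = 96 * 1 * √N + 128 * k * √N := by ring
    _ ≤ 96 * k * √N + 128 * k * √N := by gcongr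
    _ = _ := by ring

theorem norm_sum_periodic_rG_le {k : ℕ} (hk : 1 ≤ k) (q : ℕ) [NeZero q] {F : ZMod q → ℂ}
    (hF : ∀ a, ‖F a‖ ≤ 1) (N : ℕ) :
    ‖∑ n ∈ Ioc 0 N, F n * rG k n‖ ≤ 56 * k * q ^ 2 * √N := by
  rcases Nat.eq_zero_or_pos N with rfl | hN
  · simp
  classical
  set W := (range (N + 1)).biUnion circ with hW
  have hWm : ∀ w, w ∈ W ↔ w.norm ≤ N := by
    intro w
    simp only [hW, mem_biUnion, mem_range, mem_circ]
    constructor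
    · rintro ⟨n, h1, h2⟩
      omega
    · intro h
      have := GaussianInt.norm_nonneg w
      exact ⟨w.norm.natAbs, by omega, by omega⟩
  have h1 : ∑ w ∈ W, F (w.norm : ZMod q) * ang k w = 4 * ∑ n ∈ Ioc 0 N, F n * rG k n := by
    rw [hW, sum_biUnion]
    · have : Ioc 0 N = (range (N + 1)).erase 0 := by ext; simp; omega
      rw [this, sum_erase _ (by simp), mul_sum]
      refine sum_congr rfl fun n _ => ?_
      rw [mul_left_comm, ← circSum_eq' hk, circSum, mul_sum]
      refine sum_congr rfl fun w hw => ?_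
      rw [mem_circ.1 hw, Int.cast_natCast]
    · intro a _ b _ hab
      refine disjoint_left.2 fun w h1 h2 => hab ?_
      rw [mem_circ] at h1 h2
      exact_mod_cast h1.symm.trans h2
  have h2 : ∑ w ∈ W, F (w.norm : ZMod q) * ang k w = ∑ j : ZMod q × ZMod q, F (j.1 ^ 2 + j.2 ^ 2) *
        ∑ w ∈ W with ((w.re : ZMod q), (w.im : ZMod q)) = j, ang k w := by
    rw [← sum_fiberwise W (fun w => ((w.re : ZMod q), (w.im : ZMod q)))]
    refine sum_congr rfl fun j _ => ?_
    rw [mul_sum]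
    refine sum_congr rfl fun w hw => ?_
    rw [← (mem_filter.1 hw).2, ← sq_add_sq_eq_norm]
    push_cast
    rfl
  have h3 : ‖∑ w ∈ W, F (w.norm : ZMod q) * ang k w‖ ≤ q ^ 2 * (224 * k * √N) := by
    rw [h2]
    refine (norm_sum_le_of_le _ (f := fun j : ZMod q × ZMod q => F (j.1 ^ 2 + j.2 ^ 2) *
        ∑ w ∈ W with ((w.re : ZMod q), (w.im : ZMod q)) = j, ang k w)
        (n := fun _ => 1 * (224 * k * √N)) fun j _ => ?_).trans_eq ?_
    · rw [norm_mul]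
      refine mul_le_mul (hF _) (norm_sum_class_le hk q j hN fun w => ?_) (norm_nonneg _) zero_le_one
      rw [mem_filter, hWm]
    · rw [sum_const, card_univ, Fintype.card_prod, ZMod.card, nsmul_eq_mul]
      push_cast
      ring
  rw [h1, norm_mul] at h3
  norm_num at h3
  linarith

end

theorem norm_one_sub_pow_mul_le_one {u : ℝ} (hu0 : 0 ≤ u) (hu : u < 1) {w : ℂ} (hw : ‖w‖ ≤ 1) :
    ‖1 - (u : ℂ)‖ ^ 3 * ‖1 - u * w‖ ^ 4 * ‖1 - u * w ^ 2‖ ≤ 1 := by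
  have key : ∀ v : ℂ, ‖v‖ ≤ 1 → HasSum (fun n : ℕ => u ^ n * (v ^ n).re / n) (-log ‖1 - u * v‖)
      ∧ 0 < ‖1 - u * v‖ := by
    intro v hv
    have hlt : ‖(u : ℂ) * v‖ < 1 := by
      rw [norm_mul, norm_real, norm_of_nonneg hu0]
      nlinarith [norm_nonneg v]
    refine ⟨?_, ?_⟩
    · have h := Complex.hasSum_re (Complex.hasSum_taylorSeries_neg_log hlt)
      rw [Complex.neg_re, Complex.log_re] at h
      convert h using 1
      funext n
      rw [mul_pow, ← Complex.ofReal_pow, mul_div_assoc, mul_div_assoc, Complex.re_ofReal_mul,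
        ← Complex.ofReal_natCast n, Complex.div_ofReal_re]
    · rw [norm_pos_iff, sub_ne_zero]
      rintro h
      rw [← h, norm_one] at hlt
      exact lt_irrefl _ hlt
  obtain ⟨h1, p1⟩ := key 1 (by simp)
  obtain ⟨h2, p2⟩ := key w hw
  obtain ⟨h3, p3⟩ := key (w ^ 2) (by rw [norm_pow]; exact pow_le_one₀ (norm_nonneg _) hw)
  rw [mul_one] at h1 p1
  have h4 := ((h1.mul_left 3).add (h2.mul_left 4)).add h3
  have h5 : 0 ≤ 3 * -log ‖1 - (u : ℂ)‖ + 4 * -log ‖1 - u * w‖ + -log ‖1 - u * w ^ 2‖ := by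
    refine h4.nonneg fun n => ?_
    have e : 3 * (u ^ n * ((1 : ℂ) ^ n).re / n) + 4 * (u ^ n * (w ^ n).re / n) +
        u ^ n * ((w ^ 2) ^ n).re / n = u ^ n / n * (3 + 4 * (w ^ n).re + ((w ^ n) ^ 2).re) := by
      rw [one_pow, Complex.one_re, ← pow_mul, ← pow_mul, mul_comm 2 n]
      ring
    rw [e]
    refine mul_nonneg (by positivity) ?_
    have hn : ‖w ^ n‖ ^ 2 ≤ 1 := by
      rw [norm_pow]
      exact pow_le_one₀ (by positivity) (pow_le_one₀ (norm_nonneg _) hw)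
    rw [← normSq_eq_norm_sq, Complex.normSq_apply] at hn
    rw [sq (w ^ n), mul_re]
    nlinarith [sq_nonneg (1 + (w ^ n).re)]
  rw [← Real.log_nonpos_iff (by positivity), log_mul (by positivity) p3.ne',
    log_mul (by positivity) (by positivity), Real.log_pow, Real.log_pow]
  push_cast
  linarith

theorem hasProd_LSeries_tw {F : ℕ → ℂ} (hF : IsCM F) {s : ℂ} (hs : 1 < s.re) :
    HasProd (fun p : Nat.Primes => (1 - F p * (p : ℂ) ^ (-s))⁻¹) (LSeries (tw F zeta ·) s) := by
  have hs0 : s ≠ 0 := fun h => by simp [h] at hs; linarith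
  let f : ℕ →*₀ ℂ :=
    { toFun := fun n => F n * (n : ℂ) ^ (-s)
      map_zero' := by simp [hs0]
      map_one' := by simp [hF.one]
      map_mul' := fun m n => by
        simp only [hF.mul, Nat.cast_mul, Complex.natCast_mul_natCast_cpow]
        ring }
  have hterm : ∀ n, f n = LSeries.term (tw F zeta ·) s n := by
    intro n
    rcases eq_or_ne n 0 with rfl | hn
    · simp
    · simp [f, tw_apply, hn, cpow_neg, div_eq_mul_inv]
  have hsum : Summable fun n => ‖f n‖ := by
    have h : LSeriesSummable (tw F zeta ·) s := by
      refine summable_of_abscissa (abscissa_le_one_of_norm_le_dcount fun n => ?_) hs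
      exact (datum_zeta.twist hF).norm_r n
    simp only [hterm]
    exact h.norm
  have := EulerProduct.eulerProduct_completely_multiplicative_hasProd hsum
  simp only [hterm] at this
  have e : ∀ p : Nat.Primes, LSeries.term (tw F zeta ·) s p = F p * (p : ℂ) ^ (-s) := fun p => by
    rw [← hterm]
    rfl
  simp only [e] at this
  exact this

theorem one_le_norm_of_hasProd {f : Nat.Primes → ℂ} {a : ℂ} (h : HasProd f a)
    (hf : ∀ p, 1 ≤ ‖f p‖) : 1 ≤ ‖a‖ := by
  refine ge_of_tendsto (Filter.Tendsto.norm h) (Filter.Eventually.of_forall fun s => ?_)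
  rw [norm_prod]
  induction s using Finset.induction_on with
  | empty => simp
  | insert p s hp ih =>
    rw [prod_insert hp]
    exact one_le_mul_of_one_le_of_one_le (hf p) ih

theorem gA_two_mul {k p : ℕ} (hp : p.Prime) : gA (2 * k) p = gA k p ^ 2 := by
  rw [gA, gA, cmExt_prime _ hp, cmExt_prime _ hp]
  split_ifs
  · simp
  · rw [ang, ang, ← pow_mul]
    ring_nf

theorem gB_two_mul {k p : ℕ} (hp : p.Prime) (h3 : p % 4 ≠ 3) : gB (2 * k) p = gB k p ^ 2 := by
  rw [gB, gB, cmExt_prime _ hp, cmExt_prime _ hp, if_neg h3, if_neg h3]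
  split_ifs
  · simp
  · rw [ang, ang, ← map_pow, ← pow_mul]
    ring_nf

theorem local_factor_le {k p : ℕ} (hp : p.Prime) {u : ℝ} (hu0 : 0 ≤ u) (hu : u < 1) {w : ℂ}
    (hw : ‖w‖ ≤ 1) :
    ‖(1 - (u : ℂ)) * (1 - ev chi4 p * u)‖ ^ 3 *
      ‖(1 - gA k p * (u * w)) * (1 - gB k p * (u * w))‖ ^ 4 *
      ‖(1 - gA (2 * k) p * (u * w ^ 2)) * (1 - gB (2 * k) p * (u * w ^ 2))‖ ≤ 1 := by
  by_cases h3 : p % 4 = 3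
  · have e1 : ev chi4 p = -1 := by rw [ev_chi4, ZMod.χ₄_nat_three_mod_four h3]; simp
    have e2 : ∀ j, gA j p = 1 := fun j => by rw [gA, cmExt_prime _ hp, if_pos h3]
    have e3 : ∀ j, gB j p = -1 := fun j => by rw [gB, cmExt_prime _ hp, if_pos h3]
    rw [e1, e2, e2, e3, e3]
    have h := norm_one_sub_pow_mul_le_one (u := u ^ 2) (by positivity) (by nlinarith) (w := w ^ 2)
      (by rw [norm_pow]; exact pow_le_one₀ (norm_nonneg _) hw)
    refine le_of_eq_of_le ?_ h
    congr 3
    · congr 1; push_cast; ring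
    · congr 2; push_cast; ring
    · push_cast; ring
  · have hA : ‖gA k p * w‖ ≤ 1 := by
      rw [norm_mul]
      exact mul_le_one₀ ((isCM_gA k).norm_le p) (norm_nonneg _) hw
    have hB : ‖gB k p * w‖ ≤ 1 := by
      rw [norm_mul]
      exact mul_le_one₀ ((isCM_gB k).norm_le p) (norm_nonneg _) hw
    have h1 := norm_one_sub_pow_mul_le_one hu0 hu hA
    have h2 := norm_one_sub_pow_mul_le_one hu0 hu hB
    rw [gA_two_mul hp, gB_two_mul hp h3]
    by_cases hp2 : p = 2
    · have e1 : ev chi4 p = 0 := by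
        rw [ev_chi4, hp2]
        have : ZMod.χ₄ ((2 : ℕ) : ZMod 4) = 0 := by decide
        rw [this]; simp
      have e2 : gB k p = 0 := by rw [gB, cmExt_prime _ hp, if_neg h3, if_pos hp2]
      rw [e1, e2]
      refine le_of_eq_of_le ?_ h1
      congr 3
      · congr 1; ring
      · congr 2; ring
      · ring
    · have e1 : ev chi4 p = 1 := by
        rw [ev_chi4, ZMod.χ₄_nat_one_mod_four]
        · simp
        · have := hp.eq_two_or_odd
          omega
      rw [e1]
      refine le_of_eq_of_le ?_ (mul_le_one₀ h1 (by positivity) h2)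
      simp only [norm_mul, one_mul, mul_pow]
      rw [show gA k p * (u * w) = u * (gA k p * w) by ring,
        show gB k p * (u * w) = u * (gB k p * w) by ring,
        show gA k p ^ 2 * (u * w ^ 2) = u * (gA k p * w) ^ 2 by ring,
        show gB k p ^ 2 * (u * w ^ 2) = u * (gB k p * w) ^ 2 by ring]
      simp only [mul_pow]
      ring

theorem tw_tw (χ F : ℕ → ℂ) (f : 𝓐) : tw χ (tw F f) = tw (fun n => χ n * F n) f := by
  ext n
  rw [tw_apply, tw_apply, tw_apply, mul_assoc]

theorem hasProd_LSeries_tw_rG {χ : ℕ → ℂ} (hχ : IsCM χ) (k : ℕ) {s : ℂ} (hs : 1 < s.re) :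
    HasProd (fun p : Nat.Primes => ((1 - gA k p * ((p : ℂ) ^ (-s) * χ p)) *
      (1 - gB k p * ((p : ℂ) ^ (-s) * χ p)))⁻¹) (LSeries (tw χ (rG k) ·) s) := by
  have hA := hχ.prod (isCM_gA k)
  have hB := hχ.prod (isCM_gB k)
  have hsum : ∀ {F : ℕ → ℂ}, IsCM F → LSeriesSummable (tw F zeta ·) s := fun hF =>
    summable_of_abscissa (abscissa_le_one_of_norm_le_dcount (datum_zeta.twist hF).norm_r) hs
  have e : LSeries (tw χ (rG k) ·) s = LSeries (tw (fun n => χ n * gA k n) zeta ·) s *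
      LSeries (tw (fun n => χ n * gB k n) zeta ·) s := by
    rw [rG, tw_mul hχ, tw_tw, tw_tw]
    exact ArithmeticFunction.LSeries_mul' (hsum hA) (hsum hB)
  rw [e]
  convert (hasProd_LSeries_tw hA hs).mul (hasProd_LSeries_tw hB hs) using 2 with p
  rw [mul_inv]
  congr 3 <;> ring

theorem one_le_norm_LSeries_rG {χ : ℕ → ℂ} (hχ : IsCM χ) (k : ℕ) {σ t : ℝ} (hσ : 1 < σ) :
    1 ≤ ‖LSeries (tw (fun _ => 1) zeta ·) σ * LSeries (dchar chi4 ·) σ‖ ^ 3 *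
      ‖LSeries (tw χ (rG k) ·) (σ + t * I)‖ ^ 4 *
      ‖LSeries (tw (fun n => χ n * χ n) (rG (2 * k)) ·) (σ + (2 * t : ℝ) * I)‖ := by
  have h1 : IsCM (fun _ => (1 : ℂ)) := ⟨rfl, by simp, by simp⟩
  have hs : ∀ t : ℝ, 1 < ((σ : ℂ) + t * I).re := fun t => by simpa using hσ
  have hs0 : 1 < (σ : ℂ).re := by simpa using hσ
  have h := ((((hasProd_LSeries_tw h1 hs0).mul (hasProd_LSeries_tw (isCM_ev chi4) hs0)).pow 3).mul
    ((hasProd_LSeries_tw_rG hχ k (hs t)).pow 4)).mul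
    (hasProd_LSeries_tw_rG (hχ.prod hχ) (2 * k) (hs (2 * t)))
  rw [← norm_pow, ← norm_pow, ← norm_mul, ← norm_mul]
  refine one_le_norm_of_hasProd h fun p => ?_
  have hp := p.2
  have hp0 : (0 : ℝ) < p := by exact_mod_cast hp.pos
  have hpc : ((p : ℕ) : ℂ) ≠ 0 := by exact_mod_cast hp.ne_zero
  set u : ℝ := ((p : ℕ) : ℝ) ^ (-σ) with hu
  set v : ℂ := ((p : ℕ) : ℂ) ^ (-(t * I)) with hv
  have hu0 : 0 < u := by positivity
  have hu1 : u < 1 := Real.rpow_lt_one_of_one_lt_of_neg (by exact_mod_cast hp.one_lt) (by linarith)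
  have hvn : ‖v‖ = 1 := by
    rw [hv, Complex.norm_natCast_cpow_of_pos hp.pos]
    simp
  have e0 : ((p : ℕ) : ℂ) ^ (-(σ : ℂ)) = u := by
    rw [hu, Complex.ofReal_cpow hp0.le]
    push_cast
    rfl
  have e1 : ((p : ℕ) : ℂ) ^ (-((σ : ℂ) + t * I)) = u * v := by
    rw [neg_add, Complex.cpow_add _ _ hpc, e0]
  have e2 : ((p : ℕ) : ℂ) ^ (-((σ : ℂ) + (2 * t : ℝ) * I)) = u * v ^ 2 := by
    rw [neg_add, Complex.cpow_add _ _ hpc, e0, hv, ← Complex.cpow_nat_mul]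
    congr 2
    push_cast
    ring
  have hw : ‖v * χ p‖ ≤ 1 := by
    rw [norm_mul, hvn, one_mul]
    exact hχ.norm_le p
  have key := local_factor_le (k := k) hp hu0.le hu1 hw
  have hne : ∀ {a b : ℂ}, ‖a‖ ≤ 1 → ‖b‖ ≤ 1 → 1 - a * (u * b) ≠ 0 := by
    intro a b ha hb h0
    have h2 : ‖a * (u * b)‖ = 1 := by rw [← sub_eq_zero.1 h0, norm_one]
    rw [norm_mul, norm_mul, norm_real, norm_of_nonneg hu0.le] at h2
    have h3 : ‖a‖ * (u * ‖b‖) ≤ 1 * (u * 1) := by gcongr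
    linarith
  have hw2 : ‖(v * χ p) ^ 2‖ ≤ 1 := by
    rw [norm_pow]
    exact pow_le_one₀ (norm_nonneg _) hw
  have n1 := hne (a := 1) (b := 1) (by simp) (by simp)
  have n2 := hne (b := 1) ((isCM_ev chi4).norm_le p) (by simp)
  have n3 := hne ((isCM_gA k).norm_le p) hw
  have n4 := hne ((isCM_gB k).norm_le p) hw
  have n5 := hne ((isCM_gA (2 * k)).norm_le p) hw2
  have n6 := hne ((isCM_gB (2 * k)).norm_le p) hw2
  simp only [mul_one, one_mul] at n1 n2
  rw [e0, e1, e2, ← mul_inv, inv_pow, inv_pow, ← mul_inv, one_mul,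
    show (u : ℂ) * v * χ p = u * (v * χ p) by ring,
    show (u : ℂ) * v ^ 2 * (χ p * χ p) = u * (v * χ p) ^ 2 by ring]
  rw [← mul_inv, norm_inv, one_le_inv₀ (norm_pos_iff.2 (mul_ne_zero (mul_ne_zero
    (pow_ne_zero _ (mul_ne_zero n1 n2)) (pow_ne_zero _ (mul_ne_zero n3 n4)))
    (mul_ne_zero n5 n6))), norm_mul, norm_mul, norm_pow, norm_pow]
  exact key

theorem norm_sum_tw_rG_le {k : ℕ} (hk : 1 ≤ k) {q : ℕ} [NeZero q] {χ : ZMod q → ℂ}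
    (hχ : ∀ a, ‖χ a‖ ≤ 1) (N : ℕ) :
    ‖∑ n ∈ Ioc 0 N, tw (fun n => χ n) (rG k) n‖ ≤ 56 * k * q ^ 2 * √N := by
  simp only [tw_apply]
  exact norm_sum_periodic_rG_le hk q hχ N

theorem exists_norm_LSeries_dchar_chi4_le : ∃ K : ℝ, 0 < K ∧ ∀ σ : ℝ, 1 < σ → σ ≤ 2 →
    ‖LSeries (dchar chi4 ·) σ‖ ≤ K := by
  obtain ⟨C, hC, h⟩ := exists_norm_LSeries_lg_le 0 one_pos
  have h4 : chi4 ≠ 1 := by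
    intro h
    have h1 : ev chi4 3 = 1 := by
      rw [h, ev]
      exact MulChar.one_apply (by decide)
    rw [ev_chi4, ZMod.χ₄_nat_three_mod_four (by norm_num)] at h1
    norm_num at h1
  have : NeZero 4 := ⟨by norm_num⟩
  refine ⟨C * (4 * 2), by positivity, fun σ hσ hσ2 => ?_⟩
  have := h (dchar chi4) 4 (dchar_norm_le _) (by norm_num)
    (fun N => by exact_mod_cast norm_sum_dchar_le h4 N) σ 0 hσ hσ2
  simpa [lg_zero] using this

theorem exists_admissible_rG : ∃ c : ℝ → ℝ, (∀ δ, 0 < δ → 0 < c δ) ∧ ∀ k : ℕ, 1 ≤ k →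
    Admissible False c (56 * k) (rG k) (tw (gA k) moebius * tw (gB k) moebius)
      (tw (gA k) mangoldtC + tw (gB k) mangoldtC) := by
  have main : ∀ δ : ℝ, 0 < δ → ∃ c : ℝ, 0 < c ∧ ∀ k : ℕ, 1 ≤ k → ∀ (q : ℕ) [NeZero q]
      (χ : 𝓧 q), ∀ σ t : ℝ, 1 < σ → σ ≤ 2 →
      c * (56 * k * q ^ 2 * (2 + |t|)) ^ (-δ) ≤ ‖LSeries (tw (ev χ) (rG k) ·) (σ + t * I)‖ := by
    intro δ' hδ'
    set δ := δ' / 7 with hδdef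
    have hδ : 0 < δ := by positivity
    obtain ⟨C₀, hC₀, hL0⟩ := exists_norm_LSeries_lg_le 0 hδ
    obtain ⟨C₁, hC₁, hL1⟩ := exists_norm_LSeries_lg_le 1 hδ
    obtain ⟨K, hK, hL4⟩ := exists_norm_LSeries_dchar_chi4_le
    set E := C₀ * 4 ^ δ with hE
    have hE0 : 0 < E := by positivity
    set c := ((8 * K ^ 3 * E)⁻¹) ^ (1 / 4 : ℝ) with hc
    have hc0 : 0 < c := by positivity
    have hc4 : c ^ 4 = (8 * K ^ 3 * E)⁻¹ := by
      rw [hc, ← rpow_natCast, ← rpow_mul (by positivity)]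
      norm_num
    refine ⟨c / 2 * min 1 (c / (2 * C₁)) ^ 3, by positivity, ?_⟩
    intro k hk q _ χ σ t hσ hσ2
    have hq : (1 : ℝ) ≤ q := one_le_cast
    have hk1 : (1 : ℝ) ≤ k := by exact_mod_cast hk
    have ht0 := abs_nonneg t
    have hkq : (1 : ℝ) ≤ 56 * k * q ^ 2 := by
      have h2 : (1 : ℝ) ≤ q ^ 2 := one_le_pow₀ hq
      have h3 : (1 : ℝ) ≤ k * q ^ 2 := one_le_mul_of_one_le_of_one_le hk1 h2
      linarith
    set X : ℝ := 56 * k * q ^ 2 * (2 + |t|) with hX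
    have hX1 : 1 ≤ X := one_le_conductor_mul hkq t
    have hX0 : 0 < X := by linarith
    set P : ℝ := X ^ (-δ) with hP
    have hP0 : 0 < P := by positivity
    have hP1 : P ≤ 1 := rpow_le_one_of_one_le_of_nonpos hX1 (by linarith)
    have hPinv : P⁻¹ = X ^ δ := by rw [hP, rpow_neg hX0.le, inv_inv]
    have hfin : X ^ (-δ') = P ^ 7 := by
      rw [hP, ← rpow_natCast, ← rpow_mul hX0.le]
      congr 1
      push_cast
      linarith
    rw [hfin]
    have hd : ∀ {F : ℕ → ℂ} (hF : IsCM F) (k n : ℕ), ‖tw F (rG k) n‖ ≤ dcount n :=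
      fun hF k => ((datum_prod (isCM_gA k) (isCM_gB k)).twist hF).norm_r
    have hχ : ∀ a, ‖χ a‖ ≤ 1 := fun a => χ.norm_le_one a
    refine le_norm_LSeries_of_pow_four (abscissa_le_one_of_norm_le_dcount (hd (isCM_ev χ) k))
      hc0 hC₁ hP0 hP1 (fun σ hσ hσ2 => ?_) (fun σ hσ hσ2 => ?_) hσ hσ2
    · rw [hPinv]
      exact hL1 _ _ (hd (isCM_ev χ) k) hkq (norm_sum_tw_rG_le hk hχ) σ t hσ hσ2
    have hup : ‖LSeries (tw (fun n => ev χ n * ev χ n) (rG (2 * k)) ·)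
        (σ + (2 * t : ℝ) * I)‖ ≤ E * P⁻¹ := by
      have h := hL0 _ (56 * (2 * k : ℕ) * q ^ 2) (hd ((isCM_ev χ).prod (isCM_ev χ)) (2 * k))
        (by push_cast; linarith) (norm_sum_tw_rG_le (χ := fun a => χ a * χ a) (by omega) fun a => by
          rw [norm_mul]; exact mul_le_one₀ (hχ a) (norm_nonneg _) (hχ a)) σ (2 * t) hσ hσ2
      rw [lg_zero] at h
      refine h.trans ?_
      rw [hE, mul_assoc C₀, hPinv, ← mul_rpow (x := 4) (y := X) (by norm_num) hX0.le, abs_mul,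
        abs_two]
      refine mul_le_mul_of_nonneg_left (rpow_le_rpow (by positivity) ?_ hδ.le) hC₀.le
      have h6 : 56 * k * q ^ 2 * (2 + 2 * |t|) ≤ 56 * k * q ^ 2 * (2 * (2 + |t|)) := by
        gcongr
        linarith
      rw [hX]
      push_cast
      linarith
    have h := one_le_norm_LSeries_rG (isCM_ev χ) k (t := t) hσ
    rw [norm_mul] at h
    have hz : ‖LSeries (tw (fun _ => 1) (zeta : 𝓐) ·) σ‖ ≤ 2 / (σ - 1) := by
      refine norm_LSeries_le_two_div (fun n hn => ?_) (ofReal_re σ) hσ hσ2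
      rw [tw_apply, natCoe_apply, zeta_apply_ne hn]
      simp
    have h4 : 0 < σ - 1 := sub_pos.2 hσ
    have h3 : 1 ≤ (2 / (σ - 1) * K) ^ 3 *
        ‖LSeries (tw (ev χ) (rG k) ·) (σ + t * I)‖ ^ 4 * (E * P⁻¹) := by
      refine le_trans h ?_
      gcongr
      exact hL4 σ hσ hσ2
    have e2 : (2 / (σ - 1) * K) ^ 3 * ‖LSeries (tw (ev χ) (rG k) ·) (σ + t * I)‖ ^ 4 *
        (E * P⁻¹) = ‖LSeries (tw (ev χ) (rG k) ·) (σ + t * I)‖ ^ 4 / (c ^ 4 * (σ - 1) ^ 3 * P) := by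
      rw [hc4]
      field_simp
      ring
    rw [e2, one_le_div (by positivity)] at h3
    refine le_trans ?_ h3
    have h5 : P ^ 4 ≤ P := by
      calc P ^ 4 ≤ P ^ 1 := pow_le_pow_of_le_one hP0.le hP1 (by norm_num)
        _ = P := pow_one P
    gcongr
  choose! c hc0 hc using main
  refine ⟨c, hc0, fun k hk => ⟨datum_prod (isCM_gA k) (isCM_gB k), ?_, ?_, ?_⟩⟩
  · have hk1 : (1 : ℝ) ≤ k := by exact_mod_cast hk
    linarith
  · intro q _ χ _ _ _ N
    exact norm_sum_tw_rG_le hk (fun a => χ.norm_le_one a) N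
  · intro q _ χ _ _ _ δ hδ σ t hσ hσ2
    exact hc δ hδ k hk q χ σ t hσ hσ2

theorem le_totient_mul_dcount (n : ℕ) : (n : ℝ) ≤ n.totient * dcount n := by
  have h : n ≤ n.totient * n.divisors.card := by
    conv_lhs => rw [← Nat.sum_totient n]
    rw [mul_comm, ← smul_eq_mul, ← sum_const]
    rcases Nat.eq_zero_or_pos n with rfl | hn
    · simp
    exact sum_le_sum fun d hd => Nat.le_of_dvd (Nat.totient_pos.2 hn)
      (Nat.totient_dvd_of_dvd (Nat.dvd_of_mem_divisors hd))
  rw [dcount]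
  exact_mod_cast h

theorem card_divisors_le_two_mul_sqrt (n : ℕ) : n.divisors.card ≤ 2 * n.sqrt := by
  have h : n.divisors ⊆ Icc 1 n.sqrt ∪ (Icc 1 n.sqrt).image (n / ·) := by
    intro d hd
    obtain ⟨⟨e, rfl⟩, hn⟩ := Nat.mem_divisors.1 hd
    have hd0 : 0 < d := Nat.pos_of_ne_zero (left_ne_zero_of_mul hn)
    have he0 : 0 < e := Nat.pos_of_ne_zero (right_ne_zero_of_mul hn)
    rw [mem_union, mem_image]
    rcases le_total d e with hde | hde
    · exact Or.inl (mem_Icc.2 ⟨hd0, Nat.le_sqrt.2 (Nat.mul_le_mul_left d hde)⟩)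
    · exact Or.inr ⟨e, mem_Icc.2 ⟨he0, Nat.le_sqrt.2 (Nat.mul_le_mul_right e hde)⟩,
        Nat.mul_div_cancel d he0⟩
  refine (card_le_card h).trans ((card_union_le _ _).trans ?_)
  have := card_image_le (s := Icc 1 n.sqrt) (f := (n / ·))
  rw [Nat.card_Icc] at *
  omega

theorem sqrt_le_two_mul_totient (n : ℕ) : √(n : ℝ) ≤ 2 * n.totient := by
  rcases Nat.eq_zero_or_pos n with rfl | hn
  · simp
  have hn' : (0 : ℝ) < √n := Real.sqrt_pos.2 (by exact_mod_cast hn)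
  have h1 := le_totient_mul_dcount n
  have h2 : dcount n ≤ 2 * √(n : ℝ) := by
    have h3 : (n.divisors.card : ℝ) ≤ 2 * n.sqrt := by
      exact_mod_cast card_divisors_le_two_mul_sqrt n
    rw [dcount]
    linarith [Real.nat_sqrt_le_real_sqrt (a := n)]
  have h4 : √(n : ℝ) * √n ≤ 2 * n.totient * √n := by
    rw [Real.mul_self_sqrt (Nat.cast_nonneg n)]
    refine h1.trans ((mul_le_mul_of_nonneg_left h2 (Nat.cast_nonneg _)).trans_eq (by ring))
  exact le_of_mul_le_mul_right h4 hn'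

open Classical in
/-- Primitive characters of odd conductor at most `Q`; the trivial one is excluded under `e`. -/
def primPairs (e : Prop) (Q : ℕ) : Finset (Σ q, 𝓧 q) :=
  ((Icc 1 Q).filter fun d => Odd d ∧ (e → d ≠ 1)).sigma prims

theorem mem_primPairs {e : Prop} {Q : ℕ} {i : Σ q, 𝓧 q} :
    i ∈ primPairs e Q ↔ (1 ≤ i.1 ∧ i.1 ≤ Q) ∧ (Odd i.1 ∧ (e → i.1 ≠ 1)) ∧ i.2.IsPrimitive := by
  classical
  rw [primPairs, mem_sigma, mem_filter, mem_Icc]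
  constructor
  · rintro ⟨⟨h1, h2⟩, h3⟩
    exact ⟨h1, h2, (mem_prims (by omega)).1 h3⟩
  · rintro ⟨h1, h2, h3⟩
    exact ⟨⟨h1, h2⟩, (mem_prims (by omega)).2 h3⟩

theorem card_primPairs_le (e : Prop) (Q : ℕ) : (primPairs e Q).card ≤ Q ^ 2 := by
  classical
  rw [primPairs, card_sigma]
  refine (sum_le_card_nsmul _ _ Q fun d hd => (card_prims_le d).trans ?_).trans ?_
  · rw [mem_filter, mem_Icc] at hd
    exact hd.1.2
  · rw [smul_eq_mul, sq]
    refine Nat.mul_le_mul_right Q ((card_filter_le _ _).trans ?_)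
    simp

theorem pow_eight_mul_sqrt_le {Q : ℕ} {x : ℝ} (hx : 1 ≤ x) (hQ : (Q : ℝ) ^ 18 ≤ x) (n : ℕ) :
    (Q : ℝ) ^ 8 * √x * log x ^ n ≤ 18 ^ n * n.factorial * x := by
  set z := x ^ (1 / 18 : ℝ) with hz
  have hx0 : 0 < x := by linarith
  have hz0 : 0 < z := by positivity
  have hz18 : z ^ 18 = x := by
    rw [hz, ← rpow_natCast, ← rpow_mul hx0.le]
    norm_num
  have hz1 : 1 ≤ z := one_le_rpow hx (by norm_num)
  have hQz : (Q : ℝ) ≤ z := by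
    rw [← hz18] at hQ
    exact le_of_pow_le_pow_left₀ (by norm_num) hz0.le hQ
  have hs : √x = z ^ 9 := by
    rw [← hz18, show z ^ 18 = (z ^ 9) ^ 2 by ring, Real.sqrt_sq (by positivity)]
  have hl : log x = 18 * log z := by
    rw [← hz18, Real.log_pow]
    push_cast
    ring
  have hlz := log_pow_le_factorial_mul hz1 n
  have hlz0 := log_nonneg hz1
  rw [hs, hl, mul_pow]
  calc (Q : ℝ) ^ 8 * z ^ 9 * (18 ^ n * log z ^ n)
      ≤ z ^ 8 * z ^ 9 * (18 ^ n * (n.factorial * z)) := by gcongr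
    _ = 18 ^ n * n.factorial * x := by rw [← hz18]; ring

theorem exists_sum_primPairs_le {c : ℝ → ℝ} (hc : ∀ δ, 0 < δ → 0 < c δ) (A B : ℕ) :
    ∃ C : ℝ, 0 < C ∧ ∀ (e : Prop) (H : ℝ) (r μ' Λ' : 𝓐) (x y : ℝ) (Q : ℕ),
      Admissible e c H r μ' Λ' → 1 ≤ log x → 1 ≤ x → H ≤ log x ^ B → 1 ≤ Q →
      (Q : ℝ) ^ 18 ≤ x → 1 ≤ y → y ≤ x →
      (∑ i ∈ primPairs e Q, ‖smooth (tw (ev i.2) Λ') y‖ / i.1.totient) * log x ^ A ≤ C * x := by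
  set B₁ := A + 65 with hB₁
  obtain ⟨C, hC, hSW⟩ := siegelWalfisz hc (A + 4 * B₁) (B + 4 * B₁)
  refine ⟨C + (192 * (18 ^ (B + 4 + A) * (B + 4 + A).factorial) +
    2 * (1152 * kernelConst * 2 ^ 65)), ?_, ?_⟩
  · have := kernelConst_nonneg
    positivity
  intro e H r μ' Λ' x y Q h hL hx hHB hQ hQx hy hyx
  classical
  set L := log x with hLdef
  have hL0 : 0 < L := by linarith
  have hx0 : 0 < x := by linarith
  have hx1 : 1 < x := by
    rcases hx.eq_or_lt with h1 | h1
    · rw [hLdef, ← h1, Real.log_one] at hL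
      norm_num at hL
    · exact h1
  have hH := h.one_le
  have hK := kernelConst_nonneg
  set f : (Σ q, 𝓧 q) → ℝ := fun i => ‖smooth (tw (ev i.2) Λ') y‖ with hf
  have hf0 : ∀ i, 0 ≤ f i := fun i => norm_nonneg _
  have hphi : ∀ i ∈ primPairs e Q, (1 : ℝ) ≤ i.1.totient := fun i hi => by
    exact_mod_cast Nat.totient_pos.2 (mem_primPairs.1 hi).1.1
  have hsplit : ∀ i ∈ primPairs e Q, f i / i.1.totient * L ^ A ≤
      (if (i.1 : ℝ) ≤ L ^ (2 * B₁) then f i * L ^ A else 0) + 2 * f i * (L ^ B₁)⁻¹ * L ^ A := by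
    intro i hi
    have h1 := hphi i hi
    split_ifs with hs
    · refine (mul_le_mul_of_nonneg_right (div_le_self (hf0 i) h1) (by positivity)).trans ?_
      exact le_add_of_nonneg_right (mul_nonneg (mul_nonneg (mul_nonneg zero_le_two (hf0 i))
        (by positivity)) (by positivity))
    · rw [zero_add]
      refine mul_le_mul_of_nonneg_right ?_ (by positivity)
      rw [← div_eq_mul_inv, div_le_div_iff₀ (by linarith) (by positivity), mul_comm 2, mul_assoc]
      refine mul_le_mul_of_nonneg_left ?_ (hf0 i)
      refine le_trans ?_ (sqrt_le_two_mul_totient i.1)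
      rw [Real.le_sqrt (by positivity) (by positivity), ← pow_mul, mul_comm B₁]
      exact (not_le.1 hs).le
  have hsmall : ∑ i ∈ primPairs e Q, (if (i.1 : ℝ) ≤ L ^ (2 * B₁) then f i * L ^ A else 0) ≤
      C * x := by
    set M := ⌊L ^ (2 * B₁)⌋₊
    have hM : (M : ℝ) ≤ L ^ (2 * B₁) := Nat.floor_le (by positivity)
    rw [← sum_filter]
    have hsub : (primPairs e Q).filter (fun i => (i.1 : ℝ) ≤ L ^ (2 * B₁)) ⊆ primPairs e M := by
      intro i hi
      rw [mem_filter, mem_primPairs] at hi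
      exact mem_primPairs.2 ⟨⟨hi.1.1.1, Nat.le_floor hi.2⟩, hi.1.2⟩
    refine (sum_le_sum_of_subset_of_nonneg hsub fun i _ _ =>
      mul_nonneg (hf0 i) (by positivity)).trans ?_
    have hterm : ∀ i ∈ primPairs e M, f i * L ^ A ≤ C * x / L ^ (4 * B₁) := by
      intro i hi
      obtain ⟨⟨h1, h2⟩, ⟨h3, h4⟩, h5⟩ := mem_primPairs.1 hi
      have : NeZero i.1 := ⟨by omega⟩
      have hi1 : (1 : ℝ) ≤ i.1 := by exact_mod_cast h1
      have hiM : (i.1 : ℝ) ≤ L ^ (2 * B₁) := le_trans (by exact_mod_cast h2) hM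
      have h6 : H * (i.1 : ℝ) ^ 2 ≤ L ^ (B + 4 * B₁) := by
        calc H * (i.1 : ℝ) ^ 2 ≤ L ^ B * (L ^ (2 * B₁)) ^ 2 := by gcongr
          _ = L ^ (B + 4 * B₁) := by ring
      have h7 := hSW _ _ _ (H * (i.1 : ℝ) ^ 2) x hL hx (h.datum.twist (isCM_ev i.2))
        (one_le_mul_of_one_le_of_one_le hH (one_le_pow₀ hi1)) h6 (h.bound i.1 i.2 h3 h5 h4)
        (h.lower i.1 i.2 h3 h5 h4) y hy hyx
      rw [le_div_iff₀ (by positivity), mul_assoc, ← pow_add]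
      exact h7
    refine (sum_le_sum hterm).trans ?_
    rw [sum_const, nsmul_eq_mul, mul_div_assoc', div_le_iff₀ (by positivity), mul_comm]
    refine mul_le_mul_of_nonneg_left ?_ (by positivity)
    calc ((primPairs e M).card : ℝ) ≤ (M : ℝ) ^ 2 := by exact_mod_cast card_primPairs_le e M
      _ ≤ (L ^ (2 * B₁)) ^ 2 := by gcongr
      _ = L ^ (4 * B₁) := by ring
  have hlarge : ∑ i ∈ primPairs e Q, f i ≤
      (Q : ℝ) ^ 2 * (6 * (H * Q ^ 2) * (1 + L) ^ 4 * (√x * (Q ^ 4 : ℕ))) +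
        1152 * kernelConst * (1 + L) ^ 65 * x := by
    have hQ1 : (1 : ℝ) ≤ Q := by exact_mod_cast hQ
    refine (sum_norm_smooth_tw_der_le h.datum (primPairs e Q) (Q := Q) (V := Q ^ 4)
      (fun i hi => ?_) (Nat.one_le_pow _ _ hQ) ?_ (H := H * Q ^ 2)
      (one_le_mul_of_one_le_of_one_le hH (one_le_pow₀ hQ1)) hx1 hy hyx ?_ ?_).trans ?_
    · obtain ⟨⟨h1, h2⟩, _, h5⟩ := mem_primPairs.1 hi
      exact ⟨by omega, h2, h5⟩
    · calc (primPairs e Q).card * Q ^ 2 ≤ Q ^ 2 * Q ^ 2 :=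
          Nat.mul_le_mul_right _ (card_primPairs_le e Q)
        _ = Q ^ 4 := by ring
    · push_cast
      refine le_trans ?_ hQx
      rw [← pow_mul]
      exact pow_le_pow_right₀ hQ1 (by norm_num)
    · intro i hi N
      obtain ⟨⟨h1, h2⟩, ⟨h3, h4⟩, h5⟩ := mem_primPairs.1 hi
      have : NeZero i.1 := ⟨by omega⟩
      refine (h.bound i.1 i.2 h3 h5 h4 N).trans ?_
      gcongr
    · gcongr
      exact_mod_cast card_primPairs_le e Q
  rw [sum_mul]
  refine (sum_le_sum hsplit).trans ?_
  rw [sum_add_distrib, ← sum_mul, ← sum_mul, ← mul_sum, add_mul]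
  refine add_le_add hsmall ?_
  have h1L : 1 + L ≤ 2 * L := by linarith
  have hB1L : 1 ≤ L ^ B₁ := one_le_pow₀ hL
  have hA1 : 2 * (∑ i ∈ primPairs e Q, f i) * (L ^ B₁)⁻¹ * L ^ A ≤
      2 * ((Q : ℝ) ^ 2 * (6 * (L ^ B * Q ^ 2) * (2 * L) ^ 4 * (√x * Q ^ 4)) * 1 +
        1152 * kernelConst * (2 * L) ^ 65 * x * (L ^ B₁)⁻¹) * L ^ A := by
    rw [mul_assoc 2]
    refine mul_le_mul_of_nonneg_right (mul_le_mul_of_nonneg_left ?_ zero_le_two) (by positivity)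
    refine (mul_le_mul_of_nonneg_right hlarge (by positivity)).trans ?_
    rw [add_mul]
    push_cast
    gcongr
    exact inv_le_one_of_one_le₀ hB1L
  refine hA1.trans ?_
  have h3 := pow_eight_mul_sqrt_le hx hQx (B + 4 + A)
  have e1 : L ^ B₁ = L ^ A * L ^ 65 := by rw [hB₁, pow_add]
  calc _ = 192 * ((Q : ℝ) ^ 8 * √x * L ^ (B + 4 + A)) +
        2 * (1152 * kernelConst * 2 ^ 65) * x := by
        rw [e1]
        field_simp
        ring
    _ ≤ 192 * (18 ^ (B + 4 + A) * (B + 4 + A).factorial * x) +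
        2 * (1152 * kernelConst * 2 ^ 65) * x := by gcongr
    _ = _ := by ring

section
open DirichletCharacter

/-- The indicator function of a residue class. -/
def resInd (q a n : ℕ) : ℂ := if n ≡ a [MOD q] then 1 else 0

theorem smooth_tw_sum {ι : Type*} (s : Finset ι) (w : ι → ℂ) (F : ι → ℕ → ℂ) (f : 𝓐) (y : ℝ) :
    smooth (tw (fun n => ∑ i ∈ s, w i * F i n) f) y = ∑ i ∈ s, w i * smooth (tw (F i) f) y := by
  simp only [smooth, tw_apply, sum_mul, mul_sum]
  rw [sum_comm]
  refine sum_congr rfl fun i _ => sum_congr rfl fun n _ => ?_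
  ring

theorem smooth_tw_resInd {q a : ℕ} [NeZero q] (ha : a.Coprime q) (f : 𝓐)
    (y : ℝ) : smooth (tw (resInd q a) f) y = ∑ χ : 𝓧 q, (q.totient : ℂ)⁻¹ * χ (a : ZMod q)⁻¹ *
        smooth (tw (ev χ) f) y := by
  rw [← smooth_tw_sum]
  congr 2
  funext n
  have h := sum_char_inv_mul_char_eq ℂ ((ZMod.isUnit_iff_coprime a q).2 ha) (n : ZMod q)
  have h0 : (q.totient : ℂ) ≠ 0 := by exact_mod_cast (Nat.totient_pos.2 (NeZero.pos q)).ne'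
  simp only [mul_assoc, ev]
  rw [← mul_sum, h, resInd]
  by_cases hn : n ≡ a [MOD q]
  · rw [if_pos hn, if_pos ((ZMod.natCast_eq_natCast_iff a n q).2 hn.symm), inv_mul_cancel₀ h0]
  · rw [if_neg hn, if_neg fun h => hn ((ZMod.natCast_eq_natCast_iff a n q).1 h).symm, mul_zero]

theorem norm_smooth_tw_resInd_sub_le (e : Prop) [Decidable e] {q a : ℕ} [NeZero q]
    (ha : a.Coprime q) (f : 𝓐) (y : ℝ)
    [DecidablePred fun χ : 𝓧 q => e → χ ≠ 1] :
    ‖smooth (tw (resInd q a) f) y -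
      (if e then (q.totient : ℂ)⁻¹ * smooth (tw (ev (1 : 𝓧 q)) f) y else 0)‖ ≤
      (q.totient : ℝ)⁻¹ * ∑ χ : 𝓧 q with e → χ ≠ 1, ‖smooth (tw (ev χ) f) y‖ := by
  classical
  have key : smooth (tw (resInd q a) f) y -
      (if e then (q.totient : ℂ)⁻¹ * smooth (tw (ev (1 : 𝓧 q)) f) y else 0) =
      ∑ χ : 𝓧 q with e → χ ≠ 1, (q.totient : ℂ)⁻¹ * χ (a : ZMod q)⁻¹ * smooth (tw (ev χ) f) y := by
    rw [smooth_tw_resInd ha, sub_eq_iff_eq_add,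
      ← sum_filter_add_sum_filter_not _ (fun χ => e → χ ≠ 1)]
    congr 1
    split_ifs with he
    · have : (univ.filter fun χ : 𝓧 q => ¬ (e → χ ≠ 1)) = {1} := by
        ext χ
        simp [he]
      rw [this, sum_singleton, MulChar.one_apply, mul_one]
      have hu := (ZMod.isUnit_iff_coprime a q).2 ha
      rw [← ZMod.coe_unitOfCoprime a ha, ZMod.inv_coe_unit]
      exact Units.isUnit _
    · refine sum_eq_zero fun χ hχ => ?_
      exact absurd (fun h => absurd h he) (mem_filter.1 hχ).2
  rw [key, mul_sum]
  refine (norm_sum_le _ _).trans (sum_le_sum fun χ _ => ?_)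
  rw [norm_mul, norm_mul, norm_inv, norm_natCast]
  refine mul_le_mul_of_nonneg_right ?_ (norm_nonneg _)
  exact mul_le_of_le_one_right (by positivity) (χ.norm_le_one _)

/-- A sum of the von Mangoldt function over powers of the primes up to `M`. -/
theorem sum_vonMangoldt_filter_le {N M : ℕ} {L : ℝ} (hL : 1 ≤ L) (hN : log N ≤ L) (P : ℕ → Prop)
    [DecidablePred P] (hP : ∀ p k : ℕ, p.Prime → 0 < k → p ^ k ≤ N → P (p ^ k) → p ≤ M) :
    ∑ n ∈ Ioc 0 N with P n, vonMangoldt n ≤ 3 * M * L ^ 2 := by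
  classical
  have hlog : (Nat.log 2 N : ℝ) ≤ 2 * L := by
    refine (Real.natLog_le_logb N 2).trans ?_
    rw [logb, div_le_iff₀ (log_pos (by norm_num))]
    have := Real.log_two_gt_d9
    push_cast
    nlinarith
  have hsub : ((Ioc 0 N).filter P).filter (fun n => vonMangoldt n ≠ 0) ⊆
      ((Ioc 0 M) ×ˢ (range (Nat.log 2 N + 1))).image fun i => i.1 ^ i.2 := by
    intro n hn
    rw [mem_filter, mem_filter, mem_Ioc, vonMangoldt_ne_zero_iff, isPrimePow_nat_iff] at hn
    obtain ⟨⟨⟨hn0, hnN⟩, hc⟩, p, k, hp, hk, rfl⟩ := hn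
    refine mem_image.2 ⟨(p, k), mem_product.2 ⟨mem_Ioc.2 ⟨hp.pos, hP p k hp hk hnN hc⟩,
      mem_range.2 (Nat.lt_succ_of_le (Nat.le_log_of_pow_le one_lt_two ?_))⟩, rfl⟩
    exact (Nat.pow_le_pow_left hp.two_le k).trans hnN
  rw [← sum_filter_ne_zero]
  refine (sum_le_card_nsmul _ _ L fun n hn => ?_).trans ?_
  · rw [mem_filter, mem_filter, mem_Ioc] at hn
    refine vonMangoldt_le_log.trans (le_trans ?_ hN)
    exact log_le_log (by exact_mod_cast hn.1.1.1) (by exact_mod_cast hn.1.1.2)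
  · have h := (card_le_card hsub).trans card_image_le
    rw [card_product, card_range, Nat.card_Ioc, tsub_zero] at h
    rw [nsmul_eq_mul]
    calc _ ≤ ((M * (Nat.log 2 N + 1) : ℕ) : ℝ) * L := by gcongr
      _ ≤ M * (3 * L) * L := by
        push_cast
        gcongr
        linarith
      _ = 3 * M * L ^ 2 := by ring

theorem sum_vonMangoldt_not_coprime_le {q N : ℕ} (hq : q ≠ 0) {L : ℝ} (hL : 1 ≤ L)
    (hN : log N ≤ L) : ∑ n ∈ Ioc 0 N with ¬ n.Coprime q, vonMangoldt n ≤ 3 * q * L ^ 2 :=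
  sum_vonMangoldt_filter_le hL hN _ fun _ k hp _ _ h =>
    Nat.le_of_dvd hq.bot_lt (by_contra fun hd =>
      h (Nat.Coprime.pow_left k ((Nat.Prime.coprime_iff_not_dvd hp).2 hd)))

theorem norm_smooth_tw_le_primitive {q : ℕ} [NeZero q] (χ : 𝓧 q)
    {f : 𝓐} (hf : ∀ n, ‖f n‖ ≤ 2 * vonMangoldt n) {x y : ℝ}
    (hL : 1 ≤ log x) (hy : 1 ≤ y) (hyx : y ≤ x) :
    ‖smooth (tw (ev χ) f) y‖ ≤ ‖smooth (tw (ev χ.primitiveCharacter) f) y‖ + 6 * q * log x ^ 3 := by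
  have hyN : (⌊y⌋₊ : ℝ) ≤ y := Nat.floor_le (by linarith)
  have hN : log ⌊y⌋₊ ≤ log x := by
    have : 1 ≤ ⌊y⌋₊ := Nat.le_floor (by exact_mod_cast hy)
    exact log_le_log (by exact_mod_cast this) (by linarith)
  have key : ‖smooth (tw (ev χ) f) y - smooth (tw (ev χ.primitiveCharacter) f) y‖ ≤
      ∑ n ∈ Ioc 0 ⌊y⌋₊ with ¬ n.Coprime q, log x * (2 * vonMangoldt n) := by
    rw [smooth, smooth, ← sum_sub_distrib, sum_filter]
    refine (norm_sum_le _ _).trans (sum_le_sum fun n hn => ?_)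
    rw [mem_Ioc] at hn
    have hn1 : (1 : ℝ) ≤ n := by exact_mod_cast hn.1
    have hny : (n : ℝ) ≤ y := (by exact_mod_cast hn.2 : (n : ℝ) ≤ ⌊y⌋₊).trans hyN
    rw [tw_apply, tw_apply, ← mul_sub, ← sub_mul]
    split_ifs with hc
    · have h : ev χ n = ev χ.primitiveCharacter n := by
        conv_lhs => rw [← changeLevel_primitiveCharacter χ]
        exact ev_changeLevel _ _ hc
      rw [h, sub_self, zero_mul, mul_zero, norm_zero]
    · rw [ev_eq_zero χ hc, zero_sub, norm_mul, norm_mul, norm_neg, norm_real,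
        norm_of_nonneg (log_div_nonneg hn.1 hny)]
      refine mul_le_mul ?_ ?_ (by positivity) (by linarith)
      · refine log_le_log (by positivity) ((div_le_self (by linarith) hn1).trans hyx)
      · exact (mul_le_of_le_one_left (norm_nonneg _)
          ((isCM_ev χ.primitiveCharacter).norm_le n)).trans (hf n)
  rw [← mul_sum, ← mul_sum] at key
  have h2 := sum_vonMangoldt_not_coprime_le (NeZero.ne q) hL hN
  have h3 : log x * (2 * ∑ n ∈ Ioc 0 ⌊y⌋₊ with ¬ n.Coprime q, vonMangoldt n) ≤
      log x * (2 * (3 * q * log x ^ 2)) := by gcongr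
  have h4 := norm_sub_norm_le (smooth (tw (ev χ) f) y) (smooth (tw (ev χ.primitiveCharacter) f) y)
  linarith

theorem sum_inv_totient_le (Q : ℕ) : ∑ m ∈ Icc 1 Q, (m.totient : ℝ)⁻¹ ≤ (1 + log Q) ^ 2 := by
  have h := sum_dcount_pow_div_le Q 1
  refine le_trans ?_ (by simpa using h)
  refine sum_le_sum fun m hm => ?_
  have hm1 : 1 ≤ m := (mem_Icc.1 hm).1
  have h1 : (0 : ℝ) < m.totient := by exact_mod_cast Nat.totient_pos.2 hm1
  have h2 : (0 : ℝ) < m := by exact_mod_cast hm1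
  rw [← div_eq_mul_inv, inv_eq_one_div, div_le_div_iff₀ h1 h2, one_mul, mul_comm]
  exact le_totient_mul_dcount m

theorem sum_inv_totient_le_log {Q : ℕ} {x : ℝ} (hL : 1 ≤ log x) (hQ : 1 ≤ Q)
    (hQx : (Q : ℝ) ^ 18 ≤ x) : ∑ m ∈ Icc 1 Q, (m.totient : ℝ)⁻¹ ≤ 4 * log x ^ 2 := by
  have hQ1 : (1 : ℝ) ≤ Q := by exact_mod_cast hQ
  have hQL := log_le_log (by linarith) ((le_self_pow₀ hQ1 (by norm_num)).trans hQx)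
  have := log_nonneg hQ1
  calc _ ≤ (1 + log Q) ^ 2 := sum_inv_totient_le Q
    _ ≤ (log x + log x) ^ 2 := by gcongr
    _ = 4 * log x ^ 2 := by ring

theorem sum_primitiveCharacter_le (e : Prop) {Q q : ℕ} [NeZero q] (hq : Odd q) (hqQ : q ≤ Q)
    [DecidablePred fun χ : 𝓧 q => e → χ ≠ 1]
    {g : (Σ q, 𝓧 q) → ℝ} (hg : ∀ i, 0 ≤ g i) :
    ∑ χ : 𝓧 q with e → χ ≠ 1, g ⟨χ.conductor, χ.primitiveCharacter⟩ ≤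
      ∑ i ∈ primPairs e Q with i.1 ∣ q, g i := by
  classical
  have hinj : Function.Injective fun χ : 𝓧 q =>
      (⟨χ.conductor, χ.primitiveCharacter⟩ : Σ q, 𝓧 q) := by
    intro χ ψ h
    have key : ∀ (i : Σ q, 𝓧 q) (h1 : i.1 ∣ q) (j : Σ q, 𝓧 q)
        (h2 : j.1 ∣ q), i = j → changeLevel h1 i.2 = changeLevel h2 j.2 := by
      rintro i h1 j h2 rfl
      rfl
    have := key _ χ.conductor_dvd_level _ ψ.conductor_dvd_level h
    rwa [changeLevel_primitiveCharacter, changeLevel_primitiveCharacter] at this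
  rw [← sum_image (f := g) (g := fun χ : 𝓧 q =>
      (⟨χ.conductor, χ.primitiveCharacter⟩ : Σ q, 𝓧 q)) hinj.injOn]
  refine sum_le_sum_of_subset_of_nonneg (fun i hi => ?_) fun i _ _ => hg i
  obtain ⟨χ, hχ, rfl⟩ := mem_image.1 hi
  have hd := χ.conductor_dvd_level
  have hc0 : 0 < χ.conductor := Nat.pos_of_dvd_of_pos hd (NeZero.pos q)
  rw [mem_filter, mem_primPairs]
  refine ⟨⟨⟨hc0, (Nat.le_of_dvd (NeZero.pos q) hd).trans hqQ⟩, ⟨hq.of_dvd_nat hd, fun he h1 => ?_⟩,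
    primitiveCharacter_isPrimitive χ⟩, hd⟩
  exact (mem_filter.1 hχ).2 he (eq_one_iff_conductor_eq_one.2 h1)

theorem sum_inv_totient_dvd_le {Q d : ℕ} (hd : 1 ≤ d) :
    ∑ q ∈ Icc 1 Q with d ∣ q, (q.totient : ℝ)⁻¹ ≤
      (d.totient : ℝ)⁻¹ * ∑ m ∈ Icc 1 Q, (m.totient : ℝ)⁻¹ := by
  have hsub : ((Icc 1 Q).filter fun q => d ∣ q) ⊆ (Icc 1 Q).image (d * ·) := by
    intro q hq
    rw [mem_filter, mem_Icc] at hq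
    obtain ⟨⟨h1, h2⟩, m, rfl⟩ := hq
    refine mem_image.2 ⟨m, mem_Icc.2 ⟨Nat.pos_of_ne_zero ?_, ?_⟩, rfl⟩
    · rintro rfl
      omega
    · exact (Nat.le_mul_of_pos_left m hd).trans h2
  refine (sum_le_sum_of_subset_of_nonneg hsub fun i _ _ => by positivity).trans ?_
  rw [sum_image fun a _ b _ h => Nat.eq_of_mul_eq_mul_left hd h, mul_sum]
  refine sum_le_sum fun m hm => ?_
  rw [← mul_inv]
  have h1 : 0 < d.totient := Nat.totient_pos.2 hd
  have h2 : 0 < m.totient := Nat.totient_pos.2 (mem_Icc.1 hm).1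
  refine inv_anti₀ (by positivity) ?_
  exact_mod_cast Nat.totient_super_multiplicative d m

end

/-- The error term in the prime number theorem for a residue class, with smooth weights. -/
def bvErr (e : Prop) (f : 𝓐) (y : ℝ) (q a : ℕ) : ℂ := by
  classical exact smooth (tw (resInd q a) f) y -
    (if e then (q.totient : ℂ)⁻¹ * smooth (tw (ev (1 : 𝓧 q)) f) y else 0)

theorem norm_bvErr_le {e : Prop} {f : 𝓐} (hf : ∀ n, ‖f n‖ ≤ 2 * vonMangoldt n)
    {x y : ℝ} (hL : 1 ≤ log x) (hy : 1 ≤ y) (hyx : y ≤ x) {Q q a : ℕ} (hq : Odd q)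
    (hqQ : q ≤ Q) (ha : a.Coprime q) :
    ‖bvErr e f y q a‖ ≤ (q.totient : ℝ)⁻¹ *
      (∑ i ∈ primPairs e Q with i.1 ∣ q, ‖smooth (tw (ev i.2) f) y‖) +
      6 * q * log x ^ 3 := by
  classical
  have : NeZero q := ⟨hq.pos.ne'⟩
  have h1 := norm_smooth_tw_resInd_sub_le e ha f y
  have h2 := sum_primitiveCharacter_le e hq hqQ
    (g := fun i => ‖smooth (tw (ev i.2) f) y‖) fun i => norm_nonneg _
  have hcard : (((univ : Finset (𝓧 q)).filter fun χ => e → χ ≠ 1).card : ℝ) ≤ q.totient := by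
    have h := card_filter_le (univ : Finset (𝓧 q)) fun χ => e → χ ≠ 1
    rw [card_univ, ← Nat.card_eq_fintype_card,
      DirichletCharacter.card_eq_totient_of_hasEnoughRootsOfUnity] at h
    exact_mod_cast h
  have hφ : (0 : ℝ) < q.totient := by exact_mod_cast Nat.totient_pos.2 hq.pos
  have h3 : ∑ χ : 𝓧 q with e → χ ≠ 1, ‖smooth (tw (ev χ) f) y‖ ≤
      ∑ i ∈ primPairs e Q with i.1 ∣ q, ‖smooth (tw (ev i.2) f) y‖ +
        q.totient * (6 * q * log x ^ 3) := by
    refine (sum_le_sum fun χ _ => norm_smooth_tw_le_primitive χ hf hL hy hyx).trans ?_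
    rw [sum_add_distrib, sum_const, nsmul_eq_mul]
    refine add_le_add h2 ?_
    gcongr
  have h4 : ‖bvErr e f y q a‖ ≤ (q.totient : ℝ)⁻¹ *
      ∑ χ : 𝓧 q with e → χ ≠ 1, ‖smooth (tw (ev χ) f) y‖ := by
    rw [bvErr]
    convert h1 using 1
  refine h4.trans ((mul_le_mul_of_nonneg_left h3 (by positivity)).trans (le_of_eq ?_))
  field_simp

/-- The Bombieri–Vinogradov theorem for an admissible arithmetic function. -/
theorem exists_sum_bvErr_le {c : ℝ → ℝ} (hc : ∀ δ, 0 < δ → 0 < c δ) (A B : ℕ) :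
    ∃ C : ℝ, 0 < C ∧ ∀ (e : Prop) (H : ℝ) (r μ' Λ' : 𝓐) (x y : ℝ) (Q : ℕ)
      (a : ℕ → ℕ), Admissible e c H r μ' Λ' → 1 ≤ log x → 1 ≤ x → H ≤ log x ^ B →
      1 ≤ Q → (Q : ℝ) ^ 18 ≤ x → 1 ≤ y → y ≤ x → (∀ q, (a q).Coprime q) →
      (∑ q ∈ Icc 1 Q with Odd q, ‖bvErr e Λ' y q (a q)‖) * log x ^ A ≤ C * x := by
  obtain ⟨C, hC, hS⟩ := exists_sum_primPairs_le hc (A + 2) B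
  refine ⟨4 * C + 6 * (18 ^ (A + 3) * (A + 3).factorial), by positivity, ?_⟩
  intro e H r μ' Λ' x y Q a h hL hx hHB hQ hQx hy hyx ha
  classical
  have hS' := hS e H r μ' Λ' x y Q h hL hx hHB hQ hQx hy hyx
  set L := log x with hLdef
  set T := ∑ i ∈ primPairs e Q, ‖smooth (tw (ev i.2) Λ') y‖ / i.1.totient with hT
  have hT0 : 0 ≤ T := sum_nonneg fun i _ => by positivity
  have hL0 : 0 ≤ L := by linarith
  have hQ1 : (1 : ℝ) ≤ Q := by exact_mod_cast hQ
  have hφsum := sum_inv_totient_le_log hL hQ hQx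
  rw [← hLdef] at hφsum
  have hmain : ∑ q ∈ Icc 1 Q with Odd q, ‖bvErr e Λ' y q (a q)‖ ≤
      T * (4 * L ^ 2) + 6 * (Q ^ 2 * L ^ 3) := by
    calc _ ≤ ∑ q ∈ Icc 1 Q with Odd q, ((q.totient : ℝ)⁻¹ *
          (∑ i ∈ primPairs e Q with i.1 ∣ q, ‖smooth (tw (ev i.2) Λ') y‖) + 6 * Q * L ^ 3) := by
          refine sum_le_sum fun q hq => ?_
          obtain ⟨hq, hodd⟩ := mem_filter.1 hq
          have hqQ := (mem_Icc.1 hq).2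
          refine (norm_bvErr_le h.datum.norm_der hL hy hyx hodd hqQ (ha q)).trans ?_
          gcongr
      _ ≤ ∑ q ∈ Icc 1 Q, ((q.totient : ℝ)⁻¹ *
          (∑ i ∈ primPairs e Q with i.1 ∣ q, ‖smooth (tw (ev i.2) Λ') y‖) + 6 * Q * L ^ 3) := by
          refine sum_le_sum_of_subset_of_nonneg (filter_subset _ _) fun i _ _ => ?_
          have := sum_nonneg fun j (_ : j ∈ (primPairs e Q).filter fun j => j.1 ∣ i) =>
            norm_nonneg (smooth (tw (ev j.2) Λ') y)
          positivity
      _ = ∑ i ∈ primPairs e Q, ‖smooth (tw (ev i.2) Λ') y‖ *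
            (∑ q ∈ Icc 1 Q with i.1 ∣ q, (q.totient : ℝ)⁻¹) + 6 * (Q ^ 2 * L ^ 3) := by
          rw [sum_add_distrib, sum_const, Nat.card_Icc, nsmul_eq_mul]
          congr 1
          · simp only [mul_sum, sum_filter]
            rw [sum_comm]
            refine sum_congr rfl fun i _ => sum_congr rfl fun q _ => ?_
            split_ifs <;> ring
          · push_cast
            ring
      _ ≤ T * (4 * L ^ 2) + 6 * (Q ^ 2 * L ^ 3) := by
          rw [hT, sum_mul]
          refine add_le_add (sum_le_sum fun i hi => ?_) le_rfl
          have hi1 := (mem_primPairs.1 hi).1.1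
          refine (mul_le_mul_of_nonneg_left ((sum_inv_totient_dvd_le hi1).trans
            (mul_le_mul_of_nonneg_left hφsum (by positivity)))
              (norm_nonneg (smooth (tw (ev i.2) Λ') y))).trans (le_of_eq ?_)
          rw [div_eq_mul_inv]
          ring
  have hQQ : (Q : ℝ) ^ 2 * L ^ (A + 3) ≤ 18 ^ (A + 3) * (A + 3).factorial * x := by
    refine le_trans ?_ (pow_eight_mul_sqrt_le hx hQx (A + 3))
    have h1 : (1 : ℝ) ≤ √x := one_le_sqrt.2 hx
    have h2 : (Q : ℝ) ^ 2 ≤ Q ^ 8 := pow_le_pow_right₀ hQ1 (by norm_num)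
    gcongr
    exact h2.trans (le_mul_of_one_le_right (by positivity) h1)
  calc _ ≤ (T * (4 * L ^ 2) + 6 * (Q ^ 2 * L ^ 3)) * L ^ A := by gcongr
    _ = 4 * (T * L ^ (A + 2)) + 6 * (Q ^ 2 * L ^ (A + 3)) := by ring
    _ ≤ 4 * (C * x) + 6 * (18 ^ (A + 3) * (A + 3).factorial * x) := by gcongr
    _ = _ := by ring

theorem hasSum_cos_div_sq {x : ℝ} (hx : 0 ≤ x) (hx1 : x ≤ 1) :
    HasSum (fun n : ℕ => 1 / (n : ℝ) ^ 2 * cos (2 * π * n * x)) (π ^ 2 * (x ^ 2 - x + 1 / 6)) := by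
  have h := hasSum_one_div_nat_pow_mul_cos one_ne_zero (Set.mem_Icc.2 ⟨hx, hx1⟩)
  have hb : (Polynomial.map (algebraMap ℚ ℝ) (Polynomial.bernoulli (2 * 1))).eval x =
      x ^ 2 - x + 1 / 6 := by
    rw [Polynomial.bernoulli_def]
    simp [sum_range_succ, bernoulli_two]
    ring
  rw [hb] at h
  convert h using 1
  simp
  ring

/-- The trapezoidal function equal to `1` on `[0, a]`, to `0` on `[b, ∞)` and affine between. -/
def trap (a b u : ℝ) : ℝ := (max b u - max a u) / (b - a)

theorem trap_nonneg {a b : ℝ} (hab : a < b) (u : ℝ) : 0 ≤ trap a b u :=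
  div_nonneg (sub_nonneg.2 (max_le_max_right u hab.le)) (by linarith)

theorem trap_le_one {a b : ℝ} (hab : a < b) (u : ℝ) : trap a b u ≤ 1 := by
  rw [trap, div_le_one (by linarith)]
  rcases max_cases b u with h | h <;> rcases max_cases a u with h' | h' <;> linarith

theorem trap_of_le {a b u : ℝ} (hab : a < b) (hu : u ≤ a) : trap a b u = 1 := by
  rw [trap, max_eq_left hu, max_eq_left (hu.trans hab.le), div_self (by linarith)]

theorem trap_of_ge {a b u : ℝ} (hab : a < b) (hu : b ≤ u) : trap a b u = 0 := by
  rw [trap, max_eq_right hu, max_eq_right (hab.le.trans hu), sub_self, zero_div]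

/-- The Fourier coefficients of `trap a b`. -/
def trapCoeff (a b : ℝ) (k : ℕ) : ℝ := (cos (2 * π * k * a) - cos (2 * π * k * b)) /
    (π ^ 2 * (k : ℝ) ^ 2 * (b - a))

theorem abs_trapCoeff_le {a b : ℝ} (hab : a < b) (k : ℕ) :
    |trapCoeff a b k| ≤ (b - a)⁻¹ * ((k : ℝ) ^ 2)⁻¹ := by
  rcases Nat.eq_zero_or_pos k with rfl | hk
  · simp [trapCoeff]
  have hk' : (0 : ℝ) < k := by exact_mod_cast hk
  have hba : 0 < b - a := by linarith
  have hpi : (2 : ℝ) ≤ π ^ 2 := by nlinarith [Real.pi_gt_three]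
  rw [trapCoeff, abs_div, abs_of_pos (a := π ^ 2 * (k : ℝ) ^ 2 * (b - a)) (by positivity),
    ← mul_inv, ← one_div, div_le_div_iff₀ (by positivity) (by positivity)]
  have h1 : |cos (2 * π * k * a) - cos (2 * π * k * b)| ≤ 2 := by
    refine (abs_sub _ _).trans ?_
    have := Real.abs_cos_le_one (2 * π * k * a)
    have := Real.abs_cos_le_one (2 * π * k * b)
    linarith
  calc _ ≤ π ^ 2 * ((b - a) * (k : ℝ) ^ 2) := by
        gcongr
        exact h1.trans hpi
    _ = _ := by ring

theorem hasSum_of_eq {f g : ℕ → ℝ} {s t : ℝ} (h : HasSum f s) (hfg : ∀ n, g n = f n)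
    (hst : t = s) : HasSum g t := by
  rw [hst, funext hfg]
  exact h

theorem hasSum_trapCoeff {a b u : ℝ} (ha : 0 ≤ a) (hab : a < b) (hb : b ≤ 1 / 2) (hu : 0 ≤ u)
    (hu2 : u ≤ 1 / 2) :
    HasSum (fun k : ℕ => trapCoeff a b k * cos (2 * π * k * u)) (trap a b u - (a + b)) := by
  have key : ∀ c : ℝ, 0 ≤ c → c ≤ 1 / 2 → HasSum (fun k : ℕ => 1 / (k : ℝ) ^ 2 *
        (cos (2 * π * k * c) * cos (2 * π * k * u)))
        (π ^ 2 * (c ^ 2 + u ^ 2 - max c u + 1 / 6)) := by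
    intro c hc hc2
    have h1 := hasSum_cos_div_sq (x := c + u) (by linarith) (by linarith)
    have h2 := hasSum_cos_div_sq (x := |c - u|) (abs_nonneg _) (abs_le.2 ⟨by linarith, by linarith⟩)
    refine hasSum_of_eq ((h1.add h2).mul_left (1 / 2)) (fun k => ?_) ?_
    · have e1 : cos (2 * π * k * |c - u|) = cos (2 * π * k * c - 2 * π * k * u) := by
        rcases abs_cases (c - u) with h | h
        · rw [h.1]
          congr 1
          ring
        · rw [h.1, ← Real.cos_neg]
          congr 1
          ring
      rw [e1, show 2 * π * k * (c + u) = 2 * π * k * c + 2 * π * k * u by ring,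
        Real.cos_add, Real.cos_sub]
      ring
    · rcases max_cases c u with h | h
      · rw [h.1, abs_of_nonneg (by linarith)]
        ring
      · rw [h.1, abs_of_neg (by linarith)]
        ring
  have h := ((key a ha (by linarith)).sub (key b (by linarith) hb)).mul_left ((π ^ 2 * (b - a))⁻¹)
  have hpi := pi_ne_zero
  have hba : b - a ≠ 0 := by linarith
  refine hasSum_of_eq h (fun k => ?_) ?_
  · rw [trapCoeff, div_eq_mul_inv, mul_right_comm (π ^ 2), mul_inv, one_div]
    ring
  · rw [trap]
    field_simp
    ring

theorem sum_abs_trapCoeff_le {a b : ℝ} (hab : a < b) (K : ℕ) :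
    ∑ k ∈ Icc 1 K, |trapCoeff a b k| ≤ 2 * (b - a)⁻¹ := by
  have hba : 0 < b - a := by linarith
  refine (sum_le_sum fun k _ => abs_trapCoeff_le hab k).trans ?_
  rw [← mul_sum, mul_comm]
  refine mul_le_mul_of_nonneg_right ?_ (by positivity)
  have h := sum_Ioo_inv_sq_le (α := ℝ) 0 (K + 1)
  have e : Ioo 0 (K + 1) = Icc 1 K := by
    ext k
    simp only [mem_Ioo, mem_Icc]
    omega
  rw [e] at h
  simpa using h

theorem abs_trap_sub_sum_le {a b u : ℝ} (ha : 0 ≤ a) (hab : a < b) (hb : b ≤ 1 / 2) (hu : 0 ≤ u)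
    (hu2 : u ≤ 1 / 2) {K : ℕ} (hK : 1 ≤ K) :
    |trap a b u - (a + b) - ∑ k ∈ Icc 1 K, trapCoeff a b k * cos (2 * π * k * u)| ≤
      (b - a)⁻¹ * (K : ℝ)⁻¹ := by
  have hba : 0 < b - a := by linarith
  have h := (hasSum_trapCoeff ha hab hb hu hu2).tendsto_sum_nat
  have h2 := (h.sub_const (∑ k ∈ Icc 1 K, trapCoeff a b k * cos (2 * π * k * u))).abs
  refine le_of_tendsto h2 ?_
  filter_upwards [Filter.eventually_ge_atTop (K + 1)] with n hn
  have e : range n = insert 0 (Icc 1 K) ∪ Ioc K (n - 1) := by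
    ext k
    simp only [mem_union, mem_insert, mem_Icc, mem_Ioc, mem_range]
    omega
  have hdisj : Disjoint (insert 0 (Icc 1 K)) (Ioc K (n - 1)) := by
    rw [disjoint_left]
    intro k
    simp only [mem_insert, mem_Icc, mem_Ioc]
    omega
  have h0 : trapCoeff a b 0 = 0 := by simp [trapCoeff]
  rw [e, sum_union hdisj, sum_insert (by simp), h0, zero_mul, zero_add, add_sub_cancel_left]
  refine (abs_sum_le_sum_abs _ _).trans ?_
  calc _ ≤ ∑ k ∈ Ioc K (n - 1), (b - a)⁻¹ * ((k : ℝ) ^ 2)⁻¹ := by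
        refine sum_le_sum fun k _ => ?_
        rw [abs_mul]
        exact (mul_le_of_le_one_right (abs_nonneg _) (Real.abs_cos_le_one _)).trans
          (abs_trapCoeff_le hab k)
    _ ≤ (b - a)⁻¹ * (K : ℝ)⁻¹ := by
        rw [← mul_sum]
        refine mul_le_mul_of_nonneg_left ?_ (by positivity)
        refine (sum_Ioc_inv_sq_le_sub (by omega) (by omega)).trans ?_
        have : (0 : ℝ) ≤ ((n - 1 : ℕ) : ℝ)⁻¹ := by positivity
        linarith

theorem pow_add_conj_pow {w : ℂ} (hw : w * conj w = 1) {α : ℝ} (hα : w.re = cos α) (k : ℕ) :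
    w ^ k + conj (w ^ k) = ((2 * cos (k * α) : ℝ) : ℂ) := by
  have hsum : w + conj w = 2 * Complex.cos α := by
    rw [Complex.add_conj, hα]
    push_cast
    ring
  have e1 : Complex.exp (α * I) * Complex.exp (-α * I) = 1 := by
    rw [← Complex.exp_add]
    simp
  have hfac : (w - Complex.exp (α * I)) * (w - Complex.exp (-α * I)) = 0 := by
    rw [Complex.cos] at hsum
    linear_combination e1 - hw + w * hsum
  have hcos : ((2 * cos (k * α) : ℝ) : ℂ) = Complex.exp (α * I) ^ k + Complex.exp (-α * I) ^ k := by
    rw [← Complex.exp_nat_mul, ← Complex.exp_nat_mul]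
    push_cast
    rw [Complex.cos]
    ring_nf
  rw [hcos, map_pow]
  rcases mul_eq_zero.1 hfac with h | h
  · have hw1 := sub_eq_zero.1 h
    have : conj w = Complex.exp (-α * I) := by
      rw [hw1, ← Complex.exp_conj]
      simp
    rw [this, hw1]
  · have hw1 := sub_eq_zero.1 h
    have : conj w = Complex.exp (α * I) := by
      rw [hw1, ← Complex.exp_conj]
      simp
    rw [this, hw1, add_comm]

/-- The normalised angle between a Gaussian prime above `p` and the nearest coordinate axis. -/
def axisAngle (p : ℕ) : ℝ := 2 / π * arcsin (min |((gp p).re : ℝ)| |((gp p).im : ℝ)| / √p)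

theorem re_sq_add_im_sq_gp {p : ℕ} (hp : p.Prime) (h : p % 4 = 1) :
    ((gp p).re : ℝ) ^ 2 + ((gp p).im : ℝ) ^ 2 = p := by
  have h1 := norm_gp hp (by omega)
  rw [Zsqrtd.norm_def] at h1
  have h2 : (gp p).re ^ 2 + (gp p).im ^ 2 = (p : ℤ) := by rw [← h1]; ring
  exact_mod_cast h2

theorem min_abs_sq_mul {a b c : ℝ} (h : a ^ 2 + b ^ 2 = c) :
    min |a| |b| ^ 2 * (c - min |a| |b| ^ 2) = a ^ 2 * b ^ 2 := by
  rcases min_cases |a| |b| with h1 | h1 <;> rw [h1.1, sq_abs, ← h] <;> ring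

theorem two_mul_min_abs_sq_le {a b c : ℝ} (h : a ^ 2 + b ^ 2 = c) : 2 * min |a| |b| ^ 2 ≤ c := by
  rcases min_cases |a| |b| with h1 | h1
  · have := sq_le_sq.2 h1.2
    rw [h1.1, sq_abs]
    linarith
  · have := sq_le_sq.2 h1.2.le
    rw [h1.1, sq_abs]
    linarith

theorem axisAngle_nonneg (p : ℕ) : 0 ≤ axisAngle p := by
  have : 0 ≤ arcsin (min |((gp p).re : ℝ)| |((gp p).im : ℝ)| / √p) :=
    Real.arcsin_nonneg.2 (by positivity)
  have := pi_pos
  rw [axisAngle]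
  positivity

theorem min_div_sqrt_sq_le {p : ℕ} (hp : p.Prime) (h : p % 4 = 1) :
    (min |((gp p).re : ℝ)| |((gp p).im : ℝ)| / √p) ^ 2 ≤ 1 / 2 := by
  have hp0 : (0 : ℝ) < p := by exact_mod_cast hp.pos
  have := two_mul_min_abs_sq_le (re_sq_add_im_sq_gp hp h)
  rw [div_pow, Real.sq_sqrt hp0.le, div_le_iff₀ hp0]
  linarith

theorem axisAngle_le {p : ℕ} (hp : p.Prime) (h : p % 4 = 1) : axisAngle p ≤ 1 / 2 := by
  have h1 := min_div_sqrt_sq_le hp h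
  have h2 : min |((gp p).re : ℝ)| |((gp p).im : ℝ)| / √p ≤ Real.sin (π / 4) := by
    rw [Real.sin_pi_div_four]
    refine abs_le_of_sq_le_sq' ?_ (by positivity) |>.2
    rw [div_pow √2, Real.sq_sqrt (by norm_num)]
    linarith
  have h3 := Real.monotone_arcsin h2
  rw [Real.arcsin_sin (by linarith [pi_pos]) (by linarith [pi_pos])] at h3
  calc axisAngle p ≤ 2 / π * (π / 4) := by
        have := pi_pos
        rw [axisAngle]
        gcongr
    _ = 1 / 2 := by
        have := pi_ne_zero
        field_simp
        norm_num

theorem gA_add_gB_prime {p : ℕ} (hp : p.Prime) (h : p % 4 = 1) (k : ℕ) :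
    gA k p + gB k p = ((2 * cos (2 * π * k * axisAngle p) : ℝ) : ℂ) := by
  have h2 : p ≠ 2 := by rintro rfl; omega
  rw [gA, gB, cmExt_prime _ hp, cmExt_prime _ hp, if_neg (by omega), if_neg (by omega), if_neg h2]
  set z : ℂ := (gp p : ℂ) with hz
  have hp0 : (0 : ℝ) < p := by exact_mod_cast hp.pos
  have hre : z.re = (gp p).re := (GaussianInt.intCast_re _).symm
  have him : z.im = (gp p).im := (GaussianInt.intCast_im _).symm
  have hsum := re_sq_add_im_sq_gp hp h
  have hnorm : ‖z‖ ^ 2 = p := by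
    rw [← normSq_eq_norm_sq, Complex.normSq_apply, hre, him, ← hsum]
    ring
  have hz0 : z ≠ 0 := by
    rintro h0
    rw [h0, norm_zero] at hnorm
    norm_num at hnorm
    exact hp0.ne hnorm
  have hang : ∀ k, ang k z = ang 1 z ^ k := fun k => by rw [ang, ang, mul_one, pow_mul]
  set s := min |((gp p).re : ℝ)| |((gp p).im : ℝ)| / √p with hs
  have hs2 : s ^ 2 ≤ 1 / 2 := min_div_sqrt_sq_le hp h
  have hs3 : s ^ 2 * (1 - s ^ 2) = ((gp p).re : ℝ) ^ 2 * ((gp p).im : ℝ) ^ 2 / p ^ 2 := by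
    rw [← min_abs_sq_mul hsum, hs, div_pow, Real.sq_sqrt hp0.le]
    field_simp
  have hs4 := abs_le_of_sq_le_sq' (a := s) (b := 1) (by linarith) (by norm_num)
  have hre1 : (ang 1 z).re = cos (4 * arcsin s) := by
    have e1 : ang 1 z = z ^ 4 / ((p ^ 2 : ℝ) : ℂ) := by
      rw [ang, mul_one, div_pow, ← hnorm]
      push_cast
      ring
    have e2 : cos (4 * arcsin s) = 1 - 8 * (s ^ 2 * (1 - s ^ 2)) := by
      rw [show 4 * arcsin s = 2 * (2 * arcsin s) by ring, Real.cos_two_mul,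
        Real.cos_two_mul, Real.cos_sq', Real.sin_arcsin hs4.1 hs4.2]
      ring
    have e3 : (z ^ 4).re = (p : ℝ) ^ 2 - 8 * (((gp p).re : ℝ) ^ 2 * ((gp p).im : ℝ) ^ 2) := by
      rw [← hre, ← him, ← hnorm, ← normSq_eq_norm_sq, Complex.normSq_apply]
      simp only [pow_succ, pow_zero, one_mul, mul_re, mul_im]
      ring
    rw [e1, Complex.div_ofReal_re, e3, e2, hs3]
    field_simp
  rw [hang, pow_add_conj_pow (ang_mul_conj 1 hz0) hre1]
  congr 3
  have := pi_ne_zero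
  rw [axisAngle]
  field_simp
  ring

theorem gA_add_gB_prime_of_mod_three {p : ℕ} (hp : p.Prime) (h : p % 4 = 3) (k : ℕ) :
    gA k p + gB k p = 0 := by
  rw [gA, gB, cmExt_prime _ hp, cmExt_prime _ hp, if_pos h, if_pos h, add_neg_cancel]

theorem sq_eq_or_sq_eq_of_prime {p : ℕ} (hp : p.Prime) {a b c d : ℤ} (h1 : (p : ℤ) = a ^ 2 + b ^ 2)
    (h2 : (p : ℤ) = c ^ 2 + d ^ 2) : a ^ 2 = c ^ 2 ∨ a ^ 2 = d ^ 2 := by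
  have hp0 : (0 : ℤ) < p := by exact_mod_cast hp.pos
  have key : ∀ m n : ℤ, m ^ 2 + n ^ 2 = p ^ 2 → (p : ℤ) ∣ m → m = 0 ∨ n = 0 := by
    rintro m n hmn ⟨t, rfl⟩
    by_contra! hne
    have ht : t ≠ 0 := by
      rintro rfl
      exact hne.1 (by ring)
    have ht1 : 1 ≤ t ^ 2 := Int.one_le_abs (pow_ne_zero 2 ht) |>.trans_eq (abs_sq t)
    have hn : 0 < n ^ 2 := sq_pos_of_ne_zero hne.2
    nlinarith
  have hac : a * c - b * d = 0 → a ^ 2 = d ^ 2 := fun h => by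
    have : (p : ℤ) * (a ^ 2 - d ^ 2) = 0 := by
      linear_combination a ^ 2 * h2 - d ^ 2 * h1 + (a * c + b * d) * h
    have := (mul_eq_zero.1 this).resolve_left hp0.ne'
    linarith
  have hac' : a * c + b * d = 0 → a ^ 2 = d ^ 2 := fun h => by
    have : (p : ℤ) * (a ^ 2 - d ^ 2) = 0 := by
      linear_combination a ^ 2 * h2 - d ^ 2 * h1 + (a * c - b * d) * h
    have := (mul_eq_zero.1 this).resolve_left hp0.ne'
    linarith
  have had : (a * d + b * c) * (a * d - b * c) = 0 → a ^ 2 = c ^ 2 := fun h => by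
    have : (p : ℤ) * (a ^ 2 - c ^ 2) = 0 := by linear_combination a ^ 2 * h2 - c ^ 2 * h1 + h
    have := (mul_eq_zero.1 this).resolve_left hp0.ne'
    linarith
  have hdvd : (p : ℤ) ∣ (a * c - b * d) * (a * c + b * d) :=
    ⟨a ^ 2 - d ^ 2, by linear_combination d ^ 2 * h1 - a ^ 2 * h2⟩
  rcases (Nat.prime_iff_prime_int.1 hp).dvd_or_dvd hdvd with h | h
  · rcases key _ (a * d + b * c) (by rw [sq (p : ℤ)]; nth_rw 1 [h1]; rw [h2]; ring) h with h | h
    · exact Or.inr (hac h)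
    · exact Or.inl (had (by rw [h, zero_mul]))
  · rcases key _ (a * d - b * c) (by rw [sq (p : ℤ)]; nth_rw 1 [h1]; rw [h2]; ring) h with h | h
    · exact Or.inr (hac' h)
    · exact Or.inl (had (by rw [h, mul_zero]))

theorem mem_Peps_iff_axisAngle_le {p : ℕ} (hp : p.Prime) (h : p % 4 = 1) {ε : ℝ} (hε : 0 < ε)
    (hε1 : ε ≤ 1) : p ∈ Peps ε ↔ axisAngle p ≤ 2 / π * arcsin ε := by
  have hp0 : (0 : ℝ) < √p := Real.sqrt_pos.2 (by exact_mod_cast hp.pos)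
  have hpi : 0 < 2 / π := div_pos two_pos pi_pos
  have hs4 := abs_le_of_sq_le_sq' (b := 1) ((min_div_sqrt_sq_le hp h).trans (by norm_num))
    (by norm_num)
  have hsum : (p : ℤ) = (gp p).re ^ 2 + (gp p).im ^ 2 := by
    have := re_sq_add_im_sq_gp hp h
    exact_mod_cast this.symm
  rw [axisAngle, mul_le_mul_iff_right₀ hpi, Real.strictMonoOn_arcsin.le_iff_le
    (Set.mem_Icc.2 hs4) (Set.mem_Icc.2 ⟨by linarith, hε1⟩), div_le_iff₀ hp0]
  constructor
  · rintro ⟨-, a, b, hab, ha⟩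
    refine le_trans ?_ ha
    rcases sq_eq_or_sq_eq_of_prime hp hab hsum with h1 | h1
    · refine (min_le_left _ _).trans (le_of_eq ?_)
      rw [← Int.cast_abs, ← Int.cast_abs, (sq_eq_sq_iff_abs_eq_abs _ _).1 h1]
    · refine (min_le_right _ _).trans (le_of_eq ?_)
      rw [← Int.cast_abs, ← Int.cast_abs, (sq_eq_sq_iff_abs_eq_abs _ _).1 h1]
  · intro hm
    refine ⟨hp, ?_⟩
    rcases min_le_iff.1 hm with h1 | h1
    · exact ⟨_, _, hsum, h1⟩
    · exact ⟨_, _, hsum.trans (add_comm _ _), h1⟩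

theorem notMem_Peps_of_mod_three {p : ℕ} (h : p % 4 = 3) (ε : ℝ) : p ∉ Peps ε := by
  rintro ⟨-, a, b, hab, -⟩
  obtain ⟨m, rfl | rfl⟩ := Int.even_or_odd' a <;> obtain ⟨n, rfl | rfl⟩ := Int.even_or_odd' b <;>
    ring_nf at hab <;> omega

theorem two_notMem_Peps {ε : ℝ} (hε : ε < 1 / 2) : 2 ∉ Peps ε := by
  rintro ⟨-, a, b, hab, ha⟩
  have h1 : |(a : ℝ)| < 1 := by
    refine ha.trans_lt ?_
    have h2 : √((2 : ℕ) : ℝ) ≤ 2 := by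
      rw [Real.sqrt_le_left (by norm_num)]
      norm_num
    have h3 : 0 < √((2 : ℕ) : ℝ) := by positivity
    generalize √((2 : ℕ) : ℝ) = s at h2 h3 ⊢
    calc ε * s < 1 / 2 * s := by gcongr
      _ ≤ 1 := by linarith
  have h0 : a = 0 := by
    rw [← Int.cast_abs] at h1
    exact Int.abs_lt_one_iff.1 (by exact_mod_cast h1)
  rw [h0] at hab
  have hb : b ^ 2 = 2 := by push_cast at hab; linarith
  have : b ≤ 1 := by nlinarith
  have : -1 ≤ b := by nlinarith
  interval_cases b <;> omega

/-- Truncated Fourier expansion of `trap a b`, evaluated with Hecke characters. -/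
def trapVal (a b : ℝ) (K n : ℕ) : ℂ := (((a + b) / 2 : ℝ) : ℂ) * (1 + ev chi4 n) +
    ∑ k ∈ Icc 1 K, ((trapCoeff a b k / 2 : ℝ) : ℂ) * (gA k n + gB k n)

theorem smooth_tw_trapVal (a b : ℝ) (K : ℕ) (χ : ℕ → ℂ) (y : ℝ) :
    smooth (tw χ (tw (trapVal a b K) mangoldtC)) y =
      (((a + b) / 2 : ℝ) : ℂ) * (smooth (tw χ mangoldtC) y +
        smooth (tw χ (tw (ev chi4) mangoldtC)) y) +
      ∑ k ∈ Icc 1 K, ((trapCoeff a b k / 2 : ℝ) : ℂ) *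
        smooth (tw χ (tw (gA k) mangoldtC + tw (gB k) mangoldtC)) y := by
  simp only [smooth, tw_apply, ArithmeticFunction.add_apply, mul_sum]
  rw [sum_comm, ← sum_add_distrib, mul_sum, ← sum_add_distrib]
  refine sum_congr rfl fun n _ => ?_
  rw [trapVal, add_mul, sum_mul, mul_add, mul_add, mul_sum, mul_sum]
  refine congrArg₂ _ (by ring) (sum_congr rfl fun k _ => by ring)

theorem norm_trapVal_le {a b : ℝ} (ha : 0 ≤ a) (hab : a < b) (hb : b ≤ 1 / 2) (K n : ℕ) :
    ‖trapVal a b K n‖ ≤ 1 + 2 * (b - a)⁻¹ := by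
  refine (norm_add_le _ _).trans (add_le_add ?_ ?_)
  · rw [norm_mul, norm_real, norm_of_nonneg (by linarith)]
    have h : ‖1 + ev chi4 n‖ ≤ 2 := by
      refine (norm_add_le _ _).trans ?_
      have := (isCM_ev chi4).norm_le n
      rw [norm_one]
      linarith
    calc (a + b) / 2 * ‖1 + ev chi4 n‖ ≤ (a + b) / 2 * 2 := by gcongr; linarith
      _ ≤ 1 := by linarith
  · refine le_trans ((norm_sum_le _ _).trans (sum_le_sum fun k _ => ?_))
      (sum_abs_trapCoeff_le hab K)
    have h : ‖gA k n + gB k n‖ ≤ 2 := by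
      refine (norm_add_le _ _).trans ?_
      have := (isCM_gA k).norm_le n
      have := (isCM_gB k).norm_le n
      linarith
    rw [norm_mul, norm_real, norm_eq_abs, abs_div, abs_two]
    calc |trapCoeff a b k| / 2 * ‖gA k n + gB k n‖ ≤ |trapCoeff a b k| / 2 * 2 := by gcongr
      _ = |trapCoeff a b k| := by ring

theorem trapVal_prime {p : ℕ} (hp : p.Prime) (h : p % 4 = 1) (a b : ℝ) (K : ℕ) :
    trapVal a b K p = ((a + b + ∑ k ∈ Icc 1 K, trapCoeff a b k *
      cos (2 * π * k * axisAngle p) : ℝ) : ℂ) := by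
  rw [trapVal, ev_chi4, ZMod.χ₄_nat_one_mod_four h, Complex.ofReal_add, ofReal_sum]
  refine congrArg₂ _ (by push_cast; ring) (sum_congr rfl fun k _ => ?_)
  rw [gA_add_gB_prime hp h]
  push_cast
  ring

theorem trapVal_prime_of_mod_three {p : ℕ} (hp : p.Prime) (h : p % 4 = 3) (a b : ℝ) (K : ℕ) :
    trapVal a b K p = 0 := by
  rw [trapVal, ev_chi4, ZMod.χ₄_nat_three_mod_four h, sum_eq_zero fun k _ => by
    rw [gA_add_gB_prime_of_mod_three hp h, mul_zero]]
  simp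

/-- The trapezoidal weight on primes `p ≡ 1` modulo `4`. -/
def trapLog (a b : ℝ) (n : ℕ) : ℝ :=
  if n.Prime ∧ n % 4 = 1 then trap a b (axisAngle n) * log n else 0

/-- The indicator function of the numbers that are not odd primes. -/
def notOddPrime (n : ℕ) : ℝ := if n.Prime ∧ n ≠ 2 then 0 else 1

theorem abs_re_sub_trapLog_le {a b : ℝ} (ha : 0 ≤ a) (hab : a < b) (hb : b ≤ 1 / 2) {K : ℕ}
    (hK : 1 ≤ K) (n : ℕ) :
    |(trapVal a b K n * mangoldtC n).re - trapLog a b n| ≤ ((b - a)⁻¹ * (K : ℝ)⁻¹) * vonMangoldt n +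
        (1 + 2 * (b - a)⁻¹) * (vonMangoldt n * notOddPrime n) := by
  have hba : 0 < b - a := by linarith
  have hΛ : 0 ≤ vonMangoldt n := vonMangoldt_nonneg
  rw [mangoldtC_apply, Complex.re_mul_ofReal]
  by_cases hn : n.Prime ∧ n ≠ 2
  · rw [notOddPrime, if_pos hn, mul_zero, mul_zero, add_zero]
    obtain ⟨hp, h2⟩ := hn
    have hodd : n % 2 = 1 := hp.eq_two_or_odd.resolve_left h2
    rw [trapLog]
    rcases (by omega : n % 4 = 1 ∨ n % 4 = 3) with h | h
    · rw [if_pos ⟨hp, h⟩, vonMangoldt_apply_prime hp, trapVal_prime hp h, ofReal_re,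
        ← sub_mul, abs_mul, abs_of_nonneg (log_natCast_nonneg n)]
      refine mul_le_mul_of_nonneg_right ?_ (log_natCast_nonneg n)
      refine le_trans (le_of_eq ?_) (abs_trap_sub_sum_le ha hab hb (axisAngle_nonneg n)
        (axisAngle_le hp h) hK)
      rw [abs_sub_comm]
      congr 1
      ring
    · rw [if_neg (by omega), trapVal_prime_of_mod_three hp h]
      simp only [Complex.zero_re, zero_mul, sub_self, abs_zero]
      positivity
  · have h0 : trapLog a b n = 0 := by
      rw [trapLog, if_neg]
      rintro ⟨hp, h⟩
      exact hn ⟨hp, by omega⟩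
    rw [notOddPrime, if_neg hn, h0, sub_zero, mul_one, abs_mul, abs_of_nonneg hΛ]
    have := (abs_re_le_norm _).trans (norm_trapVal_le ha hab hb K n)
    have h1 : 0 ≤ (b - a)⁻¹ * (K : ℝ)⁻¹ * vonMangoldt n := by positivity
    have h2 := mul_le_mul_of_nonneg_right this hΛ
    linarith

/-- The logarithm restricted to `Peps ε`. -/
def pepsLog (ε : ℝ) (n : ℕ) : ℝ := by classical exact if n ∈ Peps ε then log n else 0

/-- The density of `Peps ε` in the primes. -/
def pepsDensity (ε : ℝ) : ℝ := 2 / π * arcsin ε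

theorem pepsLog_le_trapLog {ε η : ℝ} (hε : 0 < ε) (hε2 : ε < 1 / 2) (hη : 0 < η) (n : ℕ) :
    pepsLog ε n ≤ trapLog (pepsDensity ε) (pepsDensity ε + η) n := by
  have hab : pepsDensity ε < pepsDensity ε + η := by linarith
  rw [pepsLog, trapLog]
  have h0 := log_natCast_nonneg n
  split_ifs with h1 h2 h2
  · rw [trap_of_le hab ((mem_Peps_iff_axisAngle_le h2.1 h2.2 hε (by linarith)).1 h1), one_mul]
  · exfalso
    have hp : n.Prime := h1.1
    rcases hp.eq_two_or_odd with h | h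
    · exact two_notMem_Peps hε2 (h ▸ h1)
    · exact notMem_Peps_of_mod_three (by have := not_and.1 h2 hp; omega) ε h1
  · exact mul_nonneg (trap_nonneg hab _) h0
  · exact le_rfl

theorem trapLog_le_pepsLog {ε η : ℝ} (hε : 0 < ε) (hε2 : ε < 1 / 2) (hη : 0 < η) (n : ℕ) :
    trapLog (pepsDensity ε - η) (pepsDensity ε) n ≤ pepsLog ε n := by
  have hab : pepsDensity ε - η < pepsDensity ε := by linarith
  rw [pepsLog, trapLog]
  have h0 := log_natCast_nonneg n
  split_ifs with h1 h2 h2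
  · exact mul_le_of_le_one_left h0 (trap_le_one hab _)
  · rw [trap_of_ge hab, zero_mul]
    have := (mem_Peps_iff_axisAngle_le h1.1 h1.2 hε (by linarith)).not.1 h2
    exact (not_le.1 this).le
  · exact h0
  · exact le_rfl

theorem pepsDensity_pos {ε : ℝ} (hε : 0 < ε) : 0 < pepsDensity ε :=
  mul_pos (div_pos two_pos pi_pos) (Real.arcsin_pos.2 hε)

theorem pepsDensity_lt {ε : ℝ} (hε2 : ε < 1 / 2) : pepsDensity ε < 1 / 2 := by
  have h : arcsin ε < π / 4 := by
    rw [Real.arcsin_lt_iff_lt_sin' ⟨by linarith [pi_pos], by linarith [pi_pos]⟩,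
      Real.sin_pi_div_four]
    have : (1 : ℝ) ≤ √2 := one_le_sqrt.2 (by norm_num)
    linarith
  calc pepsDensity ε < 2 / π * (π / 4) := by
        have := pi_pos
        rw [pepsDensity]
        gcongr
    _ = 1 / 2 := by
        have := pi_ne_zero
        field_simp
        norm_num

theorem sum_vonMangoldt_notOddPrime_le {N : ℕ} (hN1 : 1 ≤ N) {L : ℝ} (hL : 1 ≤ L)
    (hN : log N ≤ L) : ∑ n ∈ Ioc 0 N, vonMangoldt n * notOddPrime n ≤ 9 * √N * L ^ 2 := by
  have h := sum_vonMangoldt_filter_le (M := N.sqrt + 2) hL hN (fun n => ¬ (n.Prime ∧ n ≠ 2))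
    fun p k hp _ hpk hc => by
      by_contra! h
      have hk1 : k ≠ 1 := by
        rintro rfl
        rw [pow_one] at hc
        exact hc ⟨hp, by omega⟩
      have := Nat.le_sqrt'.2 ((Nat.pow_le_pow_right hp.pos (by omega : 2 ≤ k)).trans hpk)
      omega
  have hN1' : (1 : ℝ) ≤ √N := one_le_sqrt.2 (by exact_mod_cast hN1)
  have h2 := Real.nat_sqrt_le_real_sqrt (a := N)
  calc _ = ∑ n ∈ Ioc 0 N with ¬ (n.Prime ∧ n ≠ 2), vonMangoldt n := by
        rw [sum_filter]
        exact sum_congr rfl fun n _ => by rw [notOddPrime]; split_ifs <;> simp_all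
    _ ≤ 3 * (N.sqrt + 2 : ℕ) * L ^ 2 := h
    _ ≤ 3 * (3 * √N) * L ^ 2 := by
        gcongr
        push_cast
        linarith
    _ = _ := by ring

theorem card_filter_modEq_le {q : ℕ} (hq : 0 < q) (a : ℕ) {m n : ℕ} (hmn : m ≤ n) :
    (((Ioc m n).filter fun k => k ≡ a [MOD q]).card : ℝ) ≤ (n - m) / q + 1 := by
  have h := Nat.Ioc_filter_modEq_card m n hq a
  have hq' : (0 : ℝ) < q := by exact_mod_cast hq
  have hmn' : (m : ℝ) ≤ n := by exact_mod_cast hmn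
  have h2 : ((((Ioc m n).filter fun k => k ≡ a [MOD q]).card : ℤ) : ℝ) ≤ (n - m) / q + 1 := by
    rw [h]
    push_cast
    refine max_le ?_ (by positivity)
    have h3 := Int.floor_le (((n : ℚ) - a) / q)
    have h4 := Int.lt_floor_add_one (((m : ℚ) - a) / q)
    have h3' : ((⌊((n : ℚ) - a) / q⌋ : ℤ) : ℝ) ≤ ((n : ℝ) - a) / q := by exact_mod_cast h3
    have h4' : ((m : ℝ) - a) / q < ((⌊((m : ℚ) - a) / q⌋ : ℤ) : ℝ) + 1 := by exact_mod_cast h4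
    have h5 : ((n : ℝ) - m) / q = (n - a) / q - (m - a) / q := by ring
    linarith
  exact_mod_cast h2

/-- The logarithm restricted to the primes. -/
def primeLog (n : ℕ) : ℝ := if n.Prime then log n else 0

theorem primeLog_nonneg (n : ℕ) : 0 ≤ primeLog n := by
  rw [primeLog]
  split_ifs
  exacts [log_natCast_nonneg n, le_rfl]

theorem primeLog_le_log (n : ℕ) : primeLog n ≤ log n := by
  rw [primeLog]
  split_ifs
  exacts [le_rfl, log_natCast_nonneg n]

theorem pepsLog_nonneg (ε : ℝ) (n : ℕ) : 0 ≤ pepsLog ε n := by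
  rw [pepsLog]
  split_ifs
  exacts [log_natCast_nonneg n, le_rfl]

theorem pepsLog_le_log (ε : ℝ) (n : ℕ) : pepsLog ε n ≤ log n := by
  rw [pepsLog]
  split_ifs
  exacts [le_rfl, log_natCast_nonneg n]

/-- The sum over a residue class with the smooth logarithmic weight. -/
def classSum (q a : ℕ) (f : ℕ → ℝ) (y : ℝ) : ℝ :=
  ∑ n ∈ Ioc 0 ⌊y⌋₊ with n ≡ a [MOD q], log (y / n) * f n

theorem mem_Ioc_floor {n : ℕ} {y : ℝ} (hn : n ∈ Ioc 0 ⌊y⌋₊) : 0 < n ∧ (n : ℝ) ≤ y := by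
  rw [mem_Ioc] at hn
  exact ⟨hn.1, (Nat.le_floor_iff' hn.1.ne').1 hn.2⟩

theorem log_div_mem {n : ℕ} {x y : ℝ} (hn : n ∈ Ioc 0 ⌊y⌋₊) (hyx : y ≤ x) :
    0 ≤ log (y / n) ∧ log (y / n) ≤ log x := by
  obtain ⟨h1, h2⟩ := mem_Ioc_floor hn
  have h3 : (1 : ℝ) ≤ n := by exact_mod_cast h1
  refine ⟨log_div_nonneg h1 h2, log_le_log (div_pos (by linarith) (by linarith)) ?_⟩
  exact (div_le_self (by linarith) h3).trans hyx

theorem classSum_mono {q a : ℕ} {f g : ℕ → ℝ} (hfg : ∀ n, f n ≤ g n) (y : ℝ) :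
    classSum q a f y ≤ classSum q a g y :=
  sum_le_sum fun n hn => mul_le_mul_of_nonneg_left (hfg n)
    (log_div_mem (mem_filter.1 hn).1 le_rfl).1

theorem re_smooth_tw_resInd (q a : ℕ) (f : 𝓐) (y : ℝ) :
    (smooth (tw (resInd q a) f) y).re = classSum q a (fun n => (f n).re) y := by
  rw [smooth, classSum, Complex.re_sum, sum_filter]
  refine sum_congr rfl fun n _ => ?_
  rw [tw_apply, Complex.re_ofReal_mul, resInd]
  split_ifs <;> simp

theorem abs_classSum_sub_le {q a : ℕ} {f g h : ℕ → ℝ} (hfg : ∀ n, |f n - g n| ≤ h n) (y : ℝ) :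
    |classSum q a f y - classSum q a g y| ≤ classSum q a h y := by
  rw [classSum, classSum, classSum, ← sum_sub_distrib]
  refine (abs_sum_le_sum_abs _ _).trans (sum_le_sum fun n hn => ?_)
  have h1 := (log_div_mem (mem_filter.1 hn).1 le_rfl).1
  rw [← mul_sub, abs_mul, abs_of_nonneg h1]
  exact mul_le_mul_of_nonneg_left (hfg n) h1

theorem classSum_error_le {q a : ℕ} (hq : 0 < q) {x y τ M : ℝ} (hL : 1 ≤ log x) (hy : 1 ≤ y)
    (hyx : y ≤ x) (hτ : 0 ≤ τ) (hM : 0 ≤ M) :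
    classSum q a (fun n => τ * vonMangoldt n + M * (vonMangoldt n * notOddPrime n)) y ≤
      τ * log x ^ 2 * (x / q + 1) + M * (9 * √x * log x ^ 3) := by
  set L := log x with hLdef
  have hN1 : 1 ≤ ⌊y⌋₊ := Nat.le_floor (by exact_mod_cast hy)
  have hNx : (⌊y⌋₊ : ℝ) ≤ x := (Nat.floor_le (by linarith)).trans hyx
  have hN : log ⌊y⌋₊ ≤ L := log_le_log (by exact_mod_cast hN1) hNx
  have hx : 0 < x := by linarith
  have hnop : ∀ n, 0 ≤ notOddPrime n := fun n => by
    rw [notOddPrime]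
    split_ifs <;> norm_num
  have h1 : ∀ n ∈ Ioc 0 ⌊y⌋₊, vonMangoldt n ≤ L := fun n hn => by
    obtain ⟨h1, h2⟩ := mem_Ioc_floor hn
    exact vonMangoldt_le_log.trans (log_le_log (by exact_mod_cast h1) (h2.trans hyx))
  calc _ ≤ ∑ n ∈ Ioc 0 ⌊y⌋₊ with n ≡ a [MOD q],
        (τ * L ^ 2 + M * (L * (vonMangoldt n * notOddPrime n))) := by
        refine sum_le_sum fun n hn => ?_
        have hn := (mem_filter.1 hn).1
        have h2 := log_div_mem hn hyx
        have h3 : 0 ≤ vonMangoldt n := vonMangoldt_nonneg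
        calc _ ≤ L * (τ * vonMangoldt n + M * (vonMangoldt n * notOddPrime n)) := by
              refine mul_le_mul_of_nonneg_right h2.2 ?_
              have := hnop n
              positivity
          _ ≤ L * (τ * L + M * (vonMangoldt n * notOddPrime n)) := by
              have := h1 n hn
              gcongr
          _ = _ := by ring
    _ ≤ τ * L ^ 2 * (x / q + 1) + M * (L * ∑ n ∈ Ioc 0 ⌊y⌋₊, vonMangoldt n * notOddPrime n) := by
        rw [sum_add_distrib, sum_const, nsmul_eq_mul, ← mul_sum, ← mul_sum]
        refine add_le_add ?_ ?_
        · rw [mul_comm]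
          have h2 := card_filter_modEq_le hq a (Nat.zero_le ⌊y⌋₊)
          have h3 : ((⌊y⌋₊ : ℝ) - (0 : ℕ)) / q + 1 ≤ x / q + 1 := by
            rw [Nat.cast_zero, sub_zero]
            gcongr
          exact mul_le_mul_of_nonneg_left (h2.trans h3) (by positivity)
        · refine mul_le_mul_of_nonneg_left (mul_le_mul_of_nonneg_left ?_ (by linarith)) hM
          exact sum_le_sum_of_subset_of_nonneg (filter_subset _ _) fun n _ _ =>
            mul_nonneg vonMangoldt_nonneg (hnop n)
    _ ≤ _ := by
        have h2 := sum_vonMangoldt_notOddPrime_le hN1 hL hN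
        have h3 : √(⌊y⌋₊ : ℝ) ≤ √x := sqrt_le_sqrt hNx
        have h4 : 9 * √(⌊y⌋₊ : ℝ) * L ^ 2 ≤ 9 * √x * L ^ 2 := by gcongr
        have h5 : M * (L * ∑ n ∈ Ioc 0 ⌊y⌋₊, vonMangoldt n * notOddPrime n) ≤
            M * (L * (9 * √x * L ^ 2)) := by
          have := h2.trans h4
          gcongr
        have h6 : M * (L * (9 * √x * L ^ 2)) = M * (9 * √x * L ^ 3) := by ring
        linarith

/-- The smoothly weighted count of primes. -/
def primeSum (y : ℝ) : ℝ := ∑ n ∈ Ioc 0 ⌊y⌋₊, log (y / n) * primeLog n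

theorem primeSum_nonneg (y : ℝ) : 0 ≤ primeSum y :=
  sum_nonneg fun n hn => mul_nonneg (log_div_mem hn le_rfl).1 (primeLog_nonneg n)

theorem primeSum_le {x y : ℝ} (hL : 1 ≤ log x) (hy : 1 ≤ y) (hyx : y ≤ x) :
    primeSum y ≤ x * log x ^ 2 := by
  have hx : 0 < x := by linarith
  refine (sum_le_card_nsmul _ _ (log x * log x) fun n hn => ?_).trans ?_
  · obtain ⟨h1, h2⟩ := mem_Ioc_floor hn
    have h3 := log_div_mem hn hyx
    have h4 : primeLog n ≤ log x := (primeLog_le_log n).trans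
      (log_le_log (by exact_mod_cast h1) (h2.trans hyx))
    exact mul_le_mul h3.2 h4 (primeLog_nonneg n) (by linarith)
  · rw [nsmul_eq_mul, Nat.card_Ioc, tsub_zero, sq]
    refine mul_le_mul_of_nonneg_right ((Nat.floor_le (by linarith)).trans hyx) (by positivity)

theorem norm_smooth_one_sub_primeSum_le {q : ℕ} (hq : Odd q) {x y : ℝ} (hL : 1 ≤ log x)
    (hy : 1 ≤ y) (hyx : y ≤ x) :
    ‖smooth (tw (ev (1 : 𝓧 q)) mangoldtC) y - (primeSum y : ℂ)‖ ≤ (3 * q + 9 * √x) * log x ^ 3 := by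
  set L := log x with hLdef
  have hN1 : 1 ≤ ⌊y⌋₊ := Nat.le_floor (by exact_mod_cast hy)
  have hNx : (⌊y⌋₊ : ℝ) ≤ x := (Nat.floor_le (by linarith)).trans hyx
  have hN : log ⌊y⌋₊ ≤ L := log_le_log (by exact_mod_cast hN1) hNx
  have hL0 : 0 ≤ L := by linarith
  have key : ∀ n, ‖tw (ev (1 : 𝓧 q)) mangoldtC n - (primeLog n : ℂ)‖ ≤
      (if ¬ n.Coprime q then vonMangoldt n else 0) + vonMangoldt n * notOddPrime n := by
    intro n
    have hΛ : 0 ≤ vonMangoldt n := vonMangoldt_nonneg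
    have h2 : n = 2 → n.Coprime q := by
      rintro rfl
      exact (Nat.coprime_two_left).2 hq
    rw [tw_apply, mangoldtC_apply]
    have hev : n.Coprime q → ev (1 : 𝓧 q) n = 1 := fun hc => by
      rw [ev, MulChar.one_apply ((ZMod.isUnit_iff_coprime n q).2 hc)]
    by_cases hp : n.Prime
    · rw [primeLog, if_pos hp, vonMangoldt_apply_prime hp] at *
      by_cases hc : n.Coprime q
      · rw [hev hc, one_mul, sub_self, norm_zero, if_neg (not_not.2 hc), zero_add, notOddPrime]
        split_ifs <;> simp [hΛ]
      · have h3 : n ≠ 2 := fun h => hc (h2 h)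
        rw [ev_eq_zero _ hc, if_pos hc, zero_mul, zero_sub, norm_neg, norm_real,
          norm_of_nonneg hΛ, notOddPrime, if_pos ⟨hp, h3⟩, mul_zero, add_zero]
    · have hnop : notOddPrime n = 1 := if_neg fun h => hp h.1
      rw [primeLog, if_neg hp, Complex.ofReal_zero, sub_zero, hnop, mul_one, norm_mul, norm_real,
        norm_of_nonneg hΛ]
      have h3 := mul_le_of_le_one_left hΛ ((isCM_ev (1 : 𝓧 q)).norm_le n)
      have h4 : 0 ≤ if ¬ n.Coprime q then vonMangoldt n else 0 := by split_ifs <;> simp [hΛ]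
      linarith
  have h1 : ‖smooth (tw (ev (1 : 𝓧 q)) mangoldtC) y - (primeSum y : ℂ)‖ ≤
      ∑ n ∈ Ioc 0 ⌊y⌋₊, L * ((if ¬ n.Coprime q then vonMangoldt n else 0) +
        vonMangoldt n * notOddPrime n) := by
    rw [smooth, primeSum, ofReal_sum, ← sum_sub_distrib]
    refine (norm_sum_le _ _).trans (sum_le_sum fun n hn => ?_)
    have h2 := log_div_mem hn hyx
    rw [ofReal_mul, ← mul_sub, norm_mul, norm_real, norm_of_nonneg h2.1]
    exact mul_le_mul h2.2 (key n) (norm_nonneg _) hL0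
  refine h1.trans ?_
  rw [← mul_sum, sum_add_distrib, ← sum_filter]
  have h2 := sum_vonMangoldt_not_coprime_le hq.pos.ne' hL hN
  have h3 := sum_vonMangoldt_notOddPrime_le hN1 hL hN
  have h4 : √(⌊y⌋₊ : ℝ) ≤ √x := sqrt_le_sqrt hNx
  calc _ ≤ L * (3 * q * L ^ 2 + 9 * √x * L ^ 2) := by
        refine mul_le_mul_of_nonneg_left (add_le_add h2 (h3.trans ?_)) hL0
        gcongr
    _ = _ := by ring

/-- The total contribution of the Bombieri–Vinogradov errors in the Fourier expansion of
`trap a b`. -/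
def trapErr (a b : ℝ) (K : ℕ) (y : ℝ) (q r : ℕ) : ℝ :=
  ‖bvErr True mangoldtC y q r‖ + ‖bvErr False (tw (ev chi4) mangoldtC) y q r‖ +
    ∑ k ∈ Icc 1 K, |trapCoeff a b k| *
      ‖bvErr False (tw (gA k) mangoldtC + tw (gB k) mangoldtC) y q r‖

theorem trapErr_nonneg (a b : ℝ) (K : ℕ) (y : ℝ) (q r : ℕ) : 0 ≤ trapErr a b K y q r := by
  have : 0 ≤ ∑ k ∈ Icc 1 K, |trapCoeff a b k| *
      ‖bvErr False (tw (gA k) mangoldtC + tw (gB k) mangoldtC) y q r‖ :=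
    sum_nonneg fun k _ => by positivity
  rw [trapErr]
  positivity

theorem norm_smooth_trapVal_sub_le {a b : ℝ} (ha : 0 ≤ a) (hab : a < b) (hb : b ≤ 1 / 2) (K : ℕ)
    {q : ℕ} (hq : Odd q) (r : ℕ) {x y : ℝ} (hL : 1 ≤ log x) (hy : 1 ≤ y) (hyx : y ≤ x) :
    ‖smooth (tw (resInd q r) (tw (trapVal a b K) mangoldtC)) y -
      (((a + b) / 2 * ((q.totient : ℝ)⁻¹ * primeSum y) : ℝ) : ℂ)‖ ≤
      trapErr a b K y q r + (3 * q + 9 * √x) * log x ^ 3 := by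
  have hφ : (1 : ℝ) ≤ q.totient := by exact_mod_cast Nat.totient_pos.2 hq.pos
  have hδ : |(a + b) / 2| ≤ 1 := abs_le.2 ⟨by linarith, by linarith⟩
  have e : smooth (tw (resInd q r) (tw (trapVal a b K) mangoldtC)) y -
      (((a + b) / 2 * ((q.totient : ℝ)⁻¹ * primeSum y) : ℝ) : ℂ) =
      (((a + b) / 2 : ℝ) : ℂ) * bvErr True mangoldtC y q r +
      (((a + b) / 2 : ℝ) : ℂ) * bvErr False (tw (ev chi4) mangoldtC) y q r +
      ∑ k ∈ Icc 1 K, ((trapCoeff a b k / 2 : ℝ) : ℂ) *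
        bvErr False (tw (gA k) mangoldtC + tw (gB k) mangoldtC) y q r +
      (((a + b) / 2 * (q.totient : ℝ)⁻¹ : ℝ) : ℂ) *
        (smooth (tw (ev (1 : 𝓧 q)) mangoldtC) y - (primeSum y : ℂ)) := by
    rw [smooth_tw_trapVal]
    simp only [bvErr, if_true, if_false, sub_zero]
    push_cast
    ring
  rw [e]
  have hmul : ∀ (t : ℝ) (z : ℂ), |t| ≤ 1 → ‖(t : ℂ) * z‖ ≤ ‖z‖ := fun t z ht => by
    rw [norm_mul, norm_real, norm_eq_abs]
    exact mul_le_of_le_one_left (norm_nonneg _) ht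
  refine (norm_add_le _ _).trans (add_le_add ((norm_add_le _ _).trans (add_le_add
    ((norm_add_le _ _).trans (add_le_add (hmul _ _ hδ) (hmul _ _ hδ))) ?_)) ?_)
  · refine (norm_sum_le _ _).trans (sum_le_sum fun k _ => ?_)
    rw [norm_mul, norm_real, norm_eq_abs, abs_div, abs_two]
    gcongr
    exact half_le_self (abs_nonneg _)
  · refine (hmul _ _ ?_).trans (norm_smooth_one_sub_primeSum_le hq hL hy hyx)
    rw [abs_mul, abs_of_nonneg (a := (q.totient : ℝ)⁻¹) (by positivity)]
    exact mul_le_one₀ hδ (by positivity) (inv_le_one_of_one_le₀ hφ)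

/-- The discrepancy of `Peps ε` in a residue class, weighted by logarithms. -/
def pepsDiff (ε : ℝ) (q r : ℕ) : 𝓐 := ⟨fun n => (((if n ≡ r [MOD q] then pepsLog ε n else 0) -
    pepsDensity ε * (q.totient : ℝ)⁻¹ * primeLog n : ℝ) : ℂ), by simp [pepsLog, primeLog]⟩

theorem pepsDiff_apply (ε : ℝ) (q r n : ℕ) : pepsDiff ε q r n =
    (((if n ≡ r [MOD q] then pepsLog ε n else 0) -
      pepsDensity ε * (q.totient : ℝ)⁻¹ * primeLog n : ℝ) : ℂ) := rfl

theorem smooth_pepsDiff (ε : ℝ) (q r : ℕ) (y : ℝ) : smooth (pepsDiff ε q r) y =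
    ((classSum q r (pepsLog ε) y - pepsDensity ε * ((q.totient : ℝ)⁻¹ * primeSum y) : ℝ) : ℂ) := by
  rw [smooth, classSum, primeSum, sum_filter, mul_sum, mul_sum, ← sum_sub_distrib, ofReal_sum]
  refine sum_congr rfl fun n _ => ?_
  rw [pepsDiff_apply, ← ofReal_mul]
  congr 1
  split_ifs <;> ring

theorem norm_smooth_pepsDiff_le {ε η : ℝ} (hε : 0 < ε) (hε2 : ε < 1 / 2) (hη : 0 < η)
    (hη1 : η ≤ pepsDensity ε) (hη2 : pepsDensity ε + η ≤ 1 / 2) {K : ℕ} (hK : 1 ≤ K)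
    (hKη : η⁻¹ * (K : ℝ)⁻¹ ≤ η) {q : ℕ} (hq : Odd q) (r : ℕ) {x y : ℝ} (hL : 1 ≤ log x)
    (hy : 1 ≤ y) (hyx : y ≤ x) :
    ‖smooth (pepsDiff ε q r) y‖ ≤ trapErr (pepsDensity ε - η) (pepsDensity ε) K y q r +
      trapErr (pepsDensity ε) (pepsDensity ε + η) K y q r +
      2 * η * x * log x ^ 2 * (q.totient : ℝ)⁻¹ +
      40 * q * √x * η⁻¹ * log x ^ 3 := by
  set δ := pepsDensity ε with hδ
  set L := log x with hLdef
  set V := (q.totient : ℝ)⁻¹ * primeSum y with hV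
  set S := classSum q r (pepsLog ε) y with hS
  have hx : 0 < x := by linarith
  have hx1 : 1 ≤ √x := one_le_sqrt.2 (by linarith)
  have hδ0 := pepsDensity_pos hε
  have hφ : (1 : ℝ) ≤ q.totient := by exact_mod_cast Nat.totient_pos.2 hq.pos
  have hq1 : (1 : ℝ) ≤ q := by exact_mod_cast hq.pos
  have hV0 : 0 ≤ V := mul_nonneg (by positivity) (primeSum_nonneg y)
  have hVx : V ≤ (q.totient : ℝ)⁻¹ * (x * L ^ 2) :=
    mul_le_mul_of_nonneg_left (primeSum_le hL hy hyx) (by positivity)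
  have hη3 : η ≤ 1 := by linarith
  have hηinv : 1 ≤ η⁻¹ := (one_le_inv₀ hη).2 hη3
  have e1 : δ + η - δ = η := by ring
  have e2 : δ - (δ - η) = η := by ring
  set R := classSum q r (fun n => (η⁻¹ * (K : ℝ)⁻¹) * vonMangoldt n +
    (1 + 2 * η⁻¹) * (vonMangoldt n * notOddPrime n)) y with hR
  have hRle : R ≤ η * L ^ 2 * x * (q.totient : ℝ)⁻¹ + L ^ 3 + 27 * √x * η⁻¹ * L ^ 3 := by
    refine (classSum_error_le hq.pos hL hy hyx (by positivity) (by positivity)).trans ?_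
    have h1 : x / q ≤ x * (q.totient : ℝ)⁻¹ := by
      rw [div_eq_mul_inv]
      gcongr
      exact_mod_cast Nat.totient_le q
    calc _ ≤ η * L ^ 2 * (x * (q.totient : ℝ)⁻¹ + 1) + (3 * η⁻¹) * (9 * √x * L ^ 3) := by
          gcongr
          linarith
      _ = η * L ^ 2 * x * (q.totient : ℝ)⁻¹ + η * L ^ 2 + 27 * √x * η⁻¹ * L ^ 3 := by ring
      _ ≤ η * L ^ 2 * x * (q.totient : ℝ)⁻¹ + L ^ 3 + 27 * √x * η⁻¹ * L ^ 3 := by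
          gcongr
          calc η * L ^ 2 ≤ 1 * L ^ 2 := by gcongr
            _ ≤ L ^ 3 := by
              rw [one_mul]
              exact pow_le_pow_right₀ hL (by norm_num)
  have hup := norm_smooth_trapVal_sub_le hδ0.le (by linarith : δ < δ + η) hη2 K hq r hL hy hyx
  have hlo := norm_smooth_trapVal_sub_le (by linarith : 0 ≤ δ - η) (by linarith : δ - η < δ)
    (pepsDensity_lt hε2).le K hq r hL hy hyx
  have hup1 := (abs_re_le_norm _).trans hup
  have hlo1 := (abs_re_le_norm _).trans hlo
  rw [Complex.sub_re, ofReal_re, re_smooth_tw_resInd, abs_le] at hup1 hlo1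
  have hup2 := abs_classSum_sub_le (q := q) (a := r)
    (abs_re_sub_trapLog_le hδ0.le (by linarith : δ < δ + η) hη2 hK) y
  have hlo2 := abs_classSum_sub_le (q := q) (a := r)
    (abs_re_sub_trapLog_le (by linarith : 0 ≤ δ - η) (by linarith : δ - η < δ)
    (pepsDensity_lt hε2).le hK) y
  rw [e1, ← hR, abs_le] at hup2
  rw [e2, ← hR, abs_le] at hlo2
  simp only [tw_apply] at hup1 hlo1
  have hup3 := classSum_mono (q := q) (a := r) (pepsLog_le_trapLog hε hε2 hη) y
  have hlo3 := classSum_mono (q := q) (a := r) (trapLog_le_pepsLog hε hε2 hη) y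
  have hEu := trapErr_nonneg δ (δ + η) K y q r
  have hEl := trapErr_nonneg (δ - η) δ K y q r
  have hηV : η * V ≤ η * ((q.totient : ℝ)⁻¹ * (x * L ^ 2)) := by gcongr
  have hηV0 : 0 ≤ η * V := by positivity
  have hmul1 : (δ + (δ + η)) / 2 * V = δ * V + η * V / 2 := by ring
  have hmul2 : (δ - η + δ) / 2 * V = δ * V - η * V / 2 := by ring
  rw [hmul1] at hup1
  rw [hmul2] at hlo1
  have hmain : |S - δ * V| ≤ trapErr (δ - η) δ K y q r + trapErr δ (δ + η) K y q r +
      η * V + (3 * q + 9 * √x) * L ^ 3 + R := by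
    rw [abs_le]
    constructor <;> linarith
  have hP : (3 * q + 9 * √x) * L ^ 3 + (L ^ 3 + 27 * √x * η⁻¹ * L ^ 3) ≤
      40 * q * √x * η⁻¹ * L ^ 3 := by
    have hq' : (q : ℝ) ≤ q * √x * η⁻¹ := by
      rw [mul_assoc]
      exact le_mul_of_one_le_right (by linarith) (one_le_mul_of_one_le_of_one_le hx1 hηinv)
    have hx' : √x * η⁻¹ ≤ q * √x * η⁻¹ := by
      rw [mul_assoc]
      exact le_mul_of_one_le_left (by positivity) hq1
    have hx'' : √x ≤ √x * η⁻¹ := le_mul_of_one_le_right (by positivity) hηinv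
    calc _ = (3 * q + 9 * √x + 1 + 27 * (√x * η⁻¹)) * L ^ 3 := by ring
      _ ≤ (40 * (q * √x * η⁻¹)) * L ^ 3 := by
          gcongr
          linarith
      _ = _ := by ring
  rw [smooth_pepsDiff, norm_real, norm_eq_abs]
  have e3 : 2 * η * x * L ^ 2 * (q.totient : ℝ)⁻¹ =
    η * ((q.totient : ℝ)⁻¹ * (x * L ^ 2)) + η * L ^ 2 * x * (q.totient : ℝ)⁻¹ := by ring
  rw [e3]
  linarith

theorem exists_sum_trapErr_le (A E : ℕ) :
    ∃ C : ℝ, 0 < C ∧ ∀ (x y a b : ℝ) (K Q : ℕ) (r : ℕ → ℕ), 1 ≤ log x → a < b →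
      (b - a)⁻¹ = log x ^ E → 56 * (K : ℝ) ≤ log x ^ (2 * E + 1) →
      4 ≤ log x → 1 ≤ Q → (Q : ℝ) ^ 18 ≤ x → 1 ≤ y → y ≤ x → (∀ q, (r q).Coprime q) →
      (∑ q ∈ Icc 1 Q with Odd q, trapErr a b K y q (r q)) * log x ^ A ≤ C * x := by
  obtain ⟨c₁, hc₁, had₁⟩ := exists_admissible_zeta
  obtain ⟨c₂, hc₂, had₂⟩ := exists_admissible_chi4
  obtain ⟨c₃, hc₃, had₃⟩ := exists_admissible_rG
  obtain ⟨C₁, hC₁, h₁⟩ := exists_sum_bvErr_le hc₁ (A + E) (2 * E + 1)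
  obtain ⟨C₂, hC₂, h₂⟩ := exists_sum_bvErr_le hc₂ (A + E) (2 * E + 1)
  obtain ⟨C₃, hC₃, h₃⟩ := exists_sum_bvErr_le hc₃ (A + E) (2 * E + 1)
  refine ⟨C₁ + C₂ + 2 * C₃, by positivity, ?_⟩
  intro x y a b K Q r hL hab hba hKL hL4 hQ hQx hy hyx hr
  have hx : 1 ≤ x := hy.trans hyx
  have hL1 : 1 ≤ log x ^ E := one_le_pow₀ hL
  have hL4' : 4 ≤ log x ^ (2 * E + 1) := hL4.trans (le_self_pow₀ hL (by omega))
  have b₁ := h₁ True 1 _ _ _ x y Q r had₁ hL hx (by linarith) hQ hQx hy hyx hr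
  have b₂ := h₂ False 4 _ _ _ x y Q r had₂ hL hx hL4' hQ hQx hy hyx hr
  have b₃ : ∀ k ∈ Icc 1 K, (∑ q ∈ Icc 1 Q with Odd q,
      ‖bvErr False (tw (gA k) mangoldtC + tw (gB k) mangoldtC) y q (r q)‖) *
        log x ^ (A + E) ≤ C₃ * x := fun k hk => by
    rw [mem_Icc] at hk
    have hkK : (k : ℝ) ≤ K := by exact_mod_cast hk.2
    exact h₃ False (56 * k) _ _ _ x y Q r (had₃ k hk.1) hL hx (by linarith) hQ hQx hy hyx hr
  set L := log x with hLdef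
  have hdrop : ∀ {s t : ℝ}, 0 ≤ s → s * L ^ (A + E) ≤ t → s * L ^ A ≤ t := fun hs h => by
    refine le_trans ?_ h
    rw [pow_add, ← mul_assoc]
    exact le_mul_of_one_le_right (by positivity) hL1
  have hsplit : ∑ q ∈ Icc 1 Q with Odd q, trapErr a b K y q (r q) =
      ∑ q ∈ Icc 1 Q with Odd q, ‖bvErr True mangoldtC y q (r q)‖ +
      ∑ q ∈ Icc 1 Q with Odd q, ‖bvErr False (tw (ev chi4) mangoldtC) y q (r q)‖ +
      ∑ k ∈ Icc 1 K, |trapCoeff a b k| * ∑ q ∈ Icc 1 Q with Odd q,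
        ‖bvErr False (tw (gA k) mangoldtC + tw (gB k) mangoldtC) y q (r q)‖ := by
    simp only [trapErr, sum_add_distrib, mul_sum]
    rw [sum_comm (s := Icc 1 K)]
  rw [hsplit, add_mul, add_mul]
  have hk : (∑ k ∈ Icc 1 K, |trapCoeff a b k| * ∑ q ∈ Icc 1 Q with Odd q,
      ‖bvErr False (tw (gA k) mangoldtC + tw (gB k) mangoldtC) y q (r q)‖) * L ^ A ≤
      2 * C₃ * x := by
    have hLE : 0 < L ^ E := by linarith
    rw [sum_mul]
    calc _ ≤ ∑ k ∈ Icc 1 K, |trapCoeff a b k| * (C₃ * x * (L ^ E)⁻¹) := by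
          refine sum_le_sum fun k hk => ?_
          rw [mul_assoc]
          refine mul_le_mul_of_nonneg_left ?_ (abs_nonneg _)
          rw [← div_eq_mul_inv, le_div_iff₀ hLE, mul_assoc, ← pow_add]
          exact b₃ k hk
      _ ≤ 2 * (b - a)⁻¹ * (C₃ * x * (L ^ E)⁻¹) := by
          rw [← sum_mul]
          exact mul_le_mul_of_nonneg_right (sum_abs_trapCoeff_le hab K) (by positivity)
      _ = 2 * C₃ * x := by
          rw [hba]
          field_simp
  have d₁ := hdrop (sum_nonneg fun q _ => norm_nonneg _) b₁
  have d₂ := hdrop (sum_nonneg fun q _ => norm_nonneg _) b₂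
  linarith

theorem exists_sum_smooth_pepsDiff_le {ε : ℝ} (hε : 0 < ε) (hε2 : ε < 1 / 2) (A : ℕ) :
    ∃ C L₀ : ℝ, 0 < C ∧ 1 ≤ L₀ ∧ ∀ (x y : ℝ) (Q : ℕ) (r : ℕ → ℕ), L₀ ≤ log x →
      1 ≤ Q → (Q : ℝ) ^ 18 ≤ x → y ≤ x → (∀ q, (r q).Coprime q) →
      (∑ q ∈ Icc 1 Q with Odd q, ‖smooth (pepsDiff ε q (r q)) y‖) * log x ^ A ≤ C * x := by
  set E := A + 4 with hE
  obtain ⟨C, hC, hT⟩ := exists_sum_trapErr_le A E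
  set n := A + E + 3 with hn
  set δ := pepsDensity ε with hδ
  have hδ0 : 0 < δ := pepsDensity_pos hε
  have hδ1 : 0 < 1 / 2 - δ := by linarith [pepsDensity_lt hε2]
  have hδi : 0 < δ⁻¹ := by positivity
  have hδi' : 0 < (1 / 2 - δ)⁻¹ := by positivity
  refine ⟨2 * C + 8 + 40 * (18 ^ n * n.factorial), 112 + δ⁻¹ + (1 / 2 - δ)⁻¹, by positivity,
    by linarith, ?_⟩
  intro x y Q r hL0 hQ hQx hyx hr
  set L := log x with hLdef
  have hL : 1 ≤ L := by linarith
  have hLpos : 0 < L := by linarith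
  have hQ1 : (1 : ℝ) ≤ Q := by exact_mod_cast hQ
  have hx : 1 ≤ x := (one_le_pow₀ hQ1).trans hQx
  rcases lt_or_ge y 1 with hy | hy
  · have h0 : ∀ f, smooth f y = 0 := fun f => by
      rw [smooth, Nat.floor_eq_zero.2 hy, Ioc_self, sum_empty]
    simp only [h0, norm_zero, sum_const_zero, zero_mul]
    positivity
  set η := (L ^ E)⁻¹ with hη
  have hLE : L ≤ L ^ E := le_self_pow₀ hL (by omega)
  have hη0 : 0 < η := by positivity
  have hηL : η ≤ L⁻¹ := inv_anti₀ hLpos hLE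
  have hη1 : η ≤ δ := hηL.trans (inv_le_of_inv_le₀ hδ0 (by linarith))
  have hη2 : δ + η ≤ 1 / 2 := by
    have := hηL.trans (inv_le_of_inv_le₀ hδ1 (by linarith))
    linarith
  set K := ⌈L ^ (2 * E)⌉₊ with hK
  have hKge : L ^ (2 * E) ≤ K := Nat.le_ceil _
  have hL2E : 1 ≤ L ^ (2 * E) := one_le_pow₀ hL
  have hK1 : 1 ≤ K := by exact_mod_cast hL2E.trans hKge
  have hKle : 56 * (K : ℝ) ≤ L ^ (2 * E + 1) := by
    have h1 := Nat.ceil_lt_add_one (by positivity : 0 ≤ L ^ (2 * E))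
    calc 56 * (K : ℝ) ≤ 112 * L ^ (2 * E) := by linarith
      _ ≤ L * L ^ (2 * E) := by
          gcongr
          linarith
      _ = _ := by ring
  have hKη : η⁻¹ * (K : ℝ)⁻¹ ≤ η := by
    rw [hη, inv_inv, ← div_eq_mul_inv, div_le_iff₀ (by positivity), inv_mul_eq_div,
      le_div_iff₀ (by positivity), ← pow_add]
    calc _ = L ^ (2 * E) := by congr 1; omega
      _ ≤ K := hKge
  have hT1 := hT x y (δ - η) δ K Q r hL (by linarith) (by rw [sub_sub_cancel, hη, inv_inv]) hKle
    (by linarith) hQ hQx hy hyx hr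
  have hT2 := hT x y δ (δ + η) K Q r hL (by linarith) (by rw [add_sub_cancel_left, hη, inv_inv])
    hKle (by linarith) hQ hQx hy hyx hr
  have hφsum := sum_inv_totient_le_log hL hQ hQx
  rw [← hLdef] at hφsum
  have hsum : ∑ q ∈ Icc 1 Q with Odd q, ‖smooth (pepsDiff ε q (r q)) y‖ ≤
      ∑ q ∈ Icc 1 Q with Odd q, trapErr (δ - η) δ K y q (r q) +
      ∑ q ∈ Icc 1 Q with Odd q, trapErr δ (δ + η) K y q (r q) +
      (2 * η * x * L ^ 2 * (4 * L ^ 2) + 40 * (Q ^ 2 * √x * L ^ (E + 3))) := by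
    calc _ ≤ ∑ q ∈ Icc 1 Q with Odd q, (trapErr (δ - η) δ K y q (r q) +
          trapErr δ (δ + η) K y q (r q) +
          (2 * η * x * L ^ 2 * (q.totient : ℝ)⁻¹ + 40 * Q * √x * L ^ (E + 3))) := by
          refine sum_le_sum fun q hq => ?_
          obtain ⟨hq, hodd⟩ := mem_filter.1 hq
          have hqQ : (q : ℝ) ≤ Q := by exact_mod_cast (mem_Icc.1 hq).2
          refine (norm_smooth_pepsDiff_le hε hε2 hη0 hη1 hη2 hK1 hKη hodd (r q) hL hy hyx).trans ?_
          rw [add_assoc]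
          refine add_le_add le_rfl (add_le_add le_rfl ?_)
          calc _ ≤ 40 * Q * √x * η⁻¹ * L ^ 3 := by gcongr
            _ = _ := by
              rw [hη, inv_inv]
              ring
      _ ≤ _ := by
          rw [sum_add_distrib, sum_add_distrib]
          refine add_le_add le_rfl ?_
          calc _ ≤ ∑ q ∈ Icc 1 Q, (2 * η * x * L ^ 2 * (q.totient : ℝ)⁻¹ +
                40 * Q * √x * L ^ (E + 3)) :=
                sum_le_sum_of_subset_of_nonneg (filter_subset _ _) fun i _ _ => by positivity
            _ ≤ _ := by
                rw [sum_add_distrib, ← mul_sum, sum_const, Nat.card_Icc, nsmul_eq_mul]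
                refine add_le_add (mul_le_mul_of_nonneg_left hφsum (by positivity)) (le_of_eq ?_)
                push_cast
                ring
  have hQQ : (Q : ℝ) ^ 2 * √x * L ^ n ≤ 18 ^ n * n.factorial * x := by
    refine le_trans ?_ (pow_eight_mul_sqrt_le hx hQx n)
    have h2 : (Q : ℝ) ^ 2 ≤ Q ^ 8 := pow_le_pow_right₀ hQ1 (by norm_num)
    gcongr
  have hη4 : η * L ^ (A + 4) = 1 := by
    rw [hη]
    exact inv_mul_cancel₀ (by positivity)
  calc _ ≤ (∑ q ∈ Icc 1 Q with Odd q, trapErr (δ - η) δ K y q (r q) +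
      ∑ q ∈ Icc 1 Q with Odd q, trapErr δ (δ + η) K y q (r q) +
      (2 * η * x * L ^ 2 * (4 * L ^ 2) + 40 * (Q ^ 2 * √x * L ^ (E + 3)))) * L ^ A := by gcongr
    _ = (∑ q ∈ Icc 1 Q with Odd q, trapErr (δ - η) δ K y q (r q)) * L ^ A +
      (∑ q ∈ Icc 1 Q with Odd q, trapErr δ (δ + η) K y q (r q)) * L ^ A +
      8 * x * (η * L ^ (A + 4)) + 40 * (Q ^ 2 * √x * L ^ n) := by ring
    _ ≤ C * x + C * x + 8 * x * 1 + 40 * (18 ^ n * n.factorial * x) := by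
        rw [hη4]
        gcongr
    _ = _ := by ring

theorem norm_pepsDiff_le {ε : ℝ} (hε : 0 < ε) (hε2 : ε < 1 / 2) (q r n : ℕ) : ‖pepsDiff ε q r n‖ ≤
      log n * ((if n ≡ r [MOD q] then 1 else 0) + (q.totient : ℝ)⁻¹) := by
  have h0 := log_natCast_nonneg n
  have h1 := pepsLog_nonneg ε n
  have h2 := pepsLog_le_log ε n
  have h3 := primeLog_nonneg n
  have hδ := pepsDensity_pos hε
  have hδ1 := pepsDensity_lt hε2
  have h4 : pepsDensity ε * (q.totient : ℝ)⁻¹ * primeLog n ≤ 1 * (q.totient : ℝ)⁻¹ * log n := by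
    gcongr
    · linarith
    · exact primeLog_le_log n
  have h5 : 0 ≤ pepsDensity ε * (q.totient : ℝ)⁻¹ * primeLog n := by positivity
  rw [pepsDiff_apply, norm_real, norm_eq_abs]
  refine (abs_sub _ _).trans ?_
  rw [abs_of_nonneg h5, mul_add]
  refine add_le_add ?_ (by linarith)
  split_ifs
  · rwa [abs_of_nonneg h1, mul_one]
  · simp

theorem sum_norm_pepsDiff_le {ε : ℝ} (hε : 0 < ε) (hε2 : ε < 1 / 2) {q : ℕ} (hq : 0 < q) (r : ℕ)
    {x y z : ℝ} (hL : 0 ≤ log x) (hy : 0 ≤ y) (hyz : y ≤ z) (hzx : z ≤ x) :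
    ∑ n ∈ Ioc ⌊y⌋₊ ⌊z⌋₊, ‖pepsDiff ε q r n‖ ≤ log x * (2 * (z - y) * (q.totient : ℝ)⁻¹ + 3) := by
  have hφ : (1 : ℝ) ≤ q.totient := by exact_mod_cast Nat.totient_pos.2 hq
  have hφ1 : (q.totient : ℝ)⁻¹ ≤ 1 := inv_le_one_of_one_le₀ hφ
  have hqφ : (q : ℝ)⁻¹ ≤ (q.totient : ℝ)⁻¹ :=
    inv_anti₀ (by linarith) (by exact_mod_cast Nat.totient_le q)
  have hcard := card_Ioc_floor_le hy hyz
  have hmn := Nat.floor_le_floor hyz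
  have hmod := card_filter_modEq_le hq r hmn
  rw [Nat.card_Ioc, Nat.cast_sub hmn] at hcard
  have hd : 0 ≤ z - y + 1 := by linarith
  calc _ ≤ ∑ n ∈ Ioc ⌊y⌋₊ ⌊z⌋₊,
        log x * ((if n ≡ r [MOD q] then 1 else 0) + (q.totient : ℝ)⁻¹) := by
        refine sum_le_sum fun n hn => (norm_pepsDiff_le hε hε2 q r n).trans ?_
        obtain ⟨hn0, hnz⟩ := mem_Ioc_floor
          (mem_Ioc.2 ⟨(Nat.zero_le _).trans_lt (mem_Ioc.1 hn).1, (mem_Ioc.1 hn).2⟩)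
        have : log n ≤ log x := log_le_log (by exact_mod_cast hn0) (hnz.trans hzx)
        gcongr
    _ = log x * (((Ioc ⌊y⌋₊ ⌊z⌋₊).filter fun n => n ≡ r [MOD q]).card +
          (⌊z⌋₊ - ⌊y⌋₊) * (q.totient : ℝ)⁻¹) := by
        rw [← mul_sum, sum_add_distrib, sum_boole, sum_const, nsmul_eq_mul, Nat.card_Ioc,
          Nat.cast_sub hmn]
    _ ≤ log x * (((z - y + 1) * (q.totient : ℝ)⁻¹ + 1) + (z - y + 1) * (q.totient : ℝ)⁻¹) := by
        gcongr
        refine hmod.trans ?_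
        rw [div_eq_mul_inv]
        gcongr
    _ ≤ _ := by
        refine mul_le_mul_of_nonneg_left ?_ hL
        linarith

theorem norm_sum_pepsDiff_le {ε : ℝ} (hε : 0 < ε) (hε2 : ε < 1 / 2) {q : ℕ} (hq : 0 < q) (r : ℕ)
    {x η : ℝ} (hx : 1 ≤ x) (hη : 0 < η) {N : ℕ} (hN : 0 < N) (hNx : (N : ℝ) ≤ x) :
    ‖∑ n ∈ Ioc 0 N, pepsDiff ε q r n‖ ≤ 2 * η⁻¹ * ∑ j ∈ range (⌊log x * η⁻¹⌋₊ + 2),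
        ‖smooth (pepsDiff ε q r) (x * exp (-(j * η)))‖ +
      2 * (log x * (2 * (η * x) * (q.totient : ℝ)⁻¹ + 3)) := by
  have hx0 : 0 < x := by linarith
  have hN1 : (1 : ℝ) ≤ N := by exact_mod_cast hN
  have hN0 : (0 : ℝ) < N := by linarith
  have hL : 0 ≤ log x := log_nonneg hx
  set f := pepsDiff ε q r with hf
  set j := ⌊log (x / N) * η⁻¹⌋₊ with hj
  set z := x * exp (-(j * η)) with hz
  set y := x * exp (-((j + 1 : ℕ) * η)) with hy
  have hlog0 : 0 ≤ log (x / N) := log_nonneg ((one_le_div hN0).2 hNx)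
  have hjle : (j : ℝ) * η ≤ log (x / N) := by
    have := Nat.floor_le (mul_nonneg hlog0 (inv_nonneg.2 hη.le))
    rwa [← div_eq_mul_inv, le_div_iff₀ hη] at this
  have hjlt : log (x / N) < (j + 1 : ℕ) * η := by
    have := Nat.lt_floor_add_one (log (x / N) * η⁻¹)
    rw [← div_eq_mul_inv, div_lt_iff₀ hη] at this
    exact_mod_cast this
  have hexp : x * exp (-log (x / N)) = N := by
    rw [Real.exp_neg, Real.exp_log (div_pos hx0 hN0)]
    field_simp
  have hNz : (N : ℝ) ≤ z := by
    rw [← hexp, hz]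
    gcongr
  have hyN : y < N := by
    rw [← hexp, hy]
    gcongr
  have hy0 : 0 < y := by positivity
  have hzx : z ≤ x := mul_le_of_le_one_right hx0.le (Real.exp_le_one_iff.2 (by
    rw [neg_nonpos]
    positivity))
  have hzy : z / y = exp η := by
    rw [hz, hy, mul_div_mul_left _ _ hx0.ne', ← Real.exp_sub]
    congr 1
    push_cast
    ring
  have hyz : y < z := hyN.trans_le hNz
  have hdiff : z - y ≤ η * x := by
    have h1 : y = z * exp (-η) := by
      have hz0 : z ≠ 0 := (hy0.trans hyz).ne'
      rw [Real.exp_neg, ← hzy]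
      field_simp
    have h2 : z * (1 - exp (-η)) ≤ z * η := by
      gcongr
      linarith [Real.add_one_le_exp (-η)]
    calc z - y = z * (1 - exp (-η)) := by rw [h1]; ring
      _ ≤ z * η := h2
      _ ≤ x * η := by gcongr
      _ = _ := mul_comm _ _
  have hjJ : j ≤ ⌊log x * η⁻¹⌋₊ := by
    refine Nat.floor_le_floor ?_
    gcongr
    exact div_le_self hx0.le hN1
  set J := ⌊log x * η⁻¹⌋₊
  set T := ∑ j ∈ range (J + 2), ‖smooth f (x * exp (-(j * η)))‖ with hT
  have hzT : ‖smooth f z‖ ≤ T := single_le_sum (f := fun j : ℕ => ‖smooth f (x * exp (-(j * η)))‖)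
      (fun _ _ => norm_nonneg _) (mem_range.2 (by omega : j < J + 2))
  have hyT : ‖smooth f y‖ ≤ T := single_le_sum (f := fun j : ℕ => ‖smooth f (x * exp (-(j * η)))‖)
      (fun _ _ => norm_nonneg _) (mem_range.2 (by omega : j + 1 < J + 2))
  have hsm := norm_sum_le_of_smooth f hy0 hyz
  rw [hzy, log_exp] at hsm
  set W := ∑ n ∈ Ioc ⌊y⌋₊ ⌊z⌋₊, ‖f n‖ with hW
  have hWle : W ≤ log x * (2 * (η * x) * (q.totient : ℝ)⁻¹ + 3) := by
    refine (sum_norm_pepsDiff_le hε hε2 hq r hL hy0.le hyz.le hzx).trans ?_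
    gcongr
  have hyN' : ⌊y⌋₊ ≤ N := Nat.floor_le_of_le hyN.le
  have hNz' : N ≤ ⌊z⌋₊ := Nat.le_floor hNz
  have hP : ‖∑ n ∈ Ioc 0 ⌊y⌋₊, f n‖ ≤ 2 * η⁻¹ * T + W := by
    have h1 : η * ‖∑ n ∈ Ioc 0 ⌊y⌋₊, f n‖ ≤ η * (2 * η⁻¹ * T + W) := by
      calc _ ≤ 2 * T + η * W := by linarith
        _ = _ := by field_simp
    exact le_of_mul_le_mul_left h1 hη
  have hR : ‖∑ n ∈ Ioc ⌊y⌋₊ N, f n‖ ≤ W := (norm_sum_le _ _).trans (sum_le_sum_of_subset_of_nonneg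
      (Ioc_subset_Ioc_right hNz') fun _ _ _ => norm_nonneg _)
  rw [← sum_Ioc_consecutive _ (Nat.zero_le _) hyN']
  refine (norm_add_le _ _).trans ?_
  linarith

theorem piEps_eq_sum (ε y : ℝ) (q a : ℕ) [DecidablePred (· ∈ Peps ε)] : (piEps ε y q a : ℝ) =
    ∑ n ∈ Ioc 1 ⌊y⌋₊, if n ≡ a [MOD q] ∧ n ∈ Peps ε then (1 : ℝ) else 0 := by
  rw [sum_boole, piEps, Nat.subtype_card]
  intro n
  rw [mem_filter, mem_Ioc]
  constructor
  · rintro ⟨⟨h1, h2⟩, h3, h4⟩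
    exact ⟨(Nat.le_floor_iff' (by omega)).1 h2, h4, h3⟩
  · rintro ⟨h1, h2, h3⟩
    exact ⟨⟨h2.1.one_lt, Nat.le_floor h1⟩, h3, h2⟩

theorem piCount_eq_sum (y : ℝ) : (piCount y : ℝ) =
    ∑ n ∈ Ioc 1 ⌊y⌋₊, if n.Prime then (1 : ℝ) else 0 := by
  rw [sum_boole, piCount, Nat.subtype_card]
  intro n
  rw [mem_filter, mem_Ioc]
  exact ⟨fun h => ⟨(Nat.le_floor_iff' (by omega)).1 h.1.2, h.2⟩,
    fun h => ⟨⟨h.2.one_lt, Nat.le_floor h.1⟩, h.2⟩⟩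

theorem sum_inv_log_mul_pepsDiff (ε y : ℝ) (q r : ℕ) :
    ∑ n ∈ Ioc 1 ⌊y⌋₊, (((log n)⁻¹ : ℝ) : ℂ) * pepsDiff ε q r n =
      (((piEps ε y q r : ℝ) - pepsDensity ε * piCount y / q.totient : ℝ) : ℂ) := by
  classical
  rw [piEps_eq_sum, piCount_eq_sum, mul_sum, sum_div, ← sum_sub_distrib, ofReal_sum]
  refine sum_congr rfl fun n hn => ?_
  have hn1 : (1 : ℝ) < n := by exact_mod_cast (mem_Ioc.1 hn).1
  have h0 := (log_pos hn1).ne'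
  rw [pepsDiff_apply, ← ofReal_mul, pepsLog, primeLog]
  congr 1
  by_cases h1 : n ≡ r [MOD q] <;> by_cases h2 : n ∈ Peps ε <;> by_cases h3 : n.Prime <;>
    simp [h1, h2, h3] <;> field_simp

theorem abs_piEps_sub_le {ε y H : ℝ} {q r : ℕ} (hy : 2 ≤ y)
    (hH : ∀ N : ℕ, 0 < N → (N : ℝ) ≤ y → ‖∑ n ∈ Ioc 0 N, pepsDiff ε q r n‖ ≤ H) :
    |(piEps ε y q r : ℝ) - pepsDensity ε * piCount y / q.totient| ≤ 2 * H := by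
  have hfl : 2 ≤ ⌊y⌋₊ := Nat.le_floor (by exact_mod_cast hy)
  have h1 : pepsDiff ε q r 1 = 0 := by simp [pepsDiff_apply, pepsLog, primeLog]
  have hH0 : 0 ≤ H := (norm_nonneg _).trans (hH 1 one_pos (by push_cast; linarith))
  have key := norm_sum_antitone_le (fun n => pepsDiff ε q r n) (fun n => (log n)⁻¹) 1 ⌊y⌋₊ H
    (by omega) (fun m hm _ => by
      have hm' : (1 : ℝ) < m := by exact_mod_cast hm
      refine inv_anti₀ (log_pos hm') (log_le_log (by linarith) ?_)
      push_cast
      linarith) (inv_nonneg.2 (log_natCast_nonneg _)) (fun m hm hmy => by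
      have h2 := hH m (by omega) ((Nat.le_floor_iff' (by omega)).1 hmy)
      rwa [← sum_Ioc_consecutive _ (Nat.zero_le 1) hm.le, Nat.Ioc_succ_singleton, sum_singleton,
        zero_add, h1, zero_add] at h2)
  rw [sum_inv_log_mul_pepsDiff, norm_real, norm_eq_abs] at key
  refine key.trans ?_
  rw [mul_comm]
  gcongr
  rw [inv_le_comm₀ (log_pos (by norm_num)) two_pos]
  have := Real.log_two_gt_d9
  norm_num
  linarith

theorem exists_sum_abs_piEps_sub_le {ε : ℝ} (hε : 0 < ε) (hε2 : ε < 1 / 2) (D : ℕ) :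
    ∃ C L₀ : ℝ, 0 < C ∧ 1 ≤ L₀ ∧ ∀ (x : ℝ) (Q : ℕ) (r : ℕ → ℕ) (Y : ℕ → ℝ), L₀ ≤ log x →
      1 ≤ Q → (Q : ℝ) ^ 18 ≤ x → (∀ q, (r q).Coprime q) → (∀ q, 2 ≤ Y q ∧ Y q ≤ x) →
      (∑ q ∈ Icc 1 Q with Odd q, |(piEps ε (Y q) q (r q) : ℝ) -
        pepsDensity ε * piCount (Y q) / q.totient|) * log x ^ D ≤ C * x := by
  set E := D + 3 with hE
  obtain ⟨C, L₀, hC, hL₀, h⟩ := exists_sum_smooth_pepsDiff_le hε hε2 ((E + 1) + (E + D))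
  refine ⟨12 * C + 32 + 12 * (18 ^ (D + 1) * (D + 1).factorial), L₀, by positivity, hL₀, ?_⟩
  intro x Q r Y hL0 hQ hQx hr hY
  set L := log x with hLdef
  have hL : 1 ≤ L := by linarith
  have hLpos : 0 < L := by linarith
  have hQ1 : (1 : ℝ) ≤ Q := by exact_mod_cast hQ
  have hx : 1 ≤ x := (one_le_pow₀ hQ1).trans hQx
  have hx0 : 0 < x := by linarith
  have hφsum := sum_inv_totient_le_log hL hQ hQx
  rw [← hLdef] at hφsum
  set η := (L ^ E)⁻¹ with hη
  have hη0 : 0 < η := by positivity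
  set J := ⌊L * η⁻¹⌋₊ with hJ
  have hJle : ((J + 2 : ℕ) : ℝ) ≤ 3 * L ^ (E + 1) := by
    have h1 : (J : ℝ) ≤ L ^ (E + 1) := by
      refine (Nat.floor_le (by positivity)).trans_eq ?_
      rw [hη, inv_inv]
      ring
    have h2 : 1 ≤ L ^ (E + 1) := one_le_pow₀ hL
    push_cast
    linarith
  set S : ℕ → ℝ := fun j => ∑ q ∈ Icc 1 Q with Odd q,
    ‖smooth (pepsDiff ε q (r q)) (x * exp (-(j * η)))‖ with hS
  have hSj : ∀ j, S j * L ^ ((E + 1) + (E + D)) ≤ C * x := fun j =>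
    h x _ Q r hL0 hQ hQx (mul_le_of_le_one_right hx0.le (Real.exp_le_one_iff.2 (by
      rw [neg_nonpos]
      positivity))) hr
  have hSsum : (∑ j ∈ range (J + 2), S j) * L ^ (E + D) ≤ 3 * C * x := by
    have h1 : L ^ (E + 1) * ((∑ j ∈ range (J + 2), S j) * L ^ (E + D)) ≤
        L ^ (E + 1) * (3 * C * x) := by
      calc _ = ∑ j ∈ range (J + 2), S j * L ^ ((E + 1) + (E + D)) := by
            rw [← sum_mul, pow_add]
            ring
        _ ≤ ∑ j ∈ range (J + 2), C * x := sum_le_sum fun j _ => hSj j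
        _ = (J + 2 : ℕ) * (C * x) := by rw [sum_const, card_range, nsmul_eq_mul]
        _ ≤ 3 * L ^ (E + 1) * (C * x) := by gcongr
        _ = _ := by ring
    exact le_of_mul_le_mul_left h1 (by positivity)
  have hmain : ∑ q ∈ Icc 1 Q with Odd q, |(piEps ε (Y q) q (r q) : ℝ) -
      pepsDensity ε * piCount (Y q) / q.totient| ≤
      4 * L ^ E * ∑ j ∈ range (J + 2), S j + (8 * L * η * x * (4 * L ^ 2) + 12 * Q * L) := by
    calc _ ≤ ∑ q ∈ Icc 1 Q with Odd q, (4 * L ^ E * ∑ j ∈ range (J + 2),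
            ‖smooth (pepsDiff ε q (r q)) (x * exp (-(j * η)))‖ +
            (8 * L * η * x * (q.totient : ℝ)⁻¹ + 12 * L)) := by
          refine sum_le_sum fun q hq => ?_
          have hq0 : 0 < q := (mem_Icc.1 (mem_filter.1 hq).1).1
          refine (abs_piEps_sub_le (hY q).1 fun N hN hNY => norm_sum_pepsDiff_le hε hε2 hq0 (r q)
            hx hη0 hN (hNY.trans (hY q).2)).trans (le_of_eq ?_)
          rw [← hLdef, ← hJ, hη, inv_inv]
          ring
      _ ≤ _ := by
          rw [sum_add_distrib, ← mul_sum, sum_comm]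
          refine add_le_add le_rfl ?_
          calc _ ≤ ∑ q ∈ Icc 1 Q, (8 * L * η * x * (q.totient : ℝ)⁻¹ + 12 * L) :=
                sum_le_sum_of_subset_of_nonneg (filter_subset _ _) fun i _ _ => by positivity
            _ ≤ _ := by
                rw [sum_add_distrib, ← mul_sum, sum_const, Nat.card_Icc, nsmul_eq_mul]
                refine add_le_add (mul_le_mul_of_nonneg_left hφsum (by positivity)) (le_of_eq ?_)
                push_cast
                ring
  have hQQ : (Q : ℝ) * L ^ (D + 1) ≤ 18 ^ (D + 1) * (D + 1).factorial * x := by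
    refine le_trans ?_ (pow_eight_mul_sqrt_le hx hQx (D + 1))
    rw [← hLdef]
    gcongr
    calc (Q : ℝ) ≤ Q ^ 8 := le_self_pow₀ hQ1 (by norm_num)
      _ ≤ Q ^ 8 * √x := le_mul_of_one_le_right (by positivity) (one_le_sqrt.2 hx)
  have hηL : η * L ^ (D + 3) = 1 := inv_mul_cancel₀ (by positivity)
  calc _ ≤ (4 * L ^ E * ∑ j ∈ range (J + 2), S j +
        (8 * L * η * x * (4 * L ^ 2) + 12 * Q * L)) * L ^ D := by gcongr
    _ = 4 * ((∑ j ∈ range (J + 2), S j) * L ^ (E + D)) + 32 * x * (η * L ^ (D + 3)) +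
        12 * (Q * L ^ (D + 1)) := by ring
    _ ≤ 4 * (3 * C * x) + 32 * x * 1 + 12 * (18 ^ (D + 1) * (D + 1).factorial * x) := by
        rw [hηL]
        gcongr
    _ = _ := by ring

theorem abs_piEps_sub_le_trivial {ε : ℝ} (hε : 0 < ε) (hε2 : ε < 1 / 2) {q : ℕ} (hq : 0 < q)
    (r : ℕ) {x y : ℝ} (hy : 2 ≤ y) (hyx : y ≤ x) :
    |(piEps ε y q r : ℝ) - pepsDensity ε * piCount y / q.totient| ≤ 2 * (log x * (2 * x + 3)) := by
  have hL : 0 ≤ log x := log_nonneg (by linarith)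
  have hx0 : 0 ≤ x := by linarith
  refine abs_piEps_sub_le hy fun N _ hNy => (norm_sum_le _ _).trans ?_
  have h := sum_norm_pepsDiff_le hε hε2 hq r hL le_rfl (Nat.cast_nonneg N) (hNy.trans hyx)
  rw [Nat.floor_zero, Nat.floor_natCast] at h
  refine h.trans ?_
  have hφ : (1 : ℝ) ≤ q.totient := by exact_mod_cast Nat.totient_pos.2 hq
  have hφ1 : (q.totient : ℝ)⁻¹ ≤ 1 := inv_le_one_of_one_le₀ hφ
  have hNx : (N : ℝ) ≤ x := hNy.trans hyx
  refine mul_le_mul_of_nonneg_left (add_le_add ?_ le_rfl) hL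
  calc 2 * ((N : ℝ) - 0) * (q.totient : ℝ)⁻¹ ≤ 2 * x * 1 := by
        rw [sub_zero]
        gcongr
    _ = _ := by ring

end

end SectorPrimes

theorem bombieri_vinogradov_sum_two_squares_small_a (ε θ D : ℝ) (hε : 0 < ε) (hε' : ε < 1 / 2)
    (hθ0 : 0 ≤ θ) (hθ : θ < 1 / 18) (hD : 0 < D) :
    ∃ c : ℝ, 0 < c ∧ ∀ x : ℝ, 2 ≤ x → ∀ A : ℕ → ℕ, ∀ Y : ℕ → ℝ,
        (∀ q, Nat.Coprime (A q) q) → (∀ q, 2 ≤ Y q ∧ Y q ≤ x) →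
        ∑ q ∈ (Finset.Icc 1 ⌊x ^ θ⌋₊).filter (fun q => Odd q),
          |(piEps ε (Y q) q (A q) : ℝ) -
            (2 / Real.pi) * Real.arcsin ε * (piCount (Y q) : ℝ) / (Nat.totient q : ℝ)| ≤
        c * x / (Real.log x) ^ D := by
  obtain ⟨C, L₀, hC, hL₀, h⟩ := SectorPrimes.exists_sum_abs_piEps_sub_le hε hε' ⌈D⌉₊
  have hL₀pos : 0 < L₀ := by linarith
  refine ⟨C + 2 * (L₀ * (2 * Real.exp L₀ + 3)) * L₀ ^ D, by positivity, ?_⟩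
  intro x hx r Y hr hY
  have hx1 : 1 ≤ x := by linarith
  have hx0 : 0 < x := by linarith
  have hLpos : 0 < Real.log x := Real.log_pos (by linarith)
  have hfl : (⌊x ^ θ⌋₊ : ℝ) ≤ x ^ θ := Nat.floor_le (by positivity)
  have hfl1 : 1 ≤ ⌊x ^ θ⌋₊ := Nat.le_floor (by exact_mod_cast Real.one_le_rpow hx1 hθ0)
  rw [le_div_iff₀ (by positivity)]
  change (∑ q ∈ Finset.Icc 1 ⌊x ^ θ⌋₊ with Odd q, |(piEps ε (Y q) q (r q) : ℝ) -
    SectorPrimes.pepsDensity ε * piCount (Y q) / q.totient|) * _ ≤ _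
  rcases le_or_gt L₀ (Real.log x) with hL | hL
  · have hQ18 : (⌊x ^ θ⌋₊ : ℝ) ^ 18 ≤ x := by
      calc _ ≤ (x ^ θ) ^ 18 := by gcongr
        _ = x ^ (θ * 18) := by rw [← Real.rpow_mul_natCast hx0.le]; norm_num
        _ ≤ x ^ (1 : ℝ) := Real.rpow_le_rpow_of_exponent_le hx1 (by linarith)
        _ = x := Real.rpow_one x
    have hpow : Real.log x ^ D ≤ Real.log x ^ ⌈D⌉₊ := by
      rw [← Real.rpow_natCast]
      exact Real.rpow_le_rpow_of_exponent_le (hL₀.trans hL) (Nat.le_ceil D)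
    refine (mul_le_mul_of_nonneg_left hpow (Finset.sum_nonneg fun _ _ => abs_nonneg _)).trans
      ((h x _ r Y hL hfl1 hQ18 hr hY).trans ?_)
    gcongr
    exact le_add_of_nonneg_right (by positivity)
  · have hxe : x ≤ Real.exp L₀ := (Real.log_le_iff_le_exp hx0).1 hL.le
    have hQx : (⌊x ^ θ⌋₊ : ℝ) ≤ x := hfl.trans (by
      conv_rhs => rw [← Real.rpow_one x]
      exact Real.rpow_le_rpow_of_exponent_le hx1 (by linarith))
    have hterm : ∀ q ∈ (Finset.Icc 1 ⌊x ^ θ⌋₊).filter fun q => Odd q, |(piEps ε (Y q) q (r q) : ℝ) -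
        SectorPrimes.pepsDensity ε * piCount (Y q) / q.totient| ≤
        2 * (L₀ * (2 * Real.exp L₀ + 3)) := fun q hq => by
      refine (SectorPrimes.abs_piEps_sub_le_trivial hε hε'
        (Finset.mem_Icc.1 (Finset.mem_filter.1 hq).1).1 (r q) (hY q).1 (hY q).2).trans ?_
      gcongr
    have hcard : (((Finset.Icc 1 ⌊x ^ θ⌋₊).filter fun q => Odd q).card : ℝ) ≤ x := by
      refine le_trans ?_ hQx
      exact_mod_cast (Finset.card_filter_le _ _).trans_eq (by rw [Nat.card_Icc]; rfl)
    calc _ ≤ (x * (2 * (L₀ * (2 * Real.exp L₀ + 3)))) * L₀ ^ D := by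
          gcongr
          refine (Finset.sum_le_card_nsmul _ _ _ hterm).trans ?_
          rw [nsmul_eq_mul]
          gcongr
      _ = 2 * (L₀ * (2 * Real.exp L₀ + 3)) * L₀ ^ D * x := by ring
      _ ≤ _ := by
          gcongr
          exact le_add_of_nonneg_left hC.le
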